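/- Let A : ℝ → ℝ be Lipschitz with constant L, let p ∈ (1,∞), and let b ∈ VMO(ℝ). Then the commutator [b, C_Γ] is a compact operator on L^p(ℝ). -/

import Mathlib

open MeasureTheory Filter Set
open scoped ENNReal

/-- The Cauchy kernel `K(x,y) = 1/(y - x + i(A(y) - A(x)))` associated to `A`. -/
noncomputable def cauchyKernel (A : ℝ → ℝ) (x y : ℝ) : ℂ :=
  ((y : ℂ) - (x : ℂ) + Complex.I * ((A y : ℂ) - (A x : ℂ)))⁻¹

/-- `cauchyPV A f x v` : the principal value `C_Γ f (x)` exists and equals `v`. -/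
def cauchyPV (A : ℝ → ℝ) (f : ℝ → ℂ) (x : ℝ) (v : ℂ) : Prop :=
  Filter.Tendsto (fun δ : ℝ => ∫ y in {y : ℝ | δ < |y - x|}, cauchyKernel A x y * f y)
    (nhdsWithin 0 (Set.Ioi 0)) (nhds v)

/-- `g` agrees a.e. with the commutator `[b, C_Γ] f = b • C_Γ f - C_Γ (b f)`. -/
def IsCommutatorFn (A b : ℝ → ℝ) (f g : ℝ → ℂ) : Prop :=
  ∀ᵐ x : ℝ, ∃ u w : ℂ,
    cauchyPV A f x u ∧ cauchyPV A (fun y => (b y : ℂ) * f y) x w ∧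
    g x = (b x : ℂ) * u - w

/-- Average of `b` over the interval `I(x,r) = (x - r, x + r)`. -/
noncomputable def intervalAvg (b : ℝ → ℝ) (x r : ℝ) : ℝ :=
  (2 * r)⁻¹ * ∫ y in Set.Ioo (x - r) (x + r), b y

/-- Mean oscillation `M(b, I(x,r))`. -/
noncomputable def meanOsc (b : ℝ → ℝ) (x r : ℝ) : ℝ :=
  (2 * r)⁻¹ * ∫ y in Set.Ioo (x - r) (x + r), |b y - intervalAvg b x r|

def IsBMOWith (b : ℝ → ℝ) (N : ℝ) : Prop :=
  MeasureTheory.LocallyIntegrable b volume ∧ ∀ x r : ℝ, 0 < r → meanOsc b x r ≤ N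

/-- `b ∈ BMO(ℝ)`. -/
def IsBMO (b : ℝ → ℝ) : Prop := ∃ N : ℝ, IsBMOWith b N

/-- `‖b‖_BMO`, the supremum of the mean oscillations of `b` over all bounded intervals. -/
noncomputable def bmoNorm (b : ℝ → ℝ) : ℝ := sInf {N : ℝ | IsBMOWith b N}

/-- `b ∈ VMO(ℝ)` : `b ∈ BMO(ℝ)` and the mean oscillations vanish for short intervals,
for long intervals, and for intervals far from the origin. -/
def IsVMO (b : ℝ → ℝ) : Prop :=
  IsBMO b ∧
  (∀ ε : ℝ, 0 < ε → ∃ δ : ℝ, 0 < δ ∧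
      ∀ x r : ℝ, 0 < r → 2 * r < δ → meanOsc b x r < ε) ∧
  (∀ ε : ℝ, 0 < ε → ∃ R : ℝ, 0 < R ∧
      ∀ x r : ℝ, 0 < r → R < 2 * r → meanOsc b x r < ε) ∧
  (∀ ε : ℝ, 0 < ε → ∃ R : ℝ, 0 < R ∧
      ∀ x r : ℝ, 0 < r → Set.Ioo (x - r) (x + r) ∩ Set.Ioo (-R) R = ∅ →
        meanOsc b x r < ε)

open scoped Topology Real
open ENNReal (add_ne_top continuous_ofReal continuous_rpow_const div_le_iff' div_le_of_le_mul
  lintegral_mul_le_Lp_mul_Lq lt_div_iff_mul_lt mul_le_mul_iff_right mul_lt_top mul_ne_top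
  mul_rpow_of_nonneg mul_top ofReal ofReal_add ofReal_le_ofReal ofReal_le_ofReal_iff ofReal_lt_top
  ofReal_mul ofReal_mul' ofReal_ne_top ofReal_ofNat ofReal_one ofReal_pos ofReal_pow
  ofReal_rpow_of_nonneg ofReal_toReal one_le_ofReal one_ne_top rpow_add rpow_inv_rpow rpow_le_rpow
  rpow_le_rpow_iff rpow_mul rpow_ne_top_of_nonneg rpow_one rpow_pos rpow_two tendsto_nhds_zero
  tendsto_ofReal toReal_mono toReal_nonneg toReal_ofReal toReal_pos top_rpow_of_pos tsum_le_tsum)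
open Real (HolderConjugate ball_eq_Ioo closedBall_eq_Icc coe_toNNReal dist_eq exp exp_add
  exp_le_one_iff exp_pos exp_zero inv_rpow norm_eq_abs norm_of_nonneg pi_pos rpow_neg sign
  sign_of_neg sign_of_pos tendsto_exp_atBot volume_Icc volume_Ico volume_ball volume_closedBall
  zero_rpow)
open Complex (I I_im I_ne_zero I_re abs_arg_lt_pi_div_two_iff abs_re_le_norm add_im add_re arg_I
  conj_I continuous_conj imCLM log log_I log_mul measurable_ofReal mul_conj mul_im mul_re norm_I
  norm_conj norm_real ofRealCLM ofReal_im ofReal_inv ofReal_ne_zero ofReal_re ofReal_zero re reCLM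
  sub_im sub_re)
open Metric (ball ball_subset_ball ball_subset_ball' closedBall isOpen_ball mem_ball mem_ball_self)
open TopologicalSpace (denseSeq denseRange_denseSeq)
open MeasureTheory.Measure (prod_restrict restrict_apply_univ restrict_restrict volume_eq_prod)

noncomputable section
variable {A b b₁ β : ℝ → ℝ} {f g F : ℝ → ℂ} {G : ℝ → ℝ≥0∞} {n : ℕ} {N : ℝ≥0∞}
  {L p q s x y τ r t c δ R a l K B σ C u z ρ γ : ℝ}

/-- Constants of the form `ofReal c` come out of a lower integral. -/
theorem lintegral_ofReal_mul {α : Type*} [MeasurableSpace α] {μ : Measure α} (F : α → ℝ≥0∞) :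
    ∫⁻ z, ofReal c * F z ∂μ = ofReal c * ∫⁻ z, F z ∂μ :=
  lintegral_const_mul' _ _ ofReal_ne_top

/-- Pointwise layer-cake formula for powers in `ℝ≥0∞`. -/
theorem rpow_layer (hp : 0 < p) (u : ℝ≥0∞) :
    u ^ p = ∫⁻ t in Ioi (0 : ℝ), {t : ℝ | ofReal t < u}.indicator
      (fun t => ofReal (p * t ^ (p - 1))) t := by
  have fin : ∀ v : ℝ, 0 ≤ v → (ofReal v) ^ p =
      ∫⁻ t in Ioi (0 : ℝ), {t : ℝ | ofReal t < ofReal v}.indicator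
      (fun t => ofReal (p * t ^ (p - 1))) t := by
    intro v hv
    have hm : MeasurableSet {t : ℝ | ofReal t < ofReal v} :=
      measurableSet_lt ENNReal.measurable_ofReal measurable_const
    rw [lintegral_indicator hm, restrict_restrict hm]
    have hs : {t : ℝ | ofReal t < ofReal v} ∩ Ioi 0 = Ioo 0 v := by
      ext t
      simp only [mem_inter_iff, mem_ofPred_eq, mem_Ioi, mem_Ioo]
      constructor
      · rintro ⟨h1, h2⟩
        exact ⟨h2, (ENNReal.ofReal_lt_ofReal_iff_of_nonneg h2.le).1 h1⟩
      · rintro ⟨h1, h2⟩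
        exact ⟨(ENNReal.ofReal_lt_ofReal_iff_of_nonneg h1.le).2 h2, h1⟩
    rw [hs]
    have hnt : IntervalIntegrable (fun t : ℝ => p * t ^ (p - 1)) volume 0 v :=
      (intervalIntegral.intervalIntegrable_rpow' (by linarith)).const_mul p
    have hnt' : IntegrableOn (fun t : ℝ => p * t ^ (p - 1)) (Ioo 0 v) := by
      rw [intervalIntegrable_iff_integrableOn_Ioo_of_le hv] at hnt
      exact hnt
    rw [← ofReal_integral_eq_lintegral_ofReal hnt']
    · rw [← integral_Ioc_eq_integral_Ioo, ← intervalIntegral.integral_of_le hv,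
        intervalIntegral.integral_const_mul, integral_rpow (.inl (by linarith)),
        ofReal_rpow_of_nonneg hv hp.le]
      congr 1
      have : p - 1 + 1 = p := by ring
      rw [this, zero_rpow hp.ne']
      field_simp
      simp
    · filter_upwards [ae_restrict_mem measurableSet_Ioo] with t ht
      have := ht.1
      simp only [Pi.zero_apply]
      positivity
  rcases eq_or_ne u ⊤ with rfl | hu
  · rw [top_rpow_of_pos hp]
    symm
    rw [eq_top_iff]
    have key : ∀ n : ℕ, (ofReal (n : ℝ)) ^ p ≤ ∫⁻ t in Ioi (0 : ℝ), {t : ℝ | ofReal t < ⊤}.indicator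
      (fun t => ofReal (p * t ^ (p - 1))) t := by
      intro n
      rw [fin n (by positivity)]
      refine lintegral_mono fun t => ?_
      refine indicator_le_indicator_of_subset (fun t ht => ?_) (fun _ => zero_le) t
      simp only [mem_ofPred_eq] at ht ⊢
      exact lt_of_lt_of_le ht le_top
    have lim : Tendsto (fun n : ℕ => (ofReal (n : ℝ)) ^ p) atTop (nhds ⊤) := by
      have h1 : Tendsto (fun n : ℕ => ofReal (n : ℝ)) atTop (nhds ⊤) :=
        ENNReal.tendsto_ofReal_atTop.comp tendsto_natCast_atTop_atTop
      have h2 := (continuous_rpow_const (y := p)).tendsto ⊤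
      rw [top_rpow_of_pos hp] at h2
      exact h2.comp h1
    exact le_of_tendsto' lim key
  · have := fin u.toReal toReal_nonneg
    rwa [ofReal_toReal hu] at this

theorem lintegral_rpow_layer {α : Type*} [MeasurableSpace α] {μ : Measure α} [SFinite μ]
    (hp : 0 < p) {F : α → ℝ≥0∞} (hF : Measurable F) :
    ∫⁻ x, F x ^ p ∂μ = ∫⁻ t in Ioi (0 : ℝ), ofReal (p * t ^ (p - 1)) * μ {x | ofReal t < F x} := by
  simp_rw [rpow_layer hp]
  rw [lintegral_lintegral_swap]
  · refine lintegral_congr fun t => ?_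
    have hm : MeasurableSet {x | ofReal t < F x} := measurableSet_lt measurable_const hF
    rw [← lintegral_indicator_const hm]
    refine lintegral_congr fun x => ?_
    by_cases h : ofReal t < F x <;> simp [indicator, h]
  · have hm : MeasurableSet {q : α × ℝ | ofReal q.2 < F q.1} :=
      measurableSet_lt (ENNReal.measurable_ofReal.comp measurable_snd) (hF.comp measurable_fst)
    have : (Function.uncurry fun (x : α) (t : ℝ) => {t : ℝ | ofReal t < F x}.indicator
        (fun t => ofReal (p * t ^ (p - 1))) t) =
        {q : α × ℝ | ofReal q.2 < F q.1}.indicator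
          (fun q => ofReal (p * q.2 ^ (p - 1))) := by
      ext q
      rfl
    rw [this]
    refine (Measurable.indicator ?_ hm).aemeasurable
    exact ENNReal.measurable_ofReal.comp ((measurable_snd.pow_const _).const_mul _)

/-- The centred Hardy–Littlewood maximal function on the line. -/
def hlMax (g : ℝ → ℝ≥0∞) (x : ℝ) : ℝ≥0∞ :=
  ⨆ (r : ℝ) (_ : 0 < r), (∫⁻ y in ball x r, g y) / ofReal (2 * r)

theorem setLIntegral_le_hlMax (g : ℝ → ℝ≥0∞) (x : ℝ) (hr : 0 < r) :
    ∫⁻ y in ball x r, g y ≤ ofReal (2 * r) * hlMax g x := by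
  have h : (∫⁻ y in ball x r, g y) / ofReal (2 * r) ≤ hlMax g x :=
    le_iSup₂ (f := fun (r : ℝ) (_ : 0 < r) =>
      (∫⁻ y in ball x r, g y) / ofReal (2 * r)) r hr
  rwa [div_le_iff' (by simpa using hr) ofReal_ne_top] at h

theorem hlMax_mono {g h : ℝ → ℝ≥0∞} (hgh : ∀ᵐ x, g x ≤ h x) (x : ℝ) : hlMax g x ≤ hlMax h x := by
  refine iSup₂_mono fun r _ => ENNReal.div_le_div_right ?_ _
  exact lintegral_mono_ae (ae_restrict_of_ae hgh)

theorem hlMax_congr {g h : ℝ → ℝ≥0∞} (hgh : g =ᵐ[volume] h) : hlMax g = hlMax h := by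
  funext x
  exact le_antisymm (hlMax_mono hgh.le x) (hlMax_mono hgh.symm.le x)

theorem lt_hlMax_iff {g : ℝ → ℝ≥0∞} {t : ℝ≥0∞} :
    t < hlMax g x ↔ ∃ r > 0, t * ofReal (2 * r) < ∫⁻ y in ball x r, g y := by
  unfold hlMax
  simp only [lt_iSup_iff]
  constructor
  · rintro ⟨r, hr, h⟩
    refine ⟨r, hr, ?_⟩
    rwa [lt_div_iff_mul_lt (.inl (by simpa using hr)) (.inl ofReal_ne_top)] at h
  · rintro ⟨r, hr, h⟩
    refine ⟨r, hr, ?_⟩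
    rwa [lt_div_iff_mul_lt (.inl (by simpa using hr)) (.inl ofReal_ne_top)]

theorem measurable_hlMax (g : ℝ → ℝ≥0∞) : Measurable (hlMax g) := by
  refine LowerSemicontinuous.measurable ?_
  rw [lowerSemicontinuous_iff_isOpen_preimage]
  intro t
  rw [Metric.isOpen_iff]
  intro x hx
  rw [mem_preimage, mem_Ioi, lt_hlMax_iff] at hx
  obtain ⟨r, hr, h⟩ := hx
  have htop : t ≠ ⊤ := by
    rintro rfl
    rw [ENNReal.top_mul (by simpa using hr)] at h
    exact not_top_lt h
  have hcont : Tendsto (fun e : ℝ => t * ofReal (2 * (r + e))) (nhds 0)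
      (nhds (t * ofReal (2 * (r + 0)))) := by
    refine ENNReal.Tendsto.const_mul ?_ (.inr htop)
    exact tendsto_ofReal (Continuous.tendsto (by fun_prop) 0)
  have hev := hcont.eventually_lt_const (by simpa using h)
  obtain ⟨e, he, hball⟩ := Metric.eventually_nhds_iff.1 hev
  refine ⟨e / 2, by positivity, fun x' hx' => ?_⟩
  rw [mem_preimage, mem_Ioi, lt_hlMax_iff]
  refine ⟨r + e / 2, by positivity, ?_⟩
  refine lt_of_lt_of_le (hball (y := e / 2) ?_) (lintegral_mono_set ?_)
  · simp [abs_of_pos he]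
    linarith
  · intro y hy
    rw [mem_ball] at *
    have := dist_triangle y x x'
    rw [dist_comm x x'] at this
    linarith

theorem volume_hlMax_gt_le {g : ℝ → ℝ≥0∞} (ht : 0 < t) :
    ofReal t * volume {x | ofReal t < hlMax g x} ≤ 4 * ∫⁻ x, g x := by
  rcases eq_or_ne (∫⁻ x, g x) ⊤ with h | hfin
  · rw [h]; simp
  set S := {x | ofReal t < hlMax g x}
  have hS : ∀ x ∈ S, ∃ r > 0, ofReal t * ofReal (2 * r) < ∫⁻ y in ball x r, g y :=
    fun x hx => lt_hlMax_iff.1 hx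
  choose! r hr0 hr using hS
  have hbdd : ∀ x ∈ S, r x ≤ (∫⁻ x, g x).toReal / (2 * t) := by
    intro x hx
    have h1 := (hr x hx).le.trans (setLIntegral_le_lintegral _ _)
    rw [← ofReal_mul ht.le] at h1
    have h2 := (ENNReal.ofReal_le_iff_le_toReal hfin).1 h1
    rw [le_div_iff₀ (by positivity)]
    linarith
  obtain ⟨u, huS, hdisj, hcov⟩ := Vitali.exists_disjoint_subfamily_covering_enlargement_ball S
    (fun x => x) r _ hbdd 4 (by norm_num)
  have hcount : u.Countable := by
    refine hdisj.countable_of_isOpen (fun _ _ => isOpen_ball) (fun x hx => ?_)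
    exact ⟨x, mem_ball_self (hr0 x (huS hx))⟩
  have hsub : S ⊆ ⋃ x ∈ u, ball x (4 * r x) := by
    intro x hx
    obtain ⟨b, hb, hsub⟩ := hcov x hx
    exact mem_biUnion hb (hsub (mem_ball_self (hr0 x hx)))
  have : Countable u := hcount.to_subtype
  calc ofReal t * volume S
      ≤ ofReal t * ∑' x : u, volume (ball (x : ℝ) (4 * r x)) := by
        gcongr
        exact (measure_mono hsub).trans (measure_biUnion_le _ hcount _)
    _ = ∑' x : u, 4 * (ofReal t * ofReal (2 * r x)) := by
        rw [← ENNReal.tsum_mul_left]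
        refine tsum_congr fun x => ?_
        have h4 : (4 : ℝ≥0∞) = ofReal 4 := by norm_num
        have := hr0 x (huS x.2)
        rw [volume_ball, h4, ← ofReal_mul ht.le, ← ofReal_mul ht.le, ← ofReal_mul (by norm_num)]
        congr 1; ring
    _ ≤ ∑' x : u, 4 * ∫⁻ y in ball (x : ℝ) (r x), g y := by
        gcongr with x
        exact (hr x (huS x.2)).le
    _ = 4 * ∫⁻ y in ⋃ x : u, ball (x : ℝ) (r x), g y := by
        rw [ENNReal.tsum_mul_left, lintegral_iUnion (fun _ => isOpen_ball.measurableSet)]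
        intro x y hxy
        exact hdisj x.2 y.2 (fun h => hxy (Subtype.ext h))
    _ ≤ 4 * ∫⁻ x, g x := by
        gcongr
        exact Measure.restrict_le_self

theorem volume_hlMax_gt_le' {g : ℝ → ℝ≥0∞} (hg : Measurable g) (ht : 0 < t) :
    ofReal t * volume {x | ofReal t < hlMax g x} ≤
      8 * ∫⁻ x, {x | ofReal t < 2 * g x}.indicator g x := by
  set S := {x | ofReal t < 2 * g x}
  have hS : MeasurableSet S := measurableSet_lt measurable_const (hg.const_mul _)
  have hsub : {x | ofReal t < hlMax g x} ⊆
      {x | ofReal (t / 2) < hlMax (S.indicator g) x} := by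
    intro x hx
    rw [mem_ofPred_eq, lt_hlMax_iff] at hx ⊢
    obtain ⟨r, hr, h⟩ := hx
    refine ⟨r, hr, ?_⟩
    have h1 : ∫⁻ y in ball x r, g y ≤ (∫⁻ y in ball x r, S.indicator g y) +
          ofReal (t / 2) * ofReal (2 * r) := by
      rw [← volume_ball, ← setLIntegral_const, ← lintegral_add_right _ measurable_const]
      refine lintegral_mono fun y => ?_
      by_cases hy : y ∈ S
      · simp [hy]
      · simp only [indicator_of_notMem hy, zero_add]
        have : 2 * g y ≤ ofReal t := not_lt.1 hy
        rw [ENNReal.ofReal_div_of_pos (by norm_num), ENNReal.le_div_iff_mul_le (by simp) (by simp)]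
        simpa [mul_comm] using this
    have h2 : ofReal t * ofReal (2 * r) = ofReal (t / 2) * ofReal (2 * r) +
        ofReal (t / 2) * ofReal (2 * r) := by
      rw [← add_mul, ← ofReal_add (by positivity) (by positivity), add_halves]
    rw [h2] at h
    exact lt_of_add_lt_add_right (lt_of_lt_of_le h h1)
  have h := volume_hlMax_gt_le (g := S.indicator g) (half_pos ht)
  calc ofReal t * volume {x | ofReal t < hlMax g x}
      ≤ ofReal t * volume {x | ofReal (t / 2) < hlMax (S.indicator g) x} := by gcongr
    _ = 2 * (ofReal (t / 2) * volume {x | ofReal (t / 2) < hlMax (S.indicator g) x}) := by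
        rw [← mul_assoc]
        congr 1
        rw [show (2 : ℝ≥0∞) = ofReal 2 by norm_num, ← ofReal_mul (by norm_num)]
        congr 1; ring
    _ ≤ 2 * (4 * ∫⁻ x, S.indicator g x) := by gcongr
    _ = _ := by rw [← mul_assoc]; norm_num

/-- Strong type `(p, p)` of the maximal function. -/
theorem lintegral_hlMax_rpow_le (hp : 1 < p) : ∃ C : ℝ≥0∞, C ≠ ⊤ ∧
    ∀ g : ℝ → ℝ≥0∞, AEMeasurable g → ∫⁻ x, hlMax g x ^ p ≤ C * ∫⁻ x, g x ^ p := by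
  refine ⟨8 * (ofReal (p / (p - 1)) * 2 ^ (p - 1)), by finiteness, ?_⟩
  suffices H : ∀ g : ℝ → ℝ≥0∞, Measurable g → ∫⁻ x, hlMax g x ^ p ≤
      8 * (ofReal (p / (p - 1)) * 2 ^ (p - 1)) * ∫⁻ x, g x ^ p by
    intro g hg
    rw [hlMax_congr hg.ae_eq_mk]
    refine (H _ hg.measurable_mk).trans (le_of_eq ?_)
    congr 1
    refine lintegral_congr_ae ?_
    filter_upwards [hg.ae_eq_mk] with x hx
    rw [hx]
  intro g hg
  have hp0 : 0 < p := by linarith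
  have hp1 : 0 < p - 1 := by linarith
  rw [lintegral_rpow_layer hp0 (measurable_hlMax g)]
  have hm : MeasurableSet {q : ℝ × ℝ | ofReal q.1 < 2 * g q.2} :=
    measurableSet_lt (ENNReal.measurable_ofReal.comp measurable_fst)
      ((hg.comp measurable_snd).const_mul _)
  have hk : Measurable fun t : ℝ => ofReal ((p - 1) * t ^ (p - 1 - 1)) :=
    ENNReal.measurable_ofReal.comp ((measurable_id.pow_const _).const_mul _)
  calc ∫⁻ t in Ioi (0 : ℝ), ofReal (p * t ^ (p - 1)) * volume {x | ofReal t < hlMax g x}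
      ≤ ∫⁻ t in Ioi (0 : ℝ), 8 * ofReal (p / (p - 1)) *
        ∫⁻ x, {q : ℝ × ℝ | ofReal q.1 < 2 * g q.2}.indicator
          (fun q => g q.2 * ofReal ((p - 1) * q.1 ^ (p - 1 - 1))) (t, x) := by
        refine setLIntegral_mono' measurableSet_Ioi fun t ht => ?_
        have ht : 0 < t := ht
        have e1 : ofReal (p * t ^ (p - 1)) = ofReal (p / (p - 1)) *
            ofReal ((p - 1) * t ^ (p - 1 - 1)) * ofReal t := by
          rw [← ofReal_mul (by positivity), ← ofReal_mul (by positivity)]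
          congr 1
          rw [Real.rpow_sub_one ht.ne' (p - 1)]
          field_simp
        rw [e1, mul_assoc]
        calc _ ≤ ofReal (p / (p - 1)) * ofReal ((p - 1) * t ^ (p - 1 - 1)) *
            (8 * ∫⁻ x, {x | ofReal t < 2 * g x}.indicator g x) := by
              exact mul_le_mul' le_rfl (volume_hlMax_gt_le' hg ht)
          _ = 8 * ofReal (p / (p - 1)) * (ofReal ((p - 1) * t ^ (p - 1 - 1)) *
            ∫⁻ x, {x | ofReal t < 2 * g x}.indicator g x) := by ring
          _ = _ := by
              congr 1
              rw [← lintegral_ofReal_mul]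
              refine lintegral_congr fun x => ?_
              by_cases h : ofReal t < 2 * g x <;> simp [indicator, mul_comm]
    _ = 8 * ofReal (p / (p - 1)) * ∫⁻ x, g x * (2 * g x) ^ (p - 1) := by
        rw [lintegral_const_mul' _ _ (by finiteness)]
        congr 1
        rw [lintegral_lintegral_swap]
        · refine lintegral_congr fun x => ?_
          rw [rpow_layer hp1, ← lintegral_const_mul]
          · refine lintegral_congr fun t => ?_
            by_cases h : ofReal t < 2 * g x <;> simp [indicator, h]
          · exact hk.indicator (measurableSet_lt ENNReal.measurable_ofReal measurable_const)
        · refine (Measurable.indicator ?_ hm).aemeasurable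
          exact (hg.comp measurable_snd).mul (hk.comp measurable_fst)
    _ = _ := by
        rw [mul_assoc, mul_assoc]
        congr 1
        rw [mul_assoc]
        congr 1
        rw [← lintegral_const_mul' _ _ (by finiteness)]
        refine lintegral_congr fun x => ?_
        rw [mul_rpow_of_nonneg _ _ hp1.le]
        have : g x ^ p = g x * g x ^ (p - 1) := by
          conv_rhs => rw [← rpow_one (g x), ← rpow_mul, one_mul]
          rw [← ENNReal.rpow_add_of_nonneg _ _ zero_le_one hp1.le]
          congr 1; ring
        rw [this]; ring

/-- `A` is Lipschitz with positive constant `L`. -/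
def LipA (A : ℝ → ℝ) (L : ℝ) : Prop :=
  0 < L ∧ ∀ x y : ℝ, |A x - A y| ≤ L * |x - y|

/-- The graph parametrisation `z(x) = x + i A(x)`. -/
def zc (A : ℝ → ℝ) (x : ℝ) : ℂ := (x : ℂ) + (A x : ℂ) * I

/-- The derivative of the parametrisation of the graph. -/
def dz (A : ℝ → ℝ) (x : ℝ) : ℂ := 1 + ((deriv A x : ℝ) : ℂ) * I

@[simp] theorem zc_re (A : ℝ → ℝ) (x : ℝ) : (zc A x).re = x := by simp [zc]
@[simp] theorem zc_im (A : ℝ → ℝ) (x : ℝ) : (zc A x).im = A x := by simp [zc]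
@[simp] theorem dz_re (A : ℝ → ℝ) (x : ℝ) : (dz A x).re = 1 := by simp [dz]

theorem LipA.neg (hA : LipA A L) : LipA (fun x => -A x) L := by
  refine ⟨hA.1, fun x y => ?_⟩
  rw [show -A x - -A y = A y - A x by ring, abs_sub_comm]
  exact hA.2 x y

theorem LipA.lipschitz (hA : LipA A L) : LipschitzWith L.toNNReal A :=
  LipschitzWith.of_dist_le_mul fun x y => by
    rw [dist_eq, dist_eq, coe_toNNReal _ hA.1.le]; exact hA.2 x y

theorem LipA.continuous (hA : LipA A L) : Continuous A := hA.lipschitz.continuous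

theorem LipA.zc_continuous (hA : LipA A L) : Continuous (zc A) := by
  have := hA.continuous
  unfold zc; fun_prop

theorem LipA.norm_zc_sub (hA : LipA A L) (x y : ℝ) : ‖zc A y - zc A x‖ ≤ (1 + L) * |x - y| := by
  refine (Complex.norm_le_abs_re_add_abs_im _).trans ?_
  have := hA.2 y x
  simp only [sub_re, sub_im, zc_re, zc_im]
  rw [abs_sub_comm x y]
  linarith

theorem LipA.le_norm (hA : LipA A L) (x y s : ℝ) :
    (|s| + |x - y|) / (2 + L) ≤ ‖zc A y - zc A x + s * I‖ := by
  have hL := hA.1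
  rw [div_le_iff₀ (by linarith)]
  have h1 := abs_re_le_norm (zc A y - zc A x + s * I)
  have h2 := Complex.abs_im_le_norm (zc A y - zc A x + s * I)
  simp only [add_re, sub_re, zc_re, mul_re, ofReal_re,
    I_re, mul_zero, ofReal_im, I_im, sub_zero, add_zero, add_im,
    sub_im, zc_im, mul_im, mul_one] at h1 h2
  have h3 := hA.2 y x
  rw [abs_sub_comm x y]
  have h4 : |s| ≤ |A y - A x + s| + |A y - A x| := by
    have := abs_sub (A y - A x + s) (A y - A x)
    simpa using this
  nlinarith

theorem LipA.ne_zero (hA : LipA A L) (x y : ℝ) (hs : s ≠ 0) : zc A y - zc A x + s * I ≠ 0 := by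
  have h := hA.le_norm x y s
  have hL := hA.1
  have : 0 < |s| := abs_pos.2 hs
  have : 0 < (|s| + |x - y|) / (2 + L) := by positivity
  exact norm_pos_iff.1 (by linarith)

theorem LipA.norm_inv_le (hA : LipA A L) (x y s : ℝ) (h : s ≠ 0 ∨ x ≠ y) :
    ‖(zc A y - zc A x + s * I)⁻¹‖ ≤ (2 + L) / (|s| + |x - y|) := by
  have hL := hA.1
  have : 0 < |s| + |x - y| := by
    rcases h with h | h
    · have := abs_pos.2 h; positivity
    · have := abs_pos.2 (sub_ne_zero.2 h); positivity
  rw [norm_inv, ← inv_div]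
  exact inv_anti₀ (by positivity) (hA.le_norm x y s)

theorem LipA.norm_dz_le (hA : LipA A L) (x : ℝ) : ‖dz A x‖ ≤ 1 + L := by
  have h := norm_deriv_le_of_lipschitz hA.lipschitz (x₀ := x)
  rw [coe_toNNReal _ hA.1.le] at h
  unfold dz
  refine (norm_add_le _ _).trans ?_
  simp only [norm_one, norm_mul, norm_real, norm_I, mul_one]
  linarith

theorem one_le_norm_dz (A : ℝ → ℝ) (x : ℝ) : 1 ≤ ‖dz A x‖ := by
  have := abs_re_le_norm (dz A x)
  simpa using this

theorem measurable_dz (A : ℝ → ℝ) : Measurable (dz A) := by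
  have := measurable_deriv A
  unfold dz
  fun_prop

theorem LipA.hasDerivAt_zc (hA : LipA A L) : ∀ᵐ x, HasDerivAt (zc A) (dz A x) x := by
  filter_upwards [hA.lipschitz.ae_differentiableAt] with x hx
  have h1 : HasDerivAt (fun x : ℝ => (A x : ℂ)) ((deriv A x : ℝ) : ℂ) x := hx.hasDerivAt.ofReal_comp
  have h2 : HasDerivAt (fun x : ℝ => (x : ℂ)) 1 x := (hasDerivAt_id x).ofReal_comp
  exact h2.add (h1.mul_const I)

theorem LipA.lipschitz_zc (hA : LipA A L) : LipschitzWith (1 + L).toNNReal (zc A) :=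
  LipschitzWith.of_dist_le_mul fun x y => by
    have hL := hA.1
    rw [Complex.dist_eq, dist_eq, coe_toNNReal _ (by positivity), abs_sub_comm]
    exact hA.norm_zc_sub y x

/-- Fundamental theorem of calculus for locally Lipschitz functions. -/
theorem LocallyLipschitz.integral_eq_sub {F' : ℝ → ℂ} (hF : LocallyLipschitz F)
    (hd : ∀ᵐ x, HasDerivAt F (F' x) x) (hi : LocallyIntegrable F') (a b : ℝ) :
    ∫ x in a..b, F' x = F b - F a := by
  have hnt : IntervalIntegrable F' volume a b :=
    (hi.integrableOn_isCompact isCompact_uIcc).intervalIntegrable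
  obtain ⟨K, hK⟩ := (hF.locallyLipschitzOn (s := uIcc a b)).exists_lipschitzOnWith_of_compact
    isCompact_uIcc
  have key : ∀ g : ℂ →L[ℝ] ℝ, ∫ x in a..b, g (F' x) = g (F b) - g (F a) := by
    intro g
    have h1 : LipschitzOnWith (‖g‖₊ * K) (fun x => g (F x)) (uIcc a b) :=
      g.lipschitz.comp_lipschitzOnWith hK
    rw [← h1.absolutelyContinuousOnInterval.integral_deriv_eq_sub]
    refine intervalIntegral.integral_congr_ae ?_
    filter_upwards [hd] with x hx _
    exact ((g.hasFDerivAt.comp_hasDerivAt x hx).deriv).symm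
  apply Complex.ext
  · have := key reCLM
    rw [reCLM.intervalIntegral_comp_comm hnt] at this
    simpa using this
  · have := key imCLM
    rw [imCLM.intervalIntegral_comp_comm hnt] at this
    simpa using this

theorem LocallyLipschitz.integral_eq_sub_of_tendsto {F' : ℝ → ℂ} (hF : LocallyLipschitz F)
    (hd : ∀ᵐ x, HasDerivAt F (F' x) x) (hi : Integrable F') {l m : ℂ}
    (hl : Tendsto F atBot (nhds l)) (hm : Tendsto F atTop (nhds m)) :
    ∫ x, F' x = m - l := by
  have h1 : Tendsto (fun n : ℝ => ∫ x in (-n)..n, F' x) atTop (nhds (∫ x, F' x)) :=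
    intervalIntegral_tendsto_integral hi tendsto_neg_atTop_atBot tendsto_id
  have h2 : Tendsto (fun n : ℝ => F n - F (-n)) atTop (nhds (m - l)) :=
    hm.sub (hl.comp tendsto_neg_atTop_atBot)
  refine tendsto_nhds_unique h1 (h2.congr fun n => ?_)
  rw [hF.integral_eq_sub hd hi.locallyIntegrable]

theorem LipA.locallyLipschitz_comp (hA : LipA A L) {G : ℂ → ℂ} {G' : ℝ → ℂ}
    (hG : ∀ y, HasStrictDerivAt G (G' y) (zc A y)) : LocallyLipschitz fun y => G (zc A y) := by
  intro y
  obtain ⟨K, s, hs, hK⟩ := (hG y).hasStrictFDerivAt.exists_lipschitzOnWith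
  refine ⟨K * (1 + L).toNNReal, zc A ⁻¹' s, hA.zc_continuous.continuousAt hs, ?_⟩
  exact hK.comp (hA.lipschitz_zc.lipschitzOnWith) (mapsTo_preimage _ _)

theorem LipA.hasDerivAt_comp (hA : LipA A L) {G : ℂ → ℂ} {G' : ℝ → ℂ}
    (hG : ∀ y, HasStrictDerivAt G (G' y) (zc A y)) :
    ∀ᵐ y, HasDerivAt (fun y => G (zc A y)) (G' y * dz A y) y := by
  filter_upwards [hA.hasDerivAt_zc] with y hy
  exact (hG y).hasDerivAt.comp y hy

/-- Dyadic decomposition of the kernel `s / (s + |x - y|) ^ 2`. -/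
theorem ofReal_ker_le (hs : 0 < s) (x y : ℝ) : ofReal (s / (s + |x - y|) ^ 2) ≤
      ∑' k : ℕ, (ball x (2 ^ k * s)).indicator
        (fun _ => ofReal (4 * (1 / 4) ^ k / s)) y := by
  have hex : ∃ k : ℕ, |x - y| < 2 ^ k * s := by
    obtain ⟨k, hk⟩ := pow_unbounded_of_one_lt (|x - y| / s) (one_lt_two)
    exact ⟨k, by rwa [div_lt_iff₀ hs] at hk⟩
  classical
  have hk := Nat.find_spec hex
  have hmin := fun m => Nat.find_min hex (m := m)
  set k := Nat.find hex
  refine le_trans ?_ (ENNReal.le_tsum k)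
  rw [indicator_of_mem (by rwa [mem_ball, dist_comm, dist_eq])]
  apply ofReal_le_ofReal
  have hpos : 0 ≤ |x - y| := abs_nonneg _
  rcases Nat.eq_zero_or_pos k with h0 | h0
  · rw [h0]
    rw [div_le_div_iff₀ (by positivity) hs]
    nlinarith
  · obtain ⟨j, hj⟩ : ∃ j, k = j + 1 := ⟨k - 1, by omega⟩
    have h2 := not_lt.1 (hmin j (by omega))
    rw [hj, div_le_div_iff₀ (by positivity) hs]
    have h3 : (2 ^ j * s) ^ 2 ≤ (s + |x - y|) ^ 2 := by
      apply pow_le_pow_left₀ (by positivity); linarith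
    have h4 : 4 * (1 / 4 : ℝ) ^ (j + 1) * (2 ^ j * s) ^ 2 = s ^ 2 := by
      rw [mul_pow, ← pow_mul, mul_comm j 2, pow_mul, pow_succ]
      have : (1 / 4 : ℝ) ^ j * (2 ^ 2) ^ j = 1 := by rw [← mul_pow]; norm_num
      linear_combination s ^ 2 * this
    have h5 : (0 : ℝ) < 4 * (1 / 4) ^ (j + 1) := by positivity
    nlinarith

theorem lintegral_ker_le {g : ℝ → ℝ≥0∞} (hg : AEMeasurable g) (hs : 0 < s) (x : ℝ) :
    ∫⁻ y, ofReal (s / (s + |x - y|) ^ 2) * g y ≤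
      ∑' k : ℕ, ofReal (4 * (1 / 4) ^ k / s) * ∫⁻ y in ball x (2 ^ k * s), g y := by
  calc _ ≤ ∫⁻ y, ∑' k : ℕ, (ball x (2 ^ k * s)).indicator
        (fun y => ofReal (4 * (1 / 4) ^ k / s) * g y) y := by
        refine lintegral_mono fun y => ?_
        refine (mul_le_mul_left (ofReal_ker_le hs x y) _).trans_eq ?_
        rw [← ENNReal.tsum_mul_right]
        refine tsum_congr fun k => ?_
        by_cases h : y ∈ ball x (2 ^ k * s) <;> simp only [indicator, h, if_true, if_false,
          zero_mul]
    _ = _ := by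
        rw [lintegral_tsum fun k => (hg.const_mul _).indicator isOpen_ball.measurableSet]
        refine tsum_congr fun k => ?_
        rw [lintegral_indicator isOpen_ball.measurableSet, lintegral_ofReal_mul]

theorem lintegral_ker_le_hlMax {g : ℝ → ℝ≥0∞} (hg : AEMeasurable g) (hs : 0 < s) (x : ℝ) :
    ∫⁻ y, ofReal (s / (s + |x - y|) ^ 2) * g y ≤ 16 * hlMax g x := by
  refine (lintegral_ker_le hg hs x).trans ?_
  calc _ ≤ ∑' k : ℕ, ofReal (8 * (1 / 2) ^ k) * hlMax g x := by
        refine tsum_le_tsum fun k => ?_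
        refine (mul_le_mul_right (setLIntegral_le_hlMax g x (by positivity)) _).trans_eq ?_
        rw [← mul_assoc, ← ofReal_mul (by positivity)]
        congr 2
        have : (1 / 4 : ℝ) ^ k * 2 ^ k = (1 / 2) ^ k := by rw [← mul_pow]; norm_num
        rw [← this]
        field_simp
        norm_num
    _ = _ := by
        rw [ENNReal.tsum_mul_right]
        congr 1
        rw [← ENNReal.ofReal_tsum_of_nonneg (fun k => by positivity)
          (summable_geometric_two.mul_left 8), tsum_mul_left, tsum_geometric_two]
        norm_num

/-- A Carleson measure of a superlevel set is controlled by the level set of a majorant of the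
nontangential maximal function. -/
theorem carleson_level {μ : Measure (ℝ × ℝ)} {K : ℝ≥0∞} (hK : K ≠ 0)
    (hμ : ∀ c r : ℝ, 0 < r → μ (ball c r ×ˢ Ioc 0 r) ≤ K * ofReal r)
    {E : Set (ℝ × ℝ)} {V : Set ℝ} (hE : ∀ q ∈ E, 0 < q.2 ∧ ball q.1 q.2 ⊆ V) :
    μ E ≤ 2 * K * volume V := by
  rcases eq_or_ne (volume V) ⊤ with h | hfin
  · rw [h, mul_top (mul_ne_zero two_ne_zero hK)]; exact le_top
  have hbdd : ∀ q ∈ E, q.2 ≤ (volume V).toReal := by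
    intro q hq
    have h1 := measure_mono (μ := volume) (hE q hq).2
    rw [volume_ball] at h1
    have h2 := (ENNReal.ofReal_le_iff_le_toReal hfin).1 h1
    have := (hE q hq).1
    linarith
  obtain ⟨u, huE, hdisj, hcov⟩ := Vitali.exists_disjoint_subfamily_covering_enlargement_ball E
    (fun q => q.1) (fun q => q.2) _ hbdd 4 (by norm_num)
  have hcount : u.Countable := by
    refine hdisj.countable_of_isOpen (fun _ _ => isOpen_ball) (fun q hq => ?_)
    exact ⟨q.1, mem_ball_self (hE q (huE hq)).1⟩
  have : Countable u := hcount.to_subtype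
  have hsub : E ⊆ ⋃ b ∈ u, ball b.1 (4 * b.2) ×ˢ Ioc 0 (4 * b.2) := by
    intro q hq
    obtain ⟨b, hb, hsub⟩ := hcov q hq
    refine mem_biUnion hb ⟨hsub (mem_ball_self (hE q hq).1), (hE q hq).1, ?_⟩
    have h1 := measure_mono (μ := volume) hsub
    have hb0 := (hE b (huE hb)).1
    rw [volume_ball, volume_ball, ofReal_le_ofReal_iff (by positivity)] at h1
    linarith
  calc μ E ≤ ∑' b : u, μ (ball (b : ℝ × ℝ).1 (4 * (b : ℝ × ℝ).2) ×ˢ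
        Ioc 0 (4 * (b : ℝ × ℝ).2)) := (measure_mono hsub).trans (measure_biUnion_le _ hcount _)
    _ ≤ ∑' b : u, 2 * K * volume (ball (b : ℝ × ℝ).1 (b : ℝ × ℝ).2) := by
        refine tsum_le_tsum fun b => ?_
        have hb0 := (hE b (huE b.2)).1
        refine (hμ _ _ (by positivity)).trans_eq ?_
        rw [volume_ball, mul_comm 2 K, mul_assoc,
          show (2 : ℝ≥0∞) = ofReal 2 by norm_num, ← ofReal_mul (by norm_num)]
        congr 2; ring
    _ = 2 * K * volume (⋃ b : u, ball (b : ℝ × ℝ).1 (b : ℝ × ℝ).2) := by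
        rw [ENNReal.tsum_mul_left, measure_iUnion _ fun _ => isOpen_ball.measurableSet]
        intro x y hxy
        exact hdisj x.2 y.2 (fun h => hxy (Subtype.ext h))
    _ ≤ 2 * K * volume V := by
        gcongr
        exact iUnion_subset fun b => (hE b (huE b.2)).2

/-- Carleson embedding theorem. -/
theorem carleson_embedding {μ : Measure (ℝ × ℝ)} [SFinite μ] {K : ℝ≥0∞} (hK : K ≠ 0)
    (hμ : ∀ c r : ℝ, 0 < r → μ (ball c r ×ˢ Ioc 0 r) ≤ K * ofReal r)
    {F : ℝ × ℝ → ℝ≥0∞} (hF : Measurable F) {N : ℝ → ℝ≥0∞} (hN : Measurable N)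
    (hFN : ∀ x s y : ℝ, |x - y| < s → F (x, s) ≤ N y) :
    ∫⁻ q in univ ×ˢ Ioi 0, F q ^ (2 : ℝ) ∂μ ≤ 2 * K * ∫⁻ y, N y ^ (2 : ℝ) := by
  have hN' : Measurable fun t : ℝ => ofReal (2 * t ^ (2 - 1 : ℝ)) *
      volume {x | ofReal t < N x} := by
    refine Measurable.mul ?_ ?_
    · exact ENNReal.measurable_ofReal.comp ((measurable_id.pow_const _).const_mul _)
    · refine Antitone.measurable fun a b hab => measure_mono fun x hx => ?_
      exact lt_of_le_of_lt (ofReal_le_ofReal hab) hx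
  rw [lintegral_rpow_layer two_pos hF, lintegral_rpow_layer two_pos hN, ← lintegral_const_mul _ hN']
  refine setLIntegral_mono' measurableSet_Ioi fun t _ => ?_
  rw [Measure.restrict_apply (measurableSet_lt measurable_const hF), mul_left_comm]
  refine mul_le_mul_right (carleson_level hK hμ ?_) _
  rintro ⟨x, s⟩ ⟨h1, -, h2⟩
  refine ⟨h2, fun y hy => ?_⟩
  rw [mem_ball, dist_comm, dist_eq] at hy
  exact lt_of_lt_of_le h1 (hFN x s y hy)

/-- The kernel `s / (s + |u|) ^ 2`. -/
def pker (s u : ℝ) : ℝ := s / (s + |u|) ^ 2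

theorem pker_nonneg (hs : 0 < s) (u : ℝ) : 0 ≤ pker s u := by unfold pker; positivity

theorem measurable_pker (s : ℝ) : Measurable (pker s) := by
  unfold pker
  exact measurable_const.div ((measurable_const.add measurable_norm).pow_const 2)

theorem hlMax_const (c : ℝ≥0∞) (x : ℝ) : hlMax (fun _ => c) x ≤ c := by
  refine iSup₂_le fun r hr => ?_
  rw [setLIntegral_const, volume_ball]
  refine div_le_of_le_mul le_rfl

theorem lintegral_pker_le (hs : 0 < s) (x : ℝ) : ∫⁻ y, ofReal (pker s (x - y)) ≤ 16 := by
  have h := lintegral_ker_le_hlMax (g := fun _ => 1) aemeasurable_const hs x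
  simp only [mul_one] at h
  refine h.trans ?_
  calc _ ≤ 16 * (1 : ℝ≥0∞) := by gcongr; exact hlMax_const _ _
    _ = 16 := by norm_num

theorem integrable_pker (hs : 0 < s) (x : ℝ) : Integrable fun y => pker s (x - y) := by
  refine ⟨((measurable_pker s).comp (measurable_const.sub measurable_id)).aestronglyMeasurable, ?_⟩
  rw [hasFiniteIntegral_iff_ofReal (ae_of_all _ fun y => pker_nonneg hs _)]
  exact (lintegral_pker_le hs x).trans_lt (by norm_num)

theorem integral_pker_le (hs : 0 < s) (x : ℝ) : ∫ y, pker s (x - y) ≤ 16 := by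
  rw [integral_eq_lintegral_of_nonneg_ae (ae_of_all _ fun y => pker_nonneg hs _)
    (integrable_pker hs x).1]
  exact ENNReal.toReal_le_of_le_ofReal (by norm_num) (by simpa using lintegral_pker_le hs x)

theorem lintegral_pker_mul_le {g : ℝ → ℝ≥0∞} (hg : AEMeasurable g) (hs : 0 < s) (x : ℝ) :
    ∫⁻ y, ofReal (pker s (x - y)) * g y ≤ 16 * hlMax g x :=
  lintegral_ker_le_hlMax hg hs x

/-- The kernel `s p_s'` up to sign, for the exponential kernel `p_s(t) = e^{-|t|/s} / (2s)`. -/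
def qk (s t : ℝ) : ℝ := Real.sign t * ((2 * s)⁻¹ * exp (-|t| / s))

def pk (s t : ℝ) : ℝ := (2 * s)⁻¹ * exp (-|t| / s)

theorem cube_mul_exp_neg_le {w : ℝ} (hw : 0 ≤ w) : (1 + w) ^ 3 * exp (-w) ≤ 18 := by
  have h := Real.pow_div_factorial_le_exp (1 + w) (by linarith) 3
  have h3 : exp 1 ≤ 3 := by have := Real.exp_one_lt_d9; linarith
  have h4 : (1 + w) ^ 3 ≤ 6 * exp (1 + w) := by
    have : ((Nat.factorial 3 : ℕ) : ℝ) = 6 := by norm_num [Nat.factorial]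
    rw [this] at h
    linarith
  calc (1 + w) ^ 3 * exp (-w) ≤ 6 * exp (1 + w) * exp (-w) := by gcongr
    _ = 6 * exp 1 := by rw [mul_assoc, ← exp_add]; congr 2; ring
    _ ≤ 18 := by linarith

theorem pk_nonneg (hs : 0 < s) (t : ℝ) : 0 ≤ pk s t := by unfold pk; positivity

theorem pk_le_cube (hs : 0 < s) (t : ℝ) : pk s t ≤ 9 * (s ^ 2 / (s + |t|) ^ 3) := by
  have h := cube_mul_exp_neg_le (w := |t| / s) (by positivity)
  have h1 : 1 + |t| / s = (s + |t|) / s := by field_simp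
  rw [h1, div_pow] at h
  unfold pk
  have h0 := abs_nonneg t
  rw [neg_div, mul_div_assoc', le_div_iff₀ (by positivity)]
  rw [div_mul_eq_mul_div, div_le_iff₀ (by positivity)] at h
  have h2 : (2 * s)⁻¹ * exp (-(|t| / s)) * (s + |t|) ^ 3 =
      (2 * s)⁻¹ * ((s + |t|) ^ 3 * exp (-(|t| / s))) := by ring
  rw [h2]
  calc _ ≤ (2 * s)⁻¹ * (18 * s ^ 3) := by gcongr
    _ = _ := by field_simp; norm_num

theorem cube_le_pker (hs : 0 < s) (t : ℝ) : s ^ 2 / (s + |t|) ^ 3 ≤ pker s t := by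
  unfold pker
  have h0 := abs_nonneg t
  rw [div_le_div_iff₀ (by positivity) (by positivity)]
  have : s ≤ s + |t| := by linarith
  calc s ^ 2 * (s + |t|) ^ 2 = s * (s + |t|) ^ 2 * s := by ring
    _ ≤ s * (s + |t|) ^ 2 * (s + |t|) := by gcongr
    _ = _ := by ring

theorem pk_le_pker (hs : 0 < s) (t : ℝ) : pk s t ≤ 9 * pker s t :=
  (pk_le_cube hs t).trans (by gcongr; exact cube_le_pker hs t)

theorem measurable_pk (s : ℝ) : Measurable (pk s) := by unfold pk; fun_prop

theorem measurable_pk₂ : Measurable (Function.uncurry pk) := by unfold pk; fun_prop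

theorem measurable_sign : Measurable sign := by
  unfold sign
  exact Measurable.ite measurableSet_Iio measurable_const
    (Measurable.ite measurableSet_Ioi measurable_const measurable_const)

theorem measurable_qk₂ : Measurable (Function.uncurry qk) := by
  unfold qk
  have h : Measurable fun p : ℝ × ℝ => sign p.2 := measurable_sign.comp measurable_snd
  exact h.mul measurable_pk₂

theorem measurable_qk (s : ℝ) : Measurable (qk s) :=
  measurable_qk₂.comp (measurable_const.prodMk measurable_id)

theorem abs_qk_le (hs : 0 < s) (t : ℝ) : |qk s t| ≤ pk s t := by
  have h : |sign t| ≤ 1 := by rcases Real.sign_apply_eq t with h | h | h <;> rw [h] <;> simp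
  have h1 := pk_nonneg hs t
  unfold qk
  change |sign t * pk s t| ≤ pk s t
  rw [abs_mul, abs_of_nonneg h1]
  nlinarith

theorem LocallyLipschitz.mul_complex (hf : LocallyLipschitz f)
    (hg : LocallyLipschitz g) : LocallyLipschitz fun x => f x * g x := by
  have h : LocallyLipschitz fun p : ℂ × ℂ => p.1 * p.2 :=
    (contDiff_mul (𝕜 := ℝ) (n := 1)).locallyLipschitz
  exact h.comp (hf.prodMk hg)

theorem LocallyLipschitz.add_complex (hf : LocallyLipschitz f)
    (hg : LocallyLipschitz g) : LocallyLipschitz fun x => f x + g x := by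
  have h : LocallyLipschitz fun p : ℂ × ℂ => p.1 + p.2 :=
    (contDiff_add (𝕜 := ℝ) (n := 1)).locallyLipschitz
  exact h.comp (hf.prodMk hg)

theorem LocallyLipschitz.integral_Ioi_eq {F' : ℝ → ℂ} (hF : LocallyLipschitz F)
    (hd : ∀ᵐ x, HasDerivAt F (F' x) x) (hi : LocallyIntegrable F') (a : ℝ)
    (hi' : IntegrableOn F' (Ioi a))
    {m : ℂ} (hm : Tendsto F atTop (nhds m)) : ∫ x in Ioi a, F' x = m - F a := by
  refine tendsto_nhds_unique (intervalIntegral_tendsto_integral_Ioi a hi' tendsto_id) ?_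
  refine (hm.sub_const (F a)).congr fun n => ?_
  rw [id, hF.integral_eq_sub hd hi]

theorem LocallyLipschitz.integral_Iic_eq {F' : ℝ → ℂ} (hF : LocallyLipschitz F)
    (hd : ∀ᵐ x, HasDerivAt F (F' x) x) (hi : LocallyIntegrable F') (a : ℝ)
    (hi' : IntegrableOn F' (Iic a))
    {m : ℂ} (hm : Tendsto F atBot (nhds m)) : ∫ x in Iic a, F' x = F a - m := by
  refine tendsto_nhds_unique (intervalIntegral_tendsto_integral_Iic a hi' tendsto_id) ?_
  refine (hm.const_sub (F a)).congr fun n => ?_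
  rw [id, hF.integral_eq_sub hd hi]

/-- Tails of functions with cubic decay. -/
theorem norm_setIntegral_tail_le {r : ℝ → ℂ} (hs : 0 < s) (hC : 0 ≤ C)
    (hb : ∀ v, ‖r v‖ ≤ C * (s ^ 2 / (s + |x - v|) ^ 3)) (hu : 0 ≤ u) {S : Set ℝ}
    (hS : MeasurableSet S) (hSu : ∀ v ∈ S, u ≤ |x - v|) :
    ‖∫ v in S, r v‖ ≤ 128 * C * (s ^ 2 / (s + u) ^ 2) := by
  have hpt : ∀ v ∈ S, ‖r v‖ ≤ 8 * C * (s ^ 2 / (s + u) ^ 2) * pker (s + u) (x - v) := by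
    intro v hv
    refine (hb v).trans ?_
    have h1 := hSu v hv
    have e : 8 * C * (s ^ 2 / (s + u) ^ 2) * pker (s + u) (x - v) =
        C * (s ^ 2 * (8 / ((s + u) * (s + u + |x - v|) ^ 2))) := by
      unfold pker; field_simp
    rw [e, div_eq_mul_one_div]
    refine mul_le_mul_of_nonneg_left (mul_le_mul_of_nonneg_left ?_ (by positivity)) hC
    rw [div_le_div_iff₀ (by positivity) (by positivity), one_mul]
    have h2 : (s + u) * (s + u + |x - v|) ^ 2 ≤ (s + |x - v|) * (2 * (s + |x - v|)) ^ 2 := by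
      gcongr; linarith
    nlinarith [show (0 : ℝ) ≤ (s + |x - v|) ^ 3 by positivity]
  have hnt : Integrable fun v => 8 * C * (s ^ 2 / (s + u) ^ 2) * pker (s + u) (x - v) :=
    (integrable_pker (by positivity) x).const_mul _
  calc ‖∫ v in S, r v‖
      ≤ ∫ v in S, 8 * C * (s ^ 2 / (s + u) ^ 2) * pker (s + u) (x - v) := by
        refine norm_integral_le_of_norm_le hnt.integrableOn ?_
        filter_upwards [ae_restrict_mem hS] with v hv using hpt v hv
    _ ≤ ∫ v, 8 * C * (s ^ 2 / (s + u) ^ 2) * pker (s + u) (x - v) := by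
        refine setIntegral_le_integral hnt (ae_of_all _ fun v => ?_)
        have := pker_nonneg (show 0 < s + u by positivity) (x - v)
        simp only [Pi.zero_apply]
        positivity
    _ ≤ 8 * C * (s ^ 2 / (s + u) ^ 2) * 16 := by
        rw [integral_const_mul]
        gcongr
        exact integral_pker_le (by positivity) x
    _ = _ := by ring

theorem tendsto_exp_neg_div_atTop (hs : 0 < s) (y : ℝ) :
    Tendsto (fun v => exp (-(v - y) / s)) atTop (nhds 0) := by
  refine tendsto_exp_atBot.comp ?_
  refine Tendsto.atBot_div_const hs ?_
  exact tendsto_neg_atTop_atBot.comp (tendsto_atTop_add_const_right _ _ tendsto_id)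

/-- A mean zero kernel with decay factors through the kernel `qk`. -/
theorem exists_qk_repr {r r' : ℝ → ℂ} (hs : 0 < s) (hC : 0 ≤ C)
    (hr : LocallyLipschitz r) (hd : ∀ᵐ v, HasDerivAt r (r' v) v) (hm : Measurable r')
    (hb : ∀ v, ‖r v‖ ≤ C * (s ^ 2 / (s + |x - v|) ^ 3))
    (hb' : ∀ v, ‖r' v‖ ≤ C * (s / (s + |x - v|) ^ 3)) (h0 : ∫ v, r v = 0) :
    ∃ m : ℝ → ℂ, Measurable m ∧ (∀ v, ‖m v‖ ≤ 129 * C * pker s (x - v)) ∧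
      ∀ y, r y = ∫ v, m v * qk s (v - y) := by
  have hrc : Continuous r := hr.continuous
  have hri : Integrable r := by
    refine Integrable.mono' ((integrable_pker hs x).const_mul C) hrc.aestronglyMeasurable ?_
    exact ae_of_all _ fun v => (hb v).trans (by gcongr; exact cube_le_pker hs _)
  set ρ : ℝ → ℂ := fun v => ∫ w in Iic v, r w with hρ
  have hρd : ∀ v, HasDerivAt ρ (r v) v := by
    intro v
    have h1 : ∀ w, ρ w = (∫ t in Iic (0 : ℝ), r t) + ∫ t in (0 : ℝ)..w, r t := by
      intro w
      rw [hρ, ← intervalIntegral.integral_Iic_sub_Iic hri.integrableOn hri.integrableOn]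
      ring
    have h2 : HasDerivAt (fun w => (∫ t in Iic (0 : ℝ), r t) + ∫ t in (0 : ℝ)..w, r t) (r v) v :=
      (intervalIntegral.integral_hasDerivAt_right (hri.intervalIntegrable)
        (hrc.stronglyMeasurableAtFilter _ _) hrc.continuousAt).const_add _
    exact h2.congr_of_eventuallyEq (.of_forall h1)
  have hρll : LocallyLipschitz ρ := by
    refine ContDiff.locallyLipschitz (𝕂 := ℝ) ?_
    rw [contDiff_one_iff_deriv]
    refine ⟨fun v => (hρd v).differentiableAt, ?_⟩
    rw [show deriv ρ = r from funext fun v => (hρd v).deriv]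
    exact hrc
  have hρb : ∀ v, ‖ρ v‖ ≤ 128 * C * (s ^ 2 / (s + |x - v|) ^ 2) := by
    intro v
    rcases le_total v x with h | h
    · refine norm_setIntegral_tail_le hs hC hb (abs_nonneg _) measurableSet_Iic fun w hw => ?_
      have hw : w ≤ v := hw
      rw [abs_of_nonneg (by linarith), abs_of_nonneg (by linarith)]
      linarith
    · have h1 : ρ v = -∫ w in Ioi v, r w := by
        have := integral_add_compl (measurableSet_Iic (a := v)) hri
        rw [compl_Iic, h0] at this
        exact eq_neg_of_add_eq_zero_left this
      rw [h1, norm_neg]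
      refine norm_setIntegral_tail_le hs hC hb (abs_nonneg _) measurableSet_Ioi fun w hw => ?_
      have hw : v < w := hw
      rw [abs_of_nonpos (by linarith), abs_of_nonpos (by linarith)]
      linarith
  set m : ℝ → ℂ := fun v => ρ v / s - s * r' v with hmdef
  have hmm : Measurable m := (hρll.continuous.measurable.div_const _).sub (measurable_const.mul hm)
  have hmb : ∀ v, ‖m v‖ ≤ 129 * C * pker s (x - v) := by
    intro v
    have h1 : ‖ρ v / s‖ ≤ 128 * C * pker s (x - v) := by
      rw [norm_div, norm_real, norm_of_nonneg hs.le, div_le_iff₀ hs]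
      refine (hρb v).trans_eq ?_
      unfold pker; ring
    have h2 : ‖(s : ℂ) * r' v‖ ≤ C * pker s (x - v) := by
      rw [norm_mul, norm_real, norm_of_nonneg hs.le]
      calc s * ‖r' v‖ ≤ s * (C * (s / (s + |x - v|) ^ 3)) := by gcongr; exact hb' v
        _ = C * (s ^ 2 / (s + |x - v|) ^ 3) := by ring
        _ ≤ _ := by gcongr; exact cube_le_pker hs _
    calc ‖m v‖ ≤ ‖ρ v / s‖ + ‖(s : ℂ) * r' v‖ := norm_sub_le _ _
      _ ≤ _ := by linarith
  refine ⟨m, hmm, hmb, fun y => ?_⟩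
  have hmi : Integrable m :=
    Integrable.mono' ((integrable_pker hs x).const_mul _) hmm.aestronglyMeasurable (ae_of_all _ hmb)
  have hr'i : Integrable r' := by
    refine Integrable.mono' ((integrable_pker hs x).const_mul (C / s)) hm.aestronglyMeasurable ?_
    refine ae_of_all _ fun v => (hb' v).trans ?_
    calc C * (s / (s + |x - v|) ^ 3) = C / s * (s ^ 2 / (s + |x - v|) ^ 3) := by field_simp
      _ ≤ _ := by gcongr; exact cube_le_pker hs _
  -- boundedness of the two primitives
  have hbd : ∀ v, ‖ρ v‖ + s * ‖r v‖ ≤ 128 * C + C := by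
    intro v
    have h1 : s ^ 2 / (s + |x - v|) ^ 2 ≤ 1 := by rw [div_le_one (by positivity)]; gcongr; simp
    have h2 : s * (s ^ 2 / (s + |x - v|) ^ 3) ≤ 1 := by
      rw [mul_div_assoc', div_le_one (by positivity)]
      calc s * s ^ 2 = s ^ 3 := by ring
        _ ≤ _ := by gcongr; simp
    have h3 := hρb v
    have h4 := hb v
    calc ‖ρ v‖ + s * ‖r v‖ ≤ 128 * C * (s ^ 2 / (s + |x - v|) ^ 2) +
        s * (C * (s ^ 2 / (s + |x - v|) ^ 3)) := by gcongr
      _ = 128 * C * (s ^ 2 / (s + |x - v|) ^ 2) + C * (s * (s ^ 2 / (s + |x - v|) ^ 3)) := by ring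
      _ ≤ 128 * C * 1 + C * 1 := by gcongr
      _ = _ := by ring
  have hsC : (s : ℂ) ≠ 0 := by exact_mod_cast hs.ne'
  have hqm : Measurable fun v => m v * (qk s (v - y) : ℂ) :=
    hmm.mul (measurable_ofReal.comp ((measurable_qk s).comp (measurable_id.sub_const y)))
  have hqi : Integrable fun v => m v * (qk s (v - y) : ℂ) := by
    refine Integrable.mono' (hmi.norm.mul_const ((2 * s)⁻¹)) hqm.aestronglyMeasurable ?_
    refine ae_of_all _ fun v => ?_
    rw [norm_mul, norm_real]
    gcongr
    refine (abs_qk_le hs _).trans ?_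
    unfold pk
    have : exp (-|v - y| / s) ≤ 1 := exp_le_one_iff.2 (by rw [neg_div]; simp; positivity)
    calc _ ≤ (2 * s)⁻¹ * 1 := by gcongr
      _ = _ := mul_one _
  -- the right half line
  have hR : ∫ v in Ioi y, m v * (qk s (v - y) : ℂ) = (2 * s)⁻¹ * (ρ y + s * r y) := by
    set E : ℝ → ℝ := fun v => exp (-(v - y) / s) with hE
    have hEd : ∀ v, HasDerivAt (fun v => (E v : ℂ)) ((-(E v / s) : ℝ) : ℂ) v := by
      intro v
      have : HasDerivAt E (exp (-(v - y) / s) * (-1 / s)) v :=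
        ((((hasDerivAt_id v).sub_const y).neg).div_const s).exp
      convert this.ofReal_comp using 2
      ring
    have hEc : ContDiff ℝ 1 (fun v => (E v : ℂ)) := by
      have h1 : ContDiff ℝ 1 E := by rw [hE]; fun_prop
      exact ofRealCLM.contDiff.comp h1
    set F : ℝ → ℂ := fun v => (E v : ℂ) * (ρ v + s * r v)
    have hF : LocallyLipschitz F := hEc.locallyLipschitz.mul_complex
      (hρll.add_complex ((LocallyLipschitz.const (s : ℂ)).mul_complex hr))
    have hFd : ∀ᵐ v, HasDerivAt F (-((E v : ℂ) * m v)) v := by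
      filter_upwards [hd] with v hv
      refine ((hEd v).mul ((hρd v).add (hv.const_mul (s : ℂ)))).congr_deriv ?_
      simp only [hmdef, Pi.add_apply]
      push_cast
      field_simp
      ring
    have hEm : Measurable fun v => -((E v : ℂ) * m v) := (hEc.continuous.measurable.mul hmm).neg
    have hFi : IntegrableOn (fun v => -((E v : ℂ) * m v)) (Ioi y) := by
      refine Integrable.mono' hmi.norm.integrableOn hEm.aestronglyMeasurable ?_
      filter_upwards [ae_restrict_mem measurableSet_Ioi] with v hv
      have hv : y < v := hv
      rw [norm_neg, norm_mul, norm_real, norm_of_nonneg (exp_pos _).le]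
      refine mul_le_of_le_one_left (norm_nonneg _) (exp_le_one_iff.2 ?_)
      rw [neg_div, neg_nonpos]
      exact div_nonneg (by linarith) hs.le
    have hFl : LocallyIntegrable (fun v => -((E v : ℂ) * m v)) :=
      (hmi.locallyIntegrable.continuous_mul hEc.continuous).neg
    have hlim : Tendsto F atTop (nhds 0) := by
      rw [tendsto_zero_iff_norm_tendsto_zero]
      have h2 := (tendsto_exp_neg_div_atTop hs y).mul_const (128 * C + C)
      rw [zero_mul] at h2
      refine squeeze_zero (fun _ => norm_nonneg _) (fun v => ?_) h2
      rw [norm_mul, norm_real, norm_of_nonneg (exp_pos _).le]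
      refine mul_le_mul_of_nonneg_left ((norm_add_le _ _).trans ?_) (exp_pos _).le
      rw [norm_mul, norm_real, norm_of_nonneg hs.le]
      exact hbd v
    have := hF.integral_Ioi_eq hFd hFl y hFi hlim
    have e : ∫ v in Ioi y, m v * (qk s (v - y) : ℂ) =
        ∫ v in Ioi y, -((2 * s : ℂ)⁻¹) * (-((E v : ℂ) * m v)) := by
      refine setIntegral_congr_fun measurableSet_Ioi fun v hv => ?_
      have hv : y < v := hv
      simp only [qk, sign_of_pos (sub_pos.2 hv), abs_of_pos (sub_pos.2 hv), hE]
      push_cast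
      ring
    rw [e, integral_const_mul, this]
    simp only [F, hE, sub_self, neg_zero, zero_div, exp_zero]
    push_cast
    ring
  have hL : ∫ v in Iic y, m v * (qk s (v - y) : ℂ) = -((2 * s)⁻¹ * (ρ y - s * r y)) := by
    set E : ℝ → ℝ := fun v => exp ((v - y) / s) with hE
    have hEd : ∀ v, HasDerivAt (fun v => (E v : ℂ)) (((E v / s) : ℝ) : ℂ) v := by
      intro v
      have : HasDerivAt E (exp ((v - y) / s) * (1 / s)) v :=
        (((hasDerivAt_id v).sub_const y).div_const s).exp
      convert this.ofReal_comp using 2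
      ring
    have hEc : ContDiff ℝ 1 (fun v => (E v : ℂ)) := by
      have h1 : ContDiff ℝ 1 E := by rw [hE]; fun_prop
      exact ofRealCLM.contDiff.comp h1
    set F : ℝ → ℂ := fun v => (E v : ℂ) * (ρ v + (-s : ℂ) * r v)
    have hF : LocallyLipschitz F := hEc.locallyLipschitz.mul_complex
      (hρll.add_complex ((LocallyLipschitz.const (-s : ℂ)).mul_complex hr))
    have hFd : ∀ᵐ v, HasDerivAt F ((E v : ℂ) * m v) v := by
      filter_upwards [hd] with v hv
      refine ((hEd v).mul ((hρd v).add (hv.const_mul (-s : ℂ)))).congr_deriv ?_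
      simp only [hmdef, Pi.add_apply]
      push_cast
      field_simp
      ring
    have hEm : Measurable fun v => (E v : ℂ) * m v := hEc.continuous.measurable.mul hmm
    have hFi : IntegrableOn (fun v => (E v : ℂ) * m v) (Iic y) := by
      refine Integrable.mono' hmi.norm.integrableOn hEm.aestronglyMeasurable ?_
      filter_upwards [ae_restrict_mem measurableSet_Iic] with v hv
      have hv : v ≤ y := hv
      rw [norm_mul, norm_real, norm_of_nonneg (exp_pos _).le]
      refine mul_le_of_le_one_left (norm_nonneg _) (exp_le_one_iff.2 ?_)
      exact div_nonpos_of_nonpos_of_nonneg (by linarith) hs.le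
    have hFl : LocallyIntegrable (fun v => (E v : ℂ) * m v) :=
      hmi.locallyIntegrable.continuous_mul hEc.continuous
    have hlim : Tendsto F atBot (nhds 0) := by
      rw [tendsto_zero_iff_norm_tendsto_zero]
      have h1 : Tendsto (fun v => exp ((v - y) / s)) atBot (nhds 0) :=
        tendsto_exp_atBot.comp (Tendsto.atBot_div_const hs
          (tendsto_atBot_add_const_right _ _ tendsto_id))
      have h2 := h1.mul_const (128 * C + C)
      rw [zero_mul] at h2
      refine squeeze_zero (fun _ => norm_nonneg _) (fun v => ?_) h2
      rw [norm_mul, norm_real, norm_of_nonneg (exp_pos _).le]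
      refine mul_le_mul_of_nonneg_left ((norm_add_le _ _).trans ?_) (exp_pos _).le
      rw [norm_mul, norm_neg, norm_real, norm_of_nonneg hs.le]
      exact hbd v
    have := hF.integral_Iic_eq hFd hFl y hFi hlim
    have e : ∫ v in Iic y, m v * (qk s (v - y) : ℂ) =
        ∫ v in Iic y, -((2 * s : ℂ)⁻¹) * ((E v : ℂ) * m v) := by
      rw [integral_Iic_eq_integral_Iio, integral_Iic_eq_integral_Iio]
      refine setIntegral_congr_fun measurableSet_Iio fun v hv => ?_
      have hv : v < y := hv
      simp only [qk, sign_of_neg (sub_neg.2 hv), abs_of_neg (sub_neg.2 hv), hE, neg_neg]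
      push_cast
      ring
    rw [e, integral_const_mul, this]
    simp only [F, hE, sub_self, zero_div, exp_zero]
    push_cast
    ring
  rw [← integral_add_compl (measurableSet_Iic (a := y)) hqi, compl_Iic, hR, hL]
  push_cast
  field_simp
  ring

/-- Bounded measurable functions with bounded support. -/
structure BC (f : ℝ → ℂ) : Prop where
  meas : Measurable f
  bdd : ∃ M : ℝ, ∀ x, ‖f x‖ ≤ M
  supp : ∃ R : ℝ, ∀ x, R < |x| → f x = 0

theorem BC.exists_bound (hf : BC f) : ∃ M R : ℝ, 0 < M ∧ 0 < R ∧ (∀ x, ‖f x‖ ≤ M) ∧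
    (∀ x, R < |x| → f x = 0) := by
  obtain ⟨M, hM⟩ := hf.bdd
  obtain ⟨R, hR⟩ := hf.supp
  refine ⟨max M 1, max R 1, by positivity, by positivity, fun x => (hM x).trans (le_max_left _ _),
    fun x hx => hR x (lt_of_le_of_lt (le_max_left _ _) hx)⟩

theorem BC.memLp (hf : BC f) (p : ℝ≥0∞) : MemLp f p := by
  obtain ⟨M, R, hM, hR, hfM, hfR⟩ := hf.exists_bound
  have h1 : MemLp (fun _ : ℝ => M) p (volume.restrict (Icc (-R) R)) := memLp_const M
  have h2 : MemLp f p (volume.restrict (Icc (-R) R)) :=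
    h1.mono hf.meas.aestronglyMeasurable (ae_of_all _ fun x => by
      rw [norm_of_nonneg hM.le]; exact hfM x)
  have h3 := (memLp_indicator_iff_restrict measurableSet_Icc).2 h2
  rwa [indicator_eq_self.2] at h3
  intro x hx
  by_contra h
  refine hx (hfR x ?_)
  rw [mem_Icc, ← abs_le] at h
  exact not_le.1 h

theorem BC.integrable (hf : BC f) : Integrable f := memLp_one_iff_integrable.1 (hf.memLp 1)

theorem BC.conj (hf : BC f) : BC fun x => (starRingEnd ℂ) (f x) := by
  obtain ⟨M, R, hM, hR, hfM, hfR⟩ := hf.exists_bound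
  exact ⟨continuous_conj.measurable.comp hf.meas, ⟨M, fun x => by simpa using hfM x⟩,
    ⟨R, fun x hx => by simp [hfR x hx]⟩⟩

theorem BC.mul_bdd (hf : BC f) (hg : Measurable g) (hK : ∀ x, ‖g x‖ ≤ K) :
    BC fun x => g x * f x := by
  obtain ⟨M, R, hM, hR, hfM, hfR⟩ := hf.exists_bound
  refine ⟨hg.mul hf.meas, ⟨K * M, fun x => ?_⟩, ⟨R, fun x hx => by simp [hfR x hx]⟩⟩
  rw [norm_mul]
  exact mul_le_mul (hK x) (hfM x) (norm_nonneg _) ((norm_nonneg _).trans (hK x))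

theorem BC.indicator (hf : BC f) {S : Set ℝ} (hS : MeasurableSet S) : BC (S.indicator f) := by
  obtain ⟨M, R, hM, hR, hfM, hfR⟩ := hf.exists_bound
  refine ⟨hf.meas.indicator hS, ⟨M, fun x => ?_⟩, ⟨R, fun x hx => ?_⟩⟩
  · exact (norm_indicator_le_norm_self _ _).trans (hfM x)
  · by_cases h : x ∈ S <;> simp [h, hfR x hx]

theorem BC.sub (hf : BC f) (hg : BC g) : BC fun x => f x - g x := by
  obtain ⟨M, R, hM, hR, hfM, hfR⟩ := hf.exists_bound
  obtain ⟨M', R', hM', hR', hgM, hgR⟩ := hg.exists_bound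
  refine ⟨hf.meas.sub hg.meas, ⟨M + M', fun x => (norm_sub_le _ _).trans
    (add_le_add (hfM x) (hgM x))⟩, ⟨max R R', fun x hx => ?_⟩⟩
  rw [hfR x (lt_of_le_of_lt (le_max_left _ _) hx), hgR x (lt_of_le_of_lt (le_max_right _ _) hx),
    sub_zero]

/-- Convolution with `qk s`. -/
def Qop (s : ℝ) (f : ℝ → ℂ) (v : ℝ) : ℂ := ∫ y, (qk s (v - y) : ℂ) * f y

theorem integrable_pk (hs : 0 < s) (x : ℝ) : Integrable fun y => pk s (x - y) :=
  Integrable.mono' ((integrable_pker hs x).const_mul 9)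
    ((measurable_pk s).comp (measurable_const.sub measurable_id)).aestronglyMeasurable
    (ae_of_all _ fun y => by rw [norm_of_nonneg (pk_nonneg hs _)]; exact pk_le_pker hs _)

theorem pk_comm (s x y : ℝ) : pk s (x - y) = pk s (y - x) := by
  unfold pk; rw [abs_sub_comm]

theorem pk_le_inv (hs : 0 < s) (t : ℝ) : pk s t ≤ (2 * s)⁻¹ := by
  unfold pk
  have : exp (-|t| / s) ≤ 1 := exp_le_one_iff.2 (by rw [neg_div]; simp; positivity)
  calc _ ≤ (2 * s)⁻¹ * 1 := by gcongr
    _ = _ := mul_one _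

theorem measurable_Qop (hf : Measurable f) :
    Measurable (Function.uncurry fun s v => Qop s f v) := by
  unfold Qop
  have h : Measurable fun q : (ℝ × ℝ) × ℝ => (qk q.1.1 (q.1.2 - q.2) : ℂ) * f q.2 := by
    refine Measurable.mul (measurable_ofReal.comp ?_) (hf.comp measurable_snd)
    exact measurable_qk₂.comp ((measurable_fst.comp measurable_fst).prodMk
      ((measurable_snd.comp measurable_fst).sub measurable_snd))
  exact (h.stronglyMeasurable.integral_prod_right (ν := volume)).measurable

/-- The autocorrelation of `qk s`. -/
theorem integral_qk_mul_qk (hs : 0 < s) (y z : ℝ) : ∫ v, qk s (v - y) * qk s (v - z) =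
      (4 * s)⁻¹ * (1 - |y - z| / s) * exp (-|y - z| / s) := by
  wlog hyz : y ≤ z generalizing y z
  · rw [abs_sub_comm, ← this z y (le_of_not_ge hyz)]
    exact integral_congr_ae (ae_of_all _ fun v => mul_comm _ _)
  have hnt : Integrable fun v => qk s (v - y) * qk s (v - z) := by
    refine Integrable.mono' ((integrable_pk hs y).mul_const (2 * s)⁻¹)
      (((measurable_qk s).comp (measurable_id.sub_const y)).mul
      ((measurable_qk s).comp (measurable_id.sub_const z))).aestronglyMeasurable
      (ae_of_all _ fun v => ?_)
    rw [norm_mul, norm_eq_abs, norm_eq_abs, pk_comm]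
    exact mul_le_mul (abs_qk_le hs _) ((abs_qk_le hs _).trans (pk_le_inv hs _)) (abs_nonneg _)
      (pk_nonneg hs _)
  have h1 : ∫ v in Iic y, qk s (v - y) * qk s (v - z) = (8 * s)⁻¹ * exp (-(z - y) / s) := by
    have hd : ∀ v ∈ Iic y, HasDerivAt (fun v => (8 * s)⁻¹ * exp ((2 * v - y - z) / s))
        ((4 * s ^ 2)⁻¹ * exp ((2 * v - y - z) / s)) v := by
      intro v _
      refine (((((((hasDerivAt_id v).const_mul 2).sub_const y).sub_const z).div_const s).exp).const_mul
        (8 * s)⁻¹).congr_deriv ?_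
      simp only [id]; field_simp; norm_num
    have e : ∀ v ∈ Iio y, qk s (v - y) * qk s (v - z) =
        (4 * s ^ 2)⁻¹ * exp ((2 * v - y - z) / s) := by
      intro v hv
      have hv : v < y := hv
      simp only [qk, sign_of_neg (sub_neg.2 hv), abs_of_neg (sub_neg.2 hv),
        sign_of_neg (sub_neg.2 (hv.trans_le hyz)), abs_of_neg (sub_neg.2 (hv.trans_le hyz))]
      have : (2 * v - y - z) / s = - -(v - y) / s + - -(v - z) / s := by field_simp; ring
      rw [this, exp_add]
      ring
    have hi : IntegrableOn (fun v => (4 * s ^ 2)⁻¹ * exp ((2 * v - y - z) / s)) (Iic y) := by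
      rw [integrableOn_Iic_iff_integrableOn_Iio]
      exact (hnt.integrableOn (s := Iio y)).congr_fun e measurableSet_Iio
    have hl : Tendsto (fun v => (8 * s)⁻¹ * exp ((2 * v - y - z) / s)) atBot (nhds 0) := by
      rw [← mul_zero (8 * s)⁻¹]
      refine Tendsto.const_mul _ (tendsto_exp_atBot.comp (Tendsto.atBot_div_const hs ?_))
      refine tendsto_atBot_add_const_right _ _ (tendsto_atBot_add_const_right _ _ ?_)
      exact tendsto_id.const_mul_atBot two_pos
    have := integral_Iic_of_hasDerivAt_of_tendsto' hd hi hl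
    rw [integral_Iic_eq_integral_Iio] at this ⊢
    rw [setIntegral_congr_fun measurableSet_Iio e, this, sub_zero]
    congr 3; ring
  have h2 : ∫ v in Ioc y z, qk s (v - y) * qk s (v - z) =
      -((4 * s ^ 2)⁻¹ * (z - y) * exp (-(z - y) / s)) := by
    have e : ∀ v ∈ Ioo y z, qk s (v - y) * qk s (v - z) =
        -((4 * s ^ 2)⁻¹ * exp (-(z - y) / s)) := by
      rintro v ⟨hv, hv'⟩
      simp only [qk, sign_of_pos (sub_pos.2 hv), abs_of_pos (sub_pos.2 hv),
        sign_of_neg (sub_neg.2 hv'), abs_of_neg (sub_neg.2 hv')]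
      have : -(z - y) / s = -(v - y) / s + - -(v - z) / s := by field_simp; ring
      rw [this, exp_add]
      ring
    rw [integral_Ioc_eq_integral_Ioo, setIntegral_congr_fun measurableSet_Ioo e, setIntegral_const]
    simp only [measureReal_def, Real.volume_Ioo, smul_eq_mul, toReal_ofReal (sub_nonneg.2 hyz)]
    ring
  have h3 : ∫ v in Ioi z, qk s (v - y) * qk s (v - z) = (8 * s)⁻¹ * exp (-(z - y) / s) := by
    have hd : ∀ v ∈ Ici z, HasDerivAt (fun v => -((8 * s)⁻¹ * exp (-(2 * v - y - z) / s)))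
        ((4 * s ^ 2)⁻¹ * exp (-(2 * v - y - z) / s)) v := by
      intro v _
      refine ((((((((hasDerivAt_id v).const_mul 2).sub_const y).sub_const z).neg).div_const s).exp).const_mul
        (8 * s)⁻¹).neg.congr_deriv ?_
      simp only [id]
      generalize exp (-(2 * v - y - z) / s) = e
      field_simp; ring
    have e : ∀ v ∈ Ioi z, qk s (v - y) * qk s (v - z) =
        (4 * s ^ 2)⁻¹ * exp (-(2 * v - y - z) / s) := by
      intro v hv
      have hv : z < v := hv
      simp only [qk, sign_of_pos (sub_pos.2 hv), abs_of_pos (sub_pos.2 hv),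
        sign_of_pos (sub_pos.2 (hyz.trans_lt hv)), abs_of_pos (sub_pos.2 (hyz.trans_lt hv))]
      have : -(2 * v - y - z) / s = -(v - y) / s + -(v - z) / s := by field_simp; ring
      rw [this, exp_add]
      ring
    have hi : IntegrableOn (fun v => (4 * s ^ 2)⁻¹ * exp (-(2 * v - y - z) / s)) (Ioi z) :=
      (hnt.integrableOn (s := Ioi z)).congr_fun e measurableSet_Ioi
    have hl : Tendsto (fun v => -((8 * s)⁻¹ * exp (-(2 * v - y - z) / s))) atTop (nhds 0) := by
      rw [← neg_zero, ← mul_zero (8 * s)⁻¹]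
      refine (Tendsto.const_mul _ (tendsto_exp_atBot.comp
        (Tendsto.atBot_div_const hs (tendsto_neg_atTop_atBot.comp ?_)))).neg
      refine tendsto_atTop_add_const_right _ _ (tendsto_atTop_add_const_right _ _ ?_)
      exact tendsto_id.const_mul_atTop two_pos
    have := integral_Ioi_of_hasDerivAt_of_tendsto' hd hi hl
    rw [setIntegral_congr_fun measurableSet_Ioi e, this, zero_sub, neg_neg]
    congr 3; ring
  rw [← integral_add_compl (measurableSet_Iic (a := z)) hnt, compl_Iic,
    ← Iic_union_Ioc_eq_Iic hyz, setIntegral_union (by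
      rw [disjoint_left]; rintro v hv ⟨hv', _⟩; exact absurd hv (not_le.2 hv')) measurableSet_Ioc
      hnt.integrableOn hnt.integrableOn, h1, h2, h3, abs_of_nonpos (sub_nonpos.2 hyz), neg_sub]
  field_simp
  ring

theorem hasDerivAt_pk (hs : 0 < s) (t : ℝ) :
    HasDerivAt (fun s => -(1 / 2) * pk s t) (s⁻¹ * ((4 * s)⁻¹ * (1 - |t| / s) * exp (-|t| / s))) s := by
  have h1 : HasDerivAt (fun s : ℝ => -|t| / s) (|t| / s ^ 2) s := by
    refine ((hasDerivAt_const s (-|t|)).div (hasDerivAt_id s) hs.ne').congr_deriv ?_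
    simp
  have h2 : HasDerivAt (fun s : ℝ => (2 * s)⁻¹) (-2 / (2 * s) ^ 2) s := by
    refine (((hasDerivAt_id s).const_mul 2).inv (by simpa using hs.ne')).congr_deriv ?_
    simp
  refine ((h2.mul h1.exp).const_mul (-(1 / 2))).congr_deriv ?_
  field_simp
  ring

theorem ENNReal.mul_le_add_sq (a b : ℝ≥0∞) : a * b ≤ a ^ (2 : ℝ) + b ^ (2 : ℝ) := by
  rw [rpow_two, rpow_two, sq, sq]
  rcases le_total a b with h | h
  · exact (mul_le_mul_left h b).trans le_add_self
  · exact (mul_le_mul_right h a).trans le_self_add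

/-- Schur test on `L²` for a symmetric kernel. -/
theorem lintegral_schur {k : ℝ → ℝ → ℝ≥0∞} (hk : Measurable (Function.uncurry k))
    (hs : ∀ x y, k x y = k y x) {K : ℝ≥0∞} (hK : ∀ x, ∫⁻ y, k x y ≤ K) {f : ℝ → ℝ≥0∞}
    (hf : Measurable f) : ∫⁻ x, ∫⁻ y, k x y * (f x * f y) ≤ 2 * K * ∫⁻ x, f x ^ (2 : ℝ) := by
  have h1 : ∫⁻ x, ∫⁻ y, k x y * f x ^ (2 : ℝ) ≤ K * ∫⁻ x, f x ^ (2 : ℝ) := by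
    rw [← lintegral_const_mul _ (hf.pow_const _)]
    refine lintegral_mono fun x => ?_
    have : Measurable fun y => k x y := hk.comp measurable_prodMk_left
    rw [lintegral_mul_const _ this]
    gcongr; exact hK x
  have h2 : ∫⁻ x, ∫⁻ y, k x y * f y ^ (2 : ℝ) = ∫⁻ x, ∫⁻ y, k x y * f x ^ (2 : ℝ) := by
    rw [lintegral_lintegral_swap]
    · simp_rw [hs]
    · exact (Measurable.mul hk ((hf.comp measurable_snd).pow_const _)).aemeasurable
  have m1 : Measurable fun q : ℝ × ℝ => k q.1 q.2 * f q.1 ^ (2 : ℝ) :=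
    Measurable.mul hk ((hf.comp measurable_fst).pow_const _)
  calc _ ≤ ∫⁻ x, ∫⁻ y, (k x y * f x ^ (2 : ℝ) + k x y * f y ^ (2 : ℝ)) := by
        refine lintegral_mono fun x => lintegral_mono fun y => ?_
        rw [← mul_add]
        exact mul_le_mul_right (ENNReal.mul_le_add_sq _ _) _
    _ = (∫⁻ x, ∫⁻ y, k x y * f x ^ (2 : ℝ)) + ∫⁻ x, ∫⁻ y, k x y * f y ^ (2 : ℝ) := by
        rw [← lintegral_add_left (f := fun x => ∫⁻ y, k x y * f x ^ (2 : ℝ)) m1.lintegral_prod_right']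
        refine lintegral_congr fun x => lintegral_add_left (m1.comp measurable_prodMk_left) _
    _ ≤ _ := by rw [h2, mul_assoc, two_mul]; exact add_le_add h1 h1

theorem integrable_prod_mul_of_lintegral_le {α β : Type*} [MeasurableSpace α] [MeasurableSpace β]
    {μ : Measure α} {ν : Measure β} [SFinite μ] [SFinite ν] {h : α × β → ℂ} (mh : Measurable h)
    {g : β → ℂ} (mg : Measurable g) (hg : Integrable g ν) {K : ℝ≥0∞} (hK : K ≠ ⊤)
    (hb : ∀ y, ∫⁻ x, ‖h (x, y)‖ₑ ∂μ ≤ K) : Integrable (fun q => h q * g q.2) (μ.prod ν) := by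
  have m : Measurable fun q => h q * g q.2 := mh.mul (mg.comp measurable_snd)
  refine ⟨m.aestronglyMeasurable, ?_⟩
  rw [HasFiniteIntegral, lintegral_prod_symm' _ m.enorm]
  calc _ ≤ ∫⁻ y, K * ‖g y‖ₑ ∂ν := by
        refine lintegral_mono fun y => ?_
        simp only [enorm_mul]
        have : Measurable fun x => ‖h (x, y)‖ₑ := (mh.comp measurable_prodMk_right).enorm
        rw [lintegral_mul_const _ this]
        exact mul_le_mul_left (hb y) _
    _ = K * ∫⁻ y, ‖g y‖ₑ ∂ν := lintegral_const_mul _ mg.enorm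
    _ < ⊤ := mul_lt_top hK.lt_top hg.2

theorem lintegral_pk_le (hs : 0 < s) (x : ℝ) : ∫⁻ y, ofReal (pk s (x - y)) ≤ 144 := by
  have := lintegral_pker_le hs x
  calc _ ≤ ∫⁻ y, 9 * ofReal (pker s (x - y)) := by
        refine lintegral_mono fun y => ?_
        rw [show (9 : ℝ≥0∞) = ofReal 9 by simp, ← ofReal_mul (by norm_num)]
        exact ofReal_le_ofReal (pk_le_pker hs _)
    _ = 9 * ∫⁻ y, ofReal (pker s (x - y)) := lintegral_const_mul' _ _ (by simp)
    _ ≤ 9 * 16 := by gcongr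
    _ = 144 := by norm_num

theorem integral_inv_mul_qk {b : ℝ} (ha : 0 < a) (hab : a ≤ b) (y z : ℝ) :
    ∫ s in Ioc a b, s⁻¹ * ∫ v, qk s (v - y) * qk s (v - z) =
      1 / 2 * (pk a (y - z) - pk b (y - z)) := by
  have e : ∀ s ∈ Ioc a b, s⁻¹ * ∫ v, qk s (v - y) * qk s (v - z) =
      s⁻¹ * ((4 * s)⁻¹ * (1 - |y - z| / s) * exp (-|y - z| / s)) := fun s hs => by
    rw [integral_qk_mul_qk (ha.trans hs.1)]
  rw [setIntegral_congr_fun measurableSet_Ioc e, ← intervalIntegral.integral_of_le hab,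
    intervalIntegral.integral_eq_sub_of_hasDerivAt (f := fun s => -(1 / 2) * pk s (y - z))]
  · ring
  · intro s hs
    rw [uIcc_of_le hab] at hs
    exact hasDerivAt_pk (ha.trans_le hs.1) _
  · refine ContinuousOn.intervalIntegrable ?_
    rw [uIcc_of_le hab]
    have h0 : ∀ s ∈ Icc a b, s ≠ 0 := fun s hs => (ha.trans_le hs.1).ne'
    refine ContinuousOn.mul (continuousOn_id.inv₀ h0) (ContinuousOn.mul (ContinuousOn.mul
      (ContinuousOn.inv₀ (by fun_prop) fun s hs => by simpa using h0 s hs) ?_) ?_)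
    · exact continuousOn_const.sub (continuousOn_const.div continuousOn_id h0)
    · exact Real.continuous_exp.comp_continuousOn (continuousOn_const.div continuousOn_id h0)

theorem lintegral_Qop_sq_Ioc (hf : BC f) {b : ℝ} (ha : 0 < a) (hab : a ≤ b) :
    ∫⁻ s in Ioc a b, ∫⁻ v, ofReal s⁻¹ * ‖Qop s f v‖ₑ ^ (2 : ℝ) ≤ 288 * ∫⁻ x, ‖f x‖ₑ ^ (2 : ℝ) := by
  have hfm := hf.meas
  set μ : Measure (ℝ × ℝ) := (volume.restrict (Ioc a b)).prod volume
  set h : (ℝ × ℝ) × (ℝ × ℝ) → ℝ := fun q =>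
    q.1.1⁻¹ * (qk q.1.1 (q.1.2 - q.2.1) * qk q.1.1 (q.1.2 - q.2.2)) with hh
  set ff : ℝ × ℝ → ℂ := fun q => f q.1 * (starRingEnd ℂ) (f q.2) with hff
  have mh : Measurable h := by
    have e1 : Measurable fun q : (ℝ × ℝ) × (ℝ × ℝ) => qk q.1.1 (q.1.2 - q.2.1) :=
      measurable_qk₂.comp (f := fun q : (ℝ × ℝ) × (ℝ × ℝ) => (q.1.1, q.1.2 - q.2.1)) (by fun_prop)
    have e2 : Measurable fun q : (ℝ × ℝ) × (ℝ × ℝ) => qk q.1.1 (q.1.2 - q.2.2) :=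
      measurable_qk₂.comp (f := fun q : (ℝ × ℝ) × (ℝ × ℝ) => (q.1.1, q.1.2 - q.2.2)) (by fun_prop)
    have e3 : Measurable fun q : (ℝ × ℝ) × (ℝ × ℝ) => q.1.1⁻¹ := by fun_prop
    exact e3.mul (e1.mul e2)
  have mff : Measurable ff := (hfm.comp measurable_fst).mul
    (continuous_conj.measurable.comp (hfm.comp measurable_snd))
  have iff' : Integrable ff := hf.integrable.mul_prod hf.conj.integrable
  -- integrability in `(s, v)`
  have hi1 : ∀ y z, ∫⁻ q, ‖h (q, (y, z))‖ₑ ∂μ ≤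
      ofReal (a⁻¹ * (2 * a)⁻¹) * 144 * ofReal (b - a) := by
    intro y z
    have m0 : Measurable fun q => ‖h (q, (y, z))‖ₑ := (mh.comp measurable_prodMk_right).enorm
    rw [lintegral_prod _ m0.aemeasurable]
    calc _ ≤ ∫⁻ s in Ioc a b, ofReal (a⁻¹ * (2 * a)⁻¹) * 144 := by
          refine setLIntegral_mono measurable_const fun s hs => ?_
          have hs0 := ha.trans hs.1
          calc _ ≤ ∫⁻ v, ofReal (a⁻¹ * (2 * a)⁻¹) * ofReal (pk s (y - v)) := by
                refine lintegral_mono fun v => ?_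
                rw [← ofReal_mul (by positivity), ← ofReal_norm]
                refine ofReal_le_ofReal ?_
                simp only [hh, norm_mul, norm_eq_abs]
                rw [mul_assoc, mul_comm (2 * a)⁻¹, pk_comm]
                have e1 : |s⁻¹| ≤ a⁻¹ := by
                  rw [abs_of_pos (inv_pos.2 hs0)]; exact inv_anti₀ ha hs.1.le
                have e2 : |qk s (v - z)| ≤ (2 * a)⁻¹ :=
                  ((abs_qk_le hs0 _).trans (pk_le_inv hs0 _)).trans
                    (inv_anti₀ (by positivity) (by linarith [hs.1]))
                have := abs_qk_le hs0 (v - y)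
                have := pk_nonneg hs0 (v - y)
                gcongr
            _ ≤ _ := by
                rw [lintegral_ofReal_mul]
                gcongr; exact lintegral_pk_le hs0 y
      _ = _ := by rw [setLIntegral_const, Real.volume_Ioc]
  have hH : Integrable (fun q : (ℝ × ℝ) × (ℝ × ℝ) => (h q : ℂ) * ff q.2)
      (μ.prod (volume.prod volume)) := by
    refine integrable_prod_mul_of_lintegral_le (h := fun q => (h q : ℂ))
      (K := ofReal (a⁻¹ * (2 * a)⁻¹) * 144 * ofReal (b - a))
      (measurable_ofReal.comp mh) mff iff'
      (mul_ne_top (mul_ne_top ofReal_ne_top (by simp))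
        ofReal_ne_top) fun q => ?_
    simpa [← ofReal_norm] using hi1 q.1 q.2
  -- expand the square
  have hsq : ∀ q : ℝ × ℝ, ∫ p : ℝ × ℝ, (h (q, p) : ℂ) * ff p = ((q.1⁻¹ * ‖Qop q.1 f q.2‖ ^ 2 : ℝ) : ℂ) := by
    intro q
    have e1 : (starRingEnd ℂ) (Qop q.1 f q.2) =
        ∫ y, (qk q.1 (q.2 - y) : ℂ) * (starRingEnd ℂ) (f y) := by
      unfold Qop; rw [← integral_conj]; simp
    have e2 : ((‖Qop q.1 f q.2‖ ^ 2 : ℝ) : ℂ) = Qop q.1 f q.2 * (starRingEnd ℂ) (Qop q.1 f q.2) := by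
      rw [mul_conj, Complex.normSq_eq_norm_sq]
    rw [Complex.ofReal_mul, e2, e1, Qop, ← integral_prod_mul, ← integral_const_mul]
    refine integral_congr_ae (ae_of_all _ fun p => ?_)
    simp only [hh, hff]; push_cast; ring
  have hin : ∀ p : ℝ × ℝ, ∫ q, (h (q, p) : ℂ) * ff p ∂μ =
      ((1 / 2 * (pk a (p.1 - p.2) - pk b (p.1 - p.2)) : ℝ) : ℂ) * ff p := by
    intro p
    rw [integral_mul_const, integral_complex_ofReal]
    congr 2
    have : Integrable (fun q => h (q, p)) μ :=
      ⟨(mh.comp measurable_prodMk_right).aestronglyMeasurable,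
        lt_of_le_of_lt (hi1 p.1 p.2) (mul_lt_top (mul_lt_top ofReal_lt_top
          (by simp)) ofReal_lt_top)⟩
    rw [integral_prod _ this, ← integral_inv_mul_qk ha hab]
    simp only [hh, integral_const_mul]
  have hsw := integral_integral_swap (f := fun q p => (h (q, p) : ℂ) * ff p) hH
  rw [← volume_eq_prod] at hsw
  simp only [hsq, hin] at hsw
  have hL := hH.integral_prod_left
  rw [← volume_eq_prod] at hL
  simp only [hsq] at hL
  have hL' : Integrable (fun q : ℝ × ℝ => q.1⁻¹ * ‖Qop q.1 f q.2‖ ^ 2) μ := by exact hL.re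
  rw [integral_complex_ofReal] at hsw
  have mQ : Measurable fun q : ℝ × ℝ => Qop q.1 f q.2 := measurable_Qop hfm
  have h0 : 0 ≤ᵐ[μ] fun q : ℝ × ℝ => q.1⁻¹ * ‖Qop q.1 f q.2‖ ^ 2 := by
    have : ∀ᵐ q ∂μ, q.1 ∈ Ioc a b :=
      Measure.quasiMeasurePreserving_fst.ae (ae_restrict_mem measurableSet_Ioc)
    filter_upwards [this] with q hq
    have := ha.trans hq.1
    simp only [Pi.zero_apply]; positivity
  have hfin := ofReal_integral_eq_lintegral_ofReal hL' h0
  calc _ = ∫⁻ q, ofReal (q.1⁻¹ * ‖Qop q.1 f q.2‖ ^ 2) ∂μ := by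
        rw [lintegral_prod _ hL'.1.aemeasurable.ennreal_ofReal]
        refine setLIntegral_congr_fun measurableSet_Ioc fun s hs => lintegral_congr fun v => ?_
        rw [ofReal_mul (inv_nonneg.2 (ha.trans hs.1).le), rpow_two,
          ofReal_pow (norm_nonneg _), ofReal_norm]
    _ = ofReal (∫ q, q.1⁻¹ * ‖Qop q.1 f q.2‖ ^ 2 ∂μ) := hfin.symm
    _ ≤ ‖∫ p : ℝ × ℝ, ((1 / 2 * (pk a (p.1 - p.2) - pk b (p.1 - p.2)) : ℝ) : ℂ) * ff p‖ₑ := by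
        rw [← hsw, ← ofReal_norm, norm_real]
        exact ofReal_le_ofReal (le_abs_self _)
    _ ≤ ∫⁻ p : ℝ × ℝ, ofReal (1 / 2 * (pk a (p.1 - p.2) + pk b (p.1 - p.2))) *
          (‖f p.1‖ₑ * ‖f p.2‖ₑ) := by
        refine (enorm_integral_le_lintegral_enorm _).trans (lintegral_mono fun p => ?_)
        simp only [enorm_mul, hff]
        gcongr
        · rw [← ofReal_norm, norm_real, norm_eq_abs]
          refine ofReal_le_ofReal ?_
          rw [abs_le]
          have := pk_nonneg ha (p.1 - p.2)
          have := pk_nonneg (ha.trans_le hab) (p.1 - p.2)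
          constructor <;> linarith
        · simp [← ofReal_norm]
    _ ≤ 2 * 144 * ∫⁻ x, ‖f x‖ₑ ^ (2 : ℝ) := by
        have mk : Measurable fun p : ℝ × ℝ =>
            ofReal (1 / 2 * (pk a (p.1 - p.2) + pk b (p.1 - p.2))) := by
          have := measurable_pk a
          have := measurable_pk b
          fun_prop
        have mk' : Measurable fun p : ℝ × ℝ => ofReal (1 / 2 * (pk a (p.1 - p.2) +
            pk b (p.1 - p.2))) * (‖f p.1‖ₑ * ‖f p.2‖ₑ) := mk.mul
          ((hfm.comp measurable_fst).enorm.mul (hfm.comp measurable_snd).enorm)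
        rw [volume_eq_prod, lintegral_prod _ mk'.aemeasurable]
        refine lintegral_schur (k := fun x y => ofReal (1 / 2 * (pk a (x - y) + pk b (x - y))))
          mk (fun x y => by rw [pk_comm a, pk_comm b]) (fun x => ?_) hfm.enorm
        have hb := ha.trans_le hab
        calc _ = ∫⁻ y, (ofReal (1/2) * ofReal (pk a (x - y)) +
              ofReal (1/2) * ofReal (pk b (x - y))) := by
              refine lintegral_congr fun y => ?_
              rw [← ofReal_mul (by norm_num), ← ofReal_mul (by norm_num),
                ← ofReal_add (mul_nonneg (by norm_num) (pk_nonneg ha _))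
                  (mul_nonneg (by norm_num) (pk_nonneg hb _)), mul_add]
          _ ≤ ofReal (1/2) * 144 + ofReal (1/2) * 144 := by
              have m1 : Measurable fun y => ofReal (1/2) * ofReal (pk a (x - y)) := by
                have := measurable_pk a
                fun_prop
              rw [lintegral_add_left m1, lintegral_ofReal_mul, lintegral_ofReal_mul]
              gcongr
              · exact lintegral_pk_le ha x
              · exact lintegral_pk_le hb x
          _ = 144 := by
              rw [← add_mul, ← ofReal_add (by norm_num) (by norm_num)]
              norm_num
    _ = _ := by norm_num

/-- The square function estimate. -/
theorem lintegral_Qop_sq (hf : BC f) : ∫⁻ s in Ioi 0, ∫⁻ v, ofReal s⁻¹ * ‖Qop s f v‖ₑ ^ (2 : ℝ) ≤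
      288 * ∫⁻ x, ‖f x‖ₑ ^ (2 : ℝ) := by
  set B := 288 * ∫⁻ x, ‖f x‖ₑ ^ (2 : ℝ) with hB
  have hU : Ioi (0 : ℝ) = ⋃ n : ℕ, Ioc (1 / ((n : ℝ) + 1)) ((n : ℝ) + 1) := by
    ext s
    simp only [mem_Ioi, mem_iUnion, mem_Ioc]
    constructor
    · intro hs
      obtain ⟨n, hn⟩ := exists_nat_one_div_lt hs
      obtain ⟨m, hm⟩ := exists_nat_ge s
      refine ⟨max n m, lt_of_le_of_lt ?_ hn, hm.trans ?_⟩
      · exact one_div_le_one_div_of_le (by positivity) (by simp)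
      · have : (m : ℝ) ≤ (max n m : ℕ) := by simp
        linarith
    · rintro ⟨n, h, -⟩
      exact lt_trans (by positivity) h
  have hmono : Monotone fun n : ℕ => Ioc (1 / ((n : ℝ) + 1)) ((n : ℝ) + 1) := by
    intro m n hmn
    have : (m : ℝ) ≤ n := by exact_mod_cast hmn
    exact Ioc_subset_Ioc (one_div_le_one_div_of_le (by positivity) (by linarith)) (by linarith)
  rw [hU, setLIntegral_iUnion_of_directed _ (hmono.directed_le)]
  refine iSup_le fun n => lintegral_Qop_sq_Ioc hf (by positivity) ?_
  have : (0 : ℝ) ≤ n := by positivity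
  rw [div_le_iff₀ (by positivity)]; nlinarith

theorem enorm_integral_mul_le_hlMax_Qop (hf : BC f) {r m : ℝ → ℂ} (hs : 0 < s)
    (hC : 0 ≤ C) (hm : Measurable m) (hb : ∀ v, ‖m v‖ ≤ C * pker s (x - v))
    (hr : ∀ y, r y = ∫ v, m v * qk s (v - y)) :
    ‖∫ y, r y * f y‖ₑ ≤ ofReal C * 16 * hlMax (fun v => ‖Qop s f v‖ₑ) x := by
  have mh : Measurable fun q : ℝ × ℝ => m q.1 * (qk s (q.1 - q.2) : ℂ) :=
    (hm.comp measurable_fst).mul (measurable_ofReal.comp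
      ((measurable_qk s).comp (measurable_fst.sub measurable_snd)))
  have hm' : ∀ v, ‖m v‖ₑ ≤ ofReal C * ofReal (pker s (x - v)) := by
    intro v
    rw [← ofReal_mul hC, ← ofReal_norm]
    exact ofReal_le_ofReal (hb v)
  have hI := integrable_prod_mul_of_lintegral_le (μ := volume) (ν := volume)
    (K := ofReal C * 16 * ofReal (2 * s)⁻¹) mh hf.meas hf.integrable
    (mul_ne_top (mul_ne_top ofReal_ne_top (by simp)) ofReal_ne_top)
    (fun y => by
      calc _ ≤ ∫⁻ v, ofReal C * ofReal (pker s (x - v)) * ofReal (2 * s)⁻¹ := by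
            refine lintegral_mono fun v => ?_
            simp only [enorm_mul]
            gcongr
            · exact hm' v
            · rw [← ofReal_norm, norm_real]
              exact ofReal_le_ofReal ((abs_qk_le hs _).trans (pk_le_inv hs _))
        _ ≤ _ := by
            rw [lintegral_mul_const' _ _ ofReal_ne_top, lintegral_ofReal_mul]
            gcongr
            exact lintegral_pker_le hs x)
  have hsw := integral_integral_swap (f := fun v y => m v * (qk s (v - y) : ℂ) * f y) hI
  have e : ∫ y, r y * f y = ∫ v, m v * Qop s f v := by
    simp only [hr, Qop, ← integral_mul_const, ← integral_const_mul]
    rw [← hsw]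
    simp only [mul_assoc]
  rw [e]
  have mQ : Measurable fun v => ‖Qop s f v‖ₑ :=
    ((measurable_Qop hf.meas).comp measurable_prodMk_left).enorm
  calc _ ≤ ∫⁻ v, ‖m v * Qop s f v‖ₑ := enorm_integral_le_lintegral_enorm _
    _ ≤ ∫⁻ v, ofReal C * (ofReal (pker s (x - v)) * ‖Qop s f v‖ₑ) := by
        refine lintegral_mono fun v => ?_
        rw [enorm_mul, ← mul_assoc]
        gcongr; exact hm' v
    _ ≤ _ := by
        rw [lintegral_ofReal_mul, mul_assoc]
        gcongr
        exact lintegral_pker_mul_le mQ.aemeasurable hs x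

theorem integral_pk (hs : 0 < s) (x : ℝ) : ∫ y, pk s (x - y) = 1 := by
  have h0 : ∫ y, pk s (x - y) = ∫ y, pk s y := integral_sub_left_eq_self (fun y => pk s y) volume x
  rw [h0]
  have h1 : ∫ y in Ioi (0 : ℝ), exp (-s⁻¹ * y) = s := by
    rw [integral_exp_mul_Ioi (by simpa using hs)]; simp
  have h2 : ∫ y, exp (-s⁻¹ * |y|) = 2 * s := by
    rw [integral_comp_abs (f := fun y => exp (-s⁻¹ * y)), h1]
  unfold pk
  rw [integral_const_mul]
  have : ∀ y, exp (-|y| / s) = exp (-s⁻¹ * |y|) := fun y => by congr 1; field_simp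
  simp only [this, h2]
  field_simp

/-- The kernel `s² / (z(y) - z(x) + i s)³`. -/
def th (A : ℝ → ℝ) (s x y : ℝ) : ℂ := (s : ℂ) ^ 2 * ((zc A y - zc A x + s * I)⁻¹) ^ 3

def thOp (A : ℝ → ℝ) (s : ℝ) (f : ℝ → ℂ) (x : ℝ) : ℂ := ∫ y, th A s x y * f y

theorem LipA.measurable_th (hA : LipA A L) :
    Measurable fun q : ℝ × ℝ × ℝ => th A q.1 q.2.1 q.2.2 := by
  have := hA.zc_continuous.measurable
  unfold th
  fun_prop

theorem LipA.norm_th_le (hA : LipA A L) (hs : 0 < s) (x y : ℝ) :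
    ‖th A s x y‖ ≤ (2 + L) ^ 3 * (s ^ 2 / (s + |x - y|) ^ 3) := by
  have h := hA.norm_inv_le x y s (.inl hs.ne')
  rw [abs_of_pos hs] at h
  unfold th
  rw [norm_mul, norm_pow, norm_pow, norm_real, norm_of_nonneg hs.le]
  calc _ ≤ s ^ 2 * ((2 + L) / (s + |x - y|)) ^ 3 := by gcongr
    _ = _ := by rw [div_pow]; ring

theorem LipA.integrable_th (hA : LipA A L) (hs : 0 < s) (x : ℝ) :
    Integrable fun y => th A s x y := by
  have h2 := hA.1
  have m : Measurable fun y => th A s x y :=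
    hA.measurable_th.comp (f := fun y => (s, x, y)) (by fun_prop)
  refine Integrable.mono' ((integrable_pker hs x).const_mul ((2 + L) ^ 3)) m.aestronglyMeasurable
    (ae_of_all _ fun y => (hA.norm_th_le hs x y).trans ?_)
  gcongr
  exact cube_le_pker hs _

theorem LipA.norm_integral_th_le (hA : LipA A L) (hs : 0 < s) (x : ℝ) :
    ‖∫ y, th A s x y‖ ≤ 16 * (2 + L) ^ 3 := by
  have h2 := hA.1
  calc _ ≤ ∫ y, (2 + L) ^ 3 * pker s (x - y) := by
        refine norm_integral_le_of_norm_le ((integrable_pker hs x).const_mul ((2 + L) ^ 3))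
          (ae_of_all _ fun y => (hA.norm_th_le hs x y).trans ?_)
        gcongr
        exact cube_le_pker hs _
    _ ≤ _ := by
        rw [integral_const_mul, mul_comm]
        gcongr; exact integral_pker_le hs x

theorem hasStrictDerivAt_inv_pow (n : ℕ) {w c : ℂ} (h : w + c ≠ 0) :
    HasStrictDerivAt (fun w => ((w + c)⁻¹) ^ n) (-(n : ℂ) * ((w + c)⁻¹) ^ (n + 1)) w := by
  have h1 : HasStrictDerivAt (fun w => (w + c)⁻¹) (-((w + c) ^ 2)⁻¹ * 1) w :=
    (hasStrictDerivAt_inv h).comp w ((hasStrictDerivAt_id w).add_const c)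
  refine (h1.pow n).congr_deriv ?_
  rcases n with _ | n
  · simp
  · rw [← inv_pow, Nat.add_sub_cancel]
    ring

theorem LipA.th_locallyLipschitz (hA : LipA A L) (hs : 0 < s) (x : ℝ) :
    LocallyLipschitz (th A s x) ∧ ∀ᵐ y, HasDerivAt (th A s x)
      ((s : ℂ) ^ 2 * (-3 * ((zc A y - zc A x + s * I)⁻¹) ^ 4 * dz A y)) y := by
  have hG : ∀ y, HasStrictDerivAt (fun w : ℂ => (s : ℂ) ^ 2 * ((w + (-zc A x + s * I))⁻¹) ^ 3)
      ((s : ℂ) ^ 2 * (-3 * ((zc A y + (-zc A x + s * I))⁻¹) ^ 4)) (zc A y) := by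
    intro y
    have := hA.ne_zero x y hs.ne'
    exact ((hasStrictDerivAt_inv_pow 3 (by convert this using 1; ring)).const_mul _)
  have e : th A s x = fun y => (fun w : ℂ => (s : ℂ) ^ 2 * ((w + (-zc A x + s * I))⁻¹) ^ 3) (zc A y) := by
    funext y; unfold th; ring_nf
  rw [e]
  refine ⟨hA.locallyLipschitz_comp hG, ?_⟩
  filter_upwards [hA.hasDerivAt_comp hG] with y hy
  refine hy.congr_deriv ?_
  rw [show zc A y + (-zc A x + s * I) = zc A y - zc A x + s * I by ring]
  ring

theorem pk_locallyLipschitz (s x : ℝ) :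
    LocallyLipschitz (fun y => (pk s (x - y) : ℂ)) ∧ ∀ᵐ y, HasDerivAt (fun y => (pk s (x - y) : ℂ))
      ((s⁻¹ * (sign (x - y) * pk s (x - y)) : ℝ) : ℂ) y := by
  constructor
  · have h1 : LocallyLipschitz fun y : ℝ => |x - y| := by
      have : LipschitzWith 1 fun y : ℝ => |x - y| := LipschitzWith.of_dist_le_mul fun a b => by
        simp only [dist_eq, NNReal.coe_one, one_mul]
        refine (abs_abs_sub_abs_le _ _).trans (le_of_eq ?_)
        rw [show x - a - (x - b) = -(a - b) by ring, abs_neg]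
      exact this.locallyLipschitz
    have h2 : ContDiff ℝ 1 fun t : ℝ => ((2 * s)⁻¹ * exp (-t / s) : ℝ) := by fun_prop
    have h3 : ContDiff ℝ 1 fun t : ℝ => (((2 * s)⁻¹ * exp (-t / s) : ℝ) : ℂ) :=
      ofRealCLM.contDiff.comp h2
    exact (h3.locallyLipschitz (𝕂 := ℝ)).comp h1
  · have : ∀ᵐ y : ℝ, y ≠ x := by simp [ae_iff]
    filter_upwards [this] with y hy
    refine HasDerivAt.ofReal_comp ?_
    have h4 : HasDerivAt (fun y => |x - y|) (-sign (x - y)) y := by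
      have := (hasDerivAt_abs (sub_ne_zero.2 hy.symm)).comp y ((hasDerivAt_id y).const_sub x)
      refine this.congr_deriv ?_
      rcases lt_or_gt_of_ne hy with h | h
      · simp [h, sign_of_pos (sub_pos.2 h)]
      · simp [h, sign_of_neg (sub_neg.2 h)]
    unfold pk
    refine (((h4.neg.div_const s).exp).const_mul (2 * s)⁻¹).congr_deriv ?_
    simp; ring

/-- The averaging operator with kernel `pk s`. -/
def Pop (s : ℝ) (f : ℝ → ℂ) (x : ℝ) : ℂ := ∫ y, (pk s (x - y) : ℂ) * f y

theorem integrable_pk_mul (hf : BC f) (hs : 0 < s) (x : ℝ) :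
    Integrable fun y => (pk s (x - y) : ℂ) * f y := by
  refine hf.integrable.bdd_mul (c := (2 * s)⁻¹) ?_ (ae_of_all _ fun y => ?_)
  · exact (measurable_ofReal.comp ((measurable_pk s).comp
      (measurable_id.const_sub x))).aestronglyMeasurable
  · rw [norm_real, norm_of_nonneg (pk_nonneg hs _)]; exact pk_le_inv hs _

theorem measurable_Pop (hf : Measurable f) : Measurable fun q : ℝ × ℝ => Pop q.2 f q.1 := by
  unfold Pop
  have h : Measurable fun q : (ℝ × ℝ) × ℝ => (pk q.1.2 (q.1.1 - q.2) : ℂ) * f q.2 := by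
    refine Measurable.mul (measurable_ofReal.comp ?_) (hf.comp measurable_snd)
    exact measurable_pk₂.comp (f := fun q : (ℝ × ℝ) × ℝ => (q.1.2, q.1.1 - q.2)) (by fun_prop)
  exact (h.stronglyMeasurable.integral_prod_right (ν := volume)).measurable

theorem LipA.integrable_th_mul (hA : LipA A L) (hf : BC f) (hs : 0 < s) (x : ℝ) :
    Integrable fun y => th A s x y * f y := by
  obtain ⟨M, R, hM, hR, hfM, hfR⟩ := hf.exists_bound
  exact (hA.integrable_th hs x).mul_bdd hf.meas.aestronglyMeasurable (ae_of_all _ hfM)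

theorem LipA.measurable_thOp (hA : LipA A L) (hf : Measurable f) :
    Measurable fun q : ℝ × ℝ => thOp A q.1 f q.2 := by
  unfold thOp
  have h : Measurable fun q : (ℝ × ℝ) × ℝ => th A q.1.1 q.1.2 q.2 * f q.2 := by
    refine Measurable.mul ?_ (hf.comp measurable_snd)
    exact hA.measurable_th.comp (f := fun q : (ℝ × ℝ) × ℝ => (q.1.1, q.1.2, q.2)) (by fun_prop)
  exact (h.stronglyMeasurable.integral_prod_right (ν := volume)).measurable

theorem LipA.measurable_integral_th (hA : LipA A L) :
    Measurable fun q : ℝ × ℝ => ∫ y, th A q.1 q.2 y := by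
  have h : Measurable fun q : (ℝ × ℝ) × ℝ => th A q.1.1 q.1.2 q.2 :=
    hA.measurable_th.comp (f := fun q : (ℝ × ℝ) × ℝ => (q.1.1, q.1.2, q.2)) (by fun_prop)
  exact (h.stronglyMeasurable.integral_prod_right (ν := volume)).measurable

/-- Off its mean value, `thOp` is controlled by `Qop`. -/
theorem LipA.enorm_thOp_sub_le (hA : LipA A L) (hf : BC f) (hs : 0 < s) (x : ℝ) :
    ‖thOp A s f x - (∫ y, th A s x y) * Pop s f x‖ₑ ≤
      ofReal (129 * (147 * (2 + L) ^ 5)) * 16 * hlMax (fun v => ‖Qop s f v‖ₑ) x := by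
  have hL := hA.1
  set T := ∫ y, th A s x y with hT
  have hTn : ‖T‖ ≤ 16 * (2 + L) ^ 3 := hA.norm_integral_th_le hs x
  obtain ⟨l1, d1⟩ := hA.th_locallyLipschitz hs x
  obtain ⟨l2, d2⟩ := pk_locallyLipschitz s x
  set r : ℝ → ℂ := fun y => th A s x y + (-T) * (pk s (x - y) : ℂ) with hr
  set r' : ℝ → ℂ := fun y => (s : ℂ) ^ 2 * (-3 * ((zc A y - zc A x + s * I)⁻¹) ^ 4 * dz A y) +
    (-T) * ((s⁻¹ * (sign (x - y) * pk s (x - y)) : ℝ) : ℂ) with hr'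
  have h35 : (2 + L) ^ 3 ≤ (2 + L) ^ 5 := pow_le_pow_right₀ (by linarith) (by norm_num)
  have rl : LocallyLipschitz r := l1.add_complex ((LocallyLipschitz.const (-T)).mul_complex l2)
  have rd : ∀ᵐ y, HasDerivAt r (r' y) y := by
    filter_upwards [d1, d2] with y h1 h2
    exact h1.add (h2.const_mul (-T))
  have mr' : Measurable r' := by
    have := hA.zc_continuous.measurable
    have := measurable_dz A
    have := measurable_sign
    have := measurable_pk s
    fun_prop
  have hb : ∀ v, ‖r v‖ ≤ 147 * (2 + L) ^ 5 * (s ^ 2 / (s + |x - v|) ^ 3) := by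
    intro v
    set u := s ^ 2 / (s + |x - v|) ^ 3 with hu
    have hu0 : 0 ≤ u := by positivity
    calc _ ≤ ‖th A s x v‖ + ‖T‖ * pk s (x - v) := by
          refine (norm_add_le _ _).trans (le_of_eq ?_)
          rw [norm_mul, norm_neg, norm_real, norm_of_nonneg (pk_nonneg hs _)]
      _ ≤ (2 + L) ^ 3 * u + 16 * (2 + L) ^ 3 * (9 * u) := by
          have := pk_nonneg hs (x - v)
          gcongr
          · exact hA.norm_th_le hs x v
          · exact pk_le_cube hs _
      _ = 145 * (2 + L) ^ 3 * u := by ring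
      _ ≤ _ := by gcongr; norm_num
  have hb' : ∀ v, ‖r' v‖ ≤ 147 * (2 + L) ^ 5 * (s / (s + |x - v|) ^ 3) := by
    intro v
    have hn := hA.norm_inv_le x v s (.inl hs.ne')
    rw [abs_of_pos hs] at hn
    have hd := hA.norm_dz_le v
    set u := s / (s + |x - v|) ^ 3 with hu
    have hu0 : 0 ≤ u := by positivity
    have h1 : ‖(s : ℂ) ^ 2 * (-3 * ((zc A v - zc A x + s * I)⁻¹) ^ 4 * dz A v)‖ ≤
        3 * (2 + L) ^ 5 * u := by
      rw [norm_mul, norm_mul, norm_mul, norm_pow, norm_pow, norm_real, norm_neg,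
        norm_of_nonneg hs.le, show ‖(3 : ℂ)‖ = 3 by simp]
      calc _ ≤ s ^ 2 * (3 * ((2 + L) / (s + |x - v|)) ^ 4 * (2 + L)) := by
            gcongr; linarith
        _ = 3 * (2 + L) ^ 5 * (s ^ 2 / (s + |x - v|) ^ 4) := by rw [div_pow]; ring
        _ ≤ _ := by
            gcongr
            rw [hu, div_le_div_iff₀ (by positivity) (by positivity)]
            have := abs_nonneg (x - v)
            calc s ^ 2 * (s + |x - v|) ^ 3 = s * (s + |x - v|) ^ 3 * s := by ring
              _ ≤ s * (s + |x - v|) ^ 3 * (s + |x - v|) := by gcongr; linarith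
              _ = _ := by ring
    have h2 : |s⁻¹ * (sign (x - v) * pk s (x - v))| ≤ 9 * u := by
      have hsg : |sign (x - v)| ≤ 1 := by
        rcases Real.sign_apply_eq (x - v) with h | h | h <;> simp [h]
      have := pk_le_cube hs (x - v)
      rw [abs_mul, abs_mul, abs_of_pos (inv_pos.2 hs), abs_of_nonneg (pk_nonneg hs _)]
      calc _ ≤ s⁻¹ * (1 * (9 * (s ^ 2 / (s + |x - v|) ^ 3))) := by
            have := pk_nonneg hs (x - v)
            gcongr
        _ = _ := by rw [hu]; field_simp
    calc _ ≤ 3 * (2 + L) ^ 5 * u + ‖T‖ * (9 * u) := by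
          refine (norm_add_le _ _).trans (add_le_add h1 ?_)
          rw [norm_mul, norm_neg, norm_real, norm_eq_abs]
          gcongr
      _ ≤ 3 * (2 + L) ^ 5 * u + 16 * (2 + L) ^ 5 * (9 * u) := by gcongr; linarith
      _ = _ := by ring
  have hpi : Integrable fun y => (pk s (x - y) : ℂ) := (integrable_pk hs x).ofReal
  have h0 : ∫ v, r v = 0 := by
    rw [hr, integral_add (hA.integrable_th hs x) (hpi.const_mul _), integral_const_mul,
      integral_complex_ofReal, integral_pk hs x, ← hT]
    simp
  obtain ⟨m, mm, hm, hrep⟩ := exists_qk_repr hs (by positivity) rl rd mr' hb hb' h0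
  have := enorm_integral_mul_le_hlMax_Qop hf hs (by positivity) mm hm hrep
  convert this using 2
  have e : ∀ y, r y * f y = th A s x y * f y + (-T) * ((pk s (x - y) : ℂ) * f y) := fun y => by
    simp only [hr]; ring
  simp only [e]
  rw [integral_add (hA.integrable_th_mul hf hs x) ((integrable_pk_mul hf hs x).const_mul _),
    integral_const_mul]
  simp only [thOp, Pop]; ring

/-- Nontangential control of `Pop`. -/
theorem enorm_Pop_le (hf : Measurable f) (h : |x - y| < s) :
    ‖Pop s f x‖ₑ ≤ 576 * hlMax (fun v => ‖f v‖ₑ) y := by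
  have hs : 0 < s := (abs_nonneg _).trans_lt h
  calc _ ≤ ∫⁻ u, ‖(pk s (x - u) : ℂ) * f u‖ₑ := enorm_integral_le_lintegral_enorm _
    _ ≤ ∫⁻ u, 36 * (ofReal (pker s (y - u)) * ‖f u‖ₑ) := by
        refine lintegral_mono fun u => ?_
        rw [enorm_mul, ← mul_assoc, show (36 : ℝ≥0∞) = ofReal 36 by simp,
          ← ofReal_mul (by norm_num), ← ofReal_norm, norm_real,
          norm_of_nonneg (pk_nonneg hs _)]
        gcongr
        refine (pk_le_pker hs _).trans ?_
        have : pker s (x - u) ≤ 4 * pker s (y - u) := by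
          unfold pker
          have h3 : |y - u| ≤ |x - y| + |x - u| := by rw [abs_sub_comm x y]; exact abs_sub_le _ _ _
          rw [← mul_div_assoc, div_le_div_iff₀ (by positivity) (by positivity)]
          have h4 : s + |y - u| ≤ 2 * (s + |x - u|) := by linarith [abs_nonneg (x - u)]
          calc s * (s + |y - u|) ^ 2 ≤ s * (2 * (s + |x - u|)) ^ 2 := by gcongr
            _ = _ := by ring
        linarith
    _ ≤ 36 * (16 * hlMax (fun v => ‖f v‖ₑ) y) := by
        rw [lintegral_const_mul' _ _ (by simp)]
        gcongr
        exact lintegral_pker_mul_le hf.enorm.aemeasurable hs y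
    _ = _ := by rw [← mul_assoc]; norm_num

theorem measurable_swap_args {G : ℝ → ℝ → ℂ} (h : Measurable fun q : ℝ × ℝ => G q.1 q.2) :
    Measurable fun q : ℝ × ℝ => G q.2 q.1 :=
  h.comp measurable_swap

theorem LipA.bc_dz (hA : LipA A L) (c r : ℝ) : BC ((ball c r).indicator (dz A)) := by
  refine ⟨(measurable_dz A).indicator measurableSet_ball, ⟨1 + L, fun x =>
    (norm_indicator_le_norm_self _ _).trans (hA.norm_dz_le x)⟩, ⟨|c| + r, fun x hx => ?_⟩⟩
  refine indicator_of_notMem (fun h => ?_) _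
  rw [mem_ball, dist_eq] at h
  have := abs_sub_abs_le_abs_sub x c
  linarith

theorem LipA.norm_thOp_dz_le (hA : LipA A L) (hs : 0 < s) (hx : |x - c| < r) :
    ‖thOp A s ((ball c (3 * r)).indicator (dz A)) x‖ ≤ (2 + L) ^ 2 / 4 * (s / r) ^ 2 := by
  have hL := hA.1
  have hr : 0 < r := (abs_nonneg _).trans_lt hx
  have hG : ∀ y, HasStrictDerivAt (fun w : ℂ => (-(s : ℂ) ^ 2 / 2) * ((w + (-zc A x + s * I))⁻¹) ^ 2)
      ((-(s : ℂ) ^ 2 / 2) * (-2 * ((zc A y + (-zc A x + s * I))⁻¹) ^ 3)) (zc A y) := by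
    intro y
    have := hA.ne_zero x y hs.ne'
    exact ((hasStrictDerivAt_inv_pow 2 (by convert this using 1; ring)).const_mul _)
  have hF := hA.locallyLipschitz_comp hG
  have hFd := hA.hasDerivAt_comp hG
  set F : ℝ → ℂ := fun y => (-(s : ℂ) ^ 2 / 2) * ((zc A y + (-zc A x + s * I))⁻¹) ^ 2 with hFe
  have e : ∀ y, ((-(s : ℂ) ^ 2 / 2) * (-2 * ((zc A y + (-zc A x + s * I))⁻¹) ^ 3)) * dz A y =
      th A s x y * dz A y := by
    intro y; unfold th
    rw [show zc A y + (-zc A x + s * I) = zc A y - zc A x + s * I by ring]; ring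
  simp only [e] at hFd
  have hi : LocallyIntegrable (fun y => th A s x y * dz A y) :=
    ((hA.integrable_th hs x).mul_bdd (measurable_dz A).aestronglyMeasurable
      (ae_of_all _ hA.norm_dz_le)).locallyIntegrable
  have h1 : thOp A s ((ball c (3 * r)).indicator (dz A)) x = F (c + 3 * r) - F (c - 3 * r) := by
    rw [← LocallyLipschitz.integral_eq_sub hF hFd hi, intervalIntegral.integral_of_le (by linarith),
      integral_Ioc_eq_integral_Ioo, ← ball_eq_Ioo, ← integral_indicator measurableSet_ball]
    unfold thOp
    congr 1; ext y
    by_cases h : y ∈ ball c (3 * r) <;> simp [h]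
  have h2 : ∀ y, 2 * r ≤ |x - y| → ‖F y‖ ≤ (2 + L) ^ 2 / 8 * (s / r) ^ 2 := by
    intro y hy
    have hn := hA.norm_inv_le x y s (.inl hs.ne')
    rw [abs_of_pos hs] at hn
    simp only [hFe]
    rw [show zc A y + (-zc A x + s * I) = zc A y - zc A x + s * I by ring, norm_mul,
      norm_div, norm_neg, norm_pow, norm_pow, norm_real, norm_of_nonneg hs.le,
      show ‖(2 : ℂ)‖ = 2 by simp]
    calc _ ≤ s ^ 2 / 2 * ((2 + L) / (2 * r)) ^ 2 := by
          gcongr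
          refine hn.trans ?_
          gcongr; linarith
      _ = _ := by field_simp; ring
  rw [h1]
  obtain ⟨ha, hb⟩ := abs_lt.1 hx
  have h3 := h2 (c + 3 * r) (by rw [abs_of_nonpos (by linarith)]; linarith)
  have h4 := h2 (c - 3 * r) (by rw [abs_of_nonneg (by linarith)]; linarith)
  refine (norm_sub_le _ _).trans ?_
  linarith

theorem LipA.le_norm_Pop_dz (hA : LipA A L) (hs : 0 < s) (hx : |x - c| < r) (hsr : s ≤ r) :
    1 / 3 ≤ ‖Pop s ((ball c (3 * r)).indicator (dz A)) x‖ := by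
  have hr : 0 < r := (abs_nonneg _).trans_lt hx
  have hi := integrable_pk_mul (hA.bc_dz c (3 * r)) hs x
  refine le_trans ?_ (Complex.re_le_norm _)
  have e1 : (Pop s ((ball c (3 * r)).indicator (dz A)) x).re =
      ∫ y, ((pk s (x - y) : ℂ) * (ball c (3 * r)).indicator (dz A) y).re := by
    unfold Pop
    exact (integral_re hi).symm
  have hsub : ball x s ⊆ ball c (3 * r) := by
    refine ball_subset_ball' ?_
    rw [dist_eq]; linarith
  rw [e1]
  calc 1 / 3 ≤ ∫ y in ball x s, (6 * s)⁻¹ := by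
        rw [setIntegral_const, measureReal_def, volume_ball, toReal_ofReal (by positivity),
          smul_eq_mul]
        field_simp; norm_num
    _ ≤ ∫ y in ball x s, ((pk s (x - y) : ℂ) * (ball c (3 * r)).indicator (dz A) y).re := by
        refine setIntegral_mono_on (integrableOn_const (by rw [volume_ball]; exact ofReal_ne_top)) hi.re.integrableOn measurableSet_ball fun y hy => ?_
        rw [indicator_of_mem (hsub hy), Complex.re_ofReal_mul, dz_re, mul_one]
        rw [mem_ball, dist_comm, dist_eq] at hy
        unfold pk
        have h1 : exp (-1) ≤ exp (-|x - y| / s) := by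
          apply Real.exp_le_exp.2
          rw [le_div_iff₀ hs]; linarith
        have h2 : 1 / 3 ≤ exp (-1) := by
          rw [Real.exp_neg, one_div]
          exact inv_anti₀ (exp_pos _) (by linarith [Real.exp_one_lt_d9])
        calc (6 * s)⁻¹ = (2 * s)⁻¹ * (1 / 3) := by field_simp; norm_num
          _ ≤ _ := by gcongr; exact h2.trans h1
    _ ≤ _ := by
        refine setIntegral_le_integral hi.re (ae_of_all _ fun y => ?_)
        simp only [Pi.zero_apply]
        by_cases h : y ∈ ball c (3 * r)
        · have := pk_nonneg hs (x - y)
          simpa [h] using this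
        · simp [h]

theorem LipA.enorm_integral_th_le (hA : LipA A L) (hs : 0 < s) (hx : |x - c| < r)
    (hsr : s ≤ r) :
    ‖∫ y, th A s x y‖ₑ ≤ 3 * (ofReal ((2 + L) ^ 2 / 4 * (s / r) ^ 2) +
      ofReal (129 * (147 * (2 + L) ^ 5)) * 16 *
        hlMax (fun v => ‖Qop s ((ball c (3 * r)).indicator (dz A)) v‖ₑ) x) := by
  set g := (ball c (3 * r)).indicator (dz A)
  have h1 := hA.norm_thOp_dz_le hs hx
  have h2 := hA.le_norm_Pop_dz hs hx hsr
  have h3 := hA.enorm_thOp_sub_le (hA.bc_dz c (3 * r)) hs x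
  set T := ∫ y, th A s x y
  have h4 : ‖T‖ ≤ 3 * (‖thOp A s g x‖ + ‖thOp A s g x - T * Pop s g x‖) := by
    have : ‖T * Pop s g x‖ ≤ ‖thOp A s g x‖ + ‖thOp A s g x - T * Pop s g x‖ := by
      have := norm_sub_le (thOp A s g x) (thOp A s g x - T * Pop s g x)
      rwa [sub_sub_cancel] at this
    rw [norm_mul] at this
    nlinarith [norm_nonneg T]
  calc ‖T‖ₑ ≤ ofReal (3 * (‖thOp A s g x‖ + ‖thOp A s g x - T * Pop s g x‖)) := by
        rw [← ofReal_norm]; exact ofReal_le_ofReal h4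
    _ = 3 * (ofReal ‖thOp A s g x‖ + ‖thOp A s g x - T * Pop s g x‖ₑ) := by
        rw [ofReal_mul (by norm_num), ofReal_add (norm_nonneg _) (norm_nonneg _),
          ofReal_norm (thOp A s g x - T * Pop s g x)]
        simp
    _ ≤ _ := by gcongr

theorem ENNReal.add_sq_le (a b : ℝ≥0∞) : (a + b) ^ (2 : ℝ) ≤ 2 * (a ^ (2 : ℝ) + b ^ (2 : ℝ)) := by
  have := ENNReal.rpow_add_le_mul_rpow_add_rpow a b (p := 2) (by norm_num)
  norm_num at this ⊢
  exact this

theorem LipA.lintegral_th_carleson (hA : LipA A L) : ∃ K ≠ 0, K ≠ ⊤ ∧ ∀ c r, 0 < r →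
    ∫⁻ s in Ioc 0 r, ∫⁻ x in ball c r, ofReal s⁻¹ * ‖∫ y, th A s x y‖ₑ ^ (2 : ℝ) ≤
      K * ofReal r := by
  have hL := hA.1
  obtain ⟨Ch, hCh, hM⟩ := lintegral_hlMax_rpow_le (p := 2) one_lt_two
  set a := ofReal ((2 + L) ^ 2 / 4) with ha
  set D := ofReal (129 * (147 * (2 + L) ^ 5)) * 16 with hD
  have hDt : D ≠ ⊤ := mul_ne_top ofReal_ne_top (by simp)
  refine ⟨1 + (18 * a ^ (2 : ℝ) * 2 + 18 * D ^ (2 : ℝ) * (Ch * (288 * (ofReal (1 + L) ^ (2 : ℝ) * 6)))),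
    by simp, ?_, fun c r hr => ?_⟩
  · refine add_ne_top.2 ⟨by simp, add_ne_top.2 ⟨?_, ?_⟩⟩
    · exact mul_ne_top (mul_ne_top (by simp) (rpow_ne_top_of_nonneg (by simp)
        ofReal_ne_top)) (by simp)
    · refine mul_ne_top (mul_ne_top (by simp) (rpow_ne_top_of_nonneg (by simp)
        hDt)) (mul_ne_top hCh (mul_ne_top (by simp) (mul_ne_top
        (rpow_ne_top_of_nonneg (by simp) ofReal_ne_top) (by simp))))
  set g := (ball c (3 * r)).indicator (dz A) with hg
  have hgb : BC g := hA.bc_dz c (3 * r)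
  have mQ : ∀ s, Measurable fun v => ‖Qop s g v‖ₑ := fun s =>
    ((measurable_Qop hgb.meas).comp measurable_prodMk_left).enorm
  have step : ∀ s ∈ Ioc 0 r, ∫⁻ x in ball c r, ofReal s⁻¹ * ‖∫ y, th A s x y‖ₑ ^ (2 : ℝ) ≤
      18 * a ^ (2 : ℝ) * 2 + 18 * D ^ (2 : ℝ) * (Ch * ∫⁻ v, ofReal s⁻¹ * ‖Qop s g v‖ₑ ^ (2 : ℝ)) := by
    rintro s ⟨hs, hsr⟩
    have hpt : ∀ x ∈ ball c r, ofReal s⁻¹ * ‖∫ y, th A s x y‖ₑ ^ (2 : ℝ) ≤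
        18 * a ^ (2 : ℝ) * ofReal r⁻¹ + 18 * D ^ (2 : ℝ) * ofReal s⁻¹ *
          hlMax (fun v => ‖Qop s g v‖ₑ) x ^ (2 : ℝ) := by
      intro x hx
      rw [mem_ball, dist_eq] at hx
      have h1 := hA.enorm_integral_th_le hs hx hsr
      rw [ofReal_mul (by positivity)] at h1
      calc _ ≤ ofReal s⁻¹ * (3 * (a * ofReal ((s / r) ^ 2) + D * hlMax (fun v => ‖Qop s g v‖ₑ) x)) ^ (2 : ℝ) := by
            gcongr
        _ ≤ ofReal s⁻¹ * (9 * (2 * ((a * ofReal ((s / r) ^ 2)) ^ (2 : ℝ) + (D * hlMax (fun v => ‖Qop s g v‖ₑ) x) ^ (2 : ℝ)))) := by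
            rw [mul_rpow_of_nonneg _ _ (by norm_num : (0 : ℝ) ≤ 2),
              show (3 : ℝ≥0∞) ^ (2 : ℝ) = 9 by rw [rpow_two]; norm_num]
            gcongr
            exact ENNReal.add_sq_le _ _
        _ = 18 * a ^ (2 : ℝ) * (ofReal s⁻¹ * ofReal ((s / r) ^ 2) ^ (2 : ℝ)) +
            18 * D ^ (2 : ℝ) * ofReal s⁻¹ * hlMax (fun v => ‖Qop s g v‖ₑ) x ^ (2 : ℝ) := by
            rw [mul_rpow_of_nonneg _ _ (by norm_num : (0 : ℝ) ≤ 2),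
              mul_rpow_of_nonneg _ _ (by norm_num : (0 : ℝ) ≤ 2),
              show (18 : ℝ≥0∞) = 9 * 2 by norm_num]
            ring
        _ ≤ _ := by
            gcongr
            rw [rpow_two, ← ofReal_pow (by positivity), ← ofReal_mul (by positivity)]
            refine ofReal_le_ofReal ?_
            have h1 : s / r ≤ 1 := (div_le_one hr).2 hsr
            have h0 : 0 ≤ s / r := by positivity
            calc s⁻¹ * ((s / r) ^ 2) ^ 2 = r⁻¹ * (s / r) ^ 3 := by field_simp
              _ ≤ r⁻¹ * 1 := by gcongr; exact pow_le_one₀ h0 h1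
              _ = _ := mul_one _
    calc _ ≤ ∫⁻ x in ball c r, (18 * a ^ (2 : ℝ) * ofReal r⁻¹ +
          18 * D ^ (2 : ℝ) * ofReal s⁻¹ * hlMax (fun v => ‖Qop s g v‖ₑ) x ^ (2 : ℝ)) :=
          setLIntegral_mono' measurableSet_ball hpt
      _ = 18 * a ^ (2 : ℝ) * ofReal r⁻¹ * volume (ball c r) +
          18 * D ^ (2 : ℝ) * ofReal s⁻¹ * ∫⁻ x in ball c r, hlMax (fun v => ‖Qop s g v‖ₑ) x ^ (2 : ℝ) := by
          rw [lintegral_add_left measurable_const, setLIntegral_const,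
            lintegral_const_mul _ ((measurable_hlMax _).pow_const _)]
      _ ≤ 18 * a ^ (2 : ℝ) * 2 +
          18 * D ^ (2 : ℝ) * ofReal s⁻¹ * (Ch * ∫⁻ v, ‖Qop s g v‖ₑ ^ (2 : ℝ)) := by
          refine add_le_add ?_ (mul_le_mul_right ?_ _)
          · rw [volume_ball, mul_assoc, ← ofReal_mul (by positivity)]
            refine mul_le_mul_right ?_ _
            rw [show r⁻¹ * (2 * r) = 2 by field_simp]; simp
          · exact (setLIntegral_le_lintegral _ _).trans (hM _ (mQ s).aemeasurable)
      _ = _ := by rw [lintegral_ofReal_mul]; ring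
  have hgn : ∫⁻ x, ‖g x‖ₑ ^ (2 : ℝ) ≤ ofReal (1 + L) ^ (2 : ℝ) * 6 * ofReal r := by
    calc _ ≤ ∫⁻ x in ball c (3 * r), ofReal (1 + L) ^ (2 : ℝ) := by
          rw [← lintegral_indicator measurableSet_ball]
          refine lintegral_mono fun x => ?_
          by_cases h : x ∈ ball c (3 * r)
          · simp only [hg, indicator_of_mem h]
            gcongr
            rw [← ofReal_norm]
            exact ofReal_le_ofReal (hA.norm_dz_le x)
          · simp [hg, indicator_of_notMem h]
      _ = _ := by
          rw [setLIntegral_const, volume_ball, mul_assoc, show (6 : ℝ≥0∞) = ofReal 6 by simp,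
            ← ofReal_mul (by norm_num)]
          congr 2; ring
  calc _ ≤ ∫⁻ s in Ioc 0 r, (18 * a ^ (2 : ℝ) * 2 + 18 * D ^ (2 : ℝ) *
        (Ch * ∫⁻ v, ofReal s⁻¹ * ‖Qop s g v‖ₑ ^ (2 : ℝ))) :=
        setLIntegral_mono' measurableSet_Ioc step
    _ = 18 * a ^ (2 : ℝ) * 2 * ofReal r + 18 * D ^ (2 : ℝ) *
        (Ch * ∫⁻ s in Ioc 0 r, ∫⁻ v, ofReal s⁻¹ * ‖Qop s g v‖ₑ ^ (2 : ℝ)) := by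
        rw [lintegral_add_left measurable_const, setLIntegral_const, Real.volume_Ioc, sub_zero,
          lintegral_const_mul' _ _ (mul_ne_top (by simp) (rpow_ne_top_of_nonneg (by simp)
        hDt)), lintegral_const_mul' _ _ hCh]
    _ ≤ 18 * a ^ (2 : ℝ) * 2 * ofReal r + 18 * D ^ (2 : ℝ) *
        (Ch * (288 * (ofReal (1 + L) ^ (2 : ℝ) * 6 * ofReal r))) := by
        gcongr
        refine (lintegral_mono_set Ioc_subset_Ioi_self).trans ((lintegral_Qop_sq hgb).trans ?_)
        gcongr
    _ ≤ _ := by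
        rw [add_mul, add_mul]
        refine le_trans (le_of_eq ?_) le_add_self
        ring

theorem LipA.lintegral_thOp_sub_sq (hA : LipA A L) : ∃ K ≠ ⊤, ∀ f, BC f →
    ∫⁻ s in Ioi 0, ∫⁻ x, ofReal s⁻¹ * ‖thOp A s f x - (∫ y, th A s x y) * Pop s f x‖ₑ ^ (2 : ℝ) ≤
      K * ∫⁻ x, ‖f x‖ₑ ^ (2 : ℝ) := by
  obtain ⟨Ch, hCh, hM⟩ := lintegral_hlMax_rpow_le (p := 2) one_lt_two
  obtain ⟨D, hDt, hDl⟩ : ∃ D ≠ ⊤, ∀ f, BC f → ∀ s > 0, ∀ x : ℝ,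
      ‖thOp A s f x - (∫ y, th A s x y) * Pop s f x‖ₑ ≤ D * hlMax (fun v => ‖Qop s f v‖ₑ) x :=
    ⟨_, mul_ne_top ofReal_ne_top (by simp), fun f hf s hs x => hA.enorm_thOp_sub_le hf hs x⟩
  have hD2 : D ^ (2 : ℝ) ≠ ⊤ := rpow_ne_top_of_nonneg (by simp) hDt
  refine ⟨D ^ (2 : ℝ) * (Ch * 288), mul_ne_top hD2 (mul_ne_top hCh (by simp)), fun f hf => ?_⟩
  have mQ : ∀ s, Measurable fun v => ‖Qop s f v‖ₑ := fun s =>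
    ((measurable_Qop hf.meas).comp measurable_prodMk_left).enorm
  calc _ ≤ ∫⁻ s in Ioi 0, D ^ (2 : ℝ) * (Ch * ∫⁻ v, ofReal s⁻¹ * ‖Qop s f v‖ₑ ^ (2 : ℝ)) := by
        refine setLIntegral_mono' measurableSet_Ioi fun s hs => ?_
        calc _ ≤ ∫⁻ x, ofReal s⁻¹ * (D ^ (2 : ℝ) * hlMax (fun v => ‖Qop s f v‖ₑ) x ^ (2 : ℝ)) := by
              refine lintegral_mono fun x => ?_
              rw [← mul_rpow_of_nonneg _ _ (by norm_num : (0 : ℝ) ≤ 2)]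
              gcongr
              exact hDl f hf s hs x
          _ = D ^ (2 : ℝ) * (ofReal s⁻¹ * ∫⁻ x, hlMax (fun v => ‖Qop s f v‖ₑ) x ^ (2 : ℝ)) := by
              rw [lintegral_ofReal_mul, lintegral_const_mul' _ _ hD2]; ring
          _ ≤ D ^ (2 : ℝ) * (ofReal s⁻¹ * (Ch * ∫⁻ v, ‖Qop s f v‖ₑ ^ (2 : ℝ))) := by
              gcongr; exact hM _ (mQ s).aemeasurable
          _ = _ := by rw [lintegral_ofReal_mul]; ring
    _ ≤ _ := by
        rw [lintegral_const_mul' _ _ hD2, lintegral_const_mul' _ _ hCh, mul_assoc, mul_assoc]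
        gcongr
        exact lintegral_Qop_sq hf

set_option maxHeartbeats 1000000 in
theorem LipA.lintegral_thOp_sq (hA : LipA A L) : ∃ K ≠ ⊤, ∀ f, BC f →
    ∫⁻ s in Ioi 0, ∫⁻ x, ofReal s⁻¹ * ‖thOp A s f x‖ₑ ^ (2 : ℝ) ≤ K * ∫⁻ x, ‖f x‖ₑ ^ (2 : ℝ) := by
  have hL := hA.1
  obtain ⟨Ch, hCh, hM⟩ := lintegral_hlMax_rpow_le (p := 2) one_lt_two
  obtain ⟨K, hK0, hKt, hK⟩ := hA.lintegral_th_carleson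
  obtain ⟨D, hDt, hDl⟩ := hA.lintegral_thOp_sub_sq
  obtain ⟨k, hkt, hP⟩ : ∃ k ≠ ⊤, ∀ f, BC f → ∀ x s y : ℝ, |x - y| < s →
      ‖Pop s f x‖ₑ ≤ k * hlMax (fun v => ‖f v‖ₑ) y :=
    ⟨576, by simp, fun f hf x s y h => enorm_Pop_le hf.meas h⟩
  have h576 : k ^ (2 : ℝ) ≠ ⊤ := rpow_ne_top_of_nonneg (by simp) hkt
  refine ⟨2 * (2 * K * (k ^ (2 : ℝ) * Ch) + D), mul_ne_top (by simp) (add_ne_top.2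
    ⟨mul_ne_top (mul_ne_top (by simp) hKt) (mul_ne_top h576 hCh), hDt⟩), fun f hf => ?_⟩
  have mT : Measurable fun q : ℝ × ℝ => ∫ y, th A q.2 q.1 y :=
    measurable_swap_args (G := fun s x => ∫ y, th A s x y) hA.measurable_integral_th
  have mP := measurable_Pop hf.meas
  set w : ℝ × ℝ → ℝ≥0∞ := fun q => ofReal q.2⁻¹ * ‖∫ y, th A q.2 q.1 y‖ₑ ^ (2 : ℝ) with hw
  have mw : Measurable w := by fun_prop
  set ν : Measure (ℝ × ℝ) := (volume : Measure ℝ).prod (volume.restrict (Ioi (0 : ℝ))) with hν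
  have hcar : ∀ c r : ℝ, 0 < r → (ν.withDensity w) (ball c r ×ˢ Ioc 0 r) ≤ K * ofReal r := by
    intro c r hr
    rw [withDensity_apply _ (measurableSet_ball.prod measurableSet_Ioc), hν,
      ← prod_restrict, restrict_restrict measurableSet_Ioc,
      inter_eq_left.2 Ioc_subset_Ioi_self, lintegral_prod_symm' _ mw]
    exact hK c r hr
  have emb := carleson_embedding (μ := ν.withDensity w) hK0 hcar (F := fun q => ‖Pop q.2 f q.1‖ₑ)
    mP.enorm (N := fun y => k * hlMax (fun v => ‖f v‖ₑ) y) ((measurable_hlMax _).const_mul _)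
    (fun x s y h => hP f hf x s y h)
  have hN : ∫⁻ y, (k * hlMax (fun v => ‖f v‖ₑ) y) ^ (2 : ℝ) ≤
      k ^ (2 : ℝ) * Ch * ∫⁻ x, ‖f x‖ₑ ^ (2 : ℝ) := by
    simp only [mul_rpow_of_nonneg _ _ (by norm_num : (0 : ℝ) ≤ 2)]
    rw [lintegral_const_mul' _ _ h576, mul_assoc]
    gcongr
    exact hM _ hf.meas.enorm.aemeasurable
  have hmain : ∫⁻ s in Ioi 0, ∫⁻ x, ofReal s⁻¹ * ‖(∫ y, th A s x y) * Pop s f x‖ₑ ^ (2 : ℝ) ≤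
      2 * K * (k ^ (2 : ℝ) * Ch * ∫⁻ x, ‖f x‖ₑ ^ (2 : ℝ)) := by
    refine le_trans (le_of_eq ?_) (emb.trans (mul_le_mul_right hN _))
    have m2 : Measurable fun q : ℝ × ℝ => ‖Pop q.2 f q.1‖ₑ ^ (2 : ℝ) := mP.enorm.pow_const _
    rw [restrict_withDensity (MeasurableSet.univ.prod measurableSet_Ioi),
      lintegral_withDensity_eq_lintegral_mul _ mw m2, hν, ← prod_restrict,
      Measure.restrict_univ, restrict_restrict measurableSet_Ioi, inter_self,
      lintegral_prod_symm' _ (mw.mul m2)]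
    refine lintegral_congr fun s => lintegral_congr fun x => ?_
    simp only [hw, Pi.mul_apply, enorm_mul]
    rw [mul_rpow_of_nonneg _ _ (by norm_num : (0 : ℝ) ≤ 2), mul_assoc]
  have hdiff := hDl f hf
  have m1 : Measurable fun q : ℝ × ℝ => ofReal q.1⁻¹ *
      ‖(∫ y, th A q.1 q.2 y) * Pop q.1 f q.2‖ₑ ^ (2 : ℝ) := by
    have := hA.measurable_integral_th
    have : Measurable fun q : ℝ × ℝ => Pop q.1 f q.2 := mP.comp measurable_swap
    fun_prop
  calc _ ≤ ∫⁻ s in Ioi 0, ∫⁻ x, 2 * (ofReal s⁻¹ * ‖(∫ y, th A s x y) * Pop s f x‖ₑ ^ (2 : ℝ) +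
        ofReal s⁻¹ * ‖thOp A s f x - (∫ y, th A s x y) * Pop s f x‖ₑ ^ (2 : ℝ)) := by
        refine lintegral_mono fun s => lintegral_mono fun x => ?_
        rw [← mul_add, mul_left_comm]
        gcongr
        refine le_trans ?_ (ENNReal.add_sq_le _ _)
        gcongr
        refine le_trans (le_of_eq ?_) (enorm_add_le _ _)
        congr 1; ring
    _ = 2 * ((∫⁻ s in Ioi 0, ∫⁻ x, ofReal s⁻¹ * ‖(∫ y, th A s x y) * Pop s f x‖ₑ ^ (2 : ℝ)) +
        ∫⁻ s in Ioi 0, ∫⁻ x, ofReal s⁻¹ * ‖thOp A s f x - (∫ y, th A s x y) * Pop s f x‖ₑ ^ (2 : ℝ)) := by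
        rw [← lintegral_add_left (f := fun s => ∫⁻ x, ofReal s⁻¹ *
          ‖(∫ y, th A s x y) * Pop s f x‖ₑ ^ (2 : ℝ)) m1.lintegral_prod_right',
          ← lintegral_const_mul' _ _ (by simp)]
        refine lintegral_congr fun s => ?_
        have m3 : Measurable fun x => ofReal s⁻¹ *
          ‖(∫ y, th A s x y) * Pop s f x‖ₑ ^ (2 : ℝ) := m1.comp measurable_prodMk_left
        rw [← lintegral_add_left m3, ← lintegral_const_mul' _ _ (by simp)]
    _ ≤ 2 * (2 * K * (k ^ (2 : ℝ) * Ch * ∫⁻ x, ‖f x‖ₑ ^ (2 : ℝ)) +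
        D * ∫⁻ x, ‖f x‖ₑ ^ (2 : ℝ)) := by gcongr
    _ = _ := by ring

/-- The regularised Cauchy kernel `1 / (z(y) - z(x) + i s)`. -/
def kr (A : ℝ → ℝ) (s x y : ℝ) : ℂ := (zc A y - zc A x + s * I)⁻¹

theorem log_sub_log_of_re_pos {z w : ℂ} (hz : 0 < z.re) (hw : 0 < w.re) :
    log z - log w = log (z / w) := by
  have hz0 : z ≠ 0 := fun h => by simp [h] at hz
  have hw0 : w ≠ 0 := fun h => by simp [h] at hw
  have h1 := abs_lt.1 (abs_arg_lt_pi_div_two_iff.2 (.inl hz))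
  have h2 := abs_lt.1 (abs_arg_lt_pi_div_two_iff.2 (.inl hw))
  have h3 : w.arg ≠ π := by linarith [pi_pos]
  have h4 : (w⁻¹).arg = -w.arg := by rw [Complex.arg_inv, if_neg h3]
  rw [div_eq_mul_inv, log_mul hz0 (inv_ne_zero hw0) (by rw [h4]; constructor <;> linarith),
    Complex.log_inv _ h3, sub_eq_add_neg]

theorem log_mul_I_of_re_pos {z : ℂ} (hz : 0 < z.re) : log (I * z) = log z + π / 2 * I := by
  have hz0 : z ≠ 0 := fun h => by simp [h] at hz
  have h1 := abs_lt.1 (abs_arg_lt_pi_div_two_iff.2 (.inl hz))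
  rw [log_mul I_ne_zero hz0 (by rw [arg_I]; constructor <;> linarith), log_I]
  ring

theorem log_mul_neg_I_of_re_pos {z : ℂ} (hz : 0 < z.re) :
    log (-I * z) = log z - π / 2 * I := by
  have hz0 : z ≠ 0 := fun h => by simp [h] at hz
  have h1 := abs_lt.1 (abs_arg_lt_pi_div_two_iff.2 (.inl hz))
  rw [log_mul (neg_ne_zero.2 I_ne_zero) hz0 (by rw [Complex.arg_neg_I]; constructor <;> linarith),
    Complex.log_neg_I]
  ring

theorem LipA.measurable_kr (hA : LipA A L) :
    Measurable fun q : ℝ × ℝ × ℝ => kr A q.1 q.2.1 q.2.2 := by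
  have := hA.zc_continuous.measurable
  unfold kr
  fun_prop

theorem LipA.measurable_kr_right (hA : LipA A L) (s x : ℝ) : Measurable fun u => kr A s x u :=
  hA.measurable_kr.comp (f := fun y => (s, x, y)) (by fun_prop)

theorem LipA.norm_kr_le (hA : LipA A L) (hs : s ≠ 0) (x y : ℝ) :
    ‖kr A s x y‖ ≤ (2 + L) / (|s| + |x - y|) := hA.norm_inv_le x y s (.inl hs)

theorem LipA.norm_kr_le' (hA : LipA A L) (hs : s ≠ 0) (x y : ℝ) : ‖kr A s x y‖ ≤ (2 + L) / |s| := by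
  have := hA.1
  have := abs_pos.2 hs
  refine (hA.norm_kr_le hs x y).trans ?_
  gcongr
  linarith [abs_nonneg (x - y)]

theorem LipA.norm_kr_sq_le (hA : LipA A L) (hs : s ≠ 0) (x y : ℝ) :
    ‖kr A s x y‖ ^ 2 ≤ (2 + L) ^ 2 / |s| * pker |s| (x - y) := by
  have hL := hA.1
  have h0 := abs_pos.2 hs
  calc _ ≤ ((2 + L) / (|s| + |x - y|)) ^ 2 := by gcongr; exact hA.norm_kr_le hs x y
    _ = _ := by
      have := abs_nonneg (x - y)
      have : |s| + |x - y| ≠ 0 := by positivity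
      unfold pker; field_simp

theorem LipA.integrable_kr_mul_kr (hA : LipA A L) (hs : s ≠ 0) (ht : t ≠ 0) (x y : ℝ) :
    Integrable fun u => dz A u * (kr A s x u * kr A t y u) := by
  have hL := hA.1
  have m : Measurable fun u => dz A u * (kr A s x u * kr A t y u) :=
    (measurable_dz A).mul ((hA.measurable_kr_right s x).mul (hA.measurable_kr_right t y))
  refine Integrable.mono' ((((integrable_pker (abs_pos.2 hs) x).const_mul ((2 + L) ^ 2 / |s|)).add
    ((integrable_pker (abs_pos.2 ht) y).const_mul ((2 + L) ^ 2 / |t|))).const_mul (1 + L))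
    m.aestronglyMeasurable (ae_of_all _ fun u => ?_)
  rw [norm_mul, norm_mul]
  have h1 := hA.norm_kr_sq_le hs x u
  have h2 := hA.norm_kr_sq_le ht y u
  refine mul_le_mul (hA.norm_dz_le u) ?_ (by positivity) (by positivity)
  simp only [Pi.add_apply]
  nlinarith [sq_nonneg (‖kr A s x u‖ - ‖kr A t y u‖), norm_nonneg (kr A s x u), norm_nonneg (kr A t y u)]

theorem LipA.kr_sub_kr (hA : LipA A L) (hs : s ≠ 0) (ht : t ≠ 0) (x y u : ℝ) :
    kr A s x u - kr A t y u = ((zc A x - s * I) - (zc A y - t * I)) *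
      (kr A s x u * kr A t y u) := by
  have h1 := hA.ne_zero x u hs
  have h2 := hA.ne_zero y u ht
  unfold kr
  rw [inv_sub_inv h1 h2, div_eq_mul_inv, mul_inv]
  ring

theorem LipA.tendsto_kr (hA : LipA A L) (hs : s ≠ 0) (x : ℝ) {l : Filter ℝ}
    (hl : Tendsto (fun u : ℝ => |u|) l atTop) : Tendsto (fun u => kr A s x u) l (nhds 0) := by
  have h1 : Tendsto (fun u => (|s| + |x - u|)) l atTop := by
    refine tendsto_atTop_mono (f := fun u => -|x| + |u|) (fun u => ?_) (tendsto_atTop_add_const_left _ _ hl)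
    have := abs_sub_abs_le_abs_sub u x
    rw [abs_sub_comm] at this
    linarith [abs_nonneg s]
  exact squeeze_zero_norm (fun u => hA.norm_kr_le hs x u) (h1.const_div_atTop _)

theorem LipA.integral_kr_pow (hA : LipA A L) (hs : s ≠ 0) (x : ℝ) (n : ℕ) :
    Integrable (fun u => dz A u * kr A s x u ^ (n + 2)) ∧ ∫ u, dz A u * kr A s x u ^ (n + 2) = 0 := by
  have hL := hA.1
  have h0 := abs_pos.2 hs
  have hi : Integrable (fun u => dz A u * kr A s x u ^ (n + 2)) := by
    have m : Measurable fun u => dz A u * kr A s x u ^ (n + 2) :=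
      (measurable_dz A).mul ((hA.measurable_kr_right s x).pow_const _)
    refine Integrable.mono' ((hA.integrable_kr_mul_kr hs hs x x).norm.const_mul (((2 + L) / |s|) ^ n))
      m.aestronglyMeasurable (ae_of_all _ fun u => ?_)
    rw [norm_mul, norm_mul, norm_mul, pow_add, norm_mul, norm_pow, norm_pow]
    have := pow_le_pow_left₀ (norm_nonneg _) (hA.norm_kr_le' hs x u) n
    have h3 : 0 ≤ ‖dz A u‖ * (‖kr A s x u‖ * ‖kr A s x u‖) := by positivity
    calc _ = ‖kr A s x u‖ ^ n * (‖dz A u‖ * (‖kr A s x u‖ * ‖kr A s x u‖)) := by ring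
      _ ≤ _ := by gcongr
  refine ⟨hi, ?_⟩
  have hG : ∀ y, HasStrictDerivAt (fun w : ℂ => (-(n + 1 : ℂ)⁻¹) * ((w + (-zc A x + s * I))⁻¹) ^ (n + 1))
      (((zc A y + (-zc A x + s * I))⁻¹) ^ (n + 2)) (zc A y) := by
    intro y
    have := hA.ne_zero x y hs
    refine ((hasStrictDerivAt_inv_pow (n + 1) (by convert this using 1; ring)).const_mul _).congr_deriv ?_
    have h1 : (n + 1 : ℂ) ≠ 0 := by exact_mod_cast n.succ_ne_zero
    push_cast
    rw [show n + 1 + 1 = n + 2 by ring]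
    field_simp
  have e : ∀ y, ((zc A y + (-zc A x + s * I))⁻¹) = kr A s x y := by intro y; unfold kr; ring_nf
  have h2 := hA.hasDerivAt_comp hG
  have h3 := hA.locallyLipschitz_comp hG
  simp only [e] at h2 h3
  have lim : ∀ l : Filter ℝ, Tendsto (fun u : ℝ => |u|) l atTop →
      Tendsto (fun u => (-(n + 1 : ℂ)⁻¹) * kr A s x u ^ (n + 1)) l (nhds 0) := by
    intro l hl
    have := ((hA.tendsto_kr hs x hl).pow (n + 1)).const_mul (-(n + 1 : ℂ)⁻¹)
    simpa using this
  have := h3.integral_eq_sub_of_tendsto (h2.mono fun y hy => hy.congr_deriv (mul_comm _ _)) hi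
    (lim _ tendsto_abs_atBot_atTop) (lim _ tendsto_abs_atTop_atTop)
  simpa using this

/-- A logarithm of `z(u) - z(x) + i s` which is continuous in `u`. -/
def lg (A : ℝ → ℝ) (s x u : ℝ) : ℂ :=
  log (-(SignType.sign s : ℂ) * I * (zc A u - zc A x + s * I))

theorem LipA.lg_deriv (hA : LipA A L) (hs : s ≠ 0) (x : ℝ) :
    LocallyLipschitz (lg A s x) ∧ ∀ᵐ y, HasDerivAt (lg A s x) (dz A y * kr A s x y) y := by
  have hG : ∀ y, HasStrictDerivAt (fun w : ℂ => log (-(SignType.sign s : ℂ) * I * (w + (-zc A x + s * I))))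
      ((zc A y - zc A x + s * I)⁻¹) (zc A y) := by
    intro y
    have h0 := hA.ne_zero x y hs
    have hm : (-(SignType.sign s : ℂ) * I * (zc A y + (-zc A x + s * I))) ∈ Complex.slitPlane := by
      by_cases hyx : y = x
      · left
        subst hyx
        rcases lt_or_gt_of_ne hs with h | h
        · simp [h]
        · simp [h]
      · right
        rcases lt_or_gt_of_ne hs with h | h
        · simp [h]; intro h2; exact hyx (by linarith)
        · simp [h]; intro h2; exact hyx (by linarith)
    have h1 : HasStrictDerivAt (fun w : ℂ => (-(SignType.sign s : ℂ) * I * (w + (-zc A x + s * I))))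
        (-(SignType.sign s : ℂ) * I * 1) (zc A y) :=
      ((hasStrictDerivAt_id (zc A y)).add_const _).const_mul _
    refine (h1.clog hm).congr_deriv ?_
    rw [show zc A y + (-zc A x + s * I) = zc A y - zc A x + s * I by ring]
    have h2 : (SignType.sign s : ℂ) ≠ 0 := by rcases lt_or_gt_of_ne hs with h | h <;> simp [h]
    have := I_ne_zero
    field_simp
  have e : lg A s x = fun y => (fun w : ℂ => log (-(SignType.sign s : ℂ) * I * (w + (-zc A x + s * I)))) (zc A y) := by
    funext y; unfold lg; ring_nf
  rw [e]
  exact ⟨hA.locallyLipschitz_comp hG, (hA.hasDerivAt_comp hG).mono fun y hy => hy.congr_deriv (mul_comm _ _)⟩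

theorem lg_of_gt (hs : s ≠ 0) (h : x < u) : lg A s x u =
    log (zc A u - zc A x + s * I) - (SignType.sign s : ℂ) * (π / 2 * I) := by
  have hre : 0 < (zc A u - zc A x + s * I).re := by simp; linarith
  unfold lg
  rcases lt_or_gt_of_ne hs with h | h
  · have := log_mul_I_of_re_pos hre
    simpa [h, sign_neg] using this
  · have := log_mul_neg_I_of_re_pos hre
    simpa [h, sign_pos] using this

theorem lg_of_lt (hs : s ≠ 0) (h : u < x) : lg A s x u =
    log (-(zc A u - zc A x + s * I)) + (SignType.sign s : ℂ) * (π / 2 * I) := by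
  have hre : 0 < (-(zc A u - zc A x + s * I)).re := by simp; linarith
  unfold lg
  rcases lt_or_gt_of_ne hs with h | h
  · have := log_mul_neg_I_of_re_pos hre
    rw [neg_mul_neg] at this
    simpa [h, sign_neg, sub_eq_add_neg] using this
  · have := log_mul_I_of_re_pos hre
    rw [mul_neg, ← neg_mul] at this
    simpa [h, sign_pos] using this

theorem LipA.tendsto_log_div (hA : LipA A L) (ht : t ≠ 0) (x y : ℝ) {l : Filter ℝ}
    (hl : Tendsto (fun u : ℝ => |u|) l atTop) :
    Tendsto (fun u => log ((zc A u - zc A x + s * I) / (zc A u - zc A y + t * I)))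
      l (nhds 0) := by
  have h1 : Tendsto (fun u => 1 + (zc A y - zc A x + s * I - t * I) * kr A t y u) l (nhds 1) := by
    simpa using ((hA.tendsto_kr ht y hl).const_mul _).const_add 1
  have h2 : ContinuousAt log 1 := continuousAt_clog (by simp)
  have h3 := h2.tendsto.comp h1
  rw [Complex.log_one] at h3
  refine h3.congr fun u => ?_
  have := hA.ne_zero y u ht
  simp only [Function.comp, kr]
  congr 1
  rw [eq_div_iff this, add_mul, mul_assoc, inv_mul_cancel₀ this]
  ring

theorem LipA.integral_kr_sub_kr (hA : LipA A L) (hs : s ≠ 0) (ht : t ≠ 0) (x y : ℝ) :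
    ∫ u, dz A u * (kr A s x u - kr A t y u) =
      ((SignType.sign t : ℂ) - (SignType.sign s : ℂ)) * (π * I) := by
  have hi : Integrable fun u => dz A u * (kr A s x u - kr A t y u) := by
    simp only [hA.kr_sub_kr hs ht x y]
    refine ((hA.integrable_kr_mul_kr hs ht x y).const_mul
      ((zc A x - s * I) - (zc A y - t * I))).congr (ae_of_all _ fun u => ?_)
    simp only; ring
  have hlip : LocallyLipschitz fun u => lg A s x u + -1 * lg A t y u :=
    LocallyLipschitz.add_complex (hA.lg_deriv hs x).1
      (LocallyLipschitz.mul_complex (LocallyLipschitz.const _) (hA.lg_deriv ht y).1)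
  have hd : ∀ᵐ u, HasDerivAt (fun u => lg A s x u + -1 * lg A t y u)
      (dz A u * (kr A s x u - kr A t y u)) u := by
    filter_upwards [(hA.lg_deriv hs x).2, (hA.lg_deriv ht y).2] with u h1 h2
    exact (h1.add (h2.const_mul _)).congr_deriv (by ring)
  have top : Tendsto (fun u => lg A s x u + -1 * lg A t y u) atTop
      (nhds (((SignType.sign t : ℂ) - (SignType.sign s : ℂ)) * (π / 2 * I))) := by
    have := (hA.tendsto_log_div (s := s) ht x y tendsto_abs_atTop_atTop).add_const
      (((SignType.sign t : ℂ) - (SignType.sign s : ℂ)) * (π / 2 * I))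
    rw [zero_add] at this
    refine this.congr' ?_
    filter_upwards [eventually_gt_atTop x, eventually_gt_atTop y] with u h1 h2
    rw [lg_of_gt hs h1, lg_of_gt ht h2, ← log_sub_log_of_re_pos (by simp; linarith) (by simp; linarith)]
    ring
  have bot : Tendsto (fun u => lg A s x u + -1 * lg A t y u) atBot
      (nhds (((SignType.sign s : ℂ) - (SignType.sign t : ℂ)) * (π / 2 * I))) := by
    have := (hA.tendsto_log_div (s := s) ht x y tendsto_abs_atBot_atTop).add_const
      (((SignType.sign s : ℂ) - (SignType.sign t : ℂ)) * (π / 2 * I))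
    rw [zero_add] at this
    refine this.congr' ?_
    filter_upwards [eventually_lt_atBot x, eventually_lt_atBot y] with u h1 h2
    rw [lg_of_lt hs h1, lg_of_lt ht h2, ← neg_div_neg_eq,
      ← log_sub_log_of_re_pos (by simp; linarith) (by simp; linarith)]
    ring
  rw [hlip.integral_eq_sub_of_tendsto hd hi bot top]
  ring

theorem LipA.integral_kr_mul_kr (hA : LipA A L) (hs : s ≠ 0) (ht : t ≠ 0) (x y : ℝ) :
    ((zc A x - s * I) - (zc A y - t * I)) * ∫ u, dz A u * (kr A s x u * kr A t y u) =
      ((SignType.sign t : ℂ) - (SignType.sign s : ℂ)) * (π * I) := by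
  rw [← hA.integral_kr_sub_kr hs ht x y, ← integral_const_mul]
  refine integral_congr_ae (ae_of_all _ fun u => ?_)
  simp only
  rw [hA.kr_sub_kr hs ht]; ring

/-- Reproducing formula for the fifth power of the Cauchy kernel. -/
theorem LipA.integral_th_mul_th (hA : LipA A L) (hs : 0 < s) (x y : ℝ) :
    ∫ u, dz A u * (th A s u y * th A s x u) =
      -(12 * π * I) * (s : ℂ) ^ 4 * kr A (2 * s) x y ^ 5 := by
  have hs' : (-s) ≠ 0 := by simpa using hs.ne'
  have hD := hA.ne_zero x y (s := 2 * s) (by positivity)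
  set D := kr A (2 * s) x y with hDd
  have key : ∀ u, dz A u * (th A s u y * th A s x u) = -(s : ℂ) ^ 4 *
      (D ^ 3 * (dz A u * kr A (-s) y u ^ (1 + 2)) - D ^ 3 * (dz A u * kr A s x u ^ (1 + 2)) +
        (-3 * D ^ 4 * (dz A u * kr A (-s) y u ^ (0 + 2)) - 3 * D ^ 4 * (dz A u * kr A s x u ^ (0 + 2))) +
        6 * D ^ 5 * (dz A u * (kr A (-s) y u - kr A s x u))) := by
    intro u
    have h := hA.kr_sub_kr hs' hs.ne' y x u
    have h1 : D * (kr A (-s) y u - kr A s x u) = kr A (-s) y u * kr A s x u := by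
      rw [h, hDd, kr]
      have e : zc A y - ((-s : ℝ) : ℂ) * I - (zc A x - s * I) =
          zc A y - zc A x + ((2 * s : ℝ) : ℂ) * I := by push_cast; ring
      rw [e, inv_mul_cancel_left₀ hD]
    have h2 : th A s u y = -((s : ℂ) ^ 2 * kr A (-s) y u ^ 3) := by
      have e : zc A y - zc A u + s * I = -(zc A u - zc A y + ((-s : ℝ) : ℂ) * I) := by
        push_cast; ring
      unfold th kr
      rw [e, inv_neg]; ring
    have h3 : th A s x u = (s : ℂ) ^ 2 * kr A s x u ^ 3 := rfl
    rw [h2, h3]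
    set P := kr A (-s) y u
    set Q := kr A s x u
    have h4 : (P * Q) ^ 3 = D ^ 3 * P ^ 3 - D ^ 3 * Q ^ 3 + (-3 * D ^ 4 * P ^ 2 - 3 * D ^ 4 * Q ^ 2) +
        6 * D ^ 5 * (P - Q) := by
      linear_combination (-(D * (P - Q)) ^ 2 - (D * (P - Q)) * (P * Q) - (P * Q) ^ 2 +
        3 * D ^ 2 * (P * Q + D * (P - Q)) * 0 + 3 * D ^ 3 * (P - Q) - 6 * D ^ 4) * h1
    linear_combination (-(s : ℂ) ^ 4 * dz A u) * h4
  have i1 := hA.integral_kr_pow hs' y 1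
  have i2 := hA.integral_kr_pow hs.ne' x 1
  have i3 := hA.integral_kr_pow hs' y 0
  have i4 := hA.integral_kr_pow hs.ne' x 0
  have i5 : Integrable fun u => dz A u * (kr A (-s) y u - kr A s x u) := by
    simp only [hA.kr_sub_kr hs' hs.ne' y x]
    refine ((hA.integrable_kr_mul_kr hs' hs.ne' y x).const_mul
      ((zc A y - (-s : ℝ) * I) - (zc A x - s * I))).congr (ae_of_all _ fun u => ?_)
    simp only; ring
  simp only [key]
  have j1 := (i1.1.const_mul (D ^ 3)).sub (i2.1.const_mul (D ^ 3))
  have j3 := i5.const_mul (6 * D ^ 5)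
  have j2 := (i3.1.const_mul (-3 * D ^ 4)).sub (i4.1.const_mul (3 * D ^ 4))
  simp only [Pi.sub_def] at j1 j2
  have j4 := j1.add j2
  simp only [Pi.add_def] at j4
  rw [integral_const_mul, integral_add j4 j3, integral_add j1 j2,
    integral_sub (i1.1.const_mul _) (i2.1.const_mul _), integral_sub (i3.1.const_mul _) (i4.1.const_mul _)]
  simp only [integral_const_mul]
  rw [i1.2, i2.2, i3.2, i4.2, hA.integral_kr_sub_kr hs' hs.ne']
  simp [hs]
  ring

theorem LipA.norm_kr_pow_le (hA : LipA A L) (hτ : 0 < τ) (ht : 0 < t) (x y : ℝ) :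
    ‖(t : ℂ) ^ 3 * kr A (2 * (t + τ / 2)) x y ^ 5‖ ≤ (2 + L) ^ 5 * (2 / τ) * pker (τ / 2) t := by
  have hL := hA.1
  have h : ‖kr A (2 * (t + τ / 2)) x y‖ ≤ (2 + L) / (t + τ / 2) := by
    refine (hA.norm_kr_le' (by positivity) x y).trans ?_
    rw [abs_of_pos (by positivity)]
    gcongr
    linarith
  rw [norm_mul, norm_pow, norm_pow, norm_real, norm_of_nonneg ht.le]
  unfold pker
  rw [abs_of_pos ht]
  calc _ ≤ (t + τ / 2) ^ 3 * ((2 + L) / (t + τ / 2)) ^ 5 := by gcongr; linarith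
    _ = _ := by
      have : t + τ / 2 ≠ 0 := by positivity
      rw [add_comm (τ / 2) t]
      field_simp

theorem lintegral_pker_Ioi_le (hs : 0 < s) : ∫⁻ t in Ioi 0, ofReal (pker s t) ≤ 16 := by
  refine (setLIntegral_le_lintegral _ _).trans ((lintegral_congr fun t => ?_).trans_le (lintegral_pker_le hs 0))
  rw [zero_sub]
  unfold pker; rw [abs_neg]

theorem LipA.lintegral_kr_pow_le (hA : LipA A L) (hτ : 0 < τ) (x y : ℝ) :
    ∫⁻ t in Ioi 0, ‖((t : ℝ) : ℂ) ^ 3 * kr A (2 * (t + τ / 2)) x y ^ 5‖ₑ ≤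
      ofReal ((2 + L) ^ 5 * (2 / τ)) * 16 := by
  have hL := hA.1
  calc _ ≤ ∫⁻ t in Ioi 0, ofReal ((2 + L) ^ 5 * (2 / τ)) * ofReal (pker (τ / 2) t) := by
        refine setLIntegral_mono' measurableSet_Ioi fun t ht => ?_
        rw [← ofReal_norm, ← ofReal_mul (by positivity)]
        exact ofReal_le_ofReal (hA.norm_kr_pow_le hτ ht x y)
    _ ≤ _ := by
        rw [lintegral_ofReal_mul]
        gcongr
        exact lintegral_pker_Ioi_le (by positivity)

theorem LipA.measurable_kr_pow (hA : LipA A L) (τ : ℝ) :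
    Measurable fun q : ℝ × ℝ × ℝ => (q.1 : ℂ) ^ 3 * kr A (2 * (q.1 + τ / 2)) q.2.1 q.2.2 ^ 5 := by
  have := hA.measurable_kr.comp (f := fun q : ℝ × ℝ × ℝ => (2 * (q.1 + τ / 2), q.2.1, q.2.2)) (by fun_prop)
  exact ((measurable_ofReal.comp measurable_fst).pow_const 3).mul (this.pow_const 5)

/-- Reproducing formula: the Cauchy kernel as an average of its fifth powers. -/
theorem LipA.kr_eq_integral (hA : LipA A L) (hτ : 0 < τ) (x y : ℝ) :
    kr A τ x y = 64 * ∫ t in Ioi 0, ((t : ℝ) : ℂ) ^ 3 * kr A (2 * (t + τ / 2)) x y ^ 5 := by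
  set W := zc A y - zc A x + τ * I with hW
  have hW0 : W ≠ 0 := hA.ne_zero x y hτ.ne'
  have e : ∀ t : ℝ, kr A (2 * (t + τ / 2)) x y = (2 * I * (t : ℂ) + W)⁻¹ := by
    intro t; unfold kr; rw [hW]; push_cast; ring_nf
  have hne : ∀ t : ℝ, 0 ≤ t → 2 * I * (t : ℂ) + W ≠ 0 := by
    intro t ht h
    refine hA.ne_zero x y (s := 2 * t + τ) (by positivity) ?_
    rw [← h, hW]; push_cast; ring
  have hd : ∀ t : ℝ, 0 ≤ t → HasDerivAt (fun t : ℝ => (4 * W)⁻¹ * ((t : ℂ) ^ 4 * ((2 * I * (t : ℂ) + W)⁻¹) ^ 4))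
      ((t : ℂ) ^ 3 * kr A (2 * (t + τ / 2)) x y ^ 5) t := by
    intro t ht
    have h0 := hne t ht
    have h1 : HasDerivAt (fun t : ℝ => 2 * I * (t : ℂ)) (2 * I * 1) t :=
      (ofRealCLM.hasDerivAt (x := t)).const_mul _
    have h2 := ((hasStrictDerivAt_inv_pow 4 h0).hasDerivAt).comp t h1
    have h3 : HasDerivAt (fun t : ℝ => (t : ℂ) ^ 4) (4 * (t : ℂ) ^ 3 * 1) t :=
      ((ofRealCLM.hasDerivAt (x := t)).pow 4).congr_deriv (by simp)
    refine ((h3.mul h2).const_mul (4 * W)⁻¹).congr_deriv ?_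
    rw [e]
    simp only [Function.comp]
    push_cast
    generalize hE : 2 * I * (t : ℂ) + W = E at *
    have : 2 * I * (t : ℂ) = E - W := by rw [← hE]; ring
    field_simp
    linear_combination (-(t : ℂ) ^ 3) * this
  have hi : IntegrableOn (fun t : ℝ => ((t : ℝ) : ℂ) ^ 3 * kr A (2 * (t + τ / 2)) x y ^ 5) (Ioi 0) := by
    refine ⟨((hA.measurable_kr_pow τ).comp (g := fun q : ℝ × ℝ × ℝ => (q.1 : ℂ) ^ 3 * kr A (2 * (q.1 + τ / 2)) q.2.1 q.2.2 ^ 5)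
      (f := fun t : ℝ => (t, x, y)) (by fun_prop)).aestronglyMeasurable, ?_⟩
    exact (hA.lintegral_kr_pow_le hτ x y).trans_lt (mul_lt_top ofReal_lt_top (by simp))
  have lim : Tendsto (fun t : ℝ => (4 * W)⁻¹ * ((t : ℂ) ^ 4 * ((2 * I * (t : ℂ) + W)⁻¹) ^ 4)) atTop
      (nhds ((4 * W)⁻¹ * ((2 * I + W * 0)⁻¹) ^ 4)) := by
    have h1 : Tendsto (fun t : ℝ => ((t⁻¹ : ℝ) : ℂ)) atTop (nhds 0) := by
      have := (Complex.continuous_ofReal.tendsto 0).comp tendsto_inv_atTop_zero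
      rw [ofReal_zero] at this
      exact this
    have h2 := ((((h1.const_mul W).const_add (2 * I)).inv₀ (by simp)).pow 4).const_mul (4 * W)⁻¹
    refine h2.congr' ?_
    filter_upwards [eventually_gt_atTop 0] with t ht
    have h3 := hne t ht.le
    have ht' : (t : ℂ) ≠ 0 := by exact_mod_cast ht.ne'
    rw [← mul_pow]
    congr 2
    rw [eq_mul_inv_iff_mul_eq₀ h3]
    push_cast
    rw [inv_mul_eq_iff_eq_mul₀]
    · field_simp
    · intro h
      apply h3
      have : (2 * I + W * (t : ℂ)⁻¹) * t = 0 := by rw [h, zero_mul]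
      rw [← this]; field_simp
  have := integral_Ioi_of_hasDerivAt_of_tendsto (hd 0 le_rfl).continuousAt.continuousWithinAt
    (fun t ht => hd t (le_of_lt ht)) hi lim
  rw [this]
  simp only [ofReal_zero, mul_zero, add_zero]
  have hk : kr A τ x y = W⁻¹ := rfl
  rw [hk, inv_pow, mul_pow, Complex.I_pow_four, mul_inv]
  ring

/-- The regularised Cauchy integral operator. -/
def Cr (A : ℝ → ℝ) (τ : ℝ) (f : ℝ → ℂ) (x : ℝ) : ℂ := ∫ y, kr A τ x y * f y

theorem conj_zc (A : ℝ → ℝ) (x : ℝ) : (starRingEnd ℂ) (zc A x) = zc (fun y => -A y) x := by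
  simp [zc]

theorem LipA.norm_integral_mul_th (g : ℝ → ℂ) (s u : ℝ) :
    ‖∫ x, g x * th A s x u‖ₑ = ‖thOp (fun y => -A y) s (fun x => (starRingEnd ℂ) (g x)) u‖ₑ := by
  have e : (starRingEnd ℂ) (∫ x, g x * th A s x u) =
      -thOp (fun y => -A y) s (fun x => (starRingEnd ℂ) (g x)) u := by
    unfold thOp
    rw [← integral_conj, ← integral_neg]
    refine integral_congr_ae (ae_of_all _ fun x => ?_)
    simp only [th, map_mul, map_pow, map_inv₀, map_add, map_sub, conj_zc, Complex.conj_ofReal, conj_I]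
    rw [show zc (fun y => -A y) u - zc (fun y => -A y) x + ↑s * -I =
      -(zc (fun y => -A y) x - zc (fun y => -A y) u + ↑s * I) by ring, inv_neg]
    ring
  rw [← enorm_neg (thOp _ _ _ _), ← e, ← ofReal_norm, ← ofReal_norm, norm_conj]

theorem LipA.measurable_th_mul_th (hA : LipA A L) (s : ℝ) : Measurable fun q : ℝ × ℝ × ℝ =>
    dz A q.1 * (th A s q.1 q.2.2 * th A s q.2.1 q.1) := by
  have h1 := hA.measurable_th.comp (f := fun q : ℝ × ℝ × ℝ => (s, q.1, q.2.2)) (by fun_prop)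
  have h2 := hA.measurable_th.comp (f := fun q : ℝ × ℝ × ℝ => (s, q.2.1, q.1)) (by fun_prop)
  exact ((measurable_dz A).comp measurable_fst).mul (h1.mul h2)

theorem LipA.lintegral_th_mul_th_le (hA : LipA A L) (hs : 0 < s) (x y : ℝ) :
    ∫⁻ u, ‖dz A u * (th A s u y * th A s x u)‖ₑ ≤ ofReal ((1 + L) * ((2 + L) ^ 3 * s⁻¹ * (2 + L) ^ 3)) * 16 := by
  have hL := hA.1
  calc _ ≤ ∫⁻ u, ofReal ((1 + L) * ((2 + L) ^ 3 * s⁻¹ * (2 + L) ^ 3)) * ofReal (pker s (x - u)) := by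
        refine lintegral_mono fun u => ?_
        rw [← ofReal_norm, ← ofReal_mul (by positivity)]
        refine ofReal_le_ofReal ?_
        rw [norm_mul, norm_mul]
        have h1 : ‖th A s u y‖ ≤ (2 + L) ^ 3 * s⁻¹ := by
          refine (hA.norm_th_le hs u y).trans ?_
          gcongr
          rw [div_le_iff₀ (by positivity)]
          calc s ^ 2 = s⁻¹ * s ^ 3 := by field_simp
            _ ≤ _ := by gcongr; linarith [abs_nonneg (u - y)]
        have h2 : ‖th A s x u‖ ≤ (2 + L) ^ 3 * pker s (x - u) := by
          refine (hA.norm_th_le hs x u).trans ?_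
          gcongr
          exact cube_le_pker hs _
        have := pker_nonneg hs (x - u)
        calc _ ≤ (1 + L) * (((2 + L) ^ 3 * s⁻¹) * ((2 + L) ^ 3 * pker s (x - u))) := by
              gcongr
              exact hA.norm_dz_le u
          _ = _ := by ring
    _ ≤ _ := by
        rw [lintegral_ofReal_mul]
        gcongr
        exact lintegral_pker_le hs x

theorem BC.prod (hf : BC f) (hg : BC g) :
    Measurable (fun q : ℝ × ℝ => g q.1 * f q.2) ∧ Integrable (fun q : ℝ × ℝ => g q.1 * f q.2) :=
  ⟨(hg.meas.comp measurable_fst).mul (hf.meas.comp measurable_snd), hg.integrable.mul_prod hf.integrable⟩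

theorem LipA.enorm_integral_kr_five (hA : LipA A L) (hs : 0 < s) (hf : BC f) (hg : BC g) :
    ofReal (s ^ 4) * ‖∫ q : ℝ × ℝ, kr A (2 * s) q.1 q.2 ^ 5 * (g q.1 * f q.2)‖ₑ ≤
      ofReal (1 + L) * ∫⁻ u, ‖thOp (fun y => -A y) s (fun x => (starRingEnd ℂ) (g x)) u‖ₑ *
        ‖thOp A s f u‖ₑ := by
  obtain ⟨mG, iG⟩ := hf.prod hg
  have i1 := integrable_prod_mul_of_lintegral_le (μ := (volume : Measure ℝ)) (hA.measurable_th_mul_th s) mG iG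
    (mul_ne_top ofReal_ne_top (by simp)) (fun q => hA.lintegral_th_mul_th_le hs q.1 q.2)
  have e1 : -(12 * π * I) * (s : ℂ) ^ 4 * ∫ q : ℝ × ℝ, kr A (2 * s) q.1 q.2 ^ 5 * (g q.1 * f q.2) =
      ∫ u, dz A u * ((∫ x, g x * th A s x u) * thOp A s f u) := by
    calc _ = ∫ q : ℝ × ℝ, ∫ u, dz A u * (th A s u q.2 * th A s q.1 u) * (g q.1 * f q.2) := by
          rw [← integral_const_mul]
          refine integral_congr_ae (ae_of_all _ fun q => ?_)
          simp only
          rw [integral_mul_const, hA.integral_th_mul_th hs]; ring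
      _ = ∫ u, ∫ q : ℝ × ℝ, dz A u * (th A s u q.2 * th A s q.1 u) * (g q.1 * f q.2) :=
          (integral_integral_swap (f := fun u (q : ℝ × ℝ) => dz A u * (th A s u q.2 * th A s q.1 u) * (g q.1 * f q.2)) i1).symm
      _ = _ := by
          refine integral_congr_ae (ae_of_all _ fun u => ?_)
          simp only
          unfold thOp
          rw [← integral_prod_mul, ← integral_const_mul, ← volume_eq_prod]
          refine integral_congr_ae (ae_of_all _ fun q => ?_)
          simp only; ring
  have e2 := congrArg (fun w => ‖w‖ₑ) e1
  simp only [enorm_mul] at e2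
  have e3 : ofReal (s ^ 4) ≤ ‖-(12 * π * I)‖ₑ * ‖(s : ℂ) ^ 4‖ₑ := by
    rw [← ofReal_norm, ← ofReal_norm, norm_pow, norm_real, norm_of_nonneg hs.le]
    refine le_mul_of_one_le_left' ?_
    rw [one_le_ofReal]
    simp [abs_of_pos pi_pos]
    linarith [Real.pi_gt_three]
  calc _ ≤ ‖-(12 * π * I)‖ₑ * ‖(s : ℂ) ^ 4‖ₑ * ‖∫ q : ℝ × ℝ, kr A (2 * s) q.1 q.2 ^ 5 * (g q.1 * f q.2)‖ₑ :=
        mul_le_mul_left e3 _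
    _ ≤ ∫⁻ u, ‖dz A u * ((∫ x, g x * th A s x u) * thOp A s f u)‖ₑ := by
        rw [e2]; exact enorm_integral_le_lintegral_enorm _
    _ ≤ ∫⁻ u, ofReal (1 + L) * (‖thOp (fun y => -A y) s (fun x => (starRingEnd ℂ) (g x)) u‖ₑ *
        ‖thOp A s f u‖ₑ) := by
        refine lintegral_mono fun u => ?_
        rw [enorm_mul, enorm_mul, LipA.norm_integral_mul_th]
        gcongr
        rw [← ofReal_norm]
        exact ofReal_le_ofReal (hA.norm_dz_le u)
    _ = _ := lintegral_ofReal_mul _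

theorem LipA.lintegral_thOp_mul_thOp (hA : LipA A L) : ∃ K ≠ ⊤, ∀ f g : ℝ → ℂ, BC f → BC g →
    ∫⁻ s in Ioi 0, ∫⁻ u, ofReal s⁻¹ * (‖thOp (fun y => -A y) s (fun x => (starRingEnd ℂ) (g x)) u‖ₑ *
      ‖thOp A s f u‖ₑ) ≤ K * (∫⁻ x, ‖f x‖ₑ ^ (2 : ℝ)) + K * ∫⁻ x, ‖g x‖ₑ ^ (2 : ℝ) := by
  obtain ⟨K₁, hK₁, hb₁⟩ := hA.lintegral_thOp_sq
  obtain ⟨K₂, hK₂, hb₂⟩ := hA.neg.lintegral_thOp_sq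
  refine ⟨K₁ + K₂, add_ne_top.2 ⟨hK₁, hK₂⟩, fun f g hf hg => ?_⟩
  have mf := hA.measurable_thOp hf.meas
  have m0 : Measurable fun q : ℝ × ℝ => ofReal q.1⁻¹ * ‖thOp A q.1 f q.2‖ₑ ^ (2 : ℝ) := by fun_prop
  have m1 : Measurable fun s => ∫⁻ u, ofReal s⁻¹ * ‖thOp A s f u‖ₑ ^ (2 : ℝ) :=
    m0.lintegral_prod_right'
  have m2 : ∀ s, Measurable fun u => ofReal s⁻¹ * ‖thOp A s f u‖ₑ ^ (2 : ℝ) := fun s =>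
    m0.comp (measurable_prodMk_left (x := s))
  calc _ ≤ ∫⁻ s in Ioi 0, ((∫⁻ u, ofReal s⁻¹ * ‖thOp A s f u‖ₑ ^ (2 : ℝ)) +
          ∫⁻ u, ofReal s⁻¹ * ‖thOp (fun y => -A y) s (fun x => (starRingEnd ℂ) (g x)) u‖ₑ ^ (2 : ℝ)) := by
        refine lintegral_mono fun s => ?_
        rw [← lintegral_add_left (m2 s)]
        refine lintegral_mono fun u => ?_
        rw [← mul_add]
        refine mul_le_mul_right ?_ _
        rw [mul_comm]
        refine (ENNReal.mul_le_add_sq _ _).trans (le_of_eq ?_)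
        norm_cast
    _ = (∫⁻ s in Ioi 0, ∫⁻ u, ofReal s⁻¹ * ‖thOp A s f u‖ₑ ^ (2 : ℝ)) +
          ∫⁻ s in Ioi 0, ∫⁻ u, ofReal s⁻¹ *
            ‖thOp (fun y => -A y) s (fun x => (starRingEnd ℂ) (g x)) u‖ₑ ^ (2 : ℝ) :=
        lintegral_add_left m1 _
    _ ≤ K₁ * (∫⁻ x, ‖f x‖ₑ ^ (2 : ℝ)) + K₂ * ∫⁻ x, ‖g x‖ₑ ^ (2 : ℝ) := by
        refine add_le_add (hb₁ f hf) ((hb₂ _ hg.conj).trans (le_of_eq ?_))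
        congr 2
        funext x
        rw [← ofReal_norm, ← ofReal_norm, norm_conj]
    _ ≤ _ := add_le_add (mul_le_mul_left le_self_add _) (mul_le_mul_left le_add_self _)

theorem LipA.bilinear_bound_pos (hA : LipA A L) : ∃ K ≠ ⊤, ∀ τ > 0, ∀ f g : ℝ → ℂ, BC f → BC g →
    ‖∫ q : ℝ × ℝ, kr A τ q.1 q.2 * (g q.1 * f q.2)‖ₑ ≤ K * (∫⁻ x, ‖f x‖ₑ ^ (2 : ℝ)) + K * ∫⁻ x, ‖g x‖ₑ ^ (2 : ℝ) := by
  obtain ⟨K, hK, hb⟩ := hA.lintegral_thOp_mul_thOp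
  refine ⟨64 * (ofReal (1 + L) * K), mul_ne_top (by simp)
    (mul_ne_top ofReal_ne_top hK), fun τ hτ f g hf hg => ?_⟩
  obtain ⟨mG, iG⟩ := hf.prod hg
  have i1 := integrable_prod_mul_of_lintegral_le (μ := (volume : Measure ℝ).restrict (Ioi 0)) (hA.measurable_kr_pow τ) mG iG
    (mul_ne_top ofReal_ne_top (by simp)) (fun q => hA.lintegral_kr_pow_le hτ q.1 q.2)
  have e1 : ∫ q : ℝ × ℝ, kr A τ q.1 q.2 * (g q.1 * f q.2) = 64 * ∫ t in Ioi 0, ((t : ℝ) : ℂ) ^ 3 *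
      ∫ q : ℝ × ℝ, kr A (2 * (t + τ / 2)) q.1 q.2 ^ 5 * (g q.1 * f q.2) := by
    calc _ = ∫ q : ℝ × ℝ, 64 * ∫ t in Ioi 0, ((t : ℝ) : ℂ) ^ 3 * kr A (2 * (t + τ / 2)) q.1 q.2 ^ 5 * (g q.1 * f q.2) := by
          refine integral_congr_ae (ae_of_all _ fun q => ?_)
          simp only
          rw [integral_mul_const, hA.kr_eq_integral hτ]; ring
      _ = 64 * ∫ t in Ioi 0, ∫ q : ℝ × ℝ, ((t : ℝ) : ℂ) ^ 3 * kr A (2 * (t + τ / 2)) q.1 q.2 ^ 5 * (g q.1 * f q.2) := by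
          rw [integral_const_mul]
          congr 1
          exact (integral_integral_swap (f := fun (t : ℝ) (q : ℝ × ℝ) => ((t : ℝ) : ℂ) ^ 3 * kr A (2 * (t + τ / 2)) q.1 q.2 ^ 5 * (g q.1 * f q.2)) i1).symm
      _ = _ := by
          congr 1
          refine integral_congr_ae (ae_of_all _ fun t => ?_)
          simp only
          rw [← integral_const_mul]
          simp only [mul_assoc]
  set H : ℝ → ℝ≥0∞ := fun s => ofReal s⁻¹ * (ofReal (1 + L) *
    ∫⁻ u, ‖thOp (fun y => -A y) s (fun x => (starRingEnd ℂ) (g x)) u‖ₑ * ‖thOp A s f u‖ₑ) with hH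
  have step : ∀ t > 0, ‖((t : ℝ) : ℂ) ^ 3 *
      ∫ q : ℝ × ℝ, kr A (2 * (t + τ / 2)) q.1 q.2 ^ 5 * (g q.1 * f q.2)‖ₑ ≤ H (t + τ / 2) := by
    intro t ht
    have hs : 0 < t + τ / 2 := by positivity
    refine le_trans ?_ (mul_le_mul_right (hA.enorm_integral_kr_five hs hf hg) (ofReal (t + τ / 2)⁻¹))
    rw [enorm_mul, ← mul_assoc, ← ofReal_mul (by positivity)]
    gcongr
    rw [← ofReal_norm, norm_pow, norm_real, norm_of_nonneg ht.le]
    apply ofReal_le_ofReal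
    calc t ^ 3 ≤ (t + τ / 2) ^ 3 := by gcongr; linarith
      _ = _ := by field_simp
  have sub : ∫⁻ t in Ioi 0, H (t + τ / 2) ≤ ∫⁻ s in Ioi 0, H s := by
    rw [← lintegral_indicator measurableSet_Ioi, ← lintegral_indicator measurableSet_Ioi,
      ← lintegral_add_right_eq_self ((Ioi 0).indicator H) (τ / 2)]
    refine lintegral_mono fun t => ?_
    by_cases ht : 0 < t
    · have h2 : t + τ / 2 ∈ Ioi (0 : ℝ) := by have : 0 < t + τ / 2 := by positivity
                                              exact this
      rw [indicator_of_mem (show t ∈ Ioi 0 from ht), indicator_of_mem h2]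
    · rw [indicator_of_notMem (show t ∉ Ioi 0 from ht)]; exact bot_le
  have hsum : ∫⁻ s in Ioi 0, H s ≤ ofReal (1 + L) *
      (K * (∫⁻ x, ‖f x‖ₑ ^ (2 : ℝ)) + K * ∫⁻ x, ‖g x‖ₑ ^ (2 : ℝ)) := by
    refine le_trans (le_of_eq ?_) (mul_le_mul_right (hb f g hf hg) _)
    rw [← lintegral_ofReal_mul]
    refine lintegral_congr fun s => ?_
    rw [hH, lintegral_ofReal_mul]
    ring
  calc _ ≤ 64 * ∫⁻ t in Ioi 0, H (t + τ / 2) := by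
        rw [e1, enorm_mul]
        refine mul_le_mul' (by rw [← ofReal_norm]; simp) ?_
        refine (enorm_integral_le_lintegral_enorm _).trans ?_
        exact setLIntegral_mono' measurableSet_Ioi fun t ht => step t ht
    _ ≤ 64 * (ofReal (1 + L) * (K * (∫⁻ x, ‖f x‖ₑ ^ (2 : ℝ)) + K * ∫⁻ x, ‖g x‖ₑ ^ (2 : ℝ))) :=
        mul_le_mul_right (sub.trans hsum) _
    _ = _ := by ring

theorem measurable_fix_left {G : ℝ → ℝ → ℂ} (h : Measurable fun q : ℝ × ℝ => G q.1 q.2) (t : ℝ) :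
    Measurable (G t) := h.comp measurable_prodMk_left

theorem lintegral_le_of_forall_Icc {f : ℝ → ℝ≥0∞} {C : ℝ≥0∞}
    (h : ∀ n : ℕ, ∫⁻ x in Icc (-(n : ℝ)) n, f x ≤ C) : ∫⁻ x, f x ≤ C := by
  have hU : (⋃ n : ℕ, Icc (-(n : ℝ)) n) = univ := by
    refine eq_univ_of_forall fun x => ?_
    obtain ⟨n, hn⟩ := exists_nat_ge |x|
    exact mem_iUnion.2 ⟨n, abs_le.1 hn⟩
  have hm : Monotone fun n : ℕ => Icc (-(n : ℝ)) n := by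
    intro m n hmn
    have : (m : ℝ) ≤ n := by exact_mod_cast hmn
    exact Icc_subset_Icc (by linarith) this
  rw [← setLIntegral_univ, ← hU, setLIntegral_iUnion_of_directed _ hm.directed_le]
  exact iSup_le h

theorem kr_symm (A : ℝ → ℝ) (τ x y : ℝ) : kr A τ x y = -kr A (-τ) y x := by
  unfold kr
  rw [← inv_neg]
  push_cast
  ring_nf

theorem LipA.integrable_kr_mul (hA : LipA A L) (hτ : τ ≠ 0) (hf : Integrable f) (x : ℝ) :
    Integrable fun y => kr A τ x y * f y :=
  hf.bdd_mul (c := (2 + L) / |τ|) (hA.measurable_kr_right τ x).aestronglyMeasurable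
    (ae_of_all _ fun y => hA.norm_kr_le' hτ x y)

theorem LipA.measurable_Cr (hA : LipA A L) (hf : Measurable f) :
    Measurable fun q : ℝ × ℝ => Cr A q.1 f q.2 := by
  have h : Measurable fun q : (ℝ × ℝ) × ℝ => kr A q.1.1 q.1.2 q.2 * f q.2 :=
    (hA.measurable_kr.comp (f := fun q : (ℝ × ℝ) × ℝ => (q.1.1, q.1.2, q.2)) (by fun_prop)).mul
      (hf.comp measurable_snd)
  exact h.stronglyMeasurable.integral_prod_right'.measurable

theorem LipA.measurable_Cr_right (hA : LipA A L) (hf : Measurable f) (τ : ℝ) :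
    Measurable (Cr A τ f) := measurable_fix_left (G := fun τ x => Cr A τ f x) (hA.measurable_Cr hf) τ

theorem LipA.norm_Cr_le (hA : LipA A L) (hτ : τ ≠ 0) (hf : Integrable f) (x : ℝ) :
    ‖Cr A τ f x‖ ≤ (2 + L) / |τ| * ∫ y, ‖f y‖ := by
  have := hA.1
  unfold Cr
  rw [← integral_const_mul]
  refine norm_integral_le_of_norm_le (hf.norm.const_mul _) (ae_of_all _ fun y => ?_)
  rw [norm_mul]
  gcongr
  exact hA.norm_kr_le' hτ x y

theorem LipA.integrable_kr_prod (hA : LipA A L) (hτ : τ ≠ 0) {G : ℝ × ℝ → ℂ} (hG : Integrable G) :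
    Integrable fun q : ℝ × ℝ => kr A τ q.1 q.2 * G q :=
  hG.bdd_mul (c := (2 + L) / |τ|) (hA.measurable_kr.comp (f := fun q : ℝ × ℝ => (τ, q.1, q.2))
    (by fun_prop)).aestronglyMeasurable (ae_of_all _ fun q => hA.norm_kr_le' hτ q.1 q.2)

theorem LipA.integral_mul_Cr (hA : LipA A L) (hτ : τ ≠ 0) (hf : Integrable f)
    (hg : Integrable g) :
    ∫ x, g x * Cr A τ f x = ∫ q : ℝ × ℝ, kr A τ q.1 q.2 * (g q.1 * f q.2) := by
  rw [volume_eq_prod, integral_prod _ (hA.integrable_kr_prod hτ (hg.mul_prod hf))]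
  refine integral_congr_ae (ae_of_all _ fun x => ?_)
  simp only [Cr]
  rw [← integral_const_mul]
  refine integral_congr_ae (ae_of_all _ fun y => ?_)
  simp only; ring

theorem LipA.integral_mul_Cr_eq_neg (hA : LipA A L) (hτ : τ ≠ 0) (hf : Integrable f)
    (hg : Integrable g) :
    ∫ x, g x * Cr A τ f x = -∫ x, f x * Cr A (-τ) g x := by
  rw [hA.integral_mul_Cr hτ hf hg, hA.integral_mul_Cr (neg_ne_zero.2 hτ) hg hf, ← integral_neg,
    volume_eq_prod, ← integral_prod_swap]
  refine integral_congr_ae (ae_of_all _ fun q => ?_)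
  simp only [Prod.fst_swap, Prod.snd_swap]
  rw [kr_symm]; ring

theorem LipA.bilinear_bound (hA : LipA A L) : ∃ k > 0, ∀ τ ≠ 0, ∀ f g : ℝ → ℂ, BC f → BC g →
    ‖∫ x, g x * Cr A τ f x‖ₑ ≤
      ofReal k * (∫⁻ x, ‖f x‖ₑ ^ (2 : ℝ)) + ofReal k * ∫⁻ x, ‖g x‖ₑ ^ (2 : ℝ) := by
  obtain ⟨K, hK, hb⟩ := hA.bilinear_bound_pos
  refine ⟨K.toReal + 1, by positivity, fun τ hτ f g hf hg => ?_⟩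
  have hKk : K ≤ ofReal (K.toReal + 1) := by
    rw [← ofReal_toReal hK, toReal_ofReal toReal_nonneg]
    exact ofReal_le_ofReal (by linarith)
  refine le_trans ?_ (add_le_add (mul_le_mul_left hKk _) (mul_le_mul_left hKk _))
  rcases lt_or_gt_of_ne hτ with h | h
  · rw [hA.integral_mul_Cr_eq_neg hτ hf.integrable hg.integrable, enorm_neg,
      hA.integral_mul_Cr (neg_ne_zero.2 hτ) hg.integrable hf.integrable, add_comm]
    exact hb _ (by linarith) g f hg hf
  · rw [hA.integral_mul_Cr hτ hf.integrable hg.integrable]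
    exact hb _ h f g hf hg

theorem LipA.lintegral_Cr_sq (hA : LipA A L) : ∃ K ≠ ⊤, ∀ τ ≠ 0, ∀ f, BC f →
    ∫⁻ x, ‖Cr A τ f x‖ₑ ^ (2 : ℝ) ≤ K * ∫⁻ x, ‖f x‖ₑ ^ (2 : ℝ) := by
  obtain ⟨k, hk, hb⟩ := hA.bilinear_bound
  refine ⟨ofReal (4 * k ^ 2), ofReal_ne_top, fun τ hτ f hf => lintegral_le_of_forall_Icc fun n => ?_⟩
  set I := ∫⁻ x in Icc (-(n : ℝ)) n, ‖Cr A τ f x‖ₑ ^ (2 : ℝ) with hI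
  set e : ℝ := (2 * k)⁻¹ with he
  have he0 : 0 < e := by positivity
  have hm := hA.measurable_Cr_right hf.meas τ
  have hg0 : BC ((Icc (-(n : ℝ)) n).indicator fun x => (e : ℂ) * (starRingEnd ℂ) (Cr A τ f x)) := by
    refine ⟨(measurable_const.mul (continuous_conj.measurable.comp hm)).indicator measurableSet_Icc,
      ⟨e * ((2 + L) / |τ| * ∫ y, ‖f y‖), fun x => (norm_indicator_le_norm_self _ _).trans ?_⟩,
      ⟨n, fun x hx => indicator_of_notMem (fun h => ?_) _⟩⟩
    · rw [norm_mul, norm_conj, norm_real, norm_of_nonneg he0.le]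
      gcongr
      exact hA.norm_Cr_le hτ hf.integrable x
    · exact absurd (abs_le.2 h) (not_le.2 hx)
  set g := (Icc (-(n : ℝ)) n).indicator fun x => (e : ℂ) * (starRingEnd ℂ) (Cr A τ f x) with hg
  have h1 : ∀ x, g x * Cr A τ f x = (((Icc (-(n : ℝ)) n).indicator (fun x => e * ‖Cr A τ f x‖ ^ 2) x : ℝ) : ℂ) := by
    intro x
    by_cases h : x ∈ Icc (-(n : ℝ)) n
    · simp only [hg, indicator_of_mem h]
      rw [mul_assoc, Complex.conj_mul']
      push_cast; ring
    · simp [hg, indicator_of_notMem h]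
  have hsq : ∀ x, ofReal (e * ‖Cr A τ f x‖ ^ 2) = ofReal e * ‖Cr A τ f x‖ₑ ^ (2 : ℝ) := by
    intro x
    rw [ofReal_mul he0.le, ofReal_pow (norm_nonneg _), ofReal_norm]
    norm_cast
  have h2 : ‖∫ x, g x * Cr A τ f x‖ₑ = ofReal e * I := by
    simp only [h1]
    rw [integral_complex_ofReal, ← ofReal_norm, norm_real, norm_of_nonneg
      (integral_nonneg fun x => indicator_nonneg (fun _ _ => by positivity) _),
      integral_indicator measurableSet_Icc, ofReal_integral_eq_lintegral_ofReal]
    · simp only [hsq]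
      rw [lintegral_ofReal_mul]
    · refine Measure.integrableOn_of_bounded (M := e * ((2 + L) / |τ| * ∫ y, ‖f y‖) ^ 2) (by simp)
        (((hm.norm).pow_const 2).const_mul e).aestronglyMeasurable (ae_of_all _ fun x => ?_)
      rw [norm_of_nonneg (by positivity)]
      gcongr
      exact hA.norm_Cr_le hτ hf.integrable x
    · exact ae_of_all _ fun x => by positivity
  have h3 : ∫⁻ x, ‖g x‖ₑ ^ (2 : ℝ) = ofReal (e ^ 2) * I := by
    rw [hI, ← lintegral_ofReal_mul, ← lintegral_indicator measurableSet_Icc]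
    refine lintegral_congr fun x => ?_
    by_cases h : x ∈ Icc (-(n : ℝ)) n
    · simp only [hg, indicator_of_mem h]
      rw [enorm_mul, mul_rpow_of_nonneg _ _ (by norm_num), ← ofReal_norm (_ : ℂ), norm_real,
        norm_of_nonneg he0.le, ENNReal.ofReal_rpow_of_pos he0, ← ofReal_norm ((starRingEnd ℂ) _),
        norm_conj, ofReal_norm]
      norm_num
    · simp [hg, indicator_of_notMem h]
  have hfin : I ≠ ⊤ := by
    have h4 : ofReal e * I ≠ ⊤ := by rw [← h2]; exact enorm_ne_top
    intro h
    rw [h, mul_top (by simpa using he0)] at h4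
    exact h4 rfl
  have h5 := hb τ hτ f g hf hg0
  rw [h2, h3, ← mul_assoc, ← ofReal_mul hk.le] at h5
  have e1 : k * e ^ 2 = e / 2 := by rw [he]; field_simp
  have e2 : ofReal e = ofReal (e / 2) + ofReal (e / 2) := by
    rw [← ofReal_add (by positivity) (by positivity)]; congr 1; ring
  rw [e1, e2, add_mul] at h5
  have h6 := (ENNReal.add_le_add_iff_right (mul_ne_top ofReal_ne_top hfin)).1 h5
  calc I = ofReal (4 * k) * (ofReal (e / 2) * I) := by
        rw [← mul_assoc, ← ofReal_mul (by positivity), he,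
          show 4 * k * ((2 * k)⁻¹ / 2) = 1 by field_simp; norm_num]
        simp
    _ ≤ ofReal (4 * k) * (ofReal k * ∫⁻ x, ‖f x‖ₑ ^ (2 : ℝ)) := by gcongr
    _ = _ := by
        rw [← mul_assoc, ← ofReal_mul (by positivity)]
        congr 2; ring

/-- The index of the dyadic subinterval of generation `n` of `[a, a + l)` containing `x`. -/
def dyIdx (a l : ℝ) (n : ℕ) (x : ℝ) : ℤ := ⌊(x - a) / l * 2 ^ n⌋

/-- The `k`-th dyadic subinterval of generation `n` of `[a, a + l)`. -/
def dyCell (a l : ℝ) (n : ℕ) (k : ℤ) : Set ℝ :=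
  Ico (a + l * k / 2 ^ n) (a + l * k / 2 ^ n + l / 2 ^ n)

/-- The dyadic maximal function relative to `[a, a + l)`. -/
def dyMax (a l : ℝ) (h : ℝ → ℝ≥0∞) (x : ℝ) : ℝ≥0∞ :=
  ⨆ n : ℕ, (∫⁻ y in dyCell a l n (dyIdx a l n x), h y) / ofReal (l / 2 ^ n)

theorem mem_dyCell (hl : 0 < l) {k : ℤ} : y ∈ dyCell a l n k ↔ dyIdx a l n y = k := by
  have h2 : (0 : ℝ) < 2 ^ n := by positivity
  unfold dyCell dyIdx
  rw [Int.floor_eq_iff, mem_Ico]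
  have e : (y - a) / l * 2 ^ n = (y - a) / (l / 2 ^ n) := by field_simp
  rw [e, le_div_iff₀ (by positivity), div_lt_iff₀ (by positivity)]
  constructor
  · rintro ⟨h, h'⟩
    constructor <;> · ring_nf at h h' ⊢; linarith
  · rintro ⟨h, h'⟩
    constructor <;> · ring_nf at h h' ⊢; linarith

theorem dyIdx_of_succ (h : dyIdx a l (n + 1) x = dyIdx a l (n + 1) y) :
    dyIdx a l n x = dyIdx a l n y := by
  unfold dyIdx at *
  have key : ∀ s : ℝ, ⌊s * 2 ^ n⌋ = ⌊s * 2 ^ (n + 1)⌋ / 2 := by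
    intro s
    have h1 := Int.floor_le (s * 2 ^ n)
    have h2 := Int.lt_floor_add_one (s * 2 ^ n)
    have h3 : 2 * ⌊s * 2 ^ n⌋ ≤ ⌊s * 2 ^ (n + 1)⌋ := by
      rw [Int.le_floor]; push_cast; rw [pow_succ]; linarith
    have h4 : ⌊s * 2 ^ (n + 1)⌋ < 2 * ⌊s * 2 ^ n⌋ + 2 := by
      rw [Int.floor_lt]; push_cast; rw [pow_succ]; linarith
    omega
  rw [key, key, h]

theorem dyIdx_of_le {m : ℕ} (hmn : m ≤ n) (h : dyIdx a l n x = dyIdx a l n y) :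
    dyIdx a l m x = dyIdx a l m y := by
  induction n, hmn using Nat.le_induction with
  | base => exact h
  | succ n _ ih => exact ih (dyIdx_of_succ h)

theorem dyCell_zero : dyCell a l 0 0 = Ico a (a + l) := by simp [dyCell]

theorem dyIdx_zero (hl : 0 < l) : dyIdx a l 0 x = 0 ↔ x ∈ Ico a (a + l) := by
  rw [← mem_dyCell hl, dyCell_zero]

theorem dyCell_subset (hl : 0 < l) (hx : x ∈ Ico a (a + l)) :
    dyCell a l n (dyIdx a l n x) ⊆ Ico a (a + l) := by
  intro y hy
  rw [mem_dyCell hl] at hy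
  rw [← dyIdx_zero hl] at hx ⊢
  rw [← hx]
  exact dyIdx_of_le (Nat.zero_le n) hy

theorem volume_dyCell (n : ℕ) (k : ℤ) : volume (dyCell a l n k) = ofReal (l / 2 ^ n) := by
  rw [dyCell, volume_Ico]; congr 1; ring

theorem measurableSet_dyCell (n : ℕ) (k : ℤ) : MeasurableSet (dyCell a l n k) := measurableSet_Ico

theorem measurable_dyIdx (n : ℕ) : Measurable (dyIdx a l n) := by
  unfold dyIdx; fun_prop

theorem lt_dyMax_iff (hl : 0 < l) {h : ℝ → ℝ≥0∞} {t : ℝ≥0∞} : t < dyMax a l h x ↔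
      ∃ n, t * ofReal (l / 2 ^ n) < ∫⁻ y in dyCell a l n (dyIdx a l n x), h y := by
  unfold dyMax
  rw [lt_iSup_iff]
  refine exists_congr fun n => ?_
  have : 0 < l / 2 ^ n := by positivity
  exact lt_div_iff_mul_lt (.inl (by simpa using this)) (.inl ofReal_ne_top)

theorem measurable_dyMax (h : ℝ → ℝ≥0∞) : Measurable (dyMax a l h) := by
  refine Measurable.iSup fun n => ?_
  exact (measurable_from_top (f := fun k : ℤ =>
    (∫⁻ y in dyCell a l n k, h y) / ofReal (l / 2 ^ n))).comp (measurable_dyIdx n)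

/-- On every subinterval of `[a, a + l)` the mean oscillation of `F` is at most the infimum
of `G` there. -/
def OscLe (a l : ℝ) (F : ℝ → ℂ) (G : ℝ → ℝ≥0∞) : Prop :=
  ∀ u v : ℝ, u < v → Ico u v ⊆ Ico a (a + l) → ∃ c : ℂ, ∀ x ∈ Ico u v,
    ∫⁻ y in Ico u v, ‖F y - c‖ₑ ≤ ofReal (v - u) * G x

theorem good_lambda_cell (hl : 0 < l) (hF : Measurable F) (H : OscLe a l F G)
    {c₀ : ℂ} (h₀ : ∀ x ∈ Ico a (a + l), ∫⁻ y in Ico a (a + l), ‖F y - c₀‖ₑ ≤ ofReal l * G x)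
    (ht : 0 < t) (hγ : 0 < γ) (hγ1 : γ ≤ 1) {x₀ : ℝ} (hx₀ : x₀ ∈ Ico a (a + l))
    (hn : ofReal t * ofReal (l / 2 ^ n) <
      ∫⁻ y in dyCell a l n (dyIdx a l n x₀), ‖F y - c₀‖ₑ)
    (hm : ∀ m < n, ∫⁻ y in dyCell a l m (dyIdx a l m x₀), ‖F y - c₀‖ₑ ≤
      ofReal t * ofReal (l / 2 ^ m)) :
    volume ({y | ofReal (3 * t) < dyMax a l (fun y => ‖F y - c₀‖ₑ) y ∧
      G y ≤ ofReal (γ * t)} ∩ dyCell a l n (dyIdx a l n x₀)) ≤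
      ofReal (16 * γ) * volume (dyCell a l n (dyIdx a l n x₀)) := by
  rcases eq_empty_or_nonempty ({y | ofReal (3 * t) < dyMax a l (fun y => ‖F y - c₀‖ₑ) y ∧
      G y ≤ ofReal (γ * t)} ∩ dyCell a l n (dyIdx a l n x₀)) with he | ⟨y₀, hy₀, hy₀'⟩
  · rw [he]; simp
  have hG₀ : G y₀ ≤ ofReal (γ * t) := hy₀.2
  rcases n with _ | m
  · exfalso
    rw [(dyIdx_zero hl).2 hx₀, dyCell_zero] at hn hy₀'
    refine absurd hn (not_lt.2 ((h₀ y₀ hy₀').trans ?_))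
    rw [mul_comm]
    simp only [pow_zero, div_one]
    gcongr
    exact hG₀.trans (ofReal_le_ofReal (by nlinarith))
  set Q := dyCell a l m (dyIdx a l m x₀) with hQ
  have hr : 0 < l / 2 ^ m := by positivity
  obtain ⟨c, hc⟩ := H _ _ (by linarith) (dyCell_subset hl (n := m) hx₀)
  change ∀ x ∈ Q, ∫⁻ y in Q, ‖F y - c‖ₑ ≤ _ at hc
  rw [show ∀ u : ℝ, u + l / 2 ^ m - u = l / 2 ^ m by intro u; ring] at hc
  have hy₀Q : y₀ ∈ Q := by
    rw [mem_dyCell hl] at hy₀' ⊢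
    exact dyIdx_of_succ hy₀'
  have hQc : ∫⁻ y in Q, ‖F y - c‖ₑ ≤ ofReal (l / 2 ^ m) * ofReal (γ * t) :=
    (hc y₀ hy₀Q).trans (by gcongr)
  have hd : ‖c - c₀‖ₑ ≤ ofReal (2 * t) := by
    have h1 : ∫⁻ y in Q, ‖c - c₀‖ₑ ≤ ∫⁻ y in Q, (‖F y - c‖ₑ + ‖F y - c₀‖ₑ) := by
      refine lintegral_mono fun y => ?_
      have : c - c₀ = (F y - c₀) - (F y - c) := by ring
      rw [this, add_comm]
      exact enorm_sub_le
    rw [lintegral_const, restrict_apply_univ, volume_dyCell, lintegral_add_left (by fun_prop)] at h1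
    have h2 := h1.trans (add_le_add hQc (hm m (Nat.lt_succ_self m)))
    rw [mul_comm (ofReal t), ← mul_add, mul_comm] at h2
    rw [mul_le_mul_iff_right (by simpa using hr) ofReal_ne_top,
      ← ofReal_add (by positivity) ht.le] at h2
    exact h2.trans (ofReal_le_ofReal (by nlinarith))
  have hQm : MeasurableSet Q := measurableSet_dyCell _ _
  set g : ℝ → ℝ≥0∞ := Q.indicator fun y => ‖F y - c‖ₑ with hg
  have hgm : Measurable g := Measurable.indicator (by fun_prop) hQm
  have hgi : ∫⁻ y, g y ≤ ofReal (l / 2 ^ m) * ofReal (γ * t) := by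
    rw [hg, lintegral_indicator hQm]; exact hQc
  have hsub : ({y | ofReal (3 * t) < dyMax a l (fun y => ‖F y - c₀‖ₑ) y ∧
      G y ≤ ofReal (γ * t)} ∩ dyCell a l (m + 1) (dyIdx a l (m + 1) x₀)) ⊆
      {y | ofReal (t / 2) < hlMax g y} := by
    rintro y ⟨⟨hy, -⟩, hyc⟩
    rw [lt_dyMax_iff hl] at hy
    obtain ⟨j, hj⟩ := hy
    rw [mem_dyCell hl] at hyc
    have hmj : m ≤ j := by
      by_contra hcon
      have hjm : j < m + 1 := by omega
      rw [dyIdx_of_le hjm.le hyc] at hj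
      refine absurd hj (not_lt.2 ((hm j hjm).trans ?_))
      gcongr; linarith
    have hs : 0 < l / 2 ^ j := by positivity
    have hsubQ : dyCell a l j (dyIdx a l j y) ⊆ Q := by
      intro z hz
      rw [mem_dyCell hl] at hz ⊢
      exact (dyIdx_of_le hmj hz).trans (dyIdx_of_succ hyc)
    have hball : dyCell a l j (dyIdx a l j y) ⊆ ball y (l / 2 ^ j) := by
      have hy' : y ∈ dyCell a l j (dyIdx a l j y) := (mem_dyCell hl).2 rfl
      intro z hz
      rw [ball_eq_Ioo]
      exact ⟨by linarith [hz.1, hy'.2], by linarith [hz.2, hy'.1]⟩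
    have h1 : ∫⁻ z in dyCell a l j (dyIdx a l j y), ‖F z - c₀‖ₑ ≤
        (∫⁻ z in ball y (l / 2 ^ j), g z) + ofReal (2 * t) * ofReal (l / 2 ^ j) := by
      calc _ ≤ ∫⁻ z in dyCell a l j (dyIdx a l j y), (g z + ‖c - c₀‖ₑ) := by
            refine setLIntegral_mono' (measurableSet_dyCell _ _) fun z hz => ?_
            rw [hg, indicator_of_mem (hsubQ hz)]
            have : F z - c₀ = (F z - c) + (c - c₀) := by ring
            rw [this]
            exact enorm_add_le _ _
        _ = (∫⁻ z in dyCell a l j (dyIdx a l j y), g z) + ‖c - c₀‖ₑ * ofReal (l / 2 ^ j) := by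
            rw [lintegral_add_left hgm, lintegral_const, restrict_apply_univ, volume_dyCell]
        _ ≤ _ := by
            refine add_le_add (lintegral_mono_set hball) ?_
            gcongr
    have h2 := hj.trans_le h1
    have e3 : ofReal (3 * t) = ofReal t + ofReal (2 * t) := by
      rw [← ofReal_add ht.le (by positivity)]; congr 1; ring
    rw [e3, add_mul] at h2
    have h3 := lt_of_add_lt_add_right h2
    simp only [mem_ofPred_eq]
    rw [lt_hlMax_iff]
    refine ⟨_, hs, ?_⟩
    rw [← ofReal_mul (by positivity)] at h3 ⊢
    convert h3 using 2; ring
  have h5 := volume_hlMax_gt_le (g := g) (half_pos ht)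
  have h6 : ofReal (t / 2) * volume ({y | ofReal (3 * t) <
      dyMax a l (fun y => ‖F y - c₀‖ₑ) y ∧
      G y ≤ ofReal (γ * t)} ∩ dyCell a l (m + 1) (dyIdx a l (m + 1) x₀)) ≤
      ofReal (t / 2) * (ofReal (16 * γ) * volume (dyCell a l (m + 1) (dyIdx a l (m + 1) x₀))) := by
    refine (mul_le_mul_right (measure_mono hsub) _).trans (h5.trans ?_)
    refine (mul_le_mul_right hgi 4).trans (le_of_eq ?_)
    rw [volume_dyCell, show (4 : ℝ≥0∞) = ofReal 4 by simp]
    simp only [← ofReal_mul, hr.le, hγ.le, mul_nonneg, half_pos ht |>.le,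
      show (0 : ℝ) ≤ 4 by norm_num, show (0 : ℝ) ≤ 16 by norm_num]
    congr 1
    rw [pow_succ]; field_simp; ring
  exact (mul_le_mul_iff_right (by simpa using ht) ofReal_ne_top).1 h6

theorem lintegral_le_of_tendsto {α : Type*} [MeasurableSpace α] {μ : Measure α} {f : ℕ → α → ℝ≥0∞}
    {F : α → ℝ≥0∞} {C : ℝ≥0∞} (hf : ∀ n, AEMeasurable (f n) μ)
    (h : ∀ᵐ x ∂μ, Tendsto (fun n => f n x) atTop (nhds (F x))) (hC : ∀ n, ∫⁻ x, f n x ∂μ ≤ C) :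
    ∫⁻ x, F x ∂μ ≤ C := by
  have h1 : ∫⁻ x, F x ∂μ = ∫⁻ x, liminf (fun n => f n x) atTop ∂μ :=
    lintegral_congr_ae (h.mono fun x hx => hx.liminf_eq.symm)
  rw [h1]
  refine (lintegral_liminf_le' hf).trans ?_
  exact liminf_le_of_le (by isBoundedDefault) fun b hb => by
    obtain ⟨n, hn⟩ := hb.exists
    exact hn.trans (hC n)

theorem good_lambda (hl : 0 < l) (hF : Measurable F) (H : OscLe a l F G)
    {c₀ : ℂ} (h₀ : ∀ x ∈ Ico a (a + l), ∫⁻ y in Ico a (a + l), ‖F y - c₀‖ₑ ≤ ofReal l * G x)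
    (ht : 0 < t) (hγ : 0 < γ) (hγ1 : γ ≤ 1) :
    volume ({y | ofReal (3 * t) < dyMax a l (fun y => ‖F y - c₀‖ₑ) y ∧
      G y ≤ ofReal (γ * t)} ∩ Ico a (a + l)) ≤
      ofReal (16 * γ) *
        volume ({y | ofReal t < dyMax a l (fun y => ‖F y - c₀‖ₑ) y} ∩ Ico a (a + l)) := by
  classical
  set E := {y | ofReal (3 * t) < dyMax a l (fun y => ‖F y - c₀‖ₑ) y ∧ G y ≤ ofReal (γ * t)}
  let S : Set (ℕ × ℤ) := {q | ∃ x₀ ∈ Ico a (a + l), dyIdx a l q.1 x₀ = q.2 ∧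
    ofReal t * ofReal (l / 2 ^ q.1) <
      ∫⁻ y in dyCell a l q.1 (dyIdx a l q.1 x₀), ‖F y - c₀‖ₑ ∧
    ∀ m < q.1, ∫⁻ y in dyCell a l m (dyIdx a l m x₀), ‖F y - c₀‖ₑ ≤ ofReal t * ofReal (l / 2 ^ m)}
  have hlt : ∀ q q' : S, ∀ y, y ∈ dyCell a l q.1.1 q.1.2 → y ∈ dyCell a l q'.1.1 q'.1.2 →
      ¬ q.1.1 < q'.1.1 := by
    rintro ⟨⟨n, k⟩, x, hx, hk, h1, h2⟩ ⟨⟨n', k'⟩, x', hx', hk', h1', h2'⟩ y hy hy' hlt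
    simp only at *
    rw [mem_dyCell hl] at hy hy'
    have e1 : dyIdx a l n x' = dyIdx a l n x := by
      rw [dyIdx_of_le hlt.le (hk'.trans hy'.symm), hy, hk]
    have := h2' n hlt
    rw [e1] at this
    exact absurd h1 (not_lt.2 this)
  have hdisj : Pairwise (Function.onFun Disjoint fun q : S => dyCell a l q.1.1 q.1.2) := by
    intro q q' hne
    refine disjoint_left.2 fun y hy hy' => hne ?_
    have h1 := hlt q q' y hy hy'
    have h2 := hlt q' q y hy' hy
    have h3 : q.1.1 = q'.1.1 := by omega
    rw [mem_dyCell hl] at hy hy'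
    exact Subtype.ext (Prod.ext h3 (by rw [← hy, ← hy', h3]))
  have hcov : E ∩ Ico a (a + l) ⊆ ⋃ q : S, E ∩ dyCell a l q.1.1 q.1.2 := by
    rintro y ⟨hy, hyI⟩
    have h1 : ∃ n, ofReal t * ofReal (l / 2 ^ n) <
        ∫⁻ z in dyCell a l n (dyIdx a l n y), ‖F z - c₀‖ₑ :=
      (lt_dyMax_iff hl).1 (lt_of_le_of_lt (ofReal_le_ofReal (by linarith)) hy.1)
    exact mem_iUnion.2 ⟨⟨(Nat.find h1, dyIdx a l (Nat.find h1) y), y, hyI, rfl, Nat.find_spec h1,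
      fun m hm => not_lt.1 (Nat.find_min h1 hm)⟩, hy, (mem_dyCell hl).2 rfl⟩
  have hsub : (⋃ q : S, dyCell a l q.1.1 q.1.2) ⊆
      {y | ofReal t < dyMax a l (fun y => ‖F y - c₀‖ₑ) y} ∩ Ico a (a + l) := by
    refine iUnion_subset ?_
    rintro ⟨⟨n, k⟩, x, hx, hk, h1, h2⟩ y hy
    simp only at *
    obtain rfl : dyIdx a l n x = k := hk
    refine ⟨?_, dyCell_subset hl hx hy⟩
    rw [mem_dyCell hl] at hy
    simp only [mem_ofPred_eq, lt_dyMax_iff hl]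
    exact ⟨n, by rwa [hy]⟩
  calc _ ≤ ∑' q : S, volume (E ∩ dyCell a l q.1.1 q.1.2) := (measure_mono hcov).trans (measure_iUnion_le _)
    _ ≤ ∑' q : S, ofReal (16 * γ) * volume (dyCell a l q.1.1 q.1.2) := by
        refine tsum_le_tsum ?_
        rintro ⟨⟨n, k⟩, x, hx, hk, h1, h2⟩
        simp only at *
        obtain rfl : dyIdx a l n x = k := hk
        exact good_lambda_cell hl hF H h₀ ht hγ hγ1 hx h1 h2
    _ = ofReal (16 * γ) * volume (⋃ q : S, dyCell a l q.1.1 q.1.2) := by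
        rw [ENNReal.tsum_mul_left, measure_iUnion hdisj fun q => measurableSet_dyCell _ _]
    _ ≤ _ := mul_le_mul_right (measure_mono hsub) _

theorem le_dyMax_ae (hl : 0 < l) (hF : LocallyIntegrable F) (c₀ : ℂ) :
    ∀ᵐ x, ‖F x - c₀‖ₑ ≤ dyMax a l (fun y => ‖F y - c₀‖ₑ) x := by
  filter_upwards [IsUnifLocDoublingMeasure.ae_tendsto_average_norm_sub volume hF 1] with x hx
  set w : ℕ → ℝ := fun n => a + l * dyIdx a l n x / 2 ^ n + l / 2 ^ n / 2 with hw
  set δ : ℕ → ℝ := fun n => l / 2 ^ n / 2 with hδ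
  have hδ0 : ∀ n, 0 < δ n := fun n => by positivity
  have hδt : Tendsto δ atTop (nhds 0) := by
    have h1 : Tendsto (fun n : ℕ => ((1 : ℝ) / 2) ^ n) atTop (nhds 0) :=
      tendsto_pow_atTop_nhds_zero_of_lt_one (by norm_num) (by norm_num)
    have h2 := h1.const_mul (l / 2)
    rw [mul_zero] at h2
    refine h2.congr fun n => ?_
    rw [hδ, one_div, inv_pow]; ring
  have hsub : ∀ n, dyCell a l n (dyIdx a l n x) ⊆ closedBall (w n) (δ n) := by
    intro n y hy
    rw [closedBall_eq_Icc]
    simp only [hw, hδ]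
    exact ⟨by linarith [hy.1], by linarith [hy.2]⟩
  have ht := hx w δ (tendsto_nhdsWithin_iff.2 ⟨hδt, Eventually.of_forall hδ0⟩)
    (.of_forall fun n => by rw [one_mul]; exact hsub n ((mem_dyCell hl).2 rfl))
  have ht2 := (tendsto_ofReal ht).add_const (dyMax a l (fun y => ‖F y - c₀‖ₑ) x)
  rw [ENNReal.ofReal_zero, zero_add] at ht2
  refine ge_of_tendsto' ht2 fun n => ?_
  have hv : 0 < l / 2 ^ n := by positivity
  have hnt : IntegrableOn (fun y => F y - F x) (closedBall (w n) (δ n)) :=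
    (hF.integrableOn_isCompact (isCompact_closedBall _ _)).sub
      (integrableOn_const (by rw [volume_closedBall]; exact ofReal_ne_top))
  have h1 : ∫⁻ y in dyCell a l n (dyIdx a l n x), ‖F y - c₀‖ₑ ≤
      dyMax a l (fun y => ‖F y - c₀‖ₑ) x * ofReal (l / 2 ^ n) := by
    rw [← ENNReal.div_le_iff (by simpa using hv) ofReal_ne_top]
    exact le_iSup (fun n : ℕ => (∫⁻ y in dyCell a l n (dyIdx a l n x), ‖F y - c₀‖ₑ) /
      ofReal (l / 2 ^ n)) n
  have h2 : ∫⁻ y in dyCell a l n (dyIdx a l n x), ‖F y - F x‖ₑ ≤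
      ofReal (⨍ y in closedBall (w n) (δ n), ‖F y - F x‖) * ofReal (l / 2 ^ n) := by
    refine (lintegral_mono_set (hsub n)).trans (le_of_eq ?_)
    rw [← ofReal_integral_norm_eq_lintegral_enorm hnt, setAverage_eq, measureReal_def,
      volume_closedBall, toReal_ofReal (by linarith [hδ0 n]),
      show 2 * δ n = l / 2 ^ n by simp only [hδ]; ring, smul_eq_mul, ← ofReal_mul' hv.le]
    congr 1
    field_simp
  have h3 : ‖F x - c₀‖ₑ * ofReal (l / 2 ^ n) ≤
      (∫⁻ y in dyCell a l n (dyIdx a l n x), ‖F y - F x‖ₑ) +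
        ∫⁻ y in dyCell a l n (dyIdx a l n x), ‖F y - c₀‖ₑ := by
    have hm : AEMeasurable (fun y => ‖F y - F x‖ₑ) (volume.restrict (dyCell a l n (dyIdx a l n x))) :=
      (hF.aestronglyMeasurable.sub aestronglyMeasurable_const).enorm.restrict
    rw [← lintegral_add_left' hm, ← volume_dyCell (a := a) n (dyIdx a l n x),
      ← restrict_apply_univ, ← lintegral_const]
    refine lintegral_mono fun y => ?_
    have : F x - c₀ = (F y - c₀) - (F y - F x) := by ring
    rw [this, add_comm]
    exact enorm_sub_le
  have h4 := h3.trans (add_le_add h2 h1)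
  rw [← add_mul] at h4
  exact (ENNReal.mul_le_mul_iff_left (by simpa using hv) ofReal_ne_top).1 h4

/-- A local Fefferman–Stein inequality. -/
theorem local_sharp (hp : 0 < p) : ∃ C ≠ ⊤, ∀ {a l : ℝ}, 0 < l → ∀ {F : ℝ → ℂ},
    Measurable F → LocallyIntegrable F → ∀ {G : ℝ → ℝ≥0∞}, Measurable G → OscLe a l F G →
    ∀ {c₀ : ℂ}, (∀ x ∈ Ico a (a + l), ∫⁻ y in Ico a (a + l), ‖F y - c₀‖ₑ ≤ ofReal l * G x) →
    ∫⁻ x in Ico a (a + l), ‖F x - c₀‖ₑ ^ p ≤ C * ∫⁻ x in Ico a (a + l), G x ^ p := by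
  have h3p : 1 ≤ (3 : ℝ) ^ p := Real.one_le_rpow (by norm_num) hp.le
  set γ : ℝ := 1 / (32 * 3 ^ p) with hγd
  have hγ : 0 < γ := by positivity
  have hγ1 : γ ≤ 1 := by rw [hγd, div_le_one (by positivity)]; linarith
  have hγ0 : ofReal γ ≠ 0 := by simpa using hγ
  refine ⟨3 ^ p * (2 * ((ofReal γ)⁻¹) ^ p), by finiteness, ?_⟩
  intro a l hl F hF hFi G hG H c₀ h₀
  set D := dyMax a l (fun y => ‖F y - c₀‖ₑ)
  have hD : Measurable D := measurable_dyMax _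
  set μ := volume.restrict (Ico a (a + l)) with hμ
  set Y := ∫⁻ x, G x ^ p ∂μ
  have key : ∀ n : ℕ, ∫⁻ x, (min (D x / 3) n) ^ p ∂μ ≤ 2 * ((ofReal γ)⁻¹ ^ p * Y) := by
    intro n
    set X := ∫⁻ x, (min (D x / 3) n) ^ p ∂μ with hX
    have hXt : X ≠ ⊤ := by
      refine ne_top_of_le_ne_top (b := ∫⁻ x, ((n : ℝ≥0∞)) ^ p ∂μ) ?_ (lintegral_mono fun x => ?_)
      · rw [lintegral_const, hμ, restrict_apply_univ, volume_Ico]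
        exact mul_ne_top (by finiteness) ofReal_ne_top
      · gcongr; exact min_le_right _ _
    have m1 : Measurable fun x => min (D x / 3) (n : ℝ≥0∞) := (hD.div_const _).min measurable_const
    have m2 : Measurable fun x => min (D x) (n : ℝ≥0∞) := hD.min measurable_const
    have m3 : Measurable fun x => (ofReal γ)⁻¹ * G x := hG.const_mul _
    have hle : X ≤ ofReal (16 * γ) * (∫⁻ x, min (D x) n ^ p ∂μ) +
        ∫⁻ x, ((ofReal γ)⁻¹ * G x) ^ p ∂μ := by
      rw [hX, lintegral_rpow_layer hp m1, lintegral_rpow_layer hp m2, lintegral_rpow_layer hp m3,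
        ← lintegral_ofReal_mul, ← lintegral_add_right']
      · refine setLIntegral_mono' measurableSet_Ioi fun t ht => ?_
        have ht : 0 < t := ht
        rw [mul_left_comm, ← mul_add]
        gcongr
        by_cases htn : ofReal t < n
        · have hsub : {x | ofReal t < min (D x / 3) n} ⊆
              {y | ofReal (3 * t) < D y ∧ G y ≤ ofReal (γ * t)} ∪
              {x | ofReal t < (ofReal γ)⁻¹ * G x} := by
            intro x hx
            by_cases hxG : G x ≤ ofReal (γ * t)
            · refine Or.inl ⟨?_, hxG⟩
              have hx1 : ofReal t < D x / 3 := (lt_min_iff.1 hx).1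
              rw [lt_div_iff_mul_lt (by simp) (by simp)] at hx1
              rwa [mul_comm, ofReal_mul' (by norm_num), ofReal_ofNat]
            · refine Or.inr ?_
              simp only [mem_ofPred_eq]
              rw [mul_comm, ← div_eq_mul_inv, lt_div_iff_mul_lt (.inl hγ0) (.inl ofReal_ne_top),
                ← ofReal_mul ht.le, mul_comm]
              exact not_le.1 hxG
          refine (measure_mono hsub).trans ((measure_union_le _ _).trans ?_)
          gcongr
          have h1 := good_lambda hl hF H h₀ ht hγ hγ1
          have e : {x | ofReal t < min (D x) n} = {x | ofReal t < D x} := by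
            ext x
            simp only [mem_ofPred_eq, lt_min_iff, and_iff_left htn]
          rw [e, hμ, Measure.restrict_apply' measurableSet_Ico, Measure.restrict_apply' measurableSet_Ico]
          exact h1
        · have : {x | ofReal t < min (D x / 3) n} = ∅ := by
            ext x
            simp only [mem_ofPred_eq, mem_empty_iff_false, iff_false]
            exact fun h => htn (lt_min_iff.1 h).2
          rw [this]; simp
      · refine AEMeasurable.mul (by fun_prop) ?_
        refine Antitone.measurable ?_ |>.aemeasurable
        intro s t hst
        exact measure_mono fun x hx => lt_of_le_of_lt (ofReal_le_ofReal hst) hx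
    have h2 : ∫⁻ x, min (D x) n ^ p ∂μ ≤ 3 ^ p * X := by
      rw [hX, ← lintegral_const_mul' _ _ (by finiteness)]
      refine lintegral_mono fun x => ?_
      simp only
      rw [← mul_rpow_of_nonneg _ _ hp.le]
      gcongr
      rw [mul_min, ENNReal.mul_div_cancel (by simp) (by simp)]
      refine min_le_min le_rfl ?_
      exact le_mul_of_one_le_left' (by norm_num)
    have h3 : ∫⁻ x, ((ofReal γ)⁻¹ * G x) ^ p ∂μ = (ofReal γ)⁻¹ ^ p * Y := by
      rw [← lintegral_const_mul _ (hG.pow_const _)]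
      refine lintegral_congr fun x => ?_
      rw [mul_rpow_of_nonneg _ _ hp.le]
    have h4 : ofReal (16 * γ) * (3 ^ p * X) = X / 2 := by
      rw [← mul_assoc, show (3 : ℝ≥0∞) ^ p = ofReal (3 ^ p) by
        rw [← ENNReal.ofReal_rpow_of_pos (by norm_num)]; simp, ← ofReal_mul (by positivity),
        show 16 * γ * 3 ^ p = 2⁻¹ by rw [hγd]; field_simp; norm_num,
        ENNReal.ofReal_inv_of_pos (by norm_num), mul_comm, ENNReal.div_eq_inv_mul, mul_comm]
      simp
    rw [h3] at hle
    have h5 : X ≤ X / 2 + (ofReal γ)⁻¹ ^ p * Y :=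
      hle.trans (add_le_add ((mul_le_mul_right h2 _).trans h4.le) le_rfl)
    nth_rewrite 1 [← ENNReal.add_halves X] at h5
    have h6 := (ENNReal.add_le_add_iff_left (ENNReal.div_ne_top hXt (by simp))).1 h5
    calc X = 2 * (X / 2) := (ENNReal.mul_div_cancel (by simp) (by simp)).symm
      _ ≤ _ := by gcongr
  have hlim : ∫⁻ x, (D x / 3) ^ p ∂μ ≤ 2 * ((ofReal γ)⁻¹ ^ p * Y) := by
    refine lintegral_le_of_tendsto (f := fun n : ℕ => fun x => (min (D x / 3) n) ^ p)
      (fun n => (((hD.div_const _).min measurable_const).pow_const _).aemeasurable)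
      (ae_of_all _ fun x => ?_) key
    have h1 : Tendsto (fun n : ℕ => min (D x / 3) (n : ℝ≥0∞)) atTop (nhds (min (D x / 3) ⊤)) :=
      tendsto_const_nhds.min ENNReal.tendsto_nat_nhds_top
    rw [min_eq_left le_top] at h1
    exact (continuous_rpow_const.tendsto _).comp h1
  calc ∫⁻ x, ‖F x - c₀‖ₑ ^ p ∂μ ≤ ∫⁻ x, 3 ^ p * (D x / 3) ^ p ∂μ := by
        refine lintegral_mono_ae ?_
        filter_upwards [ae_restrict_of_ae (le_dyMax_ae (a := a) hl hFi c₀)] with x hx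
        rw [← mul_rpow_of_nonneg _ _ hp.le, ENNReal.mul_div_cancel (by simp) (by simp)]
        gcongr
    _ = 3 ^ p * ∫⁻ x, (D x / 3) ^ p ∂μ := lintegral_const_mul' _ _ (by finiteness)
    _ ≤ 3 ^ p * (2 * ((ofReal γ)⁻¹ ^ p * Y)) := by gcongr
    _ = _ := by ring

theorem lintegral_rpow_le_jensen {α : Type*} [MeasurableSpace α] {μ : Measure α} (hs : 1 < s)
    {f : α → ℝ≥0∞} (hf : AEMeasurable f μ) :
    (∫⁻ x, f x ∂μ) ^ s ≤ μ univ ^ (s - 1) * ∫⁻ x, f x ^ s ∂μ := by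
  have hc : s.HolderConjugate (s / (s - 1)) := HolderConjugate.conjExponent hs
  have h := lintegral_mul_le_Lp_mul_Lq μ hc hf (aemeasurable_const (b := (1 : ℝ≥0∞)))
  simp only [Pi.mul_apply, mul_one, ENNReal.one_rpow, lintegral_const, one_mul] at h
  have hs0 : (0 : ℝ) < s := by linarith
  have hs1 : (0 : ℝ) < s - 1 := by linarith
  refine (rpow_le_rpow h hs0.le).trans (le_of_eq ?_)
  rw [mul_rpow_of_nonneg _ _ hs0.le, ← rpow_mul, ← rpow_mul,
    one_div_mul_cancel hs0.ne', rpow_one, mul_comm]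
  congr 2
  field_simp

/-- The maximal function of order `s`. -/
def ms (s : ℝ) (g : ℝ → ℝ≥0∞) (x : ℝ) : ℝ≥0∞ := hlMax (fun y => g y ^ s) x ^ s⁻¹

theorem measurable_ms (s : ℝ) (g : ℝ → ℝ≥0∞) : Measurable (ms s g) := (measurable_hlMax _).pow_const _

theorem ms_rpow (hs : 0 < s) (g : ℝ → ℝ≥0∞) (x : ℝ) :
    ms s g x ^ s = hlMax (fun y => g y ^ s) x := by
  rw [ms, ← rpow_mul, inv_mul_cancel₀ hs.ne', rpow_one]

theorem lintegral_ms_rpow_le (hs : 0 < s) (hsp : s < p) : ∃ C : ℝ≥0∞, C ≠ ⊤ ∧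
    ∀ g : ℝ → ℝ≥0∞, AEMeasurable g → ∫⁻ x, ms s g x ^ p ≤ C * ∫⁻ x, g x ^ p := by
  obtain ⟨C, hC, h⟩ := lintegral_hlMax_rpow_le (p := p / s) ((one_lt_div hs).2 hsp)
  refine ⟨C, hC, fun g hg => ?_⟩
  convert h _ (hg.pow_const s) using 2
  · funext x
    rw [ms, ← rpow_mul]; congr 1; field_simp
  · refine lintegral_congr fun x => ?_
    rw [← rpow_mul]; congr 1; field_simp

theorem hlMax_le_ms (hs : 1 < s) {g : ℝ → ℝ≥0∞} (hg : AEMeasurable g) (x : ℝ) :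
    hlMax g x ≤ ms s g x := by
  have hs0 : (0 : ℝ) < s := by linarith
  refine iSup₂_le fun r hr => ?_
  have h2r : ofReal (2 * r) ≠ 0 := by simpa using hr
  rw [div_le_iff' h2r ofReal_ne_top, ← rpow_le_rpow_iff hs0,
    mul_rpow_of_nonneg _ _ hs0.le, ms_rpow hs0]
  refine (lintegral_rpow_le_jensen hs hg.restrict).trans ?_
  rw [restrict_apply_univ, volume_ball]
  refine (mul_le_mul_right (setLIntegral_le_hlMax _ x hr) _).trans (le_of_eq ?_)
  rw [← mul_assoc]
  congr 1
  nth_rewrite 2 [← rpow_one (ofReal (2 * r))]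
  rw [← rpow_add _ _ h2r ofReal_ne_top]
  congr 1; ring

/-- On every ball some mean oscillation of `F` is at most the infimum of `G` there. -/
def SharpLe (F : ℝ → ℂ) (G : ℝ → ℝ≥0∞) : Prop :=
  ∀ c r : ℝ, 0 < r → ∃ k : ℂ, ∀ x ∈ closedBall c r,
    ∫⁻ y in Metric.ball c r, ‖F y - k‖ₑ ≤ ofReal (2 * r) * G x

theorem SharpLe.oscLe (h : SharpLe F G) (a l : ℝ) : OscLe a l F G := by
  intro u v huv _
  obtain ⟨k, hk⟩ := h ((u + v) / 2) ((v - u) / 2) (by linarith)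
  refine ⟨k, fun x hx => ?_⟩
  have h1 := hk x (by
    rw [closedBall_eq_Icc]
    exact ⟨by linarith [hx.1], by linarith [hx.2]⟩)
  rw [ball_eq_Ioo, show (u + v) / 2 - (v - u) / 2 = u by ring,
    show (u + v) / 2 + (v - u) / 2 = v by ring, show 2 * ((v - u) / 2) = v - u by ring] at h1
  rwa [setLIntegral_congr Ioo_ae_eq_Ico.symm]

theorem add_rpow_le (a b : ℝ≥0∞) (hp : 1 ≤ p) : (a + b) ^ p ≤ 2 ^ p * (a ^ p + b ^ p) :=
  (ENNReal.rpow_add_le_mul_rpow_add_rpow a b hp).trans (by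
    gcongr
    · norm_num
    · linarith)

theorem locallyIntegrable_of_lintegral_rpow (hF : AEStronglyMeasurable F) (hq : 1 < q)
    (h : ∫⁻ x, ‖F x‖ₑ ^ q ≠ ⊤) : LocallyIntegrable F := by
  rw [locallyIntegrable_iff]
  intro K hK
  refine ⟨hF.restrict, ?_⟩
  rw [hasFiniteIntegral_iff_enorm, lt_top_iff_ne_top]
  have h1 := lintegral_rpow_le_jensen (μ := volume.restrict K) hq hF.enorm.restrict
  have h2 : (∫⁻ x in K, ‖F x‖ₑ) ^ q ≠ ⊤ := by
    refine ne_top_of_le_ne_top (mul_ne_top ?_ (ne_top_of_le_ne_top h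
      (setLIntegral_le_lintegral K _))) h1
    rw [restrict_apply_univ]
    exact rpow_ne_top_of_nonneg (by linarith) hK.measure_lt_top.ne
  intro h3
  rw [h3, top_rpow_of_pos (by linarith)] at h2
  exact h2 rfl

/-- A global Fefferman–Stein inequality. -/
theorem global_sharp (hq : 1 < q) (hqp : q < p) : ∃ C ≠ ⊤, ∀ {F : ℝ → ℂ},
    Measurable F → ∫⁻ x, ‖F x‖ₑ ^ q ≠ ⊤ → ∀ {G : ℝ → ℝ≥0∞}, Measurable G → SharpLe F G →
    ∫⁻ x, ‖F x‖ₑ ^ p ≤ C * ∫⁻ x, G x ^ p := by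
  have hp0 : 0 < p := by linarith
  have hp1 : 1 ≤ p := by linarith
  have hq0 : 0 < q := by linarith
  obtain ⟨C, hC, hS⟩ := local_sharp hp0
  refine ⟨2 ^ p * (C + 2 ^ p), by finiteness, ?_⟩
  intro F hF hFq G hG hFG
  set K := ∫⁻ x, ‖F x‖ₑ ^ q
  set Y := ∫⁻ x, G x ^ p
  have hFl : LocallyIntegrable F := locallyIntegrable_of_lintegral_rpow hF.aestronglyMeasurable hq hFq
  have key : ∀ n : ℕ, 0 < n → ∫⁻ x in Ico (-(n : ℝ)) n, ‖F x‖ₑ ^ p ≤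
      2 ^ p * (C + 2 ^ p) * Y + 2 ^ p * (2 ^ p * (K ^ (p / q) *
        (ofReal (2 * n)) ^ (1 - p / q))) := by
    intro n hn
    have hn' : (0 : ℝ) < n := by exact_mod_cast hn
    set I := Ico (-(n : ℝ)) n with hI
    set ℓ := ofReal (2 * n) with hℓ
    have hℓ0 : ℓ ≠ 0 := by simpa [hℓ] using hn.ne'
    have hℓt : ℓ ≠ ⊤ := ofReal_ne_top
    have hI' : Ico (-(n : ℝ)) (-n + 2 * n) = I := by rw [hI]; congr 1; ring
    have hv : volume I = ℓ := by rw [hI, volume_Ico, hℓ]; congr 1; ring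
    obtain ⟨c, hc⟩ := hFG.oscLe (-n) (2 * n) (-n) (-n + 2 * n) (by linarith) subset_rfl
    rw [hI'] at hc
    rw [show (-n + 2 * n - -n : ℝ) = 2 * n by ring] at hc
    have h1 := hS (a := -n) (l := 2 * n) (by positivity) hF hFl hG (hFG.oscLe _ _) (c₀ := c)
      (by rw [hI']; exact hc)
    rw [hI'] at h1
    set W := (∫⁻ x in I, ‖F x‖ₑ) / ℓ with hW
    have h2 : ∀ x ∈ I, ‖c‖ₑ ≤ G x + W := by
      intro x hx
      have h3 : ‖c‖ₑ * ℓ ≤ ∫⁻ y in I, (‖F y - c‖ₑ + ‖F y‖ₑ) := by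
        rw [← hv, ← restrict_apply_univ, ← lintegral_const]
        refine lintegral_mono fun y => ?_
        have : c = F y - (F y - c) := by ring
        nth_rewrite 1 [this]
        rw [add_comm]
        exact enorm_sub_le
      rw [lintegral_add_left (by fun_prop)] at h3
      rw [← ENNReal.mul_le_mul_iff_left hℓ0 hℓt, add_mul, hW, ENNReal.div_mul_cancel hℓ0 hℓt,
        mul_comm (G x)]
      exact h3.trans (add_le_add (hc x hx) le_rfl)
    have hWp : W ^ p * ℓ ≤ K ^ (p / q) * ℓ ^ (1 - p / q) := by
      have h3 := lintegral_rpow_le_jensen (μ := volume.restrict I) hq hF.enorm.aemeasurable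
      rw [restrict_apply_univ, hv] at h3
      have h4 : (∫⁻ x in I, ‖F x‖ₑ) ^ p ≤ ℓ ^ ((q - 1) * (p / q)) * K ^ (p / q) := by
        rw [rpow_mul, ← mul_rpow_of_nonneg _ _ (by positivity)]
        have : (∫⁻ x in I, ‖F x‖ₑ) ^ p = ((∫⁻ x in I, ‖F x‖ₑ) ^ q) ^ (p / q) := by
          rw [← rpow_mul]; congr 1; field_simp
        rw [this]
        refine rpow_le_rpow (h3.trans ?_) (by positivity)
        exact mul_le_mul_right (setLIntegral_le_lintegral _ _) _
      rw [hW, ENNReal.div_rpow_of_nonneg _ _ hp0.le, ENNReal.div_eq_inv_mul, ← ENNReal.rpow_neg]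
      calc _ ≤ ℓ ^ (-p) * (ℓ ^ ((q - 1) * (p / q)) * K ^ (p / q)) * ℓ ^ (1 : ℝ) := by
            rw [rpow_one]; gcongr
        _ = K ^ (p / q) * (ℓ ^ (-p) * ℓ ^ ((q - 1) * (p / q)) * ℓ ^ (1 : ℝ)) := by ring
        _ = _ := by
            rw [← rpow_add _ _ hℓ0 hℓt, ← rpow_add _ _ hℓ0 hℓt]
            congr 2; field_simp; ring
    have h5 : ‖c‖ₑ ^ p * ℓ ≤ 2 ^ p * (Y + K ^ (p / q) * ℓ ^ (1 - p / q)) := by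
      calc ‖c‖ₑ ^ p * ℓ = ∫⁻ x in I, ‖c‖ₑ ^ p := by
            rw [lintegral_const, restrict_apply_univ, hv]
        _ ≤ ∫⁻ x in I, 2 ^ p * (G x ^ p + W ^ p) := setLIntegral_mono' measurableSet_Ico fun x hx =>
              (rpow_le_rpow (h2 x hx) hp0.le).trans (add_rpow_le _ _ hp1)
        _ = 2 ^ p * ((∫⁻ x in I, G x ^ p) + W ^ p * ℓ) := by
            rw [lintegral_const_mul' _ _ (by finiteness), lintegral_add_left (hG.pow_const _),
              lintegral_const, restrict_apply_univ, hv]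
        _ ≤ _ := by
            gcongr
            exact setLIntegral_le_lintegral _ _
    calc ∫⁻ x in I, ‖F x‖ₑ ^ p ≤ ∫⁻ x in I, 2 ^ p * (‖F x - c‖ₑ ^ p + ‖c‖ₑ ^ p) := by
          refine lintegral_mono fun x => ?_
          refine le_trans ?_ (add_rpow_le _ _ hp1)
          gcongr
          have : F x = (F x - c) + c := by ring
          nth_rewrite 1 [this]
          exact enorm_add_le _ _
      _ = 2 ^ p * ((∫⁻ x in I, ‖F x - c‖ₑ ^ p) + ‖c‖ₑ ^ p * ℓ) := by
          rw [lintegral_const_mul' _ _ (by finiteness), lintegral_add_left (by fun_prop),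
            lintegral_const, restrict_apply_univ, hv]
      _ ≤ 2 ^ p * (C * Y + 2 ^ p * (Y + K ^ (p / q) * ℓ ^ (1 - p / q))) := by
          gcongr
          exact h1.trans (mul_le_mul_right (setLIntegral_le_lintegral _ _) _)
      _ = _ := by ring
  have hcov : AECover volume atTop fun n : ℕ => Ico (-(n : ℝ)) n :=
    aecover_Ico (tendsto_neg_atTop_atBot.comp tendsto_natCast_atTop_atTop) tendsto_natCast_atTop_atTop
  have hlim := hcov.lintegral_tendsto_of_countably_generated (f := fun x => ‖F x‖ₑ ^ p)
    (by fun_prop)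
  have hz : Tendsto (fun n : ℕ => (ofReal (2 * n)) ^ (1 - p / q)) atTop (nhds 0) := by
    have h1 : Tendsto (fun n : ℕ => ofReal (2 * n)) atTop (nhds ⊤) :=
      ENNReal.tendsto_ofReal_atTop.comp
        (tendsto_natCast_atTop_atTop.const_mul_atTop (by norm_num))
    have h2 := ((continuous_rpow_const (y := 1 - p / q)).tendsto ⊤).comp h1
    rwa [ENNReal.top_rpow_of_neg (by
      have : 1 < p / q := (one_lt_div hq0).2 hqp
      linarith)] at h2
  have hz2 : Tendsto (fun n : ℕ => 2 ^ p * (C + 2 ^ p) * Y + 2 ^ p * (2 ^ p * (K ^ (p / q) *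
        (ofReal (2 * n)) ^ (1 - p / q)))) atTop (nhds (2 ^ p * (C + 2 ^ p) * Y)) := by
    have h1 := ENNReal.Tendsto.const_mul (a := 2 ^ p) (ENNReal.Tendsto.const_mul (a := 2 ^ p)
      (ENNReal.Tendsto.const_mul (a := K ^ (p / q)) hz (.inr (by finiteness)))
        (.inr (by finiteness))) (.inr (by finiteness))
    simp only [mul_zero] at h1
    simpa using h1.const_add (2 ^ p * (C + 2 ^ p) * Y)
  refine le_of_tendsto_of_tendsto hlim hz2 ?_
  filter_upwards [eventually_gt_atTop 0] with n hn using key n hn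

theorem pker_le_four (hr : 0 < r) (hx : x ∈ closedBall c r) (y : ℝ) :
    pker r (c - y) ≤ 4 * pker r (x - y) := by
  rw [closedBall_eq_Icc] at hx
  have h1 : |x - y| ≤ |c - y| + r := by
    have e : x - y = (c - y) + (x - c) := by ring
    rw [e]
    refine (abs_add_le _ _).trans (add_le_add le_rfl (abs_le.2 ⟨by linarith [hx.1], by linarith [hx.2]⟩))
  unfold pker
  have := abs_nonneg (x - y)
  have := abs_nonneg (c - y)
  rw [← mul_div_assoc, div_le_div_iff₀ (by positivity) (by positivity)]
  have h2 : (r + |x - y|) ^ 2 ≤ (2 * (r + |c - y|)) ^ 2 := by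
    apply pow_le_pow_left₀ (by positivity); linarith
  nlinarith

theorem BC.lintegral_rpow_ne_top (hf : BC f) (hp : 0 < p) : ∫⁻ x, ‖f x‖ₑ ^ p ≠ ⊤ := by
  have h := lintegral_rpow_enorm_lt_top_of_eLpNorm_lt_top (p := ofReal p) (f := f) (μ := volume)
    (by simpa using hp) ofReal_ne_top (hf.memLp _).eLpNorm_lt_top
  rw [toReal_ofReal hp.le] at h
  exact h.ne

theorem LipA.norm_kr_sub_le (hA : LipA A L) (hτ : τ ≠ 0) (hr : 0 < r)
    (hx : x ∈ closedBall c r) (hy : 2 * r ≤ |c - y|) :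
    ‖kr A τ x y - kr A τ c y‖ ≤ 9 * (1 + L) * (2 + L) ^ 2 * pker r (c - y) := by
  have hL := hA.1
  have hxc : |x - c| ≤ r := by simpa [dist_eq] using hx
  have h0 : 0 < |c - y| := by linarith
  have hxy : (r + |c - y|) / 3 ≤ |x - y| := by
    have : |c - y| ≤ |x - y| + |x - c| := by
      have e : c - y = (x - y) - (x - c) := by ring
      rw [e]; exact abs_sub _ _
    linarith
  have hcy : (r + |c - y|) / 3 ≤ |c - y| := by linarith
  have h3 : 0 < (r + |c - y|) / 3 := by positivity
  have hb : ∀ u, (r + |c - y|) / 3 ≤ |u - y| → ‖kr A τ u y‖ ≤ (2 + L) / ((r + |c - y|) / 3) := by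
    intro u hu
    refine (hA.norm_kr_le hτ u y).trans ?_
    gcongr
    have := abs_nonneg τ
    linarith
  have hz : ‖(zc A x - τ * I) - (zc A c - τ * I)‖ ≤ (1 + L) * r := by
    rw [sub_sub_sub_cancel_right]
    refine (hA.norm_zc_sub c x).trans ?_
    rw [abs_sub_comm]
    gcongr
  rw [hA.kr_sub_kr hτ hτ, norm_mul, norm_mul]
  calc _ ≤ ((1 + L) * r) * ((2 + L) / ((r + |c - y|) / 3) * ((2 + L) / ((r + |c - y|) / 3))) := by
        gcongr
        · exact hb x hxy
        · exact hb c hcy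
    _ = _ := by unfold pker; field_simp; norm_num

theorem LipA.enorm_Cr_sub_le (hA : LipA A L) : ∃ K ≠ ⊤, ∀ τ ≠ 0, ∀ h : ℝ → ℂ,
    Integrable h → ∀ c r x : ℝ, 0 < r → x ∈ closedBall c r →
    (∀ y ∈ ball c (2 * r), h y = 0) →
    ‖Cr A τ h x - Cr A τ h c‖ₑ ≤ K * ∫⁻ y, ofReal (pker r (c - y)) * ‖h y‖ₑ := by
  have hL := hA.1
  refine ⟨ofReal (9 * (1 + L) * (2 + L) ^ 2), ofReal_ne_top, ?_⟩
  intro τ hτ h hh c r x hr hx h0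
  unfold Cr
  rw [← integral_sub (hA.integrable_kr_mul hτ hh x) (hA.integrable_kr_mul hτ hh c),
    ← lintegral_ofReal_mul]
  refine (enorm_integral_le_lintegral_enorm _).trans (lintegral_mono fun y => ?_)
  simp only
  by_cases hy : y ∈ ball c (2 * r)
  · simp [h0 y hy]
  · rw [← sub_mul, enorm_mul, ← mul_assoc, ← ofReal_mul (by positivity)]
    gcongr
    rw [← ofReal_norm]
    refine ofReal_le_ofReal (hA.norm_kr_sub_le hτ hr hx ?_)
    rw [mem_ball, dist_eq, abs_sub_comm] at hy
    exact not_lt.1 hy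

theorem LipA.Cr_sub (hA : LipA A L) (hτ : τ ≠ 0) (hf : Integrable f)
    (hg : Integrable g) (x : ℝ) : Cr A τ (fun y => f y - g y) x = Cr A τ f x - Cr A τ g x := by
  unfold Cr
  rw [← integral_sub (hA.integrable_kr_mul hτ hf x) (hA.integrable_kr_mul hτ hg x)]
  exact integral_congr_ae (ae_of_all _ fun y => mul_sub _ _ _)

theorem LipA.Cr_split (hA : LipA A L) (hτ : τ ≠ 0) (hf : Integrable f) {S : Set ℝ}
    (hS : MeasurableSet S) (x : ℝ) : Cr A τ f x = Cr A τ (S.indicator f) x + Cr A τ (Sᶜ.indicator f) x := by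
  unfold Cr
  rw [← integral_add (hA.integrable_kr_mul hτ (hf.indicator hS) x)
    (hA.integrable_kr_mul hτ (hf.indicator hS.compl) x)]
  refine integral_congr_ae (ae_of_all _ fun y => ?_)
  by_cases hy : y ∈ S <;> simp [hy]

theorem setLIntegral_ball_le_hlMax (g : ℝ → ℝ≥0∞) (hr : 0 < r)
    (hx : x ∈ closedBall c r) (k : ℝ) (hk : 0 < k) :
    ∫⁻ y in ball c (k * r), g y ≤ ofReal (2 * ((k + 1) * r)) * hlMax g x := by
  refine le_trans (lintegral_mono_set ?_) (setLIntegral_le_hlMax g x (r := (k + 1) * r) (by positivity))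
  refine ball_subset_ball' ?_
  rw [Metric.mem_closedBall, dist_comm] at hx
  linarith

theorem LipA.Cr_sharp (hA : LipA A L) : ∃ K ≠ ⊤, ∀ τ ≠ 0, ∀ f, BC f →
    SharpLe (Cr A τ f) fun x => K * ms 2 (fun y => ‖f y‖ₑ) x := by
  obtain ⟨K₁, hK₁, h₁⟩ := hA.lintegral_Cr_sq
  obtain ⟨K₂, hK₂, h₂⟩ := hA.enorm_Cr_sub_le
  refine ⟨(3 * K₁) ^ (2⁻¹ : ℝ) + K₂ * 64, by finiteness, fun τ hτ f hf c r hr => ?_⟩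
  have hS : MeasurableSet (ball c (2 * r)) := measurableSet_ball
  set S := ball c (2 * r)
  set φ : ℝ → ℝ≥0∞ := fun y => ‖f y‖ₑ
  have hφ : AEMeasurable φ := hf.meas.enorm.aemeasurable
  refine ⟨Cr A τ (Sᶜ.indicator f) c, fun x hx => ?_⟩
  set ℓ := ofReal (2 * r) with hℓ
  have hℓ0 : ℓ ≠ 0 := by simpa [hℓ] using hr
  have hv : volume (ball c r) = ℓ := volume_ball _ _
  have hm : Measurable (Cr A τ (S.indicator f)) := hA.measurable_Cr_right (hf.indicator hS).meas τ
  have e1 : ∫⁻ y in ball c r, ‖Cr A τ (S.indicator f) y‖ₑ ≤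
      ℓ * ((3 * K₁) ^ (2⁻¹ : ℝ) * ms 2 φ x) := by
    rw [← rpow_le_rpow_iff two_pos]
    refine (lintegral_rpow_le_jensen one_lt_two hm.enorm.aemeasurable).trans ?_
    rw [restrict_apply_univ, hv, mul_rpow_of_nonneg _ _ two_pos.le,
      mul_rpow_of_nonneg _ _ two_pos.le, ms_rpow two_pos, ← rpow_mul,
      inv_mul_cancel₀ two_ne_zero, rpow_one]
    calc _ ≤ ℓ ^ (2 - 1 : ℝ) * (K₁ * (ofReal (2 * ((2 + 1) * r)) * hlMax (fun y => φ y ^ (2 : ℝ)) x)) := by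
          gcongr
          refine (setLIntegral_le_lintegral _ _).trans ((h₁ τ hτ _ (hf.indicator hS)).trans ?_)
          gcongr
          refine le_trans (le_of_eq ?_) (setLIntegral_ball_le_hlMax _ hr hx 2 two_pos)
          rw [← lintegral_indicator hS]
          refine lintegral_congr fun y => ?_
          by_cases hy : y ∈ S <;> simp [hy, φ]
      _ = ℓ ^ (2 - 1 : ℝ) * ℓ * (3 * K₁ * hlMax (fun y => φ y ^ (2 : ℝ)) x) := by
          rw [show 2 * ((2 + 1) * r) = 3 * (2 * r) by ring, ofReal_mul (by norm_num), ← hℓ,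
            ofReal_ofNat]
          ring
      _ = _ := by
          congr 1
          nth_rewrite 2 [← rpow_one ℓ]
          rw [← rpow_add _ _ hℓ0 ofReal_ne_top]
          norm_num
  have e2 : ∀ y ∈ ball c r, ‖Cr A τ (Sᶜ.indicator f) y - Cr A τ (Sᶜ.indicator f) c‖ₑ ≤
      K₂ * 64 * ms 2 φ x := by
    intro y hy
    refine (h₂ τ hτ _ (hf.indicator hS.compl).integrable c r y hr (Metric.ball_subset_closedBall hy)
      fun u hu => by simp [S, hu]).trans ?_
    rw [mul_assoc]
    gcongr
    calc ∫⁻ u, ofReal (pker r (c - u)) * ‖Sᶜ.indicator f u‖ₑ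
        ≤ ∫⁻ u, 4 * (ofReal (pker r (x - u)) * φ u) := by
          refine lintegral_mono fun u => ?_
          rw [← mul_assoc]
          refine mul_le_mul' ?_ ?_
          · rw [show (4 : ℝ≥0∞) = ofReal 4 by simp, ← ofReal_mul (by norm_num)]
            exact ofReal_le_ofReal (pker_le_four hr hx u)
          · by_cases hu : u ∈ S <;> simp [hu, φ]
      _ ≤ 4 * (16 * hlMax φ x) := by
          rw [lintegral_const_mul' _ _ (by simp)]
          gcongr
          exact lintegral_pker_mul_le hφ hr x
      _ ≤ 64 * ms 2 φ x := by
          rw [← mul_assoc]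
          refine mul_le_mul' (by norm_num) (hlMax_le_ms one_lt_two hφ x)
  calc ∫⁻ y in ball c r, ‖Cr A τ f y - Cr A τ (Sᶜ.indicator f) c‖ₑ
      ≤ ∫⁻ y in ball c r, (‖Cr A τ (S.indicator f) y‖ₑ + K₂ * 64 * ms 2 φ x) := by
        refine setLIntegral_mono' measurableSet_ball fun y hy => ?_
        rw [hA.Cr_split hτ hf.integrable hS y, add_sub_assoc]
        exact (enorm_add_le _ _).trans (add_le_add le_rfl (e2 y hy))
    _ = (∫⁻ y in ball c r, ‖Cr A τ (S.indicator f) y‖ₑ) + K₂ * 64 * ms 2 φ x * ℓ := by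
        rw [lintegral_add_left hm.enorm, lintegral_const, restrict_apply_univ, hv]
    _ ≤ ℓ * ((3 * K₁) ^ (2⁻¹ : ℝ) * ms 2 φ x) + K₂ * 64 * ms 2 φ x * ℓ := by gcongr
    _ = _ := by ring

theorem LipA.lintegral_Cr_rpow_of_two_lt (hA : LipA A L) (hp : 2 < p) : ∃ K : ℝ≥0∞, K ≠ ⊤ ∧
    ∀ τ ≠ 0, ∀ f, BC f → ∫⁻ x, ‖Cr A τ f x‖ₑ ^ p ≤ K * ∫⁻ x, ‖f x‖ₑ ^ p := by
  obtain ⟨K₁, hK₁, h₁⟩ := hA.lintegral_Cr_sq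
  obtain ⟨K₂, hK₂, h₂⟩ := hA.Cr_sharp
  obtain ⟨K₃, hK₃, h₃⟩ := global_sharp one_lt_two hp
  obtain ⟨K₄, hK₄, h₄⟩ := lintegral_ms_rpow_le two_pos hp
  have hp0 : 0 < p := by linarith
  refine ⟨K₃ * (K₂ ^ p * K₄), by finiteness, fun τ hτ f hf => ?_⟩
  refine (h₃ (hA.measurable_Cr_right hf.meas τ) (ne_top_of_le_ne_top
    (mul_ne_top hK₁ (hf.lintegral_rpow_ne_top two_pos)) (h₁ τ hτ f hf))
    ((measurable_ms _ _).const_mul _) (h₂ τ hτ f hf)).trans ?_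
  rw [mul_assoc]
  gcongr
  calc _ = K₂ ^ p * ∫⁻ x, ms 2 (fun y => ‖f y‖ₑ) x ^ p := by
        rw [← lintegral_const_mul' _ _ (by finiteness)]
        refine lintegral_congr fun x => mul_rpow_of_nonneg _ _ hp0.le
    _ ≤ _ := by
        rw [mul_assoc]
        gcongr
        exact h₄ _ hf.meas.enorm.aemeasurable

theorem LipA.lintegral_Cr_rpow_of_lt_two (hA : LipA A L) (hp1 : 1 < p) (hp2 : p < 2) :
    ∃ K ≠ ⊤, ∀ τ ≠ 0, ∀ f, BC f →
    ∫⁻ x, ‖Cr A τ f x‖ₑ ^ p ≤ K * ∫⁻ x, ‖f x‖ₑ ^ p := by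
  have hp0 : 0 < p := by linarith
  have hp10 : 0 < p - 1 := by linarith
  have hc : p.HolderConjugate (p / (p - 1)) := HolderConjugate.conjExponent hp1
  set p' := p / (p - 1) with hp'
  have hp'0 : 0 < p' := by positivity
  have hp'2 : 2 < p' := by rw [hp', lt_div_iff₀ hp10]; linarith
  obtain ⟨K, hK, h⟩ := hA.lintegral_Cr_rpow_of_two_lt hp'2
  refine ⟨K ^ (p - 1), by finiteness, fun τ hτ f hf => lintegral_le_of_forall_Icc fun n => ?_⟩
  set S := Icc (-(n : ℝ)) n with hS
  have hm : Measurable (Cr A τ f) := hA.measurable_Cr_right hf.meas τ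
  set F := Cr A τ f with hF
  set X := ∫⁻ x in S, ‖F x‖ₑ ^ p with hX
  have hL := hA.1
  obtain ⟨M, hM0, hM⟩ : ∃ M : ℝ, 0 ≤ M ∧ ∀ x, ‖F x‖ ≤ M :=
    ⟨_, by positivity, hA.norm_Cr_le hτ hf.integrable⟩
  have hXt : X ≠ ⊤ := by
    refine ne_top_of_le_ne_top (b := ∫⁻ x in S, ofReal M ^ p) ?_ (lintegral_mono fun x => ?_)
    · rw [lintegral_const, restrict_apply_univ, hS, volume_Icc]
      exact mul_ne_top (by finiteness) ofReal_ne_top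
    · gcongr
      rw [← ofReal_norm]
      exact ofReal_le_ofReal (hM x)
  set g : ℝ → ℂ := S.indicator fun x => (starRingEnd ℂ) (F x) * ((‖F x‖ ^ (p - 2) : ℝ) : ℂ) with hg
  have hgn : ∀ x, ‖g x‖ = S.indicator (fun x => ‖F x‖ ^ (p - 1)) x := by
    intro x
    by_cases hx : x ∈ S
    · simp only [hg, indicator_of_mem hx, norm_mul, RCLike.norm_conj, norm_real]
      rw [norm_of_nonneg (by positivity)]
      rcases eq_or_ne ‖F x‖ 0 with h0 | h0
      · rw [h0, zero_mul, zero_rpow hp10.ne']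
      · nth_rewrite 1 [← Real.rpow_one ‖F x‖]
        rw [← Real.rpow_add ((norm_nonneg _).lt_of_ne' h0)]; congr 1; ring
    · simp [hg, hx]
  have hgm : Measurable g := Measurable.indicator (by
    refine (continuous_conj.measurable.comp hm).mul ?_
    exact measurable_ofReal.comp (hm.norm.pow_const _)) measurableSet_Icc
  have hgBC : BC g := by
    refine ⟨hgm, ⟨M ^ (p - 1), fun x => ?_⟩, ⟨n, fun x hx => ?_⟩⟩
    · rw [hgn]
      refine indicator_le_self' (fun _ _ => by positivity) x |>.trans ?_
      gcongr
      exact hM x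
    · refine indicator_of_notMem ?_ _
      rw [hS, mem_Icc, ← abs_le]; exact not_le.2 hx
  have hgp : ∫⁻ x, ‖g x‖ₑ ^ p' = X := by
    rw [hX, ← lintegral_indicator measurableSet_Icc]
    refine lintegral_congr fun x => ?_
    rw [← ofReal_norm, hgn]
    by_cases hx : x ∈ S
    · rw [indicator_of_mem hx, indicator_of_mem hx,
        ← ofReal_rpow_of_nonneg (norm_nonneg _) hp10.le, ofReal_norm, ← rpow_mul]
      congr 1; rw [hp']; field_simp
    · rw [indicator_of_notMem hx, indicator_of_notMem hx]; simp [hp'0]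
  have hgF : ∫ x, g x * F x = ((X.toReal : ℝ) : ℂ) := by
    have h1 : ∀ x, g x * F x = ((S.indicator (fun x => ‖F x‖ ^ p) x : ℝ) : ℂ) := by
      intro x
      by_cases hx : x ∈ S
      · simp only [hg, indicator_of_mem hx]
        rw [mul_right_comm, mul_comm _ (F x), mul_conj, Complex.normSq_eq_norm_sq, ← Complex.ofReal_mul]
        congr 1
        rcases eq_or_ne ‖F x‖ 0 with h0 | h0
        · rw [h0, zero_rpow hp0.ne']; simp
        · rw [← Real.rpow_two, ← Real.rpow_add ((norm_nonneg _).lt_of_ne' h0)]; congr 1; ring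
      · simp [hg, hx]
    simp_rw [h1]
    rw [integral_complex_ofReal, integral_indicator measurableSet_Icc, hX,
      integral_eq_lintegral_of_nonneg_ae (ae_of_all _ fun x => by positivity)
        (hm.norm.pow_const _).aestronglyMeasurable]
    congr 3
    funext x
    rw [← ofReal_rpow_of_nonneg (norm_nonneg _) hp0.le, ofReal_norm]
  have hneg := hA.integral_mul_Cr_eq_neg hτ hf.integrable hgBC.integrable
  have hX1 : X ≤ (∫⁻ x, ‖f x‖ₑ ^ p) ^ (1 / p) * (K * X) ^ (1 / p') := by
    calc X = ‖∫ x, g x * F x‖ₑ := by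
          rw [hgF, ← ofReal_norm, norm_real, norm_of_nonneg toReal_nonneg, ofReal_toReal hXt]
      _ = ‖∫ x, f x * Cr A (-τ) g x‖ₑ := by rw [hF, hneg, enorm_neg]
      _ ≤ ∫⁻ x, ‖f x‖ₑ * ‖Cr A (-τ) g x‖ₑ := by
          refine (enorm_integral_le_lintegral_enorm _).trans (le_of_eq (lintegral_congr fun x => enorm_mul _ _))
      _ ≤ _ := lintegral_mul_le_Lp_mul_Lq volume hc hf.meas.enorm.aemeasurable
          (hA.measurable_Cr_right hgBC.meas (-τ)).enorm.aemeasurable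
      _ ≤ _ := by
          gcongr
          rw [← hgp]
          exact h (-τ) (neg_ne_zero.2 hτ) g hgBC
  rcases eq_or_ne X 0 with hX0 | hX0
  · rw [hX0]; exact zero_le
  have hX2 := rpow_le_rpow hX1 hp0.le
  rw [mul_rpow_of_nonneg _ _ hp0.le, ← rpow_mul, ← rpow_mul,
    one_div_mul_cancel hp0.ne', rpow_one, show 1 / p' * p = p - 1 by rw [hp']; field_simp,
    mul_rpow_of_nonneg _ _ hp10.le, ← mul_assoc] at hX2
  have e : X ^ p = X * X ^ (p - 1) := by
    nth_rewrite 2 [← rpow_one X]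
    rw [← rpow_add _ _ hX0 hXt]; congr 1; ring
  rw [e, ENNReal.mul_le_mul_iff_left (by simp [hX0, hXt]) (by finiteness), mul_comm] at hX2
  exact hX2

theorem LipA.lintegral_Cr_rpow_BC (hA : LipA A L) (hp : 1 < p) :
    ∃ K ≠ ⊤, ∀ τ ≠ 0, ∀ f, BC f →
    ∫⁻ x, ‖Cr A τ f x‖ₑ ^ p ≤ K * ∫⁻ x, ‖f x‖ₑ ^ p := by
  rcases lt_trichotomy p 2 with h | rfl | h
  · exact hA.lintegral_Cr_rpow_of_lt_two hp h
  · exact hA.lintegral_Cr_sq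
  · exact hA.lintegral_Cr_rpow_of_two_lt h

/-- Measurable functions integrable against `1 / (1 + |y|)`. -/
structure Wt (f : ℝ → ℂ) : Prop where
  meas : Measurable f
  int : Integrable fun y => (((1 + |y|)⁻¹ : ℝ) : ℂ) * f y

/-- The truncation of `f` in size and support. -/
def trunc (n : ℕ) (f : ℝ → ℂ) : ℝ → ℂ := {y : ℝ | |y| ≤ n ∧ ‖f y‖ ≤ n}.indicator f

theorem measurableSet_trunc (hf : Measurable f) (n : ℕ) :
    MeasurableSet {y : ℝ | |y| ≤ n ∧ ‖f y‖ ≤ n} := by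
  have h1 : MeasurableSet {y : ℝ | |y| ≤ n} := measurableSet_le (by fun_prop) measurable_const
  have h2 : MeasurableSet {y : ℝ | ‖f y‖ ≤ n} := measurableSet_le hf.norm measurable_const
  exact h1.inter h2

theorem trunc_BC (hf : Measurable f) (n : ℕ) : BC (trunc n f) := by
  have hS : MeasurableSet {y : ℝ | |y| ≤ n ∧ ‖f y‖ ≤ n} := measurableSet_trunc hf n
  refine ⟨hf.indicator hS, ⟨n, fun x => ?_⟩, ⟨n, fun x hx => ?_⟩⟩
  · by_cases hx : x ∈ {y : ℝ | |y| ≤ n ∧ ‖f y‖ ≤ n}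
    · rw [trunc, indicator_of_mem hx]; exact hx.2
    · rw [trunc, indicator_of_notMem hx]; simp
  · exact indicator_of_notMem (fun h => absurd h.1 (not_le.2 hx)) _

theorem norm_trunc_le (n : ℕ) (f : ℝ → ℂ) (x : ℝ) : ‖trunc n f x‖ ≤ ‖f x‖ :=
  norm_indicator_le_norm_self _ _

theorem trunc_eventually_eq (f : ℝ → ℂ) (x : ℝ) : ∀ᶠ n : ℕ in atTop, trunc n f x = f x := by
  obtain ⟨N, hN⟩ := exists_nat_ge (max |x| ‖f x‖)
  filter_upwards [eventually_ge_atTop N] with n hn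
  have : (N : ℝ) ≤ n := by exact_mod_cast hn
  have hx : x ∈ {y : ℝ | |y| ≤ n ∧ ‖f y‖ ≤ n} := ⟨(le_max_left _ _).trans (hN.trans this),
    (le_max_right _ _).trans (hN.trans this)⟩
  exact indicator_of_mem hx f

theorem LipA.integrable_kr_mul_Wt (hA : LipA A L) (hτ : τ ≠ 0) (hf : Wt f) (x : ℝ) :
    Integrable fun y => kr A τ x y * f y := by
  have hL := hA.1
  have h0 := abs_pos.2 hτ
  have hm : Measurable fun y : ℝ => ((1 + |y| : ℝ) : ℂ) * kr A τ x y := by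
    refine Measurable.mul (by fun_prop) (hA.measurable_kr_right τ x)
  refine (hf.int.bdd_mul (c := (2 + L) * ((1 + |x|) / |τ| + 1)) hm.aestronglyMeasurable (ae_of_all _ fun y => ?_)).congr
    (ae_of_all _ fun y => ?_)
  · have hy : 0 < 1 + |y| := by positivity
    rw [norm_mul, norm_real, norm_of_nonneg hy.le]
    have h1 : 1 + |y| ≤ ((1 + |x|) / |τ| + 1) * (|τ| + |x - y|) := by
      have h2 : |y| ≤ |x| + |x - y| := by
        have e : y = x - (x - y) := by ring
        nth_rewrite 1 [e]; exact abs_sub _ _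
      have h3 : (1 + |x|) / |τ| * |τ| = 1 + |x| := by field_simp
      have : 0 ≤ (1 + |x|) / |τ| * |x - y| := by positivity
      nlinarith
    calc _ ≤ ((1 + |x|) / |τ| + 1) * (|τ| + |x - y|) * ((2 + L) / (|τ| + |x - y|)) := by
          gcongr
          exact hA.norm_kr_le hτ x y
      _ = _ := by
        have : |τ| + |x - y| ≠ 0 := by positivity
        field_simp
  · have hy : ((1 + |y| : ℝ) : ℂ) ≠ 0 := by
      rw [ofReal_ne_zero]; positivity
    simp only [ofReal_inv]
    field_simp

theorem Wt.mono (hf : Wt f) (hg : Measurable g) (h : ∀ x, ‖g x‖ ≤ ‖f x‖) : Wt g := by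
  refine ⟨hg, hf.int.mono (by fun_prop) (ae_of_all _ fun x => ?_)⟩
  simp only [norm_mul]
  gcongr
  exact h x

theorem LipA.tendsto_Cr (hA : LipA A L) (hτ : τ ≠ 0) (hf : Wt f) {g : ℕ → ℝ → ℂ}
    (hg : ∀ n, Measurable (g n)) (hgf : ∀ n x, ‖g n x‖ ≤ ‖f x‖)
    (hl : ∀ x, Tendsto (fun n => g n x) atTop (nhds (f x))) (x : ℝ) :
    Tendsto (fun n => Cr A τ (g n) x) atTop (nhds (Cr A τ f x)) := by
  refine tendsto_integral_of_dominated_convergence (fun y => ‖kr A τ x y * f y‖)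
    (fun n => ((hA.measurable_kr_right τ x).mul (hg n)).aestronglyMeasurable)
    (hA.integrable_kr_mul_Wt hτ hf x).norm (fun n => ae_of_all _ fun y => ?_)
    (ae_of_all _ fun y => (hl y).const_mul _)
  rw [norm_mul, norm_mul]
  gcongr
  exact hgf n y

theorem LipA.tendsto_Cr_trunc (hA : LipA A L) (hτ : τ ≠ 0) (hf : Wt f) (x : ℝ) :
    Tendsto (fun n => Cr A τ (trunc n f) x) atTop (nhds (Cr A τ f x)) :=
  hA.tendsto_Cr hτ hf (fun n => (trunc_BC hf.meas n).meas) (fun n x => norm_trunc_le n f x)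
    (fun y => tendsto_const_nhds.congr' ((trunc_eventually_eq f y).mono fun _ h => h.symm)) x

theorem LipA.lintegral_kr_mul_kr_le (hA : LipA A L) (hs : s ≠ 0) (ht : t ≠ 0) (x y : ℝ) :
    ∫⁻ u, ‖dz A u * (kr A s x u * kr A t y u)‖ₑ ≤
      ofReal ((1 + L) * ((2 + L) ^ 2 / |s|)) * 16 + ofReal ((1 + L) * ((2 + L) ^ 2 / |t|)) * 16 := by
  have hL := hA.1
  have hs' := abs_pos.2 hs
  have ht' := abs_pos.2 ht
  have hm : ∀ s x : ℝ, Measurable fun u : ℝ => ofReal (pker s (x - u)) := fun s x =>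
    ((measurable_pker s).comp (measurable_const.sub measurable_id)).ennreal_ofReal
  calc _ ≤ ∫⁻ u, (ofReal ((1 + L) * ((2 + L) ^ 2 / |s|)) * ofReal (pker |s| (x - u)) +
        ofReal ((1 + L) * ((2 + L) ^ 2 / |t|)) * ofReal (pker |t| (y - u))) := by
        refine lintegral_mono fun u => ?_
        have p1 := pker_nonneg hs' (x - u)
        have p2 := pker_nonneg ht' (y - u)
        rw [← ofReal_norm, ← ofReal_mul (by positivity), ← ofReal_mul (by positivity),
          ← ofReal_add (by positivity) (by positivity)]
        refine ofReal_le_ofReal ?_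
        rw [norm_mul, norm_mul, mul_assoc, mul_assoc, ← mul_add]
        have h1 := hA.norm_kr_sq_le hs x u
        have h2 := hA.norm_kr_sq_le ht y u
        refine mul_le_mul (hA.norm_dz_le u) ?_ (by positivity) (by positivity)
        nlinarith [sq_nonneg (‖kr A s x u‖ - ‖kr A t y u‖), norm_nonneg (kr A s x u), norm_nonneg (kr A t y u)]
    _ = ofReal ((1 + L) * ((2 + L) ^ 2 / |s|)) * (∫⁻ u, ofReal (pker |s| (x - u))) +
        ofReal ((1 + L) * ((2 + L) ^ 2 / |t|)) * ∫⁻ u, ofReal (pker |t| (y - u)) := by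
        rw [lintegral_add_left ((hm _ _).const_mul _), lintegral_const_mul _ (hm _ _),
          lintegral_const_mul _ (hm _ _)]
    _ ≤ _ := by
        gcongr
        · exact lintegral_pker_le hs' x
        · exact lintegral_pker_le ht' y

theorem LipA.integral_dz_kr_mul_Cr (hA : LipA A L) (hs : s ≠ 0) (ht : t ≠ 0) (x : ℝ) (hf : BC f) : Integrable (fun u => dz A u * kr A s x u * Cr A t f u) ∧
    ∫ u, dz A u * kr A s x u * Cr A t f u =
      -∫ y, f y * ∫ u, dz A u * (kr A s x u * kr A (-t) y u) := by
  have ht' : -t ≠ 0 := neg_ne_zero.2 ht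
  have hm : Measurable fun q : ℝ × ℝ => dz A q.1 * (kr A s x q.1 * kr A (-t) q.2 q.1) :=
    ((measurable_dz A).comp measurable_fst).mul
      (((hA.measurable_kr_right s x).comp measurable_fst).mul
        (hA.measurable_kr.comp (f := fun q : ℝ × ℝ => (-t, q.2, q.1)) (by fun_prop)))
  have hm' : Measurable fun q : ℝ × ℝ => f q.2 * (dz A q.1 * (kr A s x q.1 * kr A (-t) q.2 q.1)) :=
    (hf.meas.comp measurable_snd).mul hm
  have hi : Integrable (fun q : ℝ × ℝ => f q.2 * (dz A q.1 * (kr A s x q.1 * kr A (-t) q.2 q.1)))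
      (volume.prod volume) := by
    refine ⟨hm'.aestronglyMeasurable, ?_⟩
    rw [hasFiniteIntegral_iff_enorm, lintegral_prod_symm _ hm'.enorm.aemeasurable]
    have h1 : ∀ y, ∫⁻ u, ‖f y * (dz A u * (kr A s x u * kr A (-t) y u))‖ₑ ≤
        ‖f y‖ₑ * (ofReal ((1 + L) * ((2 + L) ^ 2 / |s|)) * 16 +
          ofReal ((1 + L) * ((2 + L) ^ 2 / |-t|)) * 16) := fun y => by
      simp_rw [enorm_mul (f y)]
      rw [lintegral_const_mul' _ _ (by finiteness)]
      gcongr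
      exact hA.lintegral_kr_mul_kr_le hs ht' x y
    refine (lintegral_mono h1).trans_lt ?_
    rw [lintegral_mul_const _ hf.meas.enorm]
    exact mul_lt_top hf.integrable.2 (by finiteness)
  have e1 : ∀ u, dz A u * kr A s x u * Cr A t f u =
      -∫ y, f y * (dz A u * (kr A s x u * kr A (-t) y u)) := fun u => by
    unfold Cr
    rw [← integral_const_mul, ← integral_neg]
    refine integral_congr_ae (ae_of_all _ fun y => ?_)
    simp only
    rw [kr_symm A t u y]; ring
  simp_rw [e1]
  refine ⟨hi.integral_prod_left.neg, ?_⟩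
  rw [integral_neg, integral_integral_swap (f := fun u y => f y * (dz A u * (kr A s x u * kr A (-t) y u))) hi]
  simp_rw [integral_const_mul]

theorem LipA.Cr_add_eq (hA : LipA A L) (hs : 0 < s) (ht : 0 < t) (x : ℝ) (hf : BC f) :
    -(2 * π * I) * Cr A (s + t) f x =
      ∫ u, dz A u * (kr A s x u - kr A (-s) x u) * Cr A t f u := by
  have hL := hA.1
  have hst : s + t ≠ 0 := by positivity
  have e0 : ∀ᵐ y : ℝ, f y * ∫ u, dz A u * (kr A s x u * kr A (-t) y u) =
      -(-(2 * π * I) * (kr A (s + t) x y * f y)) := ae_of_all _ fun y => by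
    have h := hA.integral_kr_mul_kr hs.ne' (neg_ne_zero.2 ht.ne') x y
    rw [sign_pos hs, sign_neg (neg_neg_iff_pos.2 ht)] at h
    have h0 := hA.ne_zero x y hst
    have e : ∫ u, dz A u * (kr A s x u * kr A (-t) y u) = 2 * π * I * kr A (s + t) x y := by
      unfold kr at h ⊢
      rw [← div_eq_mul_inv, eq_div_iff h0]
      simp only [SignType.coe_neg_one, SignType.coe_one] at h
      push_cast at h ⊢
      linear_combination -h
    rw [e]; ring
  have e2 : ∀ᵐ y : ℝ, f y * ∫ u, dz A u * (kr A (-s) x u * kr A (-t) y u) = 0 := by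
    have : ∀ᵐ y : ℝ, y ≠ x := by simp [ae_iff]
    filter_upwards [this] with y hy
    have h := hA.integral_kr_mul_kr (neg_ne_zero.2 hs.ne') (neg_ne_zero.2 ht.ne') x y
    rw [sign_neg (neg_neg_iff_pos.2 hs), sign_neg (neg_neg_iff_pos.2 ht), sub_self, zero_mul,
      mul_eq_zero] at h
    rcases h with h | h
    · exfalso
      apply hy
      have := congrArg re h
      simp at this
      linarith
    · rw [h, mul_zero]
  obtain ⟨i1, h1⟩ := hA.integral_dz_kr_mul_Cr hs.ne' ht.ne' x hf
  obtain ⟨i2, h2⟩ := hA.integral_dz_kr_mul_Cr (neg_ne_zero.2 hs.ne') ht.ne' x hf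
  rw [integral_congr_ae e0, integral_neg, neg_neg, integral_const_mul] at h1
  rw [integral_congr_ae e2, integral_zero, neg_zero] at h2
  have h3 := integral_sub i1 i2
  rw [h1, h2, sub_zero] at h3
  unfold Cr at h3 ⊢
  rw [← h3]
  refine integral_congr_ae (ae_of_all _ fun u => ?_)
  simp only; ring

theorem LipA.norm_kr_sub_kr_neg_le (hA : LipA A L) (hs : 0 < s) (x u : ℝ) :
    ‖kr A s x u - kr A (-s) x u‖ ≤ 2 * (2 + L) ^ 2 * pker s (x - u) := by
  have hL := hA.1
  have hs' : -s ≠ 0 := neg_ne_zero.2 hs.ne'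
  rw [hA.kr_sub_kr hs.ne' hs', norm_mul, norm_mul,
    show zc A x - s * I - (zc A x - (-s : ℝ) * I) = ((-2 * s : ℝ) : ℂ) * I by
      push_cast; ring, norm_mul, norm_I, mul_one, norm_real, norm_eq_abs, abs_mul,
    abs_of_pos hs]
  have h1 := hA.norm_kr_le hs.ne' x u
  have h2 := hA.norm_kr_le hs' x u
  rw [abs_neg] at h2
  rw [abs_of_pos hs] at h1 h2
  have h0 := abs_nonneg (x - u)
  calc _ ≤ |(-2 : ℝ)| * s * ((2 + L) / (s + |x - u|) * ((2 + L) / (s + |x - u|))) := by gcongr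
    _ = _ := by
      have : s + |x - u| ≠ 0 := by positivity
      unfold pker; norm_num; field_simp

theorem LipA.enorm_Cr_add_le (hA : LipA A L) : ∃ K ≠ ⊤, ∀ s t : ℝ, 0 < s → 0 < t →
    ∀ f, BC f → ∀ x, ‖Cr A (s + t) f x‖ₑ ≤ K * hlMax (fun u => ‖Cr A t f u‖ₑ) x := by
  have hL := hA.1
  refine ⟨ofReal ((1 + L) * (2 * (2 + L) ^ 2)) * 16, by finiteness, fun s t hs ht f hf x => ?_⟩
  have h := hA.Cr_add_eq hs ht x hf
  calc ‖Cr A (s + t) f x‖ₑ ≤ ‖-(2 * π * I) * Cr A (s + t) f x‖ₑ := by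
        rw [enorm_mul]
        refine le_mul_of_one_le_left' ?_
        rw [← ofReal_norm, ← ofReal_one]
        refine ofReal_le_ofReal ?_
        rw [norm_neg, norm_mul, norm_mul, norm_I, norm_real,
          norm_of_nonneg pi_pos.le, Complex.norm_ofNat]
        linarith [Real.pi_gt_three]
    _ ≤ ∫⁻ u, ofReal ((1 + L) * (2 * (2 + L) ^ 2)) * (ofReal (pker s (x - u)) * ‖Cr A t f u‖ₑ) := by
        rw [h]
        refine (enorm_integral_le_lintegral_enorm _).trans (lintegral_mono fun u => ?_)
        rw [enorm_mul, ← mul_assoc, ← ofReal_mul (by positivity)]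
        gcongr
        rw [← ofReal_norm]
        refine ofReal_le_ofReal ?_
        rw [norm_mul, mul_assoc]
        exact mul_le_mul (hA.norm_dz_le u) (hA.norm_kr_sub_kr_neg_le hs x u) (norm_nonneg _) (by positivity)
    _ ≤ _ := by
        rw [lintegral_ofReal_mul, mul_assoc]
        gcongr
        exact lintegral_pker_mul_le (hA.measurable_Cr_right hf.meas t).enorm.aemeasurable hs x

theorem wt_of_lintegral_rpow (hp : 1 < p) (hf : Measurable f)
    (h : ∫⁻ x, ‖f x‖ₑ ^ p ≠ ⊤) : Wt f := by
  have hc : p.HolderConjugate (p / (p - 1)) := HolderConjugate.conjExponent hp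
  have hm : Measurable fun y : ℝ => (((1 + |y|)⁻¹ : ℝ) : ℂ) := by fun_prop
  refine ⟨hf, (hm.mul hf).aestronglyMeasurable, ?_⟩
  rw [hasFiniteIntegral_iff_enorm]
  simp_rw [enorm_mul]
  refine (lintegral_mul_le_Lp_mul_Lq volume hc.symm hm.enorm.aemeasurable
    hf.enorm.aemeasurable).trans_lt ?_
  refine mul_lt_top (ENNReal.rpow_lt_top_of_nonneg (by have := hc.symm.pos; positivity) ?_)
    (ENNReal.rpow_lt_top_of_nonneg (by positivity) h)
  have h1 := finite_integral_one_add_norm (E := ℝ) (μ := volume) (r := p / (p - 1))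
    (by simpa using hc.symm.lt)
  refine ne_top_of_le_ne_top h1.ne (lintegral_mono fun y => ?_)
  rw [← ofReal_norm, norm_real, norm_of_nonneg (by positivity),
    ofReal_rpow_of_nonneg (by positivity) hc.symm.nonneg, inv_rpow (by positivity),
    rpow_neg (by positivity), norm_eq_abs]

theorem LipA.maximal_BC (hA : LipA A L) (hp : 1 < p) : ∃ K ≠ ⊤, ∀ f, BC f →
    ∃ N : ℝ → ℝ≥0∞, Measurable N ∧ (∫⁻ x, N x ^ p ≤ K * ∫⁻ x, ‖f x‖ₑ ^ p) ∧
      ∀ τ > 0, ∀ x, ‖Cr A τ f x‖ₑ ≤ N x := by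
  have hp0 : 0 < p := by linarith
  obtain ⟨K₁, hK₁, h₁⟩ := hA.enorm_Cr_add_le
  obtain ⟨K₂, hK₂, h₂⟩ := lintegral_hlMax_rpow_le hp
  obtain ⟨K₃, hK₃, h₃⟩ := hA.lintegral_Cr_rpow_BC hp
  refine ⟨K₁ ^ p * (K₂ * K₃), by finiteness, fun f hf => ?_⟩
  have hc : ∀ n : ℕ, Measurable (Cr A ((n : ℝ) + 1)⁻¹ f) := fun n => hA.measurable_Cr_right hf.meas _
  set H : ℕ → ℝ → ℝ≥0∞ := fun n x => (K₁ * hlMax (fun u => ‖Cr A ((n : ℝ) + 1)⁻¹ f u‖ₑ) x) ^ p with hH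
  have hHm : ∀ n, Measurable (H n) := fun n => ((measurable_hlMax _).const_mul _).pow_const _
  refine ⟨fun x => (liminf (fun n => H n x) atTop) ^ p⁻¹, (Measurable.liminf hHm).pow_const _, ?_, ?_⟩
  · simp_rw [← rpow_mul, inv_mul_cancel₀ hp0.ne', rpow_one]
    refine (lintegral_liminf_le hHm).trans ?_
    refine liminf_le_of_frequently_le' (Eventually.frequently (.of_forall fun n => ?_))
    simp only [hH]
    simp_rw [mul_rpow_of_nonneg _ _ hp0.le]
    rw [lintegral_const_mul _ ((measurable_hlMax _).pow_const _), mul_assoc, mul_assoc]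
    gcongr
    refine (h₂ _ (hc n).enorm.aemeasurable).trans ?_
    gcongr
    exact h₃ _ (by positivity) f hf
  · intro τ hτ x
    rw [ENNReal.le_rpow_inv_iff hp0]
    refine le_liminf_of_le (by isBoundedDefault) ?_
    have h0 : Tendsto (fun n : ℕ => ((n : ℝ) + 1)⁻¹) atTop (nhds 0) := by
      simpa using tendsto_one_div_add_atTop_nhds_zero_nat (𝕜 := ℝ)
    filter_upwards [h0.eventually (gt_mem_nhds hτ)] with n hn
    simp only [hH]
    gcongr
    have := h₁ (τ - ((n : ℝ) + 1)⁻¹) ((n : ℝ) + 1)⁻¹ (by linarith) (by positivity) f hf x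
    rwa [sub_add_cancel] at this

theorem LipA.maximal (hA : LipA A L) (hp : 1 < p) : ∃ K ≠ ⊤, ∀ f : ℝ → ℂ, Measurable f →
    ∫⁻ x, ‖f x‖ₑ ^ p ≠ ⊤ →
    ∃ N : ℝ → ℝ≥0∞, Measurable N ∧ (∫⁻ x, N x ^ p ≤ K * ∫⁻ x, ‖f x‖ₑ ^ p) ∧
      ∀ τ > 0, ∀ x, ‖Cr A τ f x‖ₑ ≤ N x := by
  have hp0 : 0 < p := by linarith
  obtain ⟨K, hK, h⟩ := hA.maximal_BC hp
  refine ⟨K, hK, fun f hf hfp => ?_⟩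
  choose N hN1 hN2 hN3 using fun n => h (trunc n f) (trunc_BC hf n)
  have hNm : ∀ n, Measurable fun x => N n x ^ p := fun n => (hN1 n).pow_const _
  refine ⟨fun x => (liminf (fun n => N n x ^ p) atTop) ^ p⁻¹, (Measurable.liminf hNm).pow_const _, ?_, ?_⟩
  · simp_rw [← rpow_mul, inv_mul_cancel₀ hp0.ne', rpow_one]
    refine (lintegral_liminf_le hNm).trans ?_
    refine liminf_le_of_frequently_le' (Eventually.frequently (.of_forall fun n => ?_))
    refine (hN2 n).trans ?_
    gcongr with x
    rw [← ofReal_norm, ← ofReal_norm]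
    exact ofReal_le_ofReal (norm_trunc_le n f x)
  · intro τ hτ x
    rw [ENNReal.le_rpow_inv_iff hp0]
    have h1 := (continuous_rpow_const (y := p)).tendsto _ |>.comp
      ((hA.tendsto_Cr_trunc hτ.ne' (wt_of_lintegral_rpow hp hf hfp) x).enorm)
    rw [← h1.liminf_eq]
    refine liminf_le_liminf (.of_forall fun n => ?_)
    simp only [Function.comp_apply]
    gcongr
    exact hN3 n τ hτ x

theorem ae_lintegral_sub_le (hf : LocallyIntegrable f) : ∀ᵐ x, ∀ ε > 0, ∃ η : ℝ, 0 < η ∧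
    ∀ r, 0 < r → r ≤ η → ∫⁻ y in ball x r, ‖f y - f x‖ₑ ≤ ofReal (2 * r) * ofReal ε := by
  filter_upwards [IsUnifLocDoublingMeasure.ae_tendsto_average_norm_sub volume hf 1] with x hx ε hε
  have h := hx (l := 𝓝[>] 0) (fun _ => x) (fun r => r) tendsto_id
    (by filter_upwards [self_mem_nhdsWithin] with r hr using Metric.mem_closedBall_self (by simpa using le_of_lt hr))
  obtain ⟨η, hη, h⟩ := (nhdsGT_basis (0 : ℝ)).eventually_iff.1 (h.eventually (gt_mem_nhds hε))
  refine ⟨η / 2, by positivity, fun r hr0 hr => ?_⟩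
  have h1 := h (show r ∈ Ioo 0 η from ⟨hr0, by linarith⟩)
  rw [setAverage_eq, measureReal_def, volume_closedBall, toReal_ofReal (by positivity), smul_eq_mul,
    inv_mul_lt_iff₀ (by positivity)] at h1
  have hi : IntegrableOn (fun y => f y - f x) (closedBall x r) :=
    (hf.integrableOn_isCompact (isCompact_closedBall x r)).sub
      (integrableOn_const (by rw [volume_closedBall]; exact ofReal_ne_top))
  calc _ ≤ ∫⁻ y in closedBall x r, ‖f y - f x‖ₑ := lintegral_mono_set Metric.ball_subset_closedBall
    _ = ofReal (∫ y in closedBall x r, ‖f y - f x‖) := (ofReal_integral_norm_eq_lintegral_enorm hi).symm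
    _ ≤ _ := by
      rw [← ofReal_mul (by positivity)]
      exact ofReal_le_ofReal h1.le

theorem Wt.locallyIntegrable (hf : Wt f) : LocallyIntegrable f := by
  have h := hf.int.locallyIntegrable.continuous_smul (g := fun y : ℝ => ((1 + |y| : ℝ) : ℂ)) (by fun_prop)
  refine h.congr (ae_of_all _ fun y => ?_)
  have : ((1 + |y| : ℝ) : ℂ) ≠ 0 := by rw [ofReal_ne_zero]; positivity
  simp only [ofReal_inv, smul_eq_mul]
  field_simp

theorem pker_le_mul_pker_one {η : ℝ} (hδ : 0 < δ) (hη : 0 < η) (hu : η ≤ |u|) :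
    pker δ u ≤ δ * (1 + η⁻¹) ^ 2 * pker 1 u := by
  unfold pker
  have hu0 : 0 < |u| := by linarith
  rw [mul_one_div, div_le_div_iff₀ (by positivity) (by positivity), mul_assoc, ← mul_pow]
  gcongr
  have h1 : 1 ≤ η⁻¹ * |u| := by rw [inv_mul_eq_div, one_le_div hη]; exact hu
  nlinarith [show 0 < η⁻¹ by positivity]

theorem Wt.lintegral_pker_one (f : ℝ → ℂ) (hf : Wt f) (x : ℝ) :
    ∫⁻ y, ofReal (pker 1 (x - y)) * ‖f y‖ₑ ≠ ⊤ := by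
  have h := hf.int.2
  rw [hasFiniteIntegral_iff_enorm] at h
  have h2 : ∫⁻ y, ofReal (1 + |x|) * ‖(((1 + |y|)⁻¹ : ℝ) : ℂ) * f y‖ₑ ≠ ⊤ := by
    rw [lintegral_ofReal_mul]
    exact mul_ne_top ofReal_ne_top h.ne
  refine ne_top_of_le_ne_top h2 (lintegral_mono fun y => ?_)
  rw [enorm_mul, ← mul_assoc]
  gcongr
  rw [← ofReal_norm, ← ofReal_mul (by positivity), norm_real, norm_of_nonneg (by positivity)]
  refine ofReal_le_ofReal ?_
  have h0 := abs_nonneg (x - y)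
  have h1 := abs_nonneg x
  have h3 : |y| ≤ |x| + |x - y| := by
    have e : y = x - (x - y) := by ring
    nth_rewrite 1 [e]; exact abs_sub _ _
  unfold pker
  rw [← div_eq_mul_inv, div_le_div_iff₀ (by positivity) (by positivity)]
  nlinarith [mul_nonneg h0 h1, mul_nonneg h0 h0, mul_nonneg h1 (mul_nonneg h0 h0)]

theorem Wt.lebesgue (hf : Wt f) : ∀ᵐ x, Tendsto
    (fun δ => ∫⁻ y, ofReal (pker δ (x - y)) * ‖f y - f x‖ₑ) (𝓝[>] 0) (nhds 0) := by
  filter_upwards [ae_lintegral_sub_le hf.locallyIntegrable] with x hx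
  have hm : Measurable fun y => ‖f y - f x‖ₑ := (hf.meas.sub_const _).enorm
  have hpm : ∀ s : ℝ, Measurable fun u : ℝ => ofReal (pker s (x - u)) := fun s =>
    ((measurable_pker s).comp (measurable_const.sub measurable_id)).ennreal_ofReal
  set J := ∫⁻ y, ofReal (pker 1 (x - y)) * ‖f y - f x‖ₑ with hJ
  have hJt : J ≠ ⊤ := by
    have h1 : ∫⁻ y, (ofReal (pker 1 (x - y)) * ‖f y‖ₑ + ofReal (pker 1 (x - y)) * ‖f x‖ₑ) ≠ ⊤ := by
      have hm1 : Measurable fun y => ofReal (pker 1 (x - y)) * ‖f y‖ₑ := (hpm 1).mul hf.meas.enorm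
      rw [lintegral_add_left hm1, lintegral_mul_const _ (hpm 1)]
      refine add_ne_top.2 ⟨hf.lintegral_pker_one _ x, mul_ne_top ?_ enorm_ne_top⟩
      exact ne_top_of_le_ne_top (by norm_num) (lintegral_pker_le one_pos x)
    refine ne_top_of_le_ne_top h1 (lintegral_mono fun y => ?_)
    rw [← mul_add]
    gcongr
    exact enorm_sub_le
  rw [tendsto_nhds_zero]
  intro ε hε
  obtain ⟨ε', hε', hle⟩ : ∃ ε' : ℝ, 0 < ε' ∧ 16 * ofReal ε' ≤ ε / 2 := by
    rcases eq_or_ne ε ⊤ with rfl | ht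
    · exact ⟨1, one_pos, by simp [ENNReal.top_div]⟩
    · have h0 : 0 < ε.toReal := toReal_pos hε.ne' ht
      refine ⟨ε.toReal / 32, by positivity, ?_⟩
      rw [show (16 : ℝ≥0∞) = ofReal 16 by simp, ← ofReal_mul (by norm_num),
        show ε / 2 = ofReal (ε.toReal / 2) by
          rw [ENNReal.ofReal_div_of_pos (by norm_num), ofReal_toReal ht]; simp]
      refine ofReal_le_ofReal (by linarith)
  obtain ⟨η, hη, hη'⟩ := hx ε' hε'
  have hlim : Tendsto (fun δ : ℝ => ofReal (δ * (1 + η⁻¹) ^ 2) * J) (𝓝[>] 0) (nhds 0) := by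
    have h1 : Tendsto (fun δ : ℝ => ofReal (δ * (1 + η⁻¹) ^ 2)) (nhds 0) (nhds 0) := by
      have : Continuous fun δ : ℝ => ofReal (δ * (1 + η⁻¹) ^ 2) :=
        continuous_ofReal.comp (by fun_prop)
      simpa using this.tendsto 0
    simpa using ENNReal.Tendsto.mul_const (h1.mono_left nhdsWithin_le_nhds) (.inr hJt)
  have hε2 : 0 < ε / 2 := ENNReal.half_pos hε.ne'
  filter_upwards [self_mem_nhdsWithin, (tendsto_nhds_zero.1 hlim) (ε / 2) hε2] with δ hδ h2
  have hδ0 : 0 < δ := hδ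
  rw [← lintegral_add_compl _ (measurableSet_ball (x := x) (ε := η)), ← ENNReal.add_halves ε]
  refine add_le_add ?_ ?_
  · rw [← lintegral_indicator measurableSet_ball]
    have e : ∀ y, (ball x η).indicator (fun y => ofReal (pker δ (x - y)) * ‖f y - f x‖ₑ) y =
        ofReal (pker δ (x - y)) * (ball x η).indicator (fun y => ‖f y - f x‖ₑ) y := fun y => by
      by_cases hy : y ∈ ball x η <;> simp [hy]
    simp_rw [e]
    refine (lintegral_pker_mul_le (hm.indicator measurableSet_ball).aemeasurable hδ0 x).trans (le_trans ?_ hle)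
    gcongr
    refine iSup₂_le fun r hr => ENNReal.div_le_of_le_mul' ?_
    rw [setLIntegral_indicator measurableSet_ball]
    rcases le_total r η with h | h
    · exact (lintegral_mono_set inter_subset_right).trans (hη' r hr h)
    · refine ((lintegral_mono_set inter_subset_left).trans (hη' η hη le_rfl)).trans ?_
      gcongr
  · refine le_trans ?_ h2
    rw [hJ, ← lintegral_ofReal_mul, ← lintegral_indicator measurableSet_ball.compl]
    refine lintegral_mono fun y => indicator_apply_le' (fun hy => ?_) (fun _ => zero_le)
    rw [← mul_assoc, ← ofReal_mul (by positivity)]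
    gcongr
    refine pker_le_mul_pker_one hδ0 hη ?_
    rw [mem_compl_iff, mem_ball, dist_comm, dist_eq, not_lt] at hy
    exact hy

theorem cauchyKernel_eq (A : ℝ → ℝ) (x y : ℝ) : cauchyKernel A x y = (zc A y - zc A x)⁻¹ := by
  unfold cauchyKernel zc
  congr 1
  ring

theorem LipA.norm_cauchyKernel_le (hA : LipA A L) (h : x ≠ y) :
    ‖cauchyKernel A x y‖ ≤ (2 + L) / |x - y| := by
  have := hA.norm_inv_le x y 0 (.inr h)
  simpa [cauchyKernel_eq] using this

theorem LipA.measurable_cauchyKernel (hA : LipA A L) (x : ℝ) : Measurable (cauchyKernel A x) := by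
  have := hA.zc_continuous.measurable
  simp_rw [funext (cauchyKernel_eq A x)]
  fun_prop

theorem tendsto_log_add_mul_I {w : ℂ} (hw : 0 < w.re) :
    Tendsto (fun s : ℝ => log (w + s * I)) (𝓝[>] 0) (nhds (log w)) := by
  have h1 : Tendsto (fun s : ℝ => w + s * I) (nhds 0) (nhds w) := by
    have : Continuous fun s : ℝ => w + s * I := by fun_prop
    simpa using this.tendsto 0
  exact ((continuousAt_clog (.inl hw)).tendsto.comp h1).mono_left nhdsWithin_le_nhds

theorem tendsto_log_sub_mul_I {w : ℂ} (hw : 0 < w.re) :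
    Tendsto (fun s : ℝ => log (w - s * I)) (𝓝[>] 0) (nhds (log w)) := by
  have h1 : Tendsto (fun s : ℝ => w - s * I) (nhds 0) (nhds w) := by
    have : Continuous fun s : ℝ => w - s * I := by fun_prop
    simpa using this.tendsto 0
  exact ((continuousAt_clog (.inl hw)).tendsto.comp h1).mono_left nhdsWithin_le_nhds

theorem LipA.integral_dz_cauchyKernel (hA : LipA A L) {b : ℝ} (hδ : 0 < δ) (hab : ∀ u ∈ uIcc a b, δ ≤ |x - u|)
    {v : ℂ} (hv : Tendsto (fun s => lg A s x b - lg A s x a) (𝓝[>] 0) (nhds v)) :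
    ∫ u in a..b, dz A u * cauchyKernel A x u = v := by
  have hL := hA.1
  refine tendsto_nhds_unique (f := fun s => lg A s x b - lg A s x a) ?_ hv
  have h1 : Tendsto (fun s => ∫ u in a..b, dz A u * kr A s x u) (𝓝[>] 0)
      (nhds (∫ u in a..b, dz A u * cauchyKernel A x u)) := by
    refine intervalIntegral.tendsto_integral_filter_of_dominated_convergence (fun _ => (1 + L) * ((2 + L) / δ))
      (.of_forall fun s => ((measurable_dz A).mul (hA.measurable_kr_right s x)).aestronglyMeasurable)
      ?_ (by simp) (ae_of_all _ fun u hu => ?_)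
    · filter_upwards [self_mem_nhdsWithin] with s hs
      refine ae_of_all _ fun u hu => ?_
      have hs0 : 0 < s := hs
      have hu' := hab u (uIoc_subset_uIcc hu)
      rw [norm_mul]
      refine mul_le_mul (hA.norm_dz_le u) ((hA.norm_kr_le hs0.ne' x u).trans ?_) (norm_nonneg _) (by positivity)
      gcongr
      linarith [abs_nonneg s]
    · have hu' := hab u (uIoc_subset_uIcc hu)
      have hne : x ≠ u := by rintro rfl; simp at hu'; linarith
      have h0 : zc A u - zc A x ≠ 0 := by
        intro h
        have := congrArg re h
        simp at this
        exact hne (by linarith)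
      refine Tendsto.const_mul _ ?_
      rw [cauchyKernel_eq]
      unfold kr
      refine Tendsto.inv₀ ?_ h0
      have : Continuous fun s : ℝ => zc A u - zc A x + s * I := by fun_prop
      simpa using (this.tendsto 0).mono_left nhdsWithin_le_nhds
  refine h1.congr' ?_
  filter_upwards [self_mem_nhdsWithin] with s hs
  have hs0 : 0 < s := hs
  obtain ⟨h2, h3⟩ := hA.lg_deriv hs0.ne' x
  refine h2.integral_eq_sub h3 ?_ a b
  refine (locallyIntegrable_const ((1 + L) * ((2 + L) / |s|))).mono
    ((measurable_dz A).mul (hA.measurable_kr_right s x)).aestronglyMeasurable (ae_of_all _ fun u => ?_)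
  rw [norm_mul, norm_of_nonneg (by positivity)]
  exact mul_le_mul (hA.norm_dz_le u) (hA.norm_kr_le' hs0.ne' x u) (norm_nonneg _) (by positivity)

theorem LipA.integral_dz_cauchyKernel_right (hA : LipA A L) {b : ℝ} (ha : x < a) (hb : x < b) :
    ∫ u in a..b, dz A u * cauchyKernel A x u = log (zc A b - zc A x) - log (zc A a - zc A x) := by
  refine hA.integral_dz_cauchyKernel (δ := min a b - x) (sub_pos.2 (lt_min ha hb)) (fun u hu => ?_) ?_
  · rw [abs_sub_comm]
    exact (sub_le_sub_right hu.1 x).trans (le_abs_self _)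
  · have h1 := (tendsto_log_add_mul_I (w := zc A b - zc A x) (by simpa using hb)).sub
      (tendsto_log_add_mul_I (w := zc A a - zc A x) (by simpa using ha))
    refine h1.congr' ?_
    filter_upwards [self_mem_nhdsWithin] with s hs
    have hs0 : 0 < s := hs
    rw [lg_of_gt hs0.ne' ha, lg_of_gt hs0.ne' hb]
    ring

theorem LipA.integral_dz_cauchyKernel_left (hA : LipA A L) {b : ℝ} (ha : a < x) (hb : b < x) :
    ∫ u in a..b, dz A u * cauchyKernel A x u = log (zc A x - zc A b) - log (zc A x - zc A a) := by
  refine hA.integral_dz_cauchyKernel (δ := x - max a b) (sub_pos.2 (max_lt ha hb)) (fun u hu => ?_) ?_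
  · exact (sub_le_sub_left hu.2 x).trans (le_abs_self _)
  · have h1 := (tendsto_log_sub_mul_I (w := zc A x - zc A b) (by simpa using hb)).sub
      (tendsto_log_sub_mul_I (w := zc A x - zc A a) (by simpa using ha))
    refine h1.congr' ?_
    filter_upwards [self_mem_nhdsWithin] with s hs
    have hs0 : 0 < s := hs
    rw [lg_of_lt hs0.ne' ha, lg_of_lt hs0.ne' hb, neg_add', neg_sub, neg_add', neg_sub]
    ring

theorem tendsto_log_slope {F' : ℂ} (hF : HasDerivAt F F' x) (h0 : 0 < F'.re)
    (hre : ∀ δ > 0, (F (x + δ) - F x).re = δ ∧ (F x - F (x - δ)).re = δ) :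
    Tendsto (fun δ : ℝ => log (F x - F (x - δ)) - log (F (x + δ) - F x)) (𝓝[>] 0)
      (nhds 0) := by
  have hs := hF.tendsto_slope
  have h1 : Tendsto (fun δ : ℝ => slope F x (x + δ)) (𝓝[>] 0) (nhds F') := by
    refine hs.comp (tendsto_nhdsWithin_iff.2 ⟨?_, ?_⟩)
    · have : Continuous fun δ : ℝ => x + δ := by fun_prop
      simpa using (this.tendsto 0).mono_left nhdsWithin_le_nhds
    · filter_upwards [self_mem_nhdsWithin] with δ hδ
      simpa using (ne_of_gt hδ)
  have h2 : Tendsto (fun δ : ℝ => slope F x (x - δ)) (𝓝[>] 0) (nhds F') := by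
    refine hs.comp (tendsto_nhdsWithin_iff.2 ⟨?_, ?_⟩)
    · have : Continuous fun δ : ℝ => x - δ := by fun_prop
      simpa using (this.tendsto 0).mono_left nhdsWithin_le_nhds
    · filter_upwards [self_mem_nhdsWithin] with δ hδ
      simpa using (ne_of_gt hδ)
  have hc := (continuousAt_clog (x := F') (.inl h0)).tendsto
  have h3 := (hc.comp h2).sub (hc.comp h1)
  rw [sub_self] at h3
  refine h3.congr' ?_
  filter_upwards [self_mem_nhdsWithin] with δ hδ
  have hδ0 : 0 < δ := hδ
  obtain ⟨r1, r2⟩ := hre δ hδ0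
  have e : ∀ w : ℂ, w.re = δ → log w = Real.log δ + log ((δ : ℂ)⁻¹ * w) := fun w hw => by
    have : (δ : ℂ) ≠ 0 := by exact_mod_cast hδ0.ne'
    rw [← Complex.log_ofReal_mul hδ0, mul_inv_cancel_left₀ this]
    refine mul_ne_zero (inv_ne_zero this) fun h => ?_
    rw [h] at hw
    exact hδ0.ne' (by simpa using hw.symm)
  rw [e _ r1, e _ r2]
  simp only [Function.comp_apply, slope, vsub_eq_sub, Complex.real_smul]
  have e1 : x - δ - x = -δ := by ring
  have e2 : x + δ - x = δ := by ring
  rw [e1, e2]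
  push_cast
  rw [inv_neg, show -((δ : ℂ)⁻¹) * (F (x - δ) - F x) = (δ : ℂ)⁻¹ * (F x - F (x - δ)) by ring]
  ring

/-- The truncated Cauchy integral. -/
def Tr (A : ℝ → ℝ) (δ : ℝ) (f : ℝ → ℂ) (x : ℝ) : ℂ :=
  ∫ y in {y : ℝ | δ < |y - x|}, cauchyKernel A x y * f y

/-- The truncated Cauchy kernel. -/
def tk (A : ℝ → ℝ) (δ x : ℝ) : ℝ → ℂ := {y : ℝ | δ < |y - x|}.indicator (cauchyKernel A x)

theorem measurableSet_far (δ x : ℝ) : MeasurableSet {y : ℝ | δ < |y - x|} :=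
  measurableSet_lt measurable_const (by fun_prop)

theorem Tr_eq (A : ℝ → ℝ) (δ : ℝ) (f : ℝ → ℂ) (x : ℝ) : Tr A δ f x = ∫ y, tk A δ x y * f y := by
  unfold Tr
  rw [← integral_indicator (measurableSet_far δ x)]
  refine integral_congr_ae (ae_of_all _ fun y => ?_)
  simp only [tk, indicator_mul_left]

theorem cauchyPV_iff {v : ℂ} :
    cauchyPV A f x v ↔ Tendsto (fun δ => Tr A δ f x) (𝓝[>] 0) (nhds v) := Iff.rfl

theorem LipA.measurable_tk (hA : LipA A L) (δ x : ℝ) : Measurable (tk A δ x) :=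
  (hA.measurable_cauchyKernel x).indicator (measurableSet_far δ x)

theorem LipA.norm_tk_le (hA : LipA A L) (hδ : 0 < δ) (x y : ℝ) :
    ‖tk A δ x y‖ ≤ 2 * (2 + L) / (δ + |x - y|) := by
  have hL := hA.1
  unfold tk
  by_cases h : y ∈ {y : ℝ | δ < |y - x|}
  · rw [indicator_of_mem h]
    have h1 : δ < |x - y| := by rw [abs_sub_comm]; exact h
    have hne : x ≠ y := by rintro rfl; simp at h1; linarith
    refine (hA.norm_cauchyKernel_le hne).trans ?_
    rw [div_le_div_iff₀ (by linarith) (by linarith)]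
    nlinarith
  · rw [indicator_of_notMem h, norm_zero]
    positivity

theorem Wt.integrable_mul {k : ℝ → ℂ} (hf : Wt f) (hk : Measurable k) (hτ : 0 < τ)
    (hc : ∀ y, ‖k y‖ ≤ c / (τ + |x - y|)) : Integrable fun y => k y * f y := by
  have hm : Measurable fun y : ℝ => ((1 + |y| : ℝ) : ℂ) * k y := Measurable.mul (by fun_prop) hk
  refine (hf.int.bdd_mul (c := c * ((1 + |x|) / τ + 1)) hm.aestronglyMeasurable (ae_of_all _ fun y => ?_)).congr
    (ae_of_all _ fun y => ?_)
  · have hy : 0 < 1 + |y| := by positivity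
    rw [norm_mul, norm_real, norm_of_nonneg hy.le]
    have h1 : 1 + |y| ≤ ((1 + |x|) / τ + 1) * (τ + |x - y|) := by
      have h2 : |y| ≤ |x| + |x - y| := by
        have e : y = x - (x - y) := by ring
        nth_rewrite 1 [e]; exact abs_sub _ _
      have h3 : (1 + |x|) / τ * τ = 1 + |x| := by field_simp
      have : 0 ≤ (1 + |x|) / τ * |x - y| := by positivity
      nlinarith
    calc _ ≤ ((1 + |x|) / τ + 1) * (τ + |x - y|) * (c / (τ + |x - y|)) := by
          gcongr
          exact hc y
      _ = _ := by
        have : τ + |x - y| ≠ 0 := by positivity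
        field_simp
  · have hy : ((1 + |y| : ℝ) : ℂ) ≠ 0 := by
      rw [ofReal_ne_zero]; positivity
    simp only [ofReal_inv]
    field_simp

theorem LipA.integrable_tk_mul (hA : LipA A L) (hf : Wt f) (hδ : 0 < δ) (x : ℝ) :
    Integrable fun y => tk A δ x y * f y :=
  hf.integrable_mul (hA.measurable_tk δ x) hδ (hA.norm_tk_le hδ x)

theorem tendsto_setIntegral_far {h : ℝ → ℂ} (hh : Integrable h) (x : ℝ) :
    Tendsto (fun δ : ℝ => ∫ y in {y : ℝ | δ < |y - x|}, h y) (𝓝[>] 0) (nhds (∫ y, h y)) := by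
  simp_rw [← integral_indicator (measurableSet_far _ x)]
  refine tendsto_integral_filter_of_dominated_convergence (fun y => ‖h y‖)
    (.of_forall fun δ => hh.1.indicator (measurableSet_far δ x))
    (.of_forall fun δ => ae_of_all _ fun y => norm_indicator_le_norm_self _ _) hh.norm ?_
  filter_upwards [compl_mem_ae_iff.2 (measure_singleton x)] with y hy
  refine tendsto_const_nhds.congr' ?_
  have hy' : 0 < |y - x| := abs_pos.2 (sub_ne_zero.2 hy)
  filter_upwards [nhdsWithin_le_nhds (Iio_mem_nhds hy')] with δ hδ
  have : y ∈ {y : ℝ | δ < |y - x|} := hδ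
  rw [indicator_of_mem this]

theorem LipA.integral_annulus (hA : LipA A L) (hδ : 0 < δ) (hR : δ < R) :
    ∫ u in {y : ℝ | δ < |y - x|} ∩ Icc (x - R) (x + R), dz A u * cauchyKernel A x u =
      log (zc A (x + R) - zc A x) - log (zc A x - zc A (x - R)) +
      (log (zc A x - zc A (x - δ)) - log (zc A (x + δ) - zc A x)) := by
  have hL := hA.1
  have e : {y : ℝ | δ < |y - x|} ∩ Icc (x - R) (x + R) = Ico (x - R) (x - δ) ∪ Ioc (x + δ) (x + R) := by
    ext y
    simp only [mem_inter_iff, mem_ofPred_eq, mem_Icc, mem_union, mem_Ico, mem_Ioc, lt_abs]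
    constructor
    · rintro ⟨h | h, h1, h2⟩
      · right; constructor <;> linarith
      · left; constructor <;> linarith
    · rintro (⟨h1, h2⟩ | ⟨h1, h2⟩)
      · exact ⟨Or.inr (by linarith), by linarith, by linarith⟩
      · exact ⟨Or.inl (by linarith), by linarith, by linarith⟩
  have hb : IntegrableOn (fun u => dz A u * cauchyKernel A x u)
      ({y : ℝ | δ < |y - x|} ∩ Icc (x - R) (x + R)) := by
    refine Measure.integrableOn_of_bounded (M := (1 + L) * ((2 + L) / δ)) ?_
      ((measurable_dz A).mul (hA.measurable_cauchyKernel x)).aestronglyMeasurable ?_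
    · refine ne_top_of_le_ne_top ?_ (measure_mono inter_subset_right)
      rw [volume_Icc]; exact ofReal_ne_top
    · refine (ae_restrict_mem ((measurableSet_far δ x).inter measurableSet_Icc)).mono fun u hu => ?_
      have h1 : δ < |x - u| := by rw [abs_sub_comm]; exact hu.1
      have hne : x ≠ u := by rintro rfl; simp at h1; linarith
      rw [norm_mul]
      refine mul_le_mul (hA.norm_dz_le u) ((hA.norm_cauchyKernel_le hne).trans ?_) (norm_nonneg _) (by positivity)
      gcongr
  rw [e] at hb ⊢
  rw [setIntegral_union ?_ measurableSet_Ioc (hb.mono_set subset_union_left) (hb.mono_set subset_union_right),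
    integral_Ico_eq_integral_Ioc, ← intervalIntegral.integral_of_le (by linarith),
    ← intervalIntegral.integral_of_le (by linarith),
    hA.integral_dz_cauchyKernel_left (by linarith) (by linarith),
    hA.integral_dz_cauchyKernel_right (by linarith) (by linarith)]
  · ring
  · rw [Set.disjoint_left]
    intro y h1 h2
    have := h1.2; have := h2.1
    linarith

theorem LipA.exists_cauchyPV_of_lipschitz (hA : LipA A L) {Λ : NNReal} (hg : LipschitzWith Λ g)
    (hc : HasCompactSupport g) : ∀ᵐ x, ∃ v, cauchyPV A (fun y => dz A y * g y) x v := by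
  have hL := hA.1
  filter_upwards [hA.hasDerivAt_zc] with x hx
  obtain ⟨R, hR0, hR⟩ : ∃ R > 0, ∀ y, R < |y - x| → g y = 0 := by
    obtain ⟨R, hR⟩ := hc.isCompact.isBounded.subset_closedBall x
    refine ⟨max R 1, by positivity, fun y hy => image_eq_zero_of_notMem_tsupport fun h => ?_⟩
    have := hR h
    rw [Metric.mem_closedBall, dist_eq] at this
    exact absurd ((le_max_left R 1).trans_lt hy) (not_lt.2 this)
  set h : ℝ → ℂ := (Icc (x - R) (x + R)).indicator (fun y => dz A y * cauchyKernel A x y * (g y - g x)) with hh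
  have hmem : ∀ y, y ∈ Icc (x - R) (x + R) ↔ |y - x| ≤ R := fun y => by
    rw [abs_le, mem_Icc]; constructor <;> rintro ⟨h1, h2⟩ <;> constructor <;> linarith
  have hgm : Measurable g := hg.continuous.measurable
  have hnt : Integrable h := by
    rw [hh, integrable_indicator_iff measurableSet_Icc]
    refine Measure.integrableOn_of_bounded (M := (1 + L) * ((2 + L) * Λ))
      (by rw [volume_Icc]; exact ofReal_ne_top)
      ((((measurable_dz A).mul (hA.measurable_cauchyKernel x))).mul (hgm.sub_const _)).aestronglyMeasurable
      (ae_of_all _ fun u => ?_)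
    rw [norm_mul, norm_mul, mul_assoc]
    refine mul_le_mul (hA.norm_dz_le u) ?_ (by positivity) (by positivity)
    rcases eq_or_ne x u with rfl | hne
    · simp; positivity
    · have h1 : 0 < |x - u| := abs_pos.2 (sub_ne_zero.2 hne)
      have h2 := hg.dist_le_mul u x
      rw [dist_eq_norm, dist_eq, abs_sub_comm] at h2
      calc _ ≤ (2 + L) / |x - u| * (Λ * |x - u|) := by
            gcongr
            exact hA.norm_cauchyKernel_le hne
        _ = _ := by field_simp
  have hK : ∀ δ > 0, IntegrableOn (fun u => dz A u * cauchyKernel A x u)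
      ({y : ℝ | δ < |y - x|} ∩ Icc (x - R) (x + R)) := fun δ hδ => by
    refine Measure.integrableOn_of_bounded (M := (1 + L) * ((2 + L) / δ)) ?_
      ((measurable_dz A).mul (hA.measurable_cauchyKernel x)).aestronglyMeasurable ?_
    · refine ne_top_of_le_ne_top ?_ (measure_mono inter_subset_right)
      rw [volume_Icc]; exact ofReal_ne_top
    · refine (ae_restrict_mem ((measurableSet_far δ x).inter measurableSet_Icc)).mono fun u hu => ?_
      have h1 : δ < |x - u| := by rw [abs_sub_comm]; exact hu.1
      have hne : x ≠ u := by rintro rfl; simp at h1; linarith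
      rw [norm_mul]
      refine mul_le_mul (hA.norm_dz_le u) ((hA.norm_cauchyKernel_le hne).trans ?_) (norm_nonneg _) (by positivity)
      gcongr
  have hlog := tendsto_log_slope hx (by simp) (fun δ _ => by simp)
  refine ⟨_, cauchyPV_iff.2 (((tendsto_setIntegral_far hnt x).add
    ((tendsto_const_nhds (x := log (zc A (x + R) - zc A x) - log (zc A x - zc A (x - R)))).add
      hlog |>.mul_const (g x))).congr' ?_)⟩
  filter_upwards [self_mem_nhdsWithin, nhdsWithin_le_nhds (Iio_mem_nhds hR0)] with δ hδ hδR
  have hδ0 : 0 < δ := hδ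
  rw [← hA.integral_annulus hδ0 hδR, hh, setIntegral_indicator measurableSet_Icc, ← integral_mul_const,
    ← integral_add ?_ ((hK δ hδ0).mul_const (g x))]
  · unfold Tr
    rw [← setIntegral_eq_of_subset_of_forall_sdiff_eq_zero (measurableSet_far δ x) inter_subset_left
      (s := {y : ℝ | δ < |y - x|} ∩ Icc (x - R) (x + R))]
    · refine integral_congr_ae (ae_of_all _ fun y => ?_)
      simp only
      ring
    · intro y hy
      have hy2 : R < |y - x| := by
        by_contra hcon
        exact hy.2 ⟨hy.1, (hmem y).2 (not_lt.1 hcon)⟩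
      simp [hR y hy2]
  · have := (integrable_indicator_iff measurableSet_Icc).1 hnt
    exact this.mono_set inter_subset_right

theorem LipA.norm_kr_sub_tk_le (hA : LipA A L) (hδ : 0 < δ) (x y : ℝ) :
    ‖kr A δ x y - tk A δ x y‖ ≤ 2 * (2 + L) ^ 2 * pker δ (x - y) := by
  have hL := hA.1
  have h0 := abs_nonneg (x - y)
  have hk := hA.norm_kr_le hδ.ne' x y
  rw [abs_of_pos hδ] at hk
  unfold pker
  by_cases h : y ∈ {y : ℝ | δ < |y - x|}
  · have h1 : δ < |x - y| := by rw [abs_sub_comm]; exact h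
    have hne : x ≠ y := by rintro rfl; simp at h1; linarith
    have e : kr A δ x y - tk A δ x y = -(δ * I) * (kr A δ x y * cauchyKernel A x y) := by
      unfold tk
      rw [indicator_of_mem h, cauchyKernel_eq]
      unfold kr
      have hz : zc A y - zc A x ≠ 0 := fun h => by
        have := congrArg re h
        simp at this
        exact hne (by linarith)
      have hz2 : zc A y - zc A x + δ * I ≠ 0 := hA.ne_zero x y hδ.ne'
      field_simp
      ring
    rw [e, norm_mul, norm_mul]
    have h2 := hA.norm_cauchyKernel_le hne
    have h3 : ‖-((δ : ℂ) * I)‖ = δ := by simp [abs_of_pos hδ]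
    rw [h3]
    calc _ ≤ δ * ((2 + L) / (δ + |x - y|) * ((2 + L) / |x - y|)) := by gcongr
      _ ≤ δ * ((2 + L) / (δ + |x - y|) * (2 * (2 + L) / (δ + |x - y|))) := by
        gcongr δ * (_ * ?_)
        rw [div_le_div_iff₀ (by linarith) (by linarith)]
        nlinarith
      _ = _ := by
        have : δ + |x - y| ≠ 0 := by positivity
        field_simp
  · have h1 : |x - y| ≤ δ := by rw [abs_sub_comm]; exact not_lt.1 h
    unfold tk
    rw [indicator_of_notMem h, sub_zero]
    refine hk.trans ?_
    rw [mul_div_assoc', div_le_div_iff₀ (by positivity) (by positivity)]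
    have h2 : 2 + L ≤ (2 + L) ^ 2 := by nlinarith
    have : (δ + |x - y|) ^ 2 ≤ 2 * δ * (δ + |x - y|) := by nlinarith
    calc (2 + L) * (δ + |x - y|) ^ 2 ≤ (2 + L) ^ 2 * (2 * δ * (δ + |x - y|)) := by gcongr
      _ = _ := by ring

theorem LipA.enorm_integral_kr_sub_tk_le (hA : LipA A L) (hδ : 0 < δ) (f : ℝ → ℂ) (x : ℝ) :
    ‖∫ y, (kr A δ x y - tk A δ x y) * f y‖ₑ ≤
      ofReal (2 * (2 + L) ^ 2) * ∫⁻ y, ofReal (pker δ (x - y)) * ‖f y‖ₑ := by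
  refine (enorm_integral_le_lintegral_enorm _).trans ?_
  rw [← lintegral_ofReal_mul]
  refine lintegral_mono fun y => ?_
  rw [enorm_mul, ← mul_assoc, ← ofReal_mul (by positivity), ← ofReal_norm]
  gcongr
  exact hA.norm_kr_sub_tk_le hδ x y

theorem LipA.Cr_sub_Tr (hA : LipA A L) (hδ : 0 < δ) (hf : Wt f) (x : ℝ) :
    Cr A δ f x - Tr A δ f x = ∫ y, (kr A δ x y - tk A δ x y) * f y := by
  unfold Cr
  rw [Tr_eq, ← integral_sub (hA.integrable_kr_mul_Wt hδ.ne' hf x) (hA.integrable_tk_mul hf hδ x)]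
  simp_rw [sub_mul]

theorem LipA.maximal_Tr (hA : LipA A L) (hp : 1 < p) : ∃ K ≠ ⊤, ∀ f : ℝ → ℂ, Measurable f →
    ∫⁻ x, ‖f x‖ₑ ^ p ≠ ⊤ → ∃ N : ℝ → ℝ≥0∞, Measurable N ∧ ∫⁻ x, N x ^ p ≤ K * ∫⁻ x, ‖f x‖ₑ ^ p ∧
      ∀ δ > 0, ∀ x, ‖Tr A δ f x‖ₑ ≤ N x := by
  obtain ⟨K, hK, h⟩ := hA.maximal hp
  obtain ⟨C, hC, h'⟩ := lintegral_hlMax_rpow_le hp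
  have hL := hA.1
  set c := ofReal (2 * (2 + L) ^ 2) * 16
  have hc : c ≠ ⊤ := mul_ne_top ofReal_ne_top (by norm_num)
  have hp0 : 0 ≤ p := by linarith
  refine ⟨2 ^ p * (K + c ^ p * C), by finiteness, fun f hf hft => ?_⟩
  obtain ⟨N, hN, hNp, hNC⟩ := h f hf hft
  have hm := measurable_hlMax (fun x => ‖f x‖ₑ)
  refine ⟨fun x => N x + c * hlMax (fun x => ‖f x‖ₑ) x, hN.add (hm.const_mul _), ?_, fun δ hδ x => ?_⟩
  · calc _ ≤ ∫⁻ x, 2 ^ p * (N x ^ p + c ^ p * hlMax (fun x => ‖f x‖ₑ) x ^ p) := lintegral_mono fun x => by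
          rw [← mul_rpow_of_nonneg _ _ hp0]
          exact add_rpow_le _ _ hp.le
      _ ≤ _ := by
        have hm' : Measurable fun x => c ^ p * hlMax (fun x => ‖f x‖ₑ) x ^ p := (hm.pow_const p).const_mul _
        rw [lintegral_const_mul' _ _ (by finiteness), lintegral_add_right _ hm',
          lintegral_const_mul' _ _ (by finiteness), mul_assoc, add_mul, mul_assoc]
        gcongr
        exact h' _ hf.enorm.aemeasurable
  · have hw := wt_of_lintegral_rpow hp hf hft
    have e : Tr A δ f x = Cr A δ f x - ∫ y, (kr A δ x y - tk A δ x y) * f y := by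
      rw [← hA.Cr_sub_Tr hδ hw]; ring
    rw [e]
    refine enorm_sub_le.trans (add_le_add (hNC δ hδ x) ((hA.enorm_integral_kr_sub_tk_le hδ f x).trans ?_))
    rw [mul_assoc]
    gcongr
    exact lintegral_pker_mul_le hf.enorm.aemeasurable hδ x

theorem LipA.Tr_sub (hA : LipA A L) (hδ : 0 < δ) (hf : Wt f) (hg : Wt g) (x : ℝ) :
    Tr A δ (fun y => f y - g y) x = Tr A δ f x - Tr A δ g x := by
  simp_rw [Tr_eq]
  rw [← integral_sub (hA.integrable_tk_mul hf hδ x) (hA.integrable_tk_mul hg hδ x)]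
  simp_rw [mul_sub]

theorem exists_tendsto_of_approx (h : ∀ ε > 0, ∃ G : ℝ → ℂ, (∃ v, Tendsto G (𝓝[>] 0) (nhds v)) ∧ ∀ δ > 0, ‖F δ - G δ‖ ≤ ε) :
    ∃ v, Tendsto F (𝓝[>] 0) (nhds v) := by
  refine cauchy_map_iff_exists_tendsto.1 (Metric.cauchy_iff.2 ⟨inferInstance, fun ε hε => ?_⟩)
  obtain ⟨G, ⟨v, hv⟩, hG⟩ := h (ε / 4) (by positivity)
  refine ⟨F '' {δ | 0 < δ ∧ ‖G δ - v‖ < ε / 4}, image_mem_map ?_, ?_⟩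
  · filter_upwards [self_mem_nhdsWithin, (Metric.tendsto_nhds.1 hv) (ε / 4) (by positivity)] with δ h1 h2
    exact ⟨h1, by rwa [dist_eq_norm] at h2⟩
  · have key : ∀ δ, 0 < δ ∧ ‖G δ - v‖ < ε / 4 → dist (F δ) v < ε / 2 := fun δ hδ => by
      rw [dist_eq_norm]
      calc _ = ‖(F δ - G δ) + (G δ - v)‖ := by ring_nf
        _ ≤ ‖F δ - G δ‖ + ‖G δ - v‖ := norm_add_le _ _
        _ < _ := by linarith [hG δ hδ.1, hδ.2]
    rintro _ ⟨δ, hδ, rfl⟩ _ ⟨δ', hδ', rfl⟩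
    calc _ ≤ dist (F δ) v + dist (F δ') v := dist_triangle_right _ _ _
      _ < _ := by linarith [key δ hδ, key δ' hδ']

theorem exists_lipschitz_lintegral_sub_le (hp : 1 < p) (hf : Measurable f)
    (hft : ∫⁻ x, ‖f x‖ₑ ^ p ≠ ⊤) {ε : ℝ≥0∞} (hε : ε ≠ 0) : ∃ (g : ℝ → ℂ) (Λ : NNReal), LipschitzWith Λ g ∧
      HasCompactSupport g ∧ ∫⁻ x, ‖f x - g x‖ₑ ^ p ≤ ε := by
  have hp0 : 0 < p := by linarith
  have hpt : ofReal p ≠ ⊤ := ofReal_ne_top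
  have hpz : ofReal p ≠ 0 := by simpa using hp0
  have hpr : (ofReal p).toReal = p := toReal_ofReal hp0.le
  have hm : MemLp f (ofReal p) volume := by
    refine ⟨hf.aestronglyMeasurable, (eLpNorm_lt_top_iff_lintegral_rpow_enorm_lt_top hpz hpt).2 ?_⟩
    rw [hpr]; exact hft.lt_top
  obtain ⟨r, hr0, hr⟩ : ∃ r > 0, ofReal r ^ p ≤ ε := by
    rcases eq_or_ne ε ⊤ with rfl | ht
    · exact ⟨1, one_pos, le_top⟩
    · refine ⟨(ε ^ p⁻¹).toReal, toReal_pos (by simp [hε, ht]) (by finiteness), ?_⟩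
      rw [ofReal_toReal (by finiteness), ← rpow_mul, inv_mul_cancel₀ hp0.ne', rpow_one]
  obtain ⟨g, hg, hgs, h⟩ := hm.exist_eLpNorm_sub_le hpt (by simpa using hp.le) hr0
  obtain ⟨Λ, hΛ⟩ := hgs.lipschitzWith_of_hasCompactSupport hg (by simp)
  refine ⟨g, Λ, hΛ, hg, le_trans ?_ hr⟩
  rw [eLpNorm_eq_lintegral_rpow_enorm_toReal hpz hpt, hpr, one_div] at h
  calc _ = ((∫⁻ x, ‖(f - g) x‖ₑ ^ p) ^ p⁻¹) ^ p := by
        rw [← rpow_mul, inv_mul_cancel₀ hp0.ne', rpow_one]; rfl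
    _ ≤ _ := by gcongr

theorem LipA.exists_approx (hA : LipA A L) (hp : 1 < p) (hf : Measurable f)
    (hft : ∫⁻ x, ‖f x‖ₑ ^ p ≠ ⊤) {ε : ℝ≥0∞} (hε : ε ≠ 0) : ∃ g : ℝ → ℂ, Wt g ∧
      (∀ᵐ x, ∃ v, cauchyPV A g x v) ∧ ∫⁻ x, ‖f x - g x‖ₑ ^ p ≤ ε := by
  have hL := hA.1
  have hp0 : 0 < p := by linarith
  have hdz : ∀ x, dz A x ≠ 0 := fun x h => by
    have := one_le_norm_dz A x
    rw [h, norm_zero] at this; linarith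
  have hb : ∀ x, ‖f x‖ₑ = ‖dz A x‖ₑ * ‖(dz A x)⁻¹ * f x‖ₑ := fun x => by
    rw [← enorm_mul, mul_inv_cancel_left₀ (hdz x)]
  have h1 : ∫⁻ x, ‖(dz A x)⁻¹ * f x‖ₑ ^ p ≠ ⊤ := by
    refine ne_top_of_le_ne_top hft (lintegral_mono fun x => ?_)
    gcongr 1
    rw [hb x]
    refine le_mul_of_one_le_left' ?_
    rw [← ofReal_norm, one_le_ofReal]
    exact one_le_norm_dz A x
  have hc : ofReal (1 + L) ^ p ≠ ⊤ := by finiteness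
  obtain ⟨g, Λ, hg, hgs, h⟩ := exists_lipschitz_lintegral_sub_le hp ((measurable_dz A).inv.mul hf) h1
    (ε := ε / ofReal (1 + L) ^ p) (ENNReal.div_ne_zero.2 ⟨hε, hc⟩)
  refine ⟨fun y => dz A y * g y, ?_, hA.exists_cauchyPV_of_lipschitz hg hgs, ?_⟩
  · have hm : Measurable fun y => dz A y * g y := (measurable_dz A).mul hg.continuous.measurable
    refine ⟨hm, ?_⟩
    have hi := hg.continuous.integrable_of_hasCompactSupport (μ := volume) hgs
    have hw : Measurable fun y : ℝ => (((1 + |y|)⁻¹ : ℝ) : ℂ) * dz A y :=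
      Measurable.mul (by fun_prop) (measurable_dz A)
    refine (hi.bdd_mul (c := 1 * (1 + L)) hw.aestronglyMeasurable (ae_of_all _ fun y => ?_)).congr
      (ae_of_all _ fun y => by simp only; ring)
    rw [norm_mul, norm_real, norm_of_nonneg (by positivity)]
    refine mul_le_mul (inv_le_one_of_one_le₀ ?_) (hA.norm_dz_le y) (norm_nonneg _) zero_le_one
    linarith [abs_nonneg y]
  · calc _ ≤ ∫⁻ x, ofReal (1 + L) ^ p * ‖(dz A x)⁻¹ * f x - g x‖ₑ ^ p := lintegral_mono fun x => by
          rw [← mul_rpow_of_nonneg _ _ hp0.le]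
          gcongr 1
          have e : f x - dz A x * g x = dz A x * ((dz A x)⁻¹ * f x - g x) := by
            rw [mul_sub, mul_inv_cancel_left₀ (hdz x)]
          rw [e, enorm_mul]
          gcongr
          rw [← ofReal_norm]
          exact ofReal_le_ofReal (hA.norm_dz_le x)
      _ ≤ _ := by
        rw [lintegral_const_mul' _ _ hc]
        exact (mul_le_mul_right h _).trans ENNReal.mul_div_le

theorem LipA.exists_cauchyPV_of_rpow (hA : LipA A L) (hp : 1 < p) (hf : Measurable f)
    (hft : ∫⁻ x, ‖f x‖ₑ ^ p ≠ ⊤) : ∀ᵐ x, ∃ v, cauchyPV A f x v := by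
  have hp0 : 0 < p := by linarith
  have hwf := wt_of_lintegral_rpow hp hf hft
  obtain ⟨K, hK, hmax⟩ := hA.maximal_Tr hp
  have hn0 : ∀ n : ℕ, ((n : ℝ≥0∞) + 1)⁻¹ ≠ 0 := fun n => by simp
  choose g hgw hgpv hgp using fun n : ℕ => hA.exists_approx hp hf hft (hn0 n)
  have hd : ∀ n, Measurable fun x => f x - g n x := fun n => hf.sub (hgw n).meas
  choose N hNm hN hNb using fun n => hmax _ (hd n)
    (ne_top_of_le_ne_top (by simp) (hgp n))
  have hinf : ∀ᵐ x, ⨅ n, N n x ^ p = 0 := by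
    refine (lintegral_eq_zero_iff (Measurable.iInf fun n => (hNm n).pow_const p)).1 ?_
    have h1 : ∀ n : ℕ, ∫⁻ x, ⨅ n, N n x ^ p ≤ K * ((n : ℝ≥0∞) + 1)⁻¹ := fun n =>
      (lintegral_mono fun x => iInf_le _ n).trans ((hN n).trans (mul_le_mul_right (hgp n) _))
    have h2 : Tendsto (fun n : ℕ => K * ((n : ℝ≥0∞) + 1)⁻¹) atTop (nhds 0) := by
      have h3 := ENNReal.tendsto_inv_nat_nhds_zero.comp (tendsto_add_atTop_nat 1)
      have := ENNReal.Tendsto.const_mul h3 (.inr hK)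
      simpa [Function.comp_def] using this
    exact le_antisymm (ge_of_tendsto' h2 h1) zero_le
  filter_upwards [hinf, ae_all_iff.2 hgpv] with x hx hpv
  refine exists_tendsto_of_approx (F := fun δ => Tr A δ f x) fun ε hε => ?_
  have h0 : ⨅ n, N n x ^ p < ofReal ε ^ p := by
    rw [hx]
    exact rpow_pos (by simpa) ofReal_ne_top
  obtain ⟨n, hn⟩ := iInf_lt_iff.1 h0
  refine ⟨fun δ => Tr A δ (g n) x, hpv n, fun δ hδ => ?_⟩
  have h1 := (hNb n δ hδ x).trans ((ENNReal.rpow_lt_rpow_iff hp0).1 hn).le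
  rw [hA.Tr_sub hδ hwf (hgw n), ← ofReal_norm] at h1
  exact (ofReal_le_ofReal_iff hε.le).1 h1

theorem LipA.exists_cauchyPV (hA : LipA A L) (hq : 1 < q) {h : ℝ → ℂ} (hw : Wt h)
    (hloc : ∀ n : ℕ, ∫⁻ x in ball 0 n, ‖h x‖ₑ ^ q ≠ ⊤) : ∀ᵐ x, ∃ v, cauchyPV A h x v := by
  have hq0 : 0 < q := by linarith
  have key : ∀ n : ℕ, ∀ᵐ x, ∃ v, cauchyPV A ((ball 0 n).indicator h) x v := fun n => by
    refine hA.exists_cauchyPV_of_rpow hq (hw.meas.indicator measurableSet_ball) ?_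
    have e : ∀ x, ‖(ball (0 : ℝ) n).indicator h x‖ₑ ^ q = (ball (0 : ℝ) n).indicator
        (fun x => ‖h x‖ₑ ^ q) x := fun x => by
      by_cases hx : x ∈ ball (0 : ℝ) n <;> simp [hx, hq0]
    simp_rw [e]
    rw [lintegral_indicator measurableSet_ball]
    exact hloc n
  filter_upwards [ae_all_iff.2 key] with x hx
  obtain ⟨n, hn⟩ := exists_nat_gt (|x| + 1)
  obtain ⟨v, hv⟩ := hx n
  have hw1 : Wt ((ball (0 : ℝ) n).indicator h) :=
    hw.mono (hw.meas.indicator measurableSet_ball) fun y => norm_indicator_le_norm_self _ _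
  refine ⟨v + Tr A 1 (fun y => h y - (ball (0 : ℝ) n).indicator h y) x, cauchyPV_iff.2 ?_⟩
  refine ((cauchyPV_iff.1 hv).add_const _).congr' ?_
  filter_upwards [self_mem_nhdsWithin, nhdsWithin_le_nhds (Iio_mem_nhds one_pos)] with δ hδ hδ1
  have hδ0 : 0 < δ := hδ
  have hδ2 : δ < 1 := hδ1
  have e : Tr A 1 (fun y => h y - (ball (0 : ℝ) n).indicator h y) x =
      Tr A δ (fun y => h y - (ball (0 : ℝ) n).indicator h y) x := by
    simp_rw [Tr_eq]
    refine integral_congr_ae (ae_of_all _ fun y => ?_)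
    simp only
    by_cases hy : y ∈ ball (0 : ℝ) n
    · simp [hy]
    · have hy1 : 1 < |y - x| := by
        rw [mem_ball, dist_eq, sub_zero, not_lt] at hy
        have := abs_sub_abs_le_abs_sub y x
        linarith
      have h1 : y ∈ {y : ℝ | 1 < |y - x|} := hy1
      have h2 : y ∈ {y : ℝ | δ < |y - x|} := hδ2.trans hy1
      simp only [tk, indicator_of_mem h1, indicator_of_mem h2]
  rw [e, hA.Tr_sub hδ0 hw hw1]
  ring

theorem LipA.ae_commutator (hA : LipA A L) (hf : Wt f) (hbf : Wt fun y => (b y : ℂ) * f y)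
    (h1 : ∀ᵐ x, ∃ v, cauchyPV A f x v) (h2 : ∀ᵐ x, ∃ v, cauchyPV A (fun y => (b y : ℂ) * f y) x v) :
    ∀ᵐ x, ∃ u w, cauchyPV A f x u ∧ cauchyPV A (fun y => (b y : ℂ) * f y) x w ∧
      Tendsto (fun τ => (b x : ℂ) * Cr A τ f x - Cr A τ (fun y => (b y : ℂ) * f y) x) (𝓝[>] 0)
        (nhds ((b x : ℂ) * u - w)) := by
  filter_upwards [h1, h2, hf.lebesgue, hbf.lebesgue] with x ⟨u, hu⟩ ⟨w, hw⟩ hl1 hl2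
  refine ⟨u, w, hu, hw, ?_⟩
  set c := ofReal (2 * (2 + L) ^ 2)
  have hd : Tendsto (fun τ => (b x : ℂ) * (Cr A τ f x - Tr A τ f x) -
      (Cr A τ (fun y => (b y : ℂ) * f y) x - Tr A τ (fun y => (b y : ℂ) * f y) x)) (𝓝[>] 0) (nhds 0) := by
    have hlim : Tendsto (fun τ => c * (‖b x‖ₑ * ∫⁻ y, ofReal (pker τ (x - y)) * ‖f y - f x‖ₑ) +
        c * ∫⁻ y, ofReal (pker τ (x - y)) * ‖(b y : ℂ) * f y - (b x : ℂ) * f x‖ₑ)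
        (𝓝[>] 0) (nhds 0) := by
      have := (ENNReal.Tendsto.const_mul (a := c) (ENNReal.Tendsto.const_mul (a := ‖b x‖ₑ) hl1 (.inr enorm_ne_top))
        (.inr ofReal_ne_top)).add (ENNReal.Tendsto.const_mul (a := c) hl2 (.inr ofReal_ne_top))
      simpa using this
    refine tendsto_zero_iff_enorm_tendsto_zero.2
      (tendsto_of_tendsto_of_tendsto_of_le_of_le' tendsto_const_nhds hlim (.of_forall fun _ => zero_le) ?_)
    filter_upwards [self_mem_nhdsWithin] with τ hτ
    have hτ0 : 0 < τ := hτ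
    have hi : ∀ {g : ℝ → ℂ}, Wt g → Integrable fun y => (kr A τ x y - tk A τ x y) * g y := fun {g} hg => by
      simp_rw [sub_mul]
      exact (hA.integrable_kr_mul_Wt hτ0.ne' hg x).sub (hA.integrable_tk_mul hg hτ0 x)
    have e : (b x : ℂ) * (Cr A τ f x - Tr A τ f x) -
        (Cr A τ (fun y => (b y : ℂ) * f y) x - Tr A τ (fun y => (b y : ℂ) * f y) x) =
        ∫ y, (kr A τ x y - tk A τ x y) * ((b x : ℂ) * f y - (b y : ℂ) * f y) := by
      rw [hA.Cr_sub_Tr hτ0 hf, hA.Cr_sub_Tr hτ0 hbf, ← integral_const_mul, ← integral_sub ((hi hf).const_mul _) (hi hbf)]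
      congr 1
      funext y
      ring
    rw [e]
    refine (hA.enorm_integral_kr_sub_tk_le hτ0 _ x).trans ?_
    rw [← mul_add]
    gcongr
    have hpm : Measurable fun u : ℝ => ofReal (pker τ (x - u)) :=
      ((measurable_pker τ).comp (measurable_const.sub measurable_id)).ennreal_ofReal
    have hm : Measurable fun y => ofReal (pker τ (x - y)) * ‖(b y : ℂ) * f y - (b x : ℂ) * f x‖ₑ :=
      hpm.mul (hbf.meas.sub_const _).enorm
    rw [← lintegral_const_mul' _ _ enorm_ne_top, ← lintegral_add_right _ hm]
    refine lintegral_mono fun y => ?_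
    have e2 : (b x : ℂ) * f y - (b y : ℂ) * f y = (b x : ℂ) * (f y - f x) - ((b y : ℂ) * f y - (b x : ℂ) * f x) := by
      ring
    rw [e2, mul_left_comm, ← mul_add]
    gcongr
    refine enorm_sub_le.trans (le_of_eq ?_)
    rw [enorm_mul, ← ofReal_norm ((b x : ℂ)), norm_real, ofReal_norm]
  have := ((hu.const_mul (b x : ℂ)).sub hw).add hd
  rw [add_zero] at this
  refine this.congr fun τ => ?_
  unfold Tr
  ring

/-- A convenient form of the `BMO` condition with constant `N`. -/
structure Bm (b : ℝ → ℝ) (N : ℝ≥0∞) : Prop where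
  meas : Measurable b
  osc : ∀ c r : ℝ, 0 < r → ∃ k : ℝ, ∫⁻ y in ball c r, ‖b y - k‖ₑ ≤ ofReal (2 * r) * N

theorem Bm.locallyIntegrable (hN : N ≠ ⊤) (hb : Bm b N) : LocallyIntegrable b := by
  rw [locallyIntegrable_iff]
  intro K hK
  obtain ⟨r, hr⟩ := hK.isBounded.subset_ball_lt 0 0
  obtain ⟨k, hk⟩ := hb.osc 0 r hr.1
  have h1 : IntegrableOn (fun y => b y - k) (ball 0 r) := by
    refine ⟨(hb.meas.sub_const k).aestronglyMeasurable, ?_⟩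
    rw [hasFiniteIntegral_iff_enorm]
    exact hk.trans_lt (by finiteness)
  have h2 : IntegrableOn (fun y => b y - k + k) (ball 0 r) :=
    h1.add (integrableOn_const (by rw [volume_ball]; exact ofReal_ne_top))
  simp only [sub_add_cancel] at h2
  exact h2.mono_set hr.2

theorem enorm_ofReal_sub (a b : ℝ) : ‖(a : ℂ) - (b : ℂ)‖ₑ = ‖a - b‖ₑ := by
  rw [← Complex.ofReal_sub, ← ofReal_norm, norm_real, ofReal_norm]

theorem Bm.sharpLe (hb : Bm b N) : SharpLe (fun y => (b y : ℂ)) fun _ => N := by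
  intro c r hr
  obtain ⟨k, hk⟩ := hb.osc c r hr
  refine ⟨k, fun x _ => ?_⟩
  simp_rw [enorm_ofReal_sub]
  exact hk

theorem Bm.john_nirenberg (hp : 0 < p) : ∃ C ≠ ⊤, ∀ {b N}, N ≠ ⊤ → Bm b N →
    ∀ {c r k : ℝ}, 0 < r → ∫⁻ y in ball c r, ‖b y - k‖ₑ ≤ ofReal (2 * r) * N →
    ∫⁻ y in ball c r, ‖b y - k‖ₑ ^ p ≤ C * (ofReal (2 * r) * N ^ p) := by
  obtain ⟨C, hC, h⟩ := local_sharp hp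
  refine ⟨C, hC, fun {b N} hN hb {c r k} hr hk => ?_⟩
  have hbm : Measurable fun y => (b y : ℂ) := measurable_ofReal.comp hb.meas
  have e : Ico (c - r) (c - r + 2 * r) =ᵐ[volume] ball c r := by
    rw [ball_eq_Ioo, show c - r + 2 * r = c + r by ring]
    exact Ioo_ae_eq_Ico.symm
  have hloc : LocallyIntegrable fun y => (b y : ℂ) := by
    refine (hb.locallyIntegrable hN).mono hbm.aestronglyMeasurable (ae_of_all _ fun y => ?_)
    rw [norm_real]
  have h1 := h (a := c - r) (l := 2 * r) (by linarith) hbm hloc measurable_const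
    (hb.sharpLe.oscLe (c - r) (2 * r)) (c₀ := k) (fun x _ => by
      rw [setLIntegral_congr e]
      simp_rw [enorm_ofReal_sub]
      exact hk)
  rw [setLIntegral_congr e, setLIntegral_congr e] at h1
  simp_rw [enorm_ofReal_sub] at h1
  refine h1.trans (le_of_eq ?_)
  rw [setLIntegral_const, volume_ball, mul_comm (N ^ p)]

theorem enorm_sub_le_of_osc (hb : Measurable b) {k k' : ℝ} (hr : 0 < r)
    (h : ∫⁻ y in ball c r, ‖b y - k‖ₑ ≤ ofReal (2 * r) * N)
    (h' : ∫⁻ y in ball c (2 * r), ‖b y - k'‖ₑ ≤ ofReal (2 * (2 * r)) * N) : ‖k' - k‖ₑ ≤ 3 * N := by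
  have h0 : ofReal (2 * r) ≠ 0 := by simpa using hr
  rw [← mul_le_mul_iff_right h0 ofReal_ne_top]
  calc ofReal (2 * r) * ‖k' - k‖ₑ = ∫⁻ y in ball c r, ‖k' - k‖ₑ := by
        rw [setLIntegral_const, volume_ball, mul_comm]
    _ ≤ ∫⁻ y in ball c r, (‖b y - k‖ₑ + ‖b y - k'‖ₑ) := lintegral_mono fun y => by
        rw [show k' - k = (b y - k) - (b y - k') by ring]
        exact enorm_sub_le
    _ = (∫⁻ y in ball c r, ‖b y - k‖ₑ) + ∫⁻ y in ball c r, ‖b y - k'‖ₑ :=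
        lintegral_add_left (hb.sub_const k).enorm _
    _ ≤ ofReal (2 * r) * N + ofReal (2 * (2 * r)) * N :=
        add_le_add h ((lintegral_mono_set (ball_subset_ball (by linarith))).trans h')
    _ = _ := by
        rw [ofReal_mul (by norm_num : (0 : ℝ) ≤ 2) (q := 2 * r), ofReal_ofNat]
        ring

theorem Bm.exists_dyadic (hb : Bm b N) {k : ℝ} (hr : 0 < r)
    (hk : ∫⁻ y in ball c r, ‖b y - k‖ₑ ≤ ofReal (2 * r) * N) : ∃ κ : ℕ → ℝ,
      ∀ j, ∫⁻ y in ball c (2 ^ j * r), ‖b y - κ j‖ₑ ≤ ofReal (2 * (2 ^ j * r)) * N ∧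
      ‖κ j - k‖ₑ ≤ 3 * j * N := by
  choose κ hκ using fun j : ℕ => hb.osc c (2 ^ j * r) (by positivity)
  have h0 : ∀ j, ∫⁻ y in ball c (2 ^ j * r), ‖b y - (if j = 0 then k else κ j)‖ₑ ≤
      ofReal (2 * (2 ^ j * r)) * N := fun j => by
    split_ifs with h
    · subst h; simpa using hk
    · exact hκ j
  refine ⟨fun j => if j = 0 then k else κ j, fun j => ⟨h0 j, ?_⟩⟩
  induction j with
  | zero => simp
  | succ j ih =>
    have h1 := enorm_sub_le_of_osc hb.meas (by positivity) (h0 j) (by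
      have := h0 (j + 1)
      rw [pow_succ', mul_assoc] at this
      exact this)
    calc _ = ‖((if j + 1 = 0 then k else κ (j + 1)) - (if j = 0 then k else κ j)) +
          ((if j = 0 then k else κ j) - k)‖ₑ := by rw [sub_add_sub_cancel]
      _ ≤ 3 * N + 3 * j * N := (enorm_add_le _ _).trans (add_le_add h1 ih)
      _ = _ := by push_cast; ring

theorem tsum_pow_mul_half_ne_top (C : ℝ) (hC : 0 ≤ C) (n : ℕ) :
    ∑' j : ℕ, ofReal (C * ((j : ℝ) ^ n * (1 / 2) ^ j)) ≠ ⊤ := by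
  have h := (summable_pow_mul_geometric_of_norm_lt_one n (r := (1 / 2 : ℝ)) (by norm_num)).mul_left C
  rw [← ENNReal.ofReal_tsum_of_nonneg (fun j => by positivity) h]
  exact ofReal_ne_top

theorem Bm.lintegral_pker (hp : 1 < p) : ∃ C ≠ ⊤, ∀ {b N}, N ≠ ⊤ → Bm b N →
    ∀ {c r k : ℝ}, 0 < r → ∫⁻ y in ball c r, ‖b y - k‖ₑ ≤ ofReal (2 * r) * N →
    ∫⁻ y, ofReal (pker r (c - y)) * ‖b y - k‖ₑ ^ p ≤ C * N ^ p := by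
  have hp0 : 0 < p := by linarith
  obtain ⟨C, hC, h⟩ := Bm.john_nirenberg hp0
  obtain ⟨n, hn⟩ := exists_nat_ge p
  have hs : ∑' j : ℕ, (C * ofReal (8 * ((j : ℝ) ^ 0 * (1 / 2) ^ j)) +
      3 ^ p * ofReal (8 * ((j : ℝ) ^ n * (1 / 2) ^ j))) ≠ ⊤ := by
    rw [ENNReal.tsum_add, ENNReal.tsum_mul_left, ENNReal.tsum_mul_left]
    exact add_ne_top.2 ⟨mul_ne_top hC (tsum_pow_mul_half_ne_top _ (by norm_num) 0),
      mul_ne_top (by finiteness) (tsum_pow_mul_half_ne_top _ (by norm_num) n)⟩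
  refine ⟨2 ^ p * ∑' j : ℕ, (C * ofReal (8 * ((j : ℝ) ^ 0 * (1 / 2) ^ j)) +
      3 ^ p * ofReal (8 * ((j : ℝ) ^ n * (1 / 2) ^ j))), mul_ne_top (by finiteness) hs,
    fun {b N} hN hb {c r k} hr hk => ?_⟩
  obtain ⟨κ, hκ⟩ := hb.exists_dyadic hr hk
  refine (lintegral_ker_le ((hb.meas.sub_const k).enorm.pow_const p).aemeasurable hr c).trans ?_
  rw [← ENNReal.tsum_mul_left, ← ENNReal.tsum_mul_right]
  refine tsum_le_tsum fun j => ?_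
  have hj : (3 * (j : ℝ≥0∞) * N) ^ p ≤ 3 ^ p * ofReal ((j : ℝ) ^ n) * N ^ p := by
    rw [mul_rpow_of_nonneg _ _ hp0.le, mul_rpow_of_nonneg _ _ hp0.le]
    gcongr
    rcases Nat.eq_zero_or_pos j with rfl | hj0
    · simp [hp0]
    · rw [ofReal_pow (by positivity), ENNReal.ofReal_natCast, ← ENNReal.rpow_natCast]
      exact ENNReal.rpow_le_rpow_of_exponent_le (by exact_mod_cast hj0) hn
  have h1 : ∫⁻ y in ball c (2 ^ j * r), ‖b y - k‖ₑ ^ p ≤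
      2 ^ p * (C * (ofReal (2 * (2 ^ j * r)) * N ^ p) +
        3 ^ p * ofReal ((j : ℝ) ^ n) * N ^ p * ofReal (2 * (2 ^ j * r))) := by
    calc _ ≤ ∫⁻ y in ball c (2 ^ j * r), 2 ^ p * (‖b y - κ j‖ₑ ^ p + (3 * (j : ℝ≥0∞) * N) ^ p) := by
          refine lintegral_mono fun y => ?_
          refine le_trans ?_ (add_rpow_le _ _ hp.le)
          gcongr 1
          rw [show b y - k = (b y - κ j) + (κ j - k) by ring]
          exact (enorm_add_le _ _).trans (add_le_add le_rfl (hκ j).2)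
      _ ≤ _ := by
          rw [lintegral_const_mul' _ _ (by finiteness), lintegral_add_right _ measurable_const, setLIntegral_const,
            volume_ball]
          gcongr
          exact h hN hb (by positivity) (hκ j).1
  refine (mul_le_mul_right h1 _).trans (le_of_eq ?_)
  have e1 : ofReal (8 * ((j : ℝ) ^ 0 * (1 / 2) ^ j)) =
      ofReal (4 * (1 / 4) ^ j / r) * ofReal (2 * (2 ^ j * r)) := by
    rw [← ofReal_mul (by positivity)]
    congr 1
    rw [show (1 / 2 : ℝ) = 1 / 4 * 2 by norm_num, mul_pow]
    field_simp
    ring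
  have e2 : ofReal (8 * ((j : ℝ) ^ n * (1 / 2) ^ j)) = ofReal ((j : ℝ) ^ n) *
      (ofReal (4 * (1 / 4) ^ j / r) * ofReal (2 * (2 ^ j * r))) := by
    rw [← e1, ← ofReal_mul (by positivity)]
    congr 1
    ring
  rw [e2, e1]
  ring

/-- The regularised commutator. -/
def Fc (A : ℝ → ℝ) (τ : ℝ) (b : ℝ → ℝ) (f : ℝ → ℂ) (x : ℝ) : ℂ :=
  (b x : ℂ) * Cr A τ f x - Cr A τ (fun y => (b y : ℂ) * f y) x

theorem lintegral_pker_rpow_le (g : ℝ → ℝ≥0∞) (hg : Measurable g) (hs : 0 < s) (hr : 0 < r)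
    (hx : x ∈ closedBall c r) : ∫⁻ y, ofReal (pker r (c - y)) * g y ^ s ≤ 64 * ms s g x ^ s := by
  calc _ ≤ ∫⁻ y, 4 * (ofReal (pker r (x - y)) * g y ^ s) := lintegral_mono fun y => by
        rw [← mul_assoc, show (4 : ℝ≥0∞) = ofReal 4 by simp, ← ofReal_mul (by norm_num)]
        exact mul_le_mul_left (ofReal_le_ofReal (pker_le_four hr hx y)) _
    _ ≤ 4 * (16 * hlMax (fun y => g y ^ s) x) := by
        rw [lintegral_const_mul' _ _ (by simp)]
        gcongr
        exact lintegral_pker_mul_le (hg.pow_const s).aemeasurable hr x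
    _ = _ := by
        rw [ms_rpow hs, ← mul_assoc]
        norm_num

theorem Bm.lintegral_pker_mul (hσ : 1 ≤ σ) (hs : σ < s) : ∃ C : ℝ≥0∞, C ≠ ⊤ ∧
    ∀ {b N}, N ≠ ⊤ → Bm b N → ∀ {g : ℝ → ℝ≥0∞}, Measurable g →
    ∀ {c r k x : ℝ}, 0 < r → ∫⁻ y in ball c r, ‖b y - k‖ₑ ≤ ofReal (2 * r) * N →
    x ∈ closedBall c r →
    ∫⁻ y, ofReal (pker r (c - y)) * (‖b y - k‖ₑ * g y) ^ σ ≤ C * (N * ms s g x) ^ σ := by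
  have hσ0 : 0 < σ := by linarith
  have hs0 : 0 < s := by linarith
  set t := s / σ with ht
  have ht1 : 1 < t := (one_lt_div hσ0).2 hs
  have hc : t.HolderConjugate (t / (t - 1)) := HolderConjugate.conjExponent ht1
  set t' := t / (t - 1)
  have ht' : 1 < t' := hc.symm.lt
  obtain ⟨C, hC, h⟩ := Bm.lintegral_pker (p := σ * t') (by nlinarith)
  refine ⟨C ^ (1 / t') * 64 ^ (1 / t), mul_ne_top (rpow_ne_top_of_nonneg (by positivity) hC)
    (rpow_ne_top_of_nonneg (by positivity) (by norm_num)), fun {b N} hN hb {g} hg {c r k x} hr hk hx => ?_⟩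
  have hw : Measurable fun y => ofReal (pker r (c - y)) :=
    ((measurable_pker r).comp (measurable_const.sub measurable_id)).ennreal_ofReal
  set ν := volume.withDensity fun y => ofReal (pker r (c - y)) with hν
  have hbm : Measurable fun y => ‖b y - k‖ₑ := (hb.meas.sub_const k).enorm
  have e : ∀ {φ : ℝ → ℝ≥0∞}, Measurable φ → ∫⁻ y, φ y ∂ν = ∫⁻ y, ofReal (pker r (c - y)) * φ y :=
    fun hφ => lintegral_withDensity_eq_lintegral_mul _ hw hφ
  have h1 := lintegral_mul_le_Lp_mul_Lq ν hc.symm (hbm.pow_const σ).aemeasurable (hg.pow_const σ).aemeasurable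
  simp only [Pi.mul_apply, ← rpow_mul] at h1
  have hm2 : Measurable fun y => ‖b y - k‖ₑ ^ σ * g y ^ σ := (hbm.pow_const σ).mul (hg.pow_const σ)
  rw [e (hbm.pow_const _), e (hg.pow_const _), e hm2] at h1
  simp_rw [mul_rpow_of_nonneg _ _ hσ0.le]
  refine h1.trans ?_
  have e2 : σ * t = s := by rw [ht]; field_simp
  rw [e2]
  calc _ ≤ (C * N ^ (σ * t')) ^ (1 / t') * (64 * ms s g x ^ s) ^ (1 / t) := by
        gcongr
        · exact h hN hb hr hk
        · exact lintegral_pker_rpow_le g hg hs0 hr hx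
    _ = _ := by
        have ht0 : 0 < t := by linarith
        have ht0' : 0 < t' := by linarith
        rw [mul_rpow_of_nonneg _ _ (by positivity), mul_rpow_of_nonneg _ _ (by positivity),
          ← rpow_mul, ← rpow_mul, show σ * t' * (1 / t') = σ by field_simp,
          show s * (1 / t) = σ by rw [← e2]; field_simp]
        ring

theorem setLIntegral_le_pker (g : ℝ → ℝ≥0∞) (hr : 0 < r) : ∫⁻ y in ball c (2 * r), g y ≤
      ofReal (9 * r) * ∫⁻ y, ofReal (pker r (c - y)) * g y := by
  rw [← lintegral_ofReal_mul, ← lintegral_indicator measurableSet_ball]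
  refine lintegral_mono fun y => indicator_apply_le' (fun hy => ?_) fun _ => zero_le
  rw [← mul_assoc, ← ofReal_mul (by positivity)]
  refine le_mul_of_one_le_left' ?_
  rw [one_le_ofReal]
  rw [mem_ball, dist_comm, dist_eq] at hy
  unfold pker
  rw [mul_div_assoc', one_le_div (by positivity)]
  nlinarith [abs_nonneg (c - y)]

theorem BC.ofReal_mul (hf : BC f) (hb : Measurable b) (hB : ∀ x, |b x| ≤ B) :
    BC fun y => (b y : ℂ) * f y :=
  hf.mul_bdd (g := fun y => (b y : ℂ)) (measurable_ofReal.comp hb) (K := B) fun x => by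
    rw [norm_real]
    exact hB x

theorem BC.sub_mul (hf : BC f) (hb : Measurable b) (hB : ∀ x, |b x| ≤ B) (m : ℝ) :
    BC fun y => ((b y - m : ℝ) : ℂ) * f y :=
  hf.ofReal_mul (hb.sub_const m) (B := B + |m|) fun x => (abs_sub _ _).trans (add_le_add (hB x) le_rfl)

theorem LipA.Fc_eq (hA : LipA A L) (hτ : τ ≠ 0) (hb : Measurable b) (hB : ∀ x, |b x| ≤ B)
    (hf : BC f) (m : ℝ) {S : Set ℝ} (hS : MeasurableSet S) (x : ℝ) :
    Fc A τ b f x = ((b x - m : ℝ) : ℂ) * Cr A τ f x - Cr A τ (S.indicator fun y => ((b y - m : ℝ) : ℂ) * f y) x -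
      Cr A τ (Sᶜ.indicator fun y => ((b y - m : ℝ) : ℂ) * f y) x := by
  have hbc := hf.sub_mul hb hB m
  have hbf := hf.ofReal_mul hb hB
  have e1 := hA.Cr_split hτ hbc.integrable hS x
  have hmf : BC fun y => (m : ℂ) * f y := hf.mul_bdd measurable_const (K := |m|) fun x => by simp
  have e2 := hA.Cr_sub hτ hbf.integrable hmf.integrable x
  have e3 : Cr A τ (fun y => (m : ℂ) * f y) x = m * Cr A τ f x := by
    unfold Cr
    rw [← integral_const_mul]
    congr 1; funext y; ring
  have e4 : (fun y => (b y : ℂ) * f y - (m : ℂ) * f y) = fun y => ((b y - m : ℝ) : ℂ) * f y := by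
    funext y; push_cast; ring
  rw [e4, e3] at e2
  rw [sub_sub, ← e1, e2]
  unfold Fc
  push_cast
  ring

theorem LipA.lintegral_Cr_local (hA : LipA A L) (hs : 1 < s) : ∃ K ≠ ⊤, ∀ τ : ℝ, τ ≠ 0 →
    ∀ {b N}, N ≠ ⊤ → Bm b N → ∀ {B}, (∀ x, |b x| ≤ B) → ∀ {f}, BC f →
    ∀ {c r m x : ℝ}, 0 < r → ∫⁻ y in ball c r, ‖b y - m‖ₑ ≤ ofReal (2 * r) * N →
    x ∈ closedBall c r →
    ∫⁻ y in ball c r, ‖Cr A τ ((ball c (2 * r)).indicator fun y => ((b y - m : ℝ) : ℂ) * f y) y‖ₑ ≤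
      ofReal (2 * r) * (K * (N * ms s (fun y => ‖f y‖ₑ) x)) := by
  set σ := (1 + s) / 2 with hσd
  have hσ : 1 < σ := by rw [hσd]; linarith
  have hσ0 : 0 < σ := by linarith
  obtain ⟨K₁, hK₁, h₁⟩ := hA.lintegral_Cr_rpow_BC hσ
  obtain ⟨K₂, hK₂, h₂⟩ := Bm.lintegral_pker_mul hσ.le (show σ < s by rw [hσd]; linarith)
  refine ⟨(5 * K₁ * K₂) ^ σ⁻¹, rpow_ne_top_of_nonneg (by positivity) (by finiteness),
    fun τ hτ {b N} hN hb {B} hB {f} hf {c r m x} hr hm hx => ?_⟩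
  have hS : MeasurableSet (ball c (2 * r)) := measurableSet_ball
  set S := ball c (2 * r)
  have hbc : BC (S.indicator fun y => ((b y - m : ℝ) : ℂ) * f y) :=
    (hf.sub_mul hb.meas hB m).indicator hS
  set ℓ := ofReal (2 * r) with hℓ
  have hℓ0 : ℓ ≠ 0 := by simpa [hℓ] using hr
  set M := N * ms s (fun y => ‖f y‖ₑ) x
  rw [← rpow_le_rpow_iff hσ0]
  refine (lintegral_rpow_le_jensen hσ (hA.measurable_Cr_right hbc.meas τ).enorm.aemeasurable).trans ?_
  rw [restrict_apply_univ, show volume (ball c r) = ℓ from volume_ball _ _,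
    mul_rpow_of_nonneg _ _ hσ0.le, mul_rpow_of_nonneg _ _ hσ0.le, ← rpow_mul,
    inv_mul_cancel₀ hσ0.ne', rpow_one]
  calc _ ≤ ℓ ^ (σ - 1) * (K₁ * (ofReal (9 * r) * (K₂ * M ^ σ))) := by
        gcongr
        refine (setLIntegral_le_lintegral _ _).trans ((h₁ τ hτ _ hbc).trans ?_)
        gcongr
        calc _ = ∫⁻ y in S, (‖b y - m‖ₑ * ‖f y‖ₑ) ^ σ := by
              rw [← lintegral_indicator hS]
              refine lintegral_congr fun y => ?_
              by_cases hy : y ∈ S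
              · simp only [indicator_of_mem hy, enorm_mul]
                rw [← ofReal_norm (((b y - m : ℝ) : ℂ)), norm_real, ofReal_norm]
              · simp [hy, hσ0]
          _ ≤ _ := (setLIntegral_le_pker _ hr).trans (mul_le_mul_right (h₂ hN hb hf.meas.enorm hr hm hx) _)
    _ ≤ ℓ ^ (σ - 1) * (K₁ * ((5 * ℓ) * (K₂ * M ^ σ))) := by
        gcongr
        rw [hℓ, show (5 : ℝ≥0∞) = ofReal 5 by simp, ← ofReal_mul (by norm_num)]
        exact ofReal_le_ofReal (by linarith)
    _ = ℓ ^ (σ - 1) * ℓ * (5 * K₁ * K₂ * M ^ σ) := by ring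
    _ = _ := by
        congr 1
        nth_rewrite 2 [← rpow_one ℓ]
        rw [← rpow_add _ _ hℓ0 ofReal_ne_top]
        norm_num

theorem LipA.Fc_sharp (hA : LipA A L) (hs : 1 < s) : ∃ K ≠ ⊤, ∀ τ : ℝ, τ ≠ 0 →
    ∀ {b N}, N ≠ ⊤ → Bm b N → ∀ {B}, (∀ x, |b x| ≤ B) → ∀ {f}, BC f →
    SharpLe (Fc A τ b f) fun x => K * N * (ms s (fun y => ‖Cr A τ f y‖ₑ) x + ms s (fun y => ‖f y‖ₑ) x) := by
  obtain ⟨K₁, hK₁, h₁⟩ := hA.lintegral_Cr_local hs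
  obtain ⟨K₂, hK₂, h₂⟩ := hA.enorm_Cr_sub_le
  obtain ⟨K₃, hK₃, h₃⟩ := Bm.lintegral_pker_mul le_rfl hs
  refine ⟨5 * K₃ + K₁ + K₂ * K₃, by finiteness, fun τ hτ {b N} hN hb {B} hB {f} hf c r hr => ?_⟩
  obtain ⟨m, hm⟩ := hb.osc c r hr
  have hS : MeasurableSet (ball c (2 * r)) := measurableSet_ball
  have h₁' := fun x => h₁ τ hτ hN hb hB hf (x := x) hr hm
  set S := ball c (2 * r) with hSd
  set h : ℝ → ℂ := fun y => ((b y - m : ℝ) : ℂ) * f y with hh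
  have hbc : BC h := hf.sub_mul hb.meas hB m
  have hre : ∀ y, ‖((b y - m : ℝ) : ℂ)‖ₑ = ‖b y - m‖ₑ := fun y => by
    rw [← ofReal_norm, norm_real, ofReal_norm]
  refine ⟨-Cr A τ (Sᶜ.indicator h) c, fun x hx => ?_⟩
  set P := ms s (fun y => ‖Cr A τ f y‖ₑ) x
  set Q := ms s (fun y => ‖f y‖ₑ) x
  set ℓ := ofReal (2 * r) with hℓ
  have hCm : Measurable fun y => ‖Cr A τ f y‖ₑ := (hA.measurable_Cr_right hf.meas τ).enorm
  have t1 : ∫⁻ y in ball c r, ‖b y - m‖ₑ * ‖Cr A τ f y‖ₑ ≤ ℓ * (5 * K₃ * N * P) := by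
    have h4 := h₃ hN hb hCm hr hm hx
    simp only [rpow_one] at h4
    calc _ ≤ ofReal (9 * r) * (K₃ * (N * P)) :=
          (lintegral_mono_set (ball_subset_ball (by linarith))).trans
            ((setLIntegral_le_pker _ hr).trans (mul_le_mul_right h4 _))
      _ ≤ (5 * ℓ) * (K₃ * (N * P)) := by
        gcongr
        rw [hℓ, show (5 : ℝ≥0∞) = ofReal 5 by simp, ← ofReal_mul (by norm_num)]
        exact ofReal_le_ofReal (by linarith)
      _ = _ := by ring
  have t3 : ∀ y ∈ ball c r, ‖Cr A τ (Sᶜ.indicator h) y - Cr A τ (Sᶜ.indicator h) c‖ₑ ≤ K₂ * K₃ * N * Q := by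
    intro y hy
    have h4 := h₃ hN hb hf.meas.enorm hr hm hx
    simp only [rpow_one] at h4
    refine (h₂ τ hτ _ (hbc.indicator hS.compl).integrable c r y hr (Metric.ball_subset_closedBall hy)
      fun u hu => by simp [S, hu]).trans ?_
    rw [mul_assoc, mul_assoc]
    gcongr
    refine le_trans (lintegral_mono fun u => ?_) h4
    gcongr
    rw [← hre, ← enorm_mul]
    by_cases hu : u ∈ S <;> simp [hu, hh]
  have hm1 : Measurable fun y => ‖b y - m‖ₑ * ‖Cr A τ f y‖ₑ := (hb.meas.sub_const m).enorm.mul hCm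
  calc _ ≤ ∫⁻ y in ball c r, (‖b y - m‖ₑ * ‖Cr A τ f y‖ₑ + ‖Cr A τ (S.indicator h) y‖ₑ + K₂ * K₃ * N * Q) := by
        refine setLIntegral_mono' measurableSet_ball fun y hy => ?_
        rw [hA.Fc_eq hτ hb.meas hB hf m hS y, ← hre, ← enorm_mul]
        refine le_trans ?_ (add_le_add le_rfl (t3 y hy))
        rw [show ∀ a b c d : ℂ, a - b - c - -d = (a - b) - (c - d) by intros; ring]
        exact enorm_sub_le.trans (add_le_add enorm_sub_le le_rfl)
    _ ≤ ℓ * (5 * K₃ * N * P) + ℓ * (K₁ * (N * Q)) + K₂ * K₃ * N * Q * ℓ := by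
        rw [lintegral_add_right _ measurable_const, lintegral_add_left hm1, setLIntegral_const, volume_ball]
        exact add_le_add (add_le_add t1 (h₁' x hx)) le_rfl
    _ ≤ ℓ * (5 * K₃ * N * P) + ℓ * (K₁ * (N * Q)) + K₂ * K₃ * N * Q * ℓ +
        ℓ * N * (5 * K₃ * Q + (K₁ + K₂ * K₃) * P) := le_self_add
    _ = _ := by ring

theorem LipA.measurable_Fc (hA : LipA A L) (hb : Measurable b) (hf : Measurable f) (τ : ℝ) :
    Measurable (Fc A τ b f) := by
  have h1 : Measurable fun x => (b x : ℂ) := measurable_ofReal.comp hb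
  exact (h1.mul (hA.measurable_Cr_right hf τ)).sub (hA.measurable_Cr_right (h1.mul hf) τ)

theorem LipA.lintegral_Fc_ne_top (hA : LipA A L) (hq : 1 < q) (hτ : τ ≠ 0) (hb : Measurable b) (hB : ∀ x, |b x| ≤ B) (hf : BC f) : ∫⁻ x, ‖Fc A τ b f x‖ₑ ^ q ≠ ⊤ := by
  have hq0 : 0 < q := by linarith
  obtain ⟨K, hK, h⟩ := hA.lintegral_Cr_rpow_BC hq
  have hbf := hf.ofReal_mul hb hB
  have hm : Measurable fun x => 2 ^ q * (ofReal B * ‖Cr A τ f x‖ₑ) ^ q :=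
    (((hA.measurable_Cr_right hf.meas τ).enorm.const_mul _).pow_const q).const_mul _
  have h1 : ∫⁻ x, (2 ^ q * (ofReal B * ‖Cr A τ f x‖ₑ) ^ q +
      2 ^ q * ‖Cr A τ (fun y => (b y : ℂ) * f y) x‖ₑ ^ q) ≠ ⊤ := by
    simp_rw [mul_rpow_of_nonneg _ _ hq0.le] at hm ⊢
    rw [lintegral_add_left hm, lintegral_const_mul' _ _ (by finiteness), lintegral_const_mul' _ _ (by finiteness),
      lintegral_const_mul' _ _ (by finiteness)]
    have i1 := ne_top_of_le_ne_top (mul_ne_top hK (hf.lintegral_rpow_ne_top hq0)) (h τ hτ f hf)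
    have i2 := ne_top_of_le_ne_top (mul_ne_top hK (hbf.lintegral_rpow_ne_top hq0)) (h τ hτ _ hbf)
    finiteness
  refine ne_top_of_le_ne_top h1 (lintegral_mono fun x => ?_)
  rw [← mul_add]
  refine le_trans ?_ (add_rpow_le _ _ hq.le)
  gcongr 1
  refine enorm_sub_le.trans (add_le_add ?_ le_rfl)
  rw [enorm_mul]
  gcongr
  rw [← ofReal_norm, norm_real]
  exact ofReal_le_ofReal (hB x)

theorem LipA.lintegral_Fc_BC (hA : LipA A L) (hp : 1 < p) : ∃ C ≠ ⊤, ∀ τ : ℝ, τ ≠ 0 →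
    ∀ {b N}, N ≠ ⊤ → Bm b N → ∀ {B}, (∀ x, |b x| ≤ B) → ∀ {f}, BC f →
    ∫⁻ x, ‖Fc A τ b f x‖ₑ ^ p ≤ C * N ^ p * ∫⁻ x, ‖f x‖ₑ ^ p := by
  have hp0 : 0 < p := by linarith
  set s := (1 + p) / 2 with hsd
  have hs : 1 < s := by rw [hsd]; linarith
  have hsp : s < p := by rw [hsd]; linarith
  obtain ⟨K₁, hK₁, h₁⟩ := hA.Fc_sharp hs
  obtain ⟨K₂, hK₂, h₂⟩ := global_sharp hs hsp
  obtain ⟨K₃, hK₃, h₃⟩ := lintegral_ms_rpow_le (by linarith) hsp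
  obtain ⟨K₄, hK₄, h₄⟩ := hA.lintegral_Cr_rpow_BC hp
  refine ⟨K₂ * (K₁ ^ p * (2 ^ p * (K₃ * K₄ + K₃))), by finiteness, fun τ hτ {b N} hN hb {B} hB {f} hf => ?_⟩
  have m1 := measurable_ms s fun y => ‖Cr A τ f y‖ₑ
  have m2 := measurable_ms s fun y => ‖f y‖ₑ
  refine (h₂ (hA.measurable_Fc hb.meas hf.meas τ) (hA.lintegral_Fc_ne_top hs hτ hb.meas hB hf)
    ((m1.add m2).const_mul _) (h₁ τ hτ hN hb hB hf)).trans ?_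
  simp_rw [mul_rpow_of_nonneg _ _ hp0.le]
  rw [lintegral_const_mul' _ _ (by finiteness)]
  have h5 : ∫⁻ x, (ms s (fun y => ‖Cr A τ f y‖ₑ) x + ms s (fun y => ‖f y‖ₑ) x) ^ p ≤
      2 ^ p * (K₃ * (K₄ * ∫⁻ x, ‖f x‖ₑ ^ p) + K₃ * ∫⁻ x, ‖f x‖ₑ ^ p) := by
    refine (lintegral_mono fun x => add_rpow_le _ _ hp.le).trans ?_
    rw [lintegral_const_mul' _ _ (by finiteness), lintegral_add_left (m1.pow_const p)]
    exact mul_le_mul_right (add_le_add ((h₃ _ (hA.measurable_Cr_right hf.meas τ).enorm.aemeasurable).trans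
      (mul_le_mul_right (h₄ τ hτ f hf) _)) (h₃ _ hf.meas.enorm.aemeasurable)) _
  refine (mul_le_mul_right (mul_le_mul_right h5 _) _).trans (le_of_eq ?_)
  ring

theorem mul_le_rpow_add_rpow (a b : ℝ≥0∞) (h : p.HolderConjugate q) : a * b ≤ a ^ p + b ^ q := by
  refine (ENNReal.young_inequality a b h).trans (add_le_add ?_ ?_) <;>
    exact div_le_of_le_mul (le_mul_of_one_le_right' (one_le_ofReal.2 (by
      first | exact h.lt.le | exact h.symm.lt.le)))

theorem Bm.lintegral_pker_one (hN : N ≠ ⊤) (hb : Bm b N) {m : ℝ} (hm : 1 < m) :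
    ∫⁻ y, ofReal (pker 1 (0 - y)) * ‖b y‖ₑ ^ m ≠ ⊤ := by
  obtain ⟨C, hC, h⟩ := Bm.lintegral_pker hm
  obtain ⟨k, hk⟩ := hb.osc 0 1 one_pos
  have h1 := h hN hb one_pos hk
  have hw : Measurable fun y => ofReal (pker 1 (0 - y)) :=
    ((measurable_pker 1).comp (measurable_const.sub measurable_id)).ennreal_ofReal
  have h2 : ∫⁻ y, (2 ^ m * (ofReal (pker 1 (0 - y)) * ‖b y - k‖ₑ ^ m) +
      2 ^ m * ‖k‖ₑ ^ m * ofReal (pker 1 (0 - y))) ≠ ⊤ := by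
    rw [lintegral_add_right _ (hw.const_mul _), lintegral_const_mul' _ _ (by finiteness),
      lintegral_const_mul' _ _ (by finiteness)]
    have i1 : ∫⁻ y, ofReal (pker 1 (0 - y)) * ‖b y - k‖ₑ ^ m ≠ ⊤ := ne_top_of_le_ne_top (by finiteness) h1
    have i2 := ne_top_of_le_ne_top (by norm_num) (lintegral_pker_le one_pos 0)
    finiteness
  refine ne_top_of_le_ne_top h2 (lintegral_mono fun y => ?_)
  calc _ ≤ ofReal (pker 1 (0 - y)) * (2 ^ m * (‖b y - k‖ₑ ^ m + ‖k‖ₑ ^ m)) := by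
        refine mul_le_mul_right (le_trans ?_ (add_rpow_le _ _ hm.le)) _
        gcongr 1
        nth_rewrite 1 [← sub_add_cancel (b y) k]
        exact enorm_add_le _ _
    _ = _ := by ring

theorem Bm.wt_mul (hN : N ≠ ⊤) (hb : Bm b N) (hp : 1 < p) (hf : Measurable f) (h : ∫⁻ x, ‖f x‖ₑ ^ p ≠ ⊤) : Wt fun y => (b y : ℂ) * f y := by
  have hc : p.HolderConjugate (p / (p - 1)) := HolderConjugate.conjExponent hp
  set t := p / (p - 1) with htd
  have ht : 1 < t := hc.symm.lt
  have ht0 : 0 < t := by linarith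
  have hp0 : 0 < p := by linarith
  have hbm : Measurable fun y => (b y : ℂ) := measurable_ofReal.comp hb.meas
  have hm : Measurable fun y : ℝ => (((1 + |y|)⁻¹ : ℝ) : ℂ) := by fun_prop
  refine ⟨hbm.mul hf, (hm.mul (hbm.mul hf)).aestronglyMeasurable, ?_⟩
  rw [hasFiniteIntegral_iff_enorm]
  set w : ℝ → ℝ≥0∞ := fun y => ofReal (1 + |y|)⁻¹ with hw
  have hwm : Measurable w := by rw [hw]; fun_prop
  have hwr : ∀ y (r : ℝ), 0 ≤ r → w y ^ r = ofReal ((1 + ‖y‖) ^ (-r)) := fun y r hr => by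
    simp only [hw]
    rw [ofReal_rpow_of_nonneg (by positivity) hr, inv_rpow (by positivity),
      rpow_neg (by positivity), norm_eq_abs]
  have hw2 : ∀ y, w y ^ (2 : ℝ) = ofReal (pker 1 (0 - y)) := fun y => by
    simp only [hw, pker]
    rw [ofReal_rpow_of_nonneg (by positivity) (by norm_num), inv_rpow (by positivity)]
    norm_num
  have hpt : 1 / p = 1 - 1 / t := by have := hc.inv_add_inv_eq_one; simp only [one_div]; linarith
  have hβ : (t - 2 / p) * t = (t - 1) ^ 2 + 1 := by
    rw [show (2 : ℝ) / p = 2 * (1 / p) by ring, hpt]; field_simp; ring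
  have hβ1 : 1 < (t - 2 / p) * t := by rw [hβ]; nlinarith
  have hβ0 : 0 ≤ t - 2 / p := by by_contra hh; nlinarith
  have h2 : ∫⁻ y, (ofReal (pker 1 (0 - y)) * ‖b y‖ₑ ^ (t * p) + w y ^ ((t - 2 / p) * t) + ‖f y‖ₑ ^ p) ≠ ⊤ := by
    rw [lintegral_add_right _ (hf.enorm.pow_const p), lintegral_add_right _ (hwm.pow_const _)]
    have i1 := hb.lintegral_pker_one hN (m := t * p) (by nlinarith)
    have i2 : ∫⁻ y, w y ^ ((t - 2 / p) * t) ≠ ⊤ := by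
      simp_rw [hwr _ _ (zero_le_one.trans hβ1.le)]
      exact (finite_integral_one_add_norm (by simpa using hβ1)).ne
    finiteness
  refine (lt_top_iff_ne_top.2 (ne_top_of_le_ne_top h2 (lintegral_mono fun y => ?_)))
  have e1 : ‖(((1 + |y|)⁻¹ : ℝ) : ℂ)‖ₑ = w y := by
    rw [← ofReal_norm, norm_real, norm_of_nonneg (by positivity)]
  have e2 : ‖(b y : ℂ)‖ₑ = ‖b y‖ₑ := by rw [← ofReal_norm, norm_real, ofReal_norm]
  rw [enorm_mul, enorm_mul, e1, e2, ← mul_assoc]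
  refine (mul_le_rpow_add_rpow _ _ hc.symm).trans (add_le_add ?_ le_rfl)
  have e3 : (w y * ‖b y‖ₑ) ^ t = (w y ^ (2 / p) * ‖b y‖ₑ ^ t) * w y ^ (t - 2 / p) := by
    rw [mul_rpow_of_nonneg _ _ ht0.le, mul_right_comm, ← ENNReal.rpow_add_of_nonneg _ _ (by positivity) hβ0]
    congr 2; ring
  rw [e3]
  refine (mul_le_rpow_add_rpow _ _ hc).trans (add_le_add (le_of_eq ?_) (le_of_eq ?_))
  · rw [mul_rpow_of_nonneg _ _ hp0.le, ← rpow_mul, ← rpow_mul, ← hw2]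
    congr 2; field_simp
  · rw [← rpow_mul]

theorem Bm.lintegral_mul_ne_top (hN : N ≠ ⊤) (hb : Bm b N) (hq : 1 < q) (hqp : q < p)
    (hf : Measurable f) (h : ∫⁻ x, ‖f x‖ₑ ^ p ≠ ⊤) (n : ℕ) :
    ∫⁻ x in ball 0 n, ‖(b x : ℂ) * f x‖ₑ ^ q ≠ ⊤ := by
  have hq0 : 0 < q := by linarith
  have ht : 1 < p / q := (one_lt_div hq0).2 hqp
  have hc : (p / q).HolderConjugate (p / q / (p / q - 1)) := HolderConjugate.conjExponent ht
  set t := p / q / (p / q - 1)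
  have i1 := hb.lintegral_pker_one hN (m := q * t) (by nlinarith [hc.symm.lt])
  have h2 : ∫⁻ y, (‖f y‖ₑ ^ p + ofReal ((1 + n) ^ 2) * (ofReal (pker 1 (0 - y)) * ‖b y‖ₑ ^ (q * t))) ≠ ⊤ := by
    rw [lintegral_add_left (hf.enorm.pow_const p), lintegral_ofReal_mul]
    finiteness
  rw [← lintegral_indicator measurableSet_ball]
  refine ne_top_of_le_ne_top h2 (lintegral_mono fun y => indicator_apply_le' (fun hy => ?_) fun _ => zero_le)
  have e2 : ‖(b y : ℂ)‖ₑ = ‖b y‖ₑ := by rw [← ofReal_norm, norm_real, ofReal_norm]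
  rw [enorm_mul, e2, mul_rpow_of_nonneg _ _ hq0.le, mul_comm]
  refine (mul_le_rpow_add_rpow _ _ hc).trans ?_
  rw [← rpow_mul, ← rpow_mul, mul_div_cancel₀ _ hq0.ne', ← mul_assoc, ← ofReal_mul (by positivity)]
  refine add_le_add le_rfl (le_mul_of_one_le_left' ?_)
  rw [one_le_ofReal]
  rw [mem_ball, dist_eq, sub_zero] at hy
  unfold pker
  rw [zero_sub, abs_neg, mul_one_div, one_le_div (by positivity)]
  gcongr

/-- Truncation of a real number to `[-n, n]`. -/
def clamp (n : ℕ) (t : ℝ) : ℝ := max (-n) (min n t)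

theorem abs_clamp_le (n : ℕ) (t : ℝ) : |clamp n t| ≤ n :=
  abs_le.2 ⟨le_max_left _ _, max_le (by linarith [n.cast_nonneg (α := ℝ)]) (min_le_left _ _)⟩

theorem abs_clamp_sub_le (n : ℕ) (s t : ℝ) : |clamp n s - clamp n t| ≤ |s - t| := by
  unfold clamp
  refine (abs_max_sub_max_le_max _ _ _ _).trans ?_
  simp only [sub_self, abs_zero]
  refine max_le (abs_nonneg _) ((abs_min_sub_min_le_max _ _ _ _).trans ?_)
  simp

theorem Bm.clamp (hb : Bm b N) (n : ℕ) : Bm (fun x => clamp n (b x)) N := by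
  refine ⟨measurable_const.max (measurable_const.min hb.meas), fun c r hr => ?_⟩
  obtain ⟨k, hk⟩ := hb.osc c r hr
  refine ⟨_root_.clamp n k, (lintegral_mono fun y => ?_).trans hk⟩
  rw [← ofReal_norm, ← ofReal_norm]
  exact ofReal_le_ofReal (abs_clamp_sub_le _ _ _)

theorem abs_clamp_le_abs (n : ℕ) (t : ℝ) : |clamp n t| ≤ |t| := by
  have h := abs_clamp_sub_le n t 0
  simpa [clamp] using h

theorem clamp_eventually_eq (t : ℝ) : ∀ᶠ n : ℕ in atTop, clamp n t = t := by
  obtain ⟨N, hN⟩ := exists_nat_ge |t|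
  filter_upwards [eventually_ge_atTop N] with n hn
  have h1 : |t| ≤ n := hN.trans (by exact_mod_cast hn)
  have h2 := abs_le.1 h1
  rw [clamp, min_eq_right h2.2, max_eq_right h2.1]

theorem LipA.lintegral_Fc_le (hA : LipA A L) (hp : 1 < p) : ∃ C ≠ ⊤, ∀ τ : ℝ, τ ≠ 0 →
    ∀ {b N}, N ≠ ⊤ → Bm b N → ∀ {f : ℝ → ℂ}, Measurable f → ∫⁻ x, ‖f x‖ₑ ^ p ≠ ⊤ →
    ∫⁻ x, ‖Fc A τ b f x‖ₑ ^ p ≤ C * N ^ p * ∫⁻ x, ‖f x‖ₑ ^ p := by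
  have hp0 : 0 < p := by linarith
  obtain ⟨C, hC, h⟩ := hA.lintegral_Fc_BC hp
  refine ⟨C, hC, fun τ hτ {b N} hN hb {f} hf hfp => ?_⟩
  have hw := wt_of_lintegral_rpow hp hf hfp
  have hbw := hb.wt_mul hN hp hf hfp
  refine lintegral_le_of_tendsto (f := fun n x => ‖Fc A τ (fun x => clamp n (b x)) (trunc n f) x‖ₑ ^ p)
    (fun n => ((hA.measurable_Fc (hb.clamp n).meas (trunc_BC hf n).meas τ).enorm.pow_const p).aemeasurable)
    (ae_of_all _ fun x => ?_) fun n => (h τ hτ hN (hb.clamp n) (fun x => abs_clamp_le n _) (trunc_BC hf n)).trans ?_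
  · refine ((continuous_rpow_const.comp continuous_enorm).tendsto _).comp ?_
    refine Tendsto.sub (Tendsto.mul ?_ ?_) ?_
    · exact tendsto_const_nhds.congr' ((clamp_eventually_eq (b x)).mono fun n hn => by simp only [hn])
    · exact hA.tendsto_Cr hτ hw (fun n => (trunc_BC hf n).meas) (fun n => norm_trunc_le n f)
        (fun x => tendsto_const_nhds.congr' ((trunc_eventually_eq f x).mono fun n hn => hn.symm)) x
    · refine hA.tendsto_Cr hτ hbw (fun n => ?_) (fun n x => ?_) (fun x => ?_) x
      · exact (measurable_ofReal.comp (hb.clamp n).meas).mul (trunc_BC hf n).meas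
      · rw [norm_mul, norm_mul, norm_real, norm_real]
        exact mul_le_mul (abs_clamp_le_abs _ _) (norm_trunc_le n f x) (norm_nonneg _) (norm_nonneg _)
      · refine tendsto_const_nhds.congr' ?_
        filter_upwards [clamp_eventually_eq (b x), trunc_eventually_eq f x] with n h1 h2
        rw [h1, h2]
  · gcongr with x
    rw [← ofReal_norm, ← ofReal_norm]
    exact ofReal_le_ofReal (norm_trunc_le n f x)

theorem LipA.exists_commutator (hA : LipA A L) (hp : 1 < p) : ∃ C : ℝ≥0∞, C ≠ ⊤ ∧
    ∀ {b N}, N ≠ ⊤ → Bm b N → ∀ {f : ℝ → ℂ}, Measurable f → ∫⁻ x, ‖f x‖ₑ ^ p ≠ ⊤ →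
    ∃ g : ℝ → ℂ, Measurable g ∧ IsCommutatorFn A b f g ∧ ∫⁻ x, ‖g x‖ₑ ^ p ≤ C * N ^ p * ∫⁻ x, ‖f x‖ₑ ^ p := by
  obtain ⟨C, hC, h⟩ := hA.lintegral_Fc_le hp
  refine ⟨C, hC, fun {b N} hN hb {f} hf hfp => ?_⟩
  have hw := wt_of_lintegral_rpow hp hf hfp
  have hbw := hb.wt_mul hN hp hf hfp
  have hae := hA.ae_commutator hw hbw (hA.exists_cauchyPV_of_rpow hp hf hfp) (hA.exists_cauchyPV
    (q := (1 + p) / 2) (by linarith) hbw fun n => hb.lintegral_mul_ne_top hN (by linarith) (by linarith) hf hfp n)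
  have hτ : Tendsto (fun n : ℕ => 1 / ((n : ℝ) + 1)) atTop (𝓝[>] 0) :=
    tendsto_nhdsWithin_iff.2 ⟨tendsto_one_div_add_atTop_nhds_zero_nat, Eventually.of_forall fun n => by
      have : (0 : ℝ) < 1 / ((n : ℝ) + 1) := by positivity
      exact this⟩
  have hm := fun n : ℕ => hA.measurable_Fc hb.meas hf (1 / ((n : ℝ) + 1))
  obtain ⟨g, hg, hgl⟩ := measurable_limit_of_tendsto_metrizable_ae (fun n => (hm n).aemeasurable)
    (hae.mono fun x ⟨u, w, _, _, h3⟩ => ⟨_, h3.comp hτ⟩)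
  refine ⟨g, hg, ?_, lintegral_le_of_tendsto (fun n => ((hm n).enorm.pow_const p).aemeasurable)
    (hgl.mono fun x hx => ((continuous_rpow_const.comp continuous_enorm).tendsto _).comp hx)
    fun n => h _ (by positivity) hN hb hf hfp⟩
  filter_upwards [hae, hgl] with x ⟨u, w, h1, h2, h3⟩ hx
  exact ⟨u, w, h1, h2, tendsto_nhds_unique hx (h3.comp hτ)⟩

/-- The mean oscillation of `b` over `ball z r` is at most `N`. -/
def Osc (b : ℝ → ℝ) (N : ℝ≥0∞) (z r : ℝ) : Prop :=
  ∃ k : ℝ, ∫⁻ y in ball z r, ‖b y - k‖ₑ ≤ ofReal (2 * r) * N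

theorem Osc.add {b' : ℝ → ℝ} (hb : Measurable b) {N' : ℝ≥0∞} (h : Osc b N z r) (h' : Osc b' N' z r) :
    Osc (fun x => b x + b' x) (N + N') z r := by
  obtain ⟨k, hk⟩ := h
  obtain ⟨k', hk'⟩ := h'
  refine ⟨k + k', ?_⟩
  rw [mul_add]
  refine le_trans ?_ (add_le_add hk hk')
  rw [← lintegral_add_left (hb.sub_const k).enorm]
  refine lintegral_mono fun y => ?_
  rw [add_sub_add_comm]
  exact enorm_add_le _ _

theorem osc_cutoff (hb : Measurable b) {ε : ℝ≥0∞} (hρ : 0 < ρ)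
    (hlarge : ∀ z r, ρ / 4 ≤ r → Osc b ε z r) (hfar : ∀ z r, 0 < r → ρ / 2 + r ≤ |z| → Osc b ε z r)
    {η : ℝ → ℝ} (hη : ∀ x, |η x| ≤ 1) (hη' : ∀ x, |1 - η x| ≤ 1) (hl : ∀ x y, |η x - η y| ≤ |x - y| / ρ)
    (h0 : ∀ x, |x| ≤ ρ → η x = 0) (h1 : ∀ x, 2 * ρ ≤ |x| → η x = 1) (hc : ∫⁻ y in ball 0 (4 * ρ), ‖b y - c‖ₑ ≤ ofReal (2 * (4 * ρ)) * ε) (hr : 0 < r) :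
    Osc (fun x => η x * (b x - c)) (17 * ε) z r := by
  have m1 : ∀ k, Measurable fun y => ‖b y - k‖ₑ := fun k => (hb.sub_const k).enorm
  have he : ∀ {u K : ℝ}, |u| ≤ K → ‖u‖ₑ ≤ ofReal K := fun h => by
    rw [← ofReal_norm]; exact ofReal_le_ofReal h
  rcases le_or_gt (ρ / 4) r with hrρ | hrρ
  · obtain ⟨k, hk⟩ := hlarge z r hrρ
    refine ⟨k - c, ?_⟩
    calc _ ≤ ∫⁻ y in ball z r, (‖b y - k‖ₑ + (ball 0 (4 * ρ)).indicator (fun y => ‖b y - c‖ₑ) y) := by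
          refine lintegral_mono fun y => ?_
          rw [show η y * (b y - c) - (k - c) = (b y - k) - (1 - η y) * (b y - c) by ring]
          refine enorm_sub_le.trans (add_le_add le_rfl ?_)
          by_cases hy : y ∈ ball 0 (4 * ρ)
          · rw [indicator_of_mem hy, enorm_mul]
            exact mul_le_of_le_one_left' (by simpa using he (hη' y))
          · rw [mem_ball, dist_eq, sub_zero, not_lt] at hy
            rw [h1 y (by linarith)]
            simp
      _ ≤ ofReal (2 * r) * ε + ofReal (2 * (4 * ρ)) * ε := by
          rw [lintegral_add_left (m1 k)]
          refine add_le_add hk (le_trans ?_ hc)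
          refine (setLIntegral_le_lintegral _ _).trans ?_
          rw [lintegral_indicator measurableSet_ball]
      _ ≤ ofReal (2 * r) * ε + ofReal (16 * (2 * r)) * ε := by
          exact add_le_add le_rfl (mul_le_mul_left (ofReal_le_ofReal (by linarith)) _)
      _ = _ := by
          rw [ofReal_mul (by norm_num) (p := 16) (q := 2 * r), ofReal_ofNat]
          ring
  rcases lt_or_ge |z| (3 * ρ / 4) with hz | hz
  · refine ⟨0, (setLIntegral_mono' (g := fun _ => 0) measurableSet_ball fun y hy => ?_).trans (by simp)⟩
    rw [mem_ball, dist_eq] at hy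
    dsimp only
    rw [h0 y (by linarith [abs_sub_abs_le_abs_sub y z])]
    simp
  obtain ⟨k, hk⟩ := hfar z r hr (by linarith)
  refine ⟨η z * (k - c), ?_⟩
  have h2 : ofReal (r / ρ) * (ofReal (2 * r) * ‖k - c‖ₑ) ≤ 16 * (ofReal (2 * r) * ε) ∨
      ∀ y ∈ ball z r, η y = η z := by
    rcases le_or_gt |z| (9 * ρ / 4) with hz' | hz'
    · left
      have hs : ball z r ⊆ ball 0 (4 * ρ) := fun y hy => by
        rw [mem_ball, dist_eq] at hy ⊢
        rw [sub_zero]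
        linarith [abs_sub_abs_le_abs_sub y z]
      calc _ ≤ ofReal (r / ρ) * (ofReal (2 * r) * ε + ofReal (2 * (4 * ρ)) * ε) := by
            gcongr
            calc _ = ∫⁻ y in ball z r, ‖k - c‖ₑ := by rw [setLIntegral_const, volume_ball, mul_comm]
              _ ≤ ∫⁻ y in ball z r, (‖b y - k‖ₑ + ‖b y - c‖ₑ) := lintegral_mono fun y => by
                  rw [show k - c = (b y - c) - (b y - k) by ring, add_comm]
                  exact enorm_sub_le
              _ ≤ _ := by
                  rw [lintegral_add_left (m1 k)]
                  exact add_le_add hk ((lintegral_mono_set hs).trans hc)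
        _ = ofReal (r / ρ * (2 * r + 2 * (4 * ρ))) * ε := by
            rw [← add_mul, ← mul_assoc, ← ofReal_add (by positivity) (by positivity),
              ← ofReal_mul (by positivity)]
        _ ≤ ofReal (16 * (2 * r)) * ε := by
            refine mul_le_mul_left (ofReal_le_ofReal ?_) _
            rw [div_mul_eq_mul_div, div_le_iff₀ hρ]
            nlinarith
        _ = _ := by rw [ofReal_mul (by norm_num), ofReal_ofNat, mul_assoc]
    · right
      intro y hy
      rw [mem_ball, dist_eq, abs_sub_comm] at hy
      rw [h1 y (by linarith [abs_sub_abs_le_abs_sub z y]), h1 z (by linarith)]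
  have h3 : ∫⁻ y in ball z r, ‖η y - η z‖ₑ * ‖k - c‖ₑ ≤ 16 * (ofReal (2 * r) * ε) := by
    rcases h2 with h2 | h2
    · refine le_trans ((setLIntegral_mono' (g := fun _ => ofReal (r / ρ) * ‖k - c‖ₑ) measurableSet_ball
        fun y hy => mul_le_mul_left (he ((hl y z).trans ?_)) _).trans (le_of_eq ?_)) h2
      · rw [mem_ball, dist_eq] at hy
        gcongr
      · rw [setLIntegral_const, volume_ball]
        ring
    · refine (setLIntegral_mono' (g := fun _ => 0) measurableSet_ball fun y hy => ?_).trans (by simp)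
      rw [h2 y hy]
      simp
  calc _ ≤ ∫⁻ y in ball z r, (‖b y - k‖ₑ + ‖η y - η z‖ₑ * ‖k - c‖ₑ) := by
        refine lintegral_mono fun y => ?_
        rw [show η y * (b y - c) - η z * (k - c) = η y * (b y - k) + (η y - η z) * (k - c) by ring]
        refine (enorm_add_le _ _).trans ?_
        rw [enorm_mul, enorm_mul]
        exact add_le_add (mul_le_of_le_one_left' (by simpa using he (hη y))) le_rfl
    _ ≤ ofReal (2 * r) * ε + 16 * (ofReal (2 * r) * ε) := by
        rw [lintegral_add_left (m1 k)]
        exact add_le_add hk h3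
    _ = _ := by ring

theorem setLIntegral_ball_le_average {g : ℝ → ℝ≥0∞} (hg : Measurable g) {h : ℝ} (hr : h ≤ r) :
    ofReal (2 * h) * ∫⁻ x in ball z r, g x ≤ ∫⁻ w in ball z (2 * r), ∫⁻ x in ball w h, g x := by
  have e : ∀ w x : ℝ, (ball w h).indicator g x = (ball x h).indicator (fun _ => g x) w := fun w x => by
    simp only [indicator, mem_ball, dist_comm]
  have hm : Measurable fun q : ℝ × ℝ => (ball q.1 h).indicator g q.2 := by
    have : (fun q : ℝ × ℝ => (ball q.1 h).indicator g q.2) =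
        {q : ℝ × ℝ | dist q.2 q.1 < h}.indicator fun q => g q.2 := by
      funext q; simp [indicator]
    rw [this]
    exact (hg.comp measurable_snd).indicator (measurableSet_lt (by fun_prop) measurable_const)
  simp_rw [← lintegral_indicator measurableSet_ball (f := g)]
  rw [lintegral_lintegral_swap hm.aemeasurable, ← lintegral_ofReal_mul]
  refine lintegral_mono fun x => ?_
  by_cases hx : x ∈ ball z r
  · rw [indicator_of_mem hx]
    simp_rw [e]
    rw [setLIntegral_indicator measurableSet_ball, setLIntegral_const, inter_eq_left.2, volume_ball, mul_comm]
    exact ball_subset_ball' (by rw [mem_ball] at hx; linarith)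
  · simp [hx]

theorem osc_sub_mollify {γ φ : ℝ → ℝ} (hγ : Measurable γ) (hi : Integrable γ) {h : ℝ} (hh : 0 < h)
    (hφm : Continuous φ) (hφ : ∀ u, |φ u| ≤ 1 / h) (hφs : ∀ u, h ≤ |u| → φ u = 0) (hφi : ∫ u, φ u = 1)
    (hβm : Measurable β) (hβ : ∀ x, β x = ∫ y, φ (x - y) * γ y) (hs : ∀ z r, 0 < r → r ≤ 2 * h → Osc γ N z r) (hr : 0 < r) : Osc (fun x => γ x - β x) (12 * N) z r := by
  have hφI : Integrable φ := by
    by_contra hc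
    rw [integral_undef hc] at hφi
    exact zero_ne_one hφi
  have m1 : ∀ k, Measurable fun y => ‖γ y - k‖ₑ := fun k => (hγ.sub_const k).enorm
  have key : ∀ w, ∃ k : ℝ, ∫⁻ y in ball w (2 * h), ‖γ y - k‖ₑ ≤ ofReal (2 * (2 * h)) * N ∧
      ∀ x ∈ ball w h, ‖β x - k‖ₑ ≤ 4 * N := fun w => by
    obtain ⟨k, hk⟩ := hs w (2 * h) (by positivity) le_rfl
    refine ⟨k, hk, fun x hx => ?_⟩
    have i1 : Integrable fun y => φ (x - y) * γ y :=
      hi.bdd_mul (c := 1 / h) (by fun_prop) (ae_of_all _ fun y => hφ _)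
    have i2 : Integrable fun y => φ (x - y) * k := (hφI.comp_sub_left x).mul_const k
    have e : β x - k = ∫ y, φ (x - y) * (γ y - k) := by
      simp_rw [mul_sub]
      rw [integral_sub i1 i2, ← hβ, integral_mul_const, integral_sub_left_eq_self φ volume x, hφi, one_mul]
    rw [e]
    calc _ ≤ ∫⁻ y, ‖φ (x - y) * (γ y - k)‖ₑ := enorm_integral_le_lintegral_enorm _
      _ ≤ ∫⁻ y, ofReal (1 / h) * (ball w (2 * h)).indicator (fun y => ‖γ y - k‖ₑ) y := by
          refine lintegral_mono fun y => ?_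
          by_cases hy : y ∈ ball w (2 * h)
          · rw [indicator_of_mem hy, enorm_mul, ← ofReal_norm (φ _)]
            gcongr
            exact hφ _
          · rw [hφs (x - y)]
            · simp
            · rw [mem_ball, dist_eq] at hx hy
              linarith [abs_sub_le y x w, abs_sub_comm x y]
      _ ≤ ofReal (1 / h) * (ofReal (2 * (2 * h)) * N) := by
          rw [lintegral_ofReal_mul, lintegral_indicator measurableSet_ball]
          gcongr
      _ = _ := by
          rw [← mul_assoc, ← ofReal_mul (by positivity), show 1 / h * (2 * (2 * h)) = 4 by field_simp; norm_num,
            ofReal_ofNat]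
  have hst : ∀ {k k' w s : ℝ}, ball w s ⊆ ball w h → (∀ x ∈ ball w h, ‖β x - k'‖ₑ ≤ 4 * N) →
      ∫⁻ x in ball w s, ‖γ x - β x - (k - k')‖ₑ ≤
        (∫⁻ x in ball w s, ‖γ x - k‖ₑ) + 4 * N * ofReal (2 * s) := fun {k k' w s} hsub hk' => by
    rw [← volume_ball w s, ← setLIntegral_const, ← lintegral_add_left (m1 k)]
    refine setLIntegral_mono' measurableSet_ball fun x hx => ?_
    rw [show γ x - β x - (k - k') = (γ x - k) - (β x - k') by ring]
    exact enorm_sub_le.trans (add_le_add le_rfl (hk' x (hsub hx)))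
  rcases le_or_gt r h with hrh | hrh
  · obtain ⟨k, hk⟩ := hs z r hr (by linarith)
    obtain ⟨k', -, hk'⟩ := key z
    refine ⟨k - k', (hst (ball_subset_ball hrh) hk').trans ((add_le_add hk le_rfl).trans ?_)⟩
    calc _ ≤ ofReal (2 * r) * N + 4 * N * ofReal (2 * r) + 7 * N * ofReal (2 * r) := le_self_add
      _ = _ := by ring
  · refine ⟨0, ?_⟩
    have h0 : ofReal (2 * h) ≠ 0 := by simpa using hh
    rw [← mul_le_mul_iff_right h0 ofReal_ne_top]
    calc _ ≤ ∫⁻ w in ball z (2 * r), ∫⁻ x in ball w h, ‖γ x - β x - 0‖ₑ :=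
          setLIntegral_ball_le_average ((hγ.sub hβm).sub_const 0).enorm hrh.le
      _ ≤ ∫⁻ w in ball z (2 * r), 6 * (ofReal (2 * h) * N) := by
          refine lintegral_mono fun w => ?_
          obtain ⟨k, hk, hk'⟩ := key w
          rw [← sub_self k]
          refine (hst subset_rfl hk').trans ((add_le_add ((lintegral_mono_set
            (ball_subset_ball (by linarith))).trans hk) le_rfl).trans (le_of_eq ?_))
          rw [ofReal_mul (by norm_num) (q := 2 * h), ofReal_ofNat]
          ring
      _ = _ := by
          rw [setLIntegral_const, volume_ball, ofReal_mul (by norm_num) (q := 2 * r), ofReal_ofNat]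
          ring

theorem exists_cutoff (hρ : 0 < ρ) : ∃ η : ℝ → ℝ, Continuous η ∧ (∀ x, |η x| ≤ 1) ∧ (∀ x, |1 - η x| ≤ 1) ∧
    (∀ x y, |η x - η y| ≤ |x - y| / ρ) ∧ (∀ x, |x| ≤ ρ → η x = 0) ∧ ∀ x, 2 * ρ ≤ |x| → η x = 1 := by
  have hb : ∀ t : ℝ, 0 ≤ max 0 (min 1 t) ∧ max 0 (min 1 t) ≤ 1 := fun t =>
    ⟨le_max_left _ _, max_le zero_le_one (min_le_left _ _)⟩
  refine ⟨fun x => max 0 (min 1 ((|x| - ρ) / ρ)), by fun_prop, fun x => ?_, fun x => ?_, fun x y => ?_, fun x hx => ?_,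
    fun x hx => ?_⟩
  · exact abs_le.2 ⟨by linarith [(hb ((|x| - ρ) / ρ)).1], (hb _).2⟩
  · exact abs_le.2 ⟨by linarith [(hb ((|x| - ρ) / ρ)).2], by linarith [(hb ((|x| - ρ) / ρ)).1]⟩
  · refine (abs_max_sub_max_le_max _ _ _ _).trans (max_le (by simp; positivity) ?_)
    refine (abs_min_sub_min_le_max _ _ _ _).trans (max_le (by simp; positivity) ?_)
    rw [← sub_div, sub_sub_sub_cancel_right, abs_div, abs_of_pos hρ]
    exact div_le_div_of_nonneg_right (abs_abs_sub_abs_le_abs_sub x y) hρ.le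
  · exact max_eq_left ((min_le_right _ _).trans (div_nonpos_of_nonpos_of_nonneg (by linarith) hρ.le))
  · dsimp only
    rw [min_eq_left ((one_le_div hρ).2 (by linarith)), max_eq_right zero_le_one]

theorem exists_mollify {γ : ℝ → ℝ} (hγ : Measurable γ) (hi : Integrable γ) (hsupp : ∀ x, ρ < |x| → γ x = 0) {h : ℝ}
    (hh : 0 < h) (hs : ∀ z r, 0 < r → r ≤ 2 * h → Osc γ N z r) :
    ∃ (β : ℝ → ℝ) (Λ R : ℝ), 0 ≤ Λ ∧ (∀ x y, |β x - β y| ≤ Λ * |x - y|) ∧ (∀ x, R < |x| → β x = 0) ∧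
      ∀ z r, 0 < r → Osc (fun x => γ x - β x) (12 * N) z r := by
  let f : ContDiffBump (0 : ℝ) := ⟨h / 2, h, by linarith, by linarith⟩
  have fc : Continuous (f.normed volume) := f.continuous_normed
  have fs : ∀ u, h ≤ |u| → f.normed volume u = 0 := fun u hu => by
    have : u ∉ Function.support (f.normed volume) := by
      rw [f.support_normed_eq, mem_ball_zero_iff, norm_eq_abs]
      exact not_lt.2 hu
    simpa using this
  have fb : ∀ u, |f.normed volume u| ≤ 1 / h := fun u => by
    rw [abs_of_nonneg (f.nonneg_normed u)]
    refine (f.normed_le_div_measure_closedBall_rIn volume u).trans (le_of_eq ?_)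
    rw [measureReal_def, volume_closedBall, toReal_ofReal (by positivity)]
    congr 1
    exact mul_div_cancel₀ h two_ne_zero
  obtain ⟨K, hK⟩ := ContDiff.lipschitzWith_of_hasCompactSupport (𝕂 := ℝ) (n := 1)
    (f.hasCompactSupport_normed (μ := volume)) (f.contDiff_normed (n := 1)) one_ne_zero
  have i1 : ∀ x, Integrable fun y => f.normed volume (x - y) * γ y := fun x =>
    hi.bdd_mul (c := 1 / h) (by fun_prop) (ae_of_all _ fun y => fb _)
  have hl : ∀ x y, |(∫ t, f.normed volume (x - t) * γ t) - ∫ t, f.normed volume (y - t) * γ t| ≤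
      (K * ∫ t, |γ t|) * |x - y| := fun x y => by
    rw [← integral_sub (i1 x) (i1 y), ← norm_eq_abs]
    refine (norm_integral_le_integral_norm _).trans ?_
    rw [mul_right_comm, ← integral_const_mul]
    refine integral_mono ((i1 x).sub (i1 y)).norm (hi.abs.const_mul _) fun t => ?_
    dsimp only
    rw [← sub_mul, norm_mul, norm_eq_abs (γ t)]
    refine mul_le_mul_of_nonneg_right ?_ (abs_nonneg _)
    simpa [dist_eq_norm] using hK.dist_le_mul (x - t) (y - t)
  have hΛ : 0 ≤ K * ∫ t, |γ t| := mul_nonneg K.2 (integral_nonneg fun t => abs_nonneg _)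
  refine ⟨_, _, ρ + h, hΛ, hl, fun x hx => ?_, fun z r hr =>
    osc_sub_mollify hγ hi hh fc fb fs f.integral_normed ?_ (fun x => rfl) hs hr⟩
  · refine integral_eq_zero_of_ae (ae_of_all _ fun t => ?_)
    change f.normed volume (x - t) * γ t = 0
    rcases lt_or_ge ρ |t| with ht | ht
    · rw [hsupp t ht]; simp
    · rw [fs (x - t) (by linarith [abs_sub_abs_le_abs_sub x t])]; simp
  · exact (LipschitzWith.of_dist_le_mul (K := ⟨_, hΛ⟩) fun x y => hl x y).continuous.measurable

/-- Uchiyama-type approximation of a function with vanishing mean oscillation, modulo constants, by compactly supported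
Lipschitz functions. -/
theorem exists_approx (hb : Measurable b) {ε : ℝ≥0∞} (hε : ε ≠ ⊤)
    (hsmall : ∃ δ > 0, ∀ z r, 0 < r → 2 * r < δ → Osc b ε z r) (hlarge : ∃ R > 0, ∀ z r, 0 < r → R < 2 * r → Osc b ε z r)
    (hfar : ∃ R > 0, ∀ z r, 0 < r → R + r ≤ |z| → Osc b ε z r) :
    ∃ (c : ℝ) (β : ℝ → ℝ) (Λ R : ℝ), 0 ≤ Λ ∧ (∀ x y, |β x - β y| ≤ Λ * |x - y|) ∧ (∀ x, R < |x| → β x = 0) ∧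
      Bm (fun x => b x - c - β x) (233 * ε) := by
  obtain ⟨δ, hδ, hsmall⟩ := hsmall
  obtain ⟨R₁, hR₁, hlarge⟩ := hlarge
  obtain ⟨R₂, hR₂, hfar⟩ := hfar
  obtain ⟨ρ, hρ, hρ₁, hρ₂⟩ : ∃ ρ > 0, 4 * R₁ ≤ ρ ∧ 2 * R₂ ≤ ρ :=
    ⟨4 * R₁ + 2 * R₂, by positivity, by linarith, by linarith⟩
  obtain ⟨c, hc⟩ := hlarge 0 (4 * ρ) (by positivity) (by linarith)
  obtain ⟨η, ηc, η1, η1', ηl, h0, h1⟩ := exists_cutoff hρ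
  have ηm := ηc.measurable
  have o1 : ∀ z r, 0 < r → Osc (fun x => η x * (b x - c)) (17 * ε) z r := fun z r hr =>
    osc_cutoff hb hρ (fun z r h => hlarge z r (by linarith) (by linarith)) (fun z r hr h => hfar z r hr (by linarith))
      η1 η1' ηl h0 h1 hc hr
  have o2 : ∀ z r, 0 < r → r ≤ 2 * (δ / 8) → Osc (fun x => (1 - η x) * (b x - c)) (18 * ε) z r := fun z r hr h => by
    obtain ⟨k, hk⟩ := o1 z r hr
    have e : Osc (fun x => -(η x * (b x - c)) - c) (17 * ε) z r := ⟨-k - c, hk.trans' (lintegral_mono fun y => by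
      rw [← enorm_neg]; exact (congrArg _ (by ring)).le)⟩
    have := (hsmall z r hr (by linarith)).add hb e
    rw [show ε + 17 * ε = 18 * ε by ring] at this
    convert this using 2
    ring
  have hγm : Measurable fun x => (1 - η x) * (b x - c) := by fun_prop
  have hsupp : ∀ x, 2 * ρ < |x| → (1 - η x) * (b x - c) = 0 := fun x hx => by rw [h1 x hx.le]; simp
  have hi : Integrable fun x => (1 - η x) * (b x - c) := by
    refine ⟨hγm.aestronglyMeasurable, ?_⟩
    refine (lintegral_mono (g := (ball 0 (4 * ρ)).indicator fun y => ‖b y - c‖ₑ) fun y => ?_).trans_lt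
      (((lintegral_indicator measurableSet_ball _).le.trans hc).trans_lt (by finiteness))
    by_cases hy : y ∈ ball 0 (4 * ρ)
    · rw [indicator_of_mem hy, enorm_mul]
      exact mul_le_of_le_one_left' (by simpa [← ofReal_norm] using η1' y)
    · rw [mem_ball_zero_iff, norm_eq_abs, not_lt] at hy
      dsimp only
      rw [hsupp y (by linarith)]
      simp
  obtain ⟨β, Λ, R, hΛ, hβ, hR, ho⟩ := exists_mollify hγm hi hsupp (by positivity) o2
  have hβm : Measurable β := (LipschitzWith.of_dist_le_mul (K := ⟨_, hΛ⟩) fun x y => hβ x y).continuous.measurable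
  refine ⟨c, β, Λ, R, hΛ, hβ, hR, by fun_prop, fun z r hr => ?_⟩
  have := (o1 z r hr).add (by fun_prop) (ho z r hr)
  rw [show 17 * ε + 12 * (18 * ε) = 233 * ε by ring] at this
  change Osc (fun x => b x - c - β x) (233 * ε) z r
  convert this using 2
  ring

/-- `β` is Lipschitz, bounded and supported in `[-R, R]`. -/
structure LC (β : ℝ → ℝ) (K R : ℝ) : Prop where
  nonneg : 0 ≤ K
  radius : 0 ≤ R
  lip : ∀ x y, |β x - β y| ≤ K * |x - y|
  bdd : ∀ x, |β x| ≤ K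
  supp : ∀ x, R < |x| → β x = 0

theorem exists_LC {Λ : ℝ} (hΛ : 0 ≤ Λ) (hl : ∀ x y, |β x - β y| ≤ Λ * |x - y|)
    (hs : ∀ x, R < |x| → β x = 0) : ∃ K R, LC β K R := by
  have h0 : 0 ≤ Λ * (2 * |R| + 1) := by positivity
  refine ⟨Λ + Λ * (2 * |R| + 1), |R|, by positivity, abs_nonneg _, fun x y => (hl x y).trans ?_, fun x => ?_,
    fun x hx => hs x ((le_abs_self R).trans_lt hx)⟩
  · gcongr; linarith
  · rcases lt_or_ge R |x| with h | h
    · rw [hs x h, abs_zero]; positivity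
    · have h1 := hl x (|R| + 1)
      have h2 : R < |(|R| + 1)| := by rw [abs_of_nonneg (by positivity)]; linarith [le_abs_self R]
      rw [hs _ h2, sub_zero] at h1
      refine h1.trans ?_
      have h3 : |x - (|R| + 1)| ≤ 2 * |R| + 1 := by
        refine (abs_sub _ _).trans ?_
        rw [abs_of_nonneg (by positivity : 0 ≤ |R| + 1)]
        linarith [le_abs_self R]
      linarith [mul_le_mul_of_nonneg_left h3 hΛ]

theorem LC.measurable (h : LC β K R) : Measurable β :=
  (LipschitzWith.of_dist_le_mul (K := ⟨K, h.nonneg⟩) fun x y => h.lip x y).continuous.measurable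

theorem LC.abs_sub_le (h : LC β K R) (x y : ℝ) : |β x - β y| ≤ 2 * K :=
  (abs_sub _ _).trans (by linarith [h.bdd x, h.bdd y])

theorem LipA.integrable_LC_kr (hA : LipA A L) (h : LC β K R) (hτ : τ ≠ 0) (hf : Wt f) (x : ℝ) : Integrable fun y => ((β x - β y : ℝ) : ℂ) * kr A τ x y * f y := by
  simp_rw [mul_assoc]
  have := h.measurable
  refine (hA.integrable_kr_mul_Wt hτ hf x).bdd_mul (c := 2 * K) (by fun_prop) (ae_of_all _ fun y => ?_)
  rw [norm_real]
  exact h.abs_sub_le x y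

theorem LipA.Fc_eq_integral (hA : LipA A L) (h : LC β K R) (hτ : τ ≠ 0) (hf : Wt f) (x : ℝ) : Fc A τ β f x = ∫ y, ((β x - β y : ℝ) : ℂ) * kr A τ x y * f y := by
  have := h.measurable
  have i1 := hA.integrable_kr_mul_Wt hτ hf x
  have i2 : Integrable fun y => (β y : ℂ) * (kr A τ x y * f y) :=
    i1.bdd_mul (c := K) (by fun_prop) (ae_of_all _ fun y => by rw [norm_real]; exact h.bdd y)
  unfold Fc Cr
  rw [← integral_const_mul, show (fun y => kr A τ x y * ((β y : ℂ) * f y)) = fun y => (β y : ℂ) * (kr A τ x y * f y) by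
    funext y; ring, ← integral_sub (i1.const_mul _) i2]
  congr 1
  funext y
  push_cast
  ring

theorem LC.mul_le (h : LC β K R) (hσ : 0 < σ) (x y : ℝ) :
    |β x - β y| * (δ + |x - y|) ^ 2 ≤ 6 * K * ((σ + |x - y|) * (δ ^ 2 + |x - y|)) := by
  have hK := h.nonneg
  have hu := abs_nonneg (x - y)
  have h1 := h.lip x y
  have h2 := mul_le_mul_of_nonneg_right (h.abs_sub_le x y) hu
  set u := |x - y|
  set d := |β x - β y|
  have h3 : d * (1 + u) ≤ 3 * K * u := by linarith
  calc _ ≤ d * (2 * ((1 + u) * (δ ^ 2 + u))) := by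
        gcongr
        nlinarith [sq_nonneg (δ - u), mul_nonneg hu (sq_nonneg δ)]
    _ = 2 * (δ ^ 2 + u) * (d * (1 + u)) := by ring
    _ ≤ 2 * (δ ^ 2 + u) * (3 * K * u) := by gcongr
    _ ≤ 2 * (δ ^ 2 + u) * (3 * K * (σ + u)) := by gcongr; linarith
    _ = _ := by ring

theorem LipA.norm_LC_kr_sub_le (hA : LipA A L) (h : LC β K R) (hσ : 0 < σ) (hδ : 0 < δ)
    (hσδ : σ ≤ δ ^ 2) (x y : ℝ) : ‖((β x - β y : ℝ) : ℂ) * kr A σ x y - ((β x - β y : ℝ) : ℂ) * kr A (δ ^ 2) x y‖ ≤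
      6 * K * (2 + L) ^ 2 * δ * pker δ (x - y) := by
  have hτ : 0 < δ ^ 2 := by positivity
  have hL := hA.1
  have hu := abs_nonneg (x - y)
  have n1 := hA.norm_kr_le hσ.ne' x y
  have n2 := hA.norm_kr_le (by positivity : δ ^ 2 ≠ 0) x y
  rw [abs_of_pos hσ] at n1
  rw [abs_of_pos hτ] at n2
  have e : (zc A x - σ * I) - (zc A x - (δ ^ 2 : ℝ) * I) = ((δ ^ 2 - σ : ℝ) : ℂ) * I := by
    push_cast; ring
  rw [← mul_sub, hA.kr_sub_kr hσ.ne' hτ.ne', e, norm_mul, norm_mul, norm_mul, norm_mul, norm_real,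
    norm_real, norm_I, mul_one, norm_eq_abs, norm_eq_abs, abs_of_nonneg (by linarith : 0 ≤ δ ^ 2 - σ)]
  calc _ ≤ |β x - β y| * (δ ^ 2 * ((2 + L) / (σ + |x - y|) * ((2 + L) / (δ ^ 2 + |x - y|)))) := by
        gcongr; linarith
    _ = (2 + L) ^ 2 * δ ^ 2 * (|β x - β y| / ((σ + |x - y|) * (δ ^ 2 + |x - y|))) := by field_simp
    _ ≤ (2 + L) ^ 2 * δ ^ 2 * (6 * K / (δ + |x - y|) ^ 2) := by
        refine mul_le_mul_of_nonneg_left ?_ (by positivity)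
        rw [div_le_div_iff₀ (by positivity) (by positivity)]
        exact h.mul_le hσ x y
    _ = _ := by unfold pker; field_simp

theorem LipA.enorm_Fc_sub_le (hA : LipA A L) (h : LC β K R) (hσ : 0 < σ) (hδ : 0 < δ)
    (hσδ : σ ≤ δ ^ 2) (hf : Wt f) (x : ℝ) : ‖Fc A σ β f x - Fc A (δ ^ 2) β f x‖ₑ ≤
      ofReal (6 * K * (2 + L) ^ 2 * δ) * (16 * hlMax (fun y => ‖f y‖ₑ) x) := by
  have hL := hA.1
  have hK := h.nonneg
  rw [hA.Fc_eq_integral h hσ.ne' hf, hA.Fc_eq_integral h (by positivity : δ ^ 2 ≠ 0) hf,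
    ← integral_sub (hA.integrable_LC_kr h hσ.ne' hf x) (hA.integrable_LC_kr h (by positivity) hf x)]
  refine le_trans ?_ (mul_le_mul_right (lintegral_pker_mul_le hf.meas.enorm.aemeasurable hδ x) _)
  rw [← lintegral_ofReal_mul]
  refine (enorm_integral_le_lintegral_enorm _).trans (lintegral_mono fun y => ?_)
  dsimp only
  rw [← sub_mul, enorm_mul, ← mul_assoc, ← ofReal_mul (by positivity), ← ofReal_norm (_ - _)]
  exact mul_le_mul_left (ofReal_le_ofReal (hA.norm_LC_kr_sub_le h hσ hδ hσδ x y)) _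

theorem LipA.norm_kr_le_one_add (hA : LipA A L) (hτ : 0 < τ) (x y : ℝ) :
    ‖kr A τ x y‖ ≤ (2 + L) * (1 + 1 / τ) / (1 + |x - y|) := by
  have hL := hA.1
  have hu := abs_nonneg (x - y)
  refine (hA.norm_kr_le hτ.ne' x y).trans ?_
  rw [abs_of_pos hτ, div_le_div_iff₀ (by positivity) (by positivity), mul_assoc]
  gcongr
  have : 1 / τ * τ = 1 := by field_simp
  have h2 : 0 ≤ 1 / τ * |x - y| := by positivity
  nlinarith

theorem one_add_abs_le (x y : ℝ) : 1 + |y| ≤ (1 + |x|) * (1 + |x - y|) := by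
  have h := abs_sub_abs_le_abs_sub y x
  rw [abs_sub_comm] at h
  nlinarith [abs_nonneg x, abs_nonneg (x - y), mul_nonneg (abs_nonneg x) (abs_nonneg (x - y))]

theorem LipA.exists_LC_kr_bounds (hA : LipA A L) (h : LC β K R) (hτ : 0 < τ) :
    ∃ D : ℝ, 0 ≤ D ∧ (∀ x y, ‖((β x - β y : ℝ) : ℂ) * kr A τ x y‖ ≤ D * (1 + |x|)⁻¹ * (1 + |y|)⁻¹) ∧
      ∀ x x' y, ‖((β x - β y : ℝ) : ℂ) * kr A τ x y - ((β x' - β y : ℝ) : ℂ) * kr A τ x' y‖ ≤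
        D * ((1 + |x|) * |x - x'|) * (1 + |y|)⁻¹ := by
  have hL := hA.1
  have hK := h.nonneg
  have hR := h.radius
  set c := (2 + L) * (1 + 1 / τ) with hc
  have hc0 : 0 ≤ c := by positivity
  have n1 := hA.norm_kr_le_one_add hτ
  refine ⟨2 * K * c * (1 + R) ^ 2 + (K * c + 2 * K * ((1 + L) * c ^ 2)), by positivity, fun x y => ?_, fun x x' y => ?_⟩
  · have hx := abs_nonneg x
    have hy := abs_nonneg y
    have hu := abs_nonneg (x - y)
    have key : |x| ≤ R ∨ |y| ≤ R → (1 + |x|) * (1 + |y|) ≤ (1 + R) ^ 2 * (1 + |x - y|) := by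
      have h1 := one_add_abs_le x y
      have h2 := one_add_abs_le y x
      rw [abs_sub_comm] at h2
      rintro (h3 | h3)
      · calc _ ≤ (1 + |x|) * ((1 + |x|) * (1 + |x - y|)) := by gcongr
          _ = (1 + |x|) ^ 2 * (1 + |x - y|) := by ring
          _ ≤ _ := by gcongr
      · calc _ ≤ ((1 + |y|) * (1 + |x - y|)) * (1 + |y|) := by gcongr
          _ = (1 + |y|) ^ 2 * (1 + |x - y|) := by ring
          _ ≤ _ := by gcongr
    rw [norm_mul, norm_real, norm_eq_abs]
    by_cases hxy : |x| ≤ R ∨ |y| ≤ R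
    · calc _ ≤ 2 * K * (c / (1 + |x - y|)) := mul_le_mul (h.abs_sub_le x y) (n1 x y) (norm_nonneg _) (by positivity)
        _ = 2 * K * c * (1 / (1 + |x - y|)) := by ring
        _ ≤ 2 * K * c * ((1 + R) ^ 2 / ((1 + |x|) * (1 + |y|))) := by
            refine mul_le_mul_of_nonneg_left ?_ (by positivity)
            rw [div_le_div_iff₀ (by positivity) (by positivity), one_mul]
            exact key hxy
        _ = 2 * K * c * (1 + R) ^ 2 * (1 + |x|)⁻¹ * (1 + |y|)⁻¹ := by field_simp
        _ ≤ _ := by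
            gcongr
            exact le_add_of_nonneg_right (by positivity)
    · rw [not_or, not_le, not_le] at hxy
      rw [h.supp x hxy.1, h.supp y hxy.2, sub_zero, abs_zero, zero_mul]
      positivity
  · have hu := abs_nonneg (x - y)
    have e : ((β x - β y : ℝ) : ℂ) * kr A τ x y - ((β x' - β y : ℝ) : ℂ) * kr A τ x' y =
        ((β x - β x' : ℝ) : ℂ) * kr A τ x y + ((β x' - β y : ℝ) : ℂ) * (kr A τ x y - kr A τ x' y) := by
      push_cast; ring
    have n2 : ‖kr A τ x y - kr A τ x' y‖ ≤ (1 + L) * |x - x'| * (c / (1 + |x - y|) * c) := by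
      rw [hA.kr_sub_kr hτ.ne' hτ.ne', norm_mul, norm_mul, sub_sub_sub_cancel_right]
      refine mul_le_mul ?_ (mul_le_mul (n1 x y) ((n1 x' y).trans ?_) (norm_nonneg _) (by positivity)) (by positivity)
        (by positivity)
      · rw [abs_sub_comm]; exact hA.norm_zc_sub _ _
      · exact div_le_self hc0 (by linarith [abs_nonneg (x' - y)])
    have h1 : (1 + |x - y|)⁻¹ ≤ (1 + |x|) * (1 + |y|)⁻¹ := by
      rw [← div_eq_mul_inv, ← one_div, div_le_div_iff₀ (by positivity) (by positivity), one_mul]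
      exact one_add_abs_le x y
    rw [e]
    refine (norm_add_le _ _).trans ?_
    rw [norm_mul, norm_mul, norm_real, norm_real, norm_eq_abs, norm_eq_abs]
    calc _ ≤ K * |x - x'| * (c / (1 + |x - y|)) + 2 * K * ((1 + L) * |x - x'| * (c / (1 + |x - y|) * c)) :=
          add_le_add (mul_le_mul (h.lip x x') (n1 x y) (norm_nonneg _) (by positivity))
            (mul_le_mul (h.abs_sub_le x' y) n2 (norm_nonneg _) (by positivity))
      _ = (K * c + 2 * K * ((1 + L) * c ^ 2)) * |x - x'| * (1 + |x - y|)⁻¹ := by rw [div_eq_mul_inv]; ring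
      _ ≤ (K * c + 2 * K * ((1 + L) * c ^ 2)) * |x - x'| * ((1 + |x|) * (1 + |y|)⁻¹) := by gcongr
      _ = (K * c + 2 * K * ((1 + L) * c ^ 2)) * ((1 + |x|) * |x - x'|) * (1 + |y|)⁻¹ := by ring
      _ ≤ _ := mul_le_mul_of_nonneg_right (mul_le_mul_of_nonneg_right (le_add_of_nonneg_left (by positivity))
          (by positivity)) (by positivity)

theorem LipA.exists_Fc_bounds (hA : LipA A L) (h : LC β K R) (hτ : 0 < τ) :
    ∃ D ≠ ⊤, ∀ f, Wt f →
      (∀ x, ‖Fc A τ β f x‖ₑ ≤ D * ofReal (1 + |x|)⁻¹ * ∫⁻ y, ofReal (1 + |y|)⁻¹ * ‖f y‖ₑ) ∧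
      ∀ x x', ‖Fc A τ β f x - Fc A τ β f x'‖ₑ ≤
        D * ofReal ((1 + |x|) * |x - x'|) * ∫⁻ y, ofReal (1 + |y|)⁻¹ * ‖f y‖ₑ := by
  obtain ⟨D, hD, h1, h2⟩ := hA.exists_LC_kr_bounds h hτ
  have key : ∀ (k : ℝ → ℂ) (f : ℝ → ℂ) (a : ℝ), 0 ≤ a → (∀ y, ‖k y‖ ≤ D * a * (1 + |y|)⁻¹) → ‖∫ y, k y * f y‖ₑ ≤
      ofReal D * ofReal a * ∫⁻ y, ofReal (1 + |y|)⁻¹ * ‖f y‖ₑ := fun k f a ha hk => by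
    rw [← ofReal_mul hD, ← lintegral_ofReal_mul]
    refine (enorm_integral_le_lintegral_enorm _).trans (lintegral_mono fun y => ?_)
    dsimp only
    rw [enorm_mul, ← mul_assoc, ← ofReal_mul (by positivity), ← ofReal_norm (k y)]
    exact mul_le_mul_left (ofReal_le_ofReal (hk y)) _
  refine ⟨ofReal D, ofReal_ne_top, fun f hf => ⟨fun x => ?_, fun x x' => ?_⟩⟩
  · rw [hA.Fc_eq_integral h hτ.ne' hf]
    exact key _ f (1 + |x|)⁻¹ (by positivity) (h1 x)
  · rw [hA.Fc_eq_integral h hτ.ne' hf, hA.Fc_eq_integral h hτ.ne' hf,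
      ← integral_sub (hA.integrable_LC_kr h hτ.ne' hf x) (hA.integrable_LC_kr h hτ.ne' hf x')]
    simp_rw [← sub_mul]
    exact key _ f ((1 + |x|) * |x - x'|) (by positivity) (h2 x x')

theorem exists_ofReal_rpow_le {K ε : ℝ≥0∞} (hK : K ≠ ⊤) (hε : ε ≠ 0) (hp : 0 < p) :
    ∃ t > 0, K * ofReal t ^ p ≤ ε := by
  have h : Tendsto (fun t : ℝ => K * ofReal t ^ p) (𝓝[>] 0) (nhds 0) := by
    have h1 : Tendsto (fun t : ℝ => ofReal t ^ p) (nhds 0) (nhds 0) := by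
      have := ((continuous_rpow_const (y := p)).comp continuous_ofReal).tendsto 0
      simpa [Function.comp_def, ENNReal.zero_rpow_of_pos hp] using this
    simpa using (ENNReal.Tendsto.const_mul h1 (.inr hK)).mono_left nhdsWithin_le_nhds
  obtain ⟨t, ht, ht'⟩ := ((h.eventually (gt_mem_nhds (pos_iff_ne_zero.2 hε))).and self_mem_nhdsWithin).exists
  exact ⟨t, ht', ht.le⟩

/-- Equicontinuous functions with a common `p`-integrable majorant which are small at sufficiently many points of a dense
sequence have small `L^p` norm. -/
theorem exists_net (hp : 1 < p) {M ε : ℝ≥0∞} (hM : M ≠ ⊤) (hε : ε ≠ 0) : ∃ n : ℕ, ∀ ψ : ℝ → ℂ, Measurable ψ →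
    (∀ x, ‖ψ x‖ₑ ≤ M * ofReal (1 + |x|)⁻¹) → (∀ x x', ‖ψ x - ψ x'‖ₑ ≤ M * ofReal ((1 + |x|) * |x - x'|)) →
    (∀ k < n, ‖ψ (denseSeq ℝ k)‖ₑ ≤ ofReal (1 / ((n : ℝ) + 1))) → ∫⁻ x, ‖ψ x‖ₑ ^ p ≤ ε := by
  have hp0 : 0 < p := by linarith
  by_contra! hc
  choose ψ hm hb hl hk hgt using hc
  have hpt : ∀ x, Tendsto (fun n => ‖ψ n x‖ₑ) atTop (nhds 0) := fun x => by
    rw [tendsto_nhds_zero]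
    intro e he
    obtain ⟨t, ht, hte⟩ := exists_ofReal_rpow_le (K := M) (p := 1) hM (ENNReal.half_pos he.ne').ne' one_pos
    rw [rpow_one] at hte
    obtain ⟨k, hd⟩ := (denseRange_denseSeq ℝ).exists_dist_lt x (show 0 < t / (1 + |x|) by positivity)
    have h1 : Tendsto (fun n : ℕ => ofReal (1 / ((n : ℝ) + 1))) atTop (nhds 0) := by
      simpa [Function.comp_def] using (continuous_ofReal.tendsto 0).comp tendsto_one_div_add_atTop_nhds_zero_nat
    filter_upwards [eventually_gt_atTop k, h1.eventually (gt_mem_nhds (ENNReal.half_pos he.ne'))] with n hn h2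
    calc _ = ‖(ψ n x - ψ n (denseSeq ℝ k)) + ψ n (denseSeq ℝ k)‖ₑ := by rw [sub_add_cancel]
      _ ≤ e / 2 + e / 2 := (enorm_add_le _ _).trans (add_le_add ((hl n _ _).trans (le_trans ?_ hte))
          ((hk n k hn).trans h2.le))
      _ = e := ENNReal.add_halves e
    refine mul_le_mul_right (ofReal_le_ofReal ?_) _
    rw [dist_eq, lt_div_iff₀ (by positivity)] at hd
    linarith
  have hlim : Tendsto (fun n => ∫⁻ x, ‖ψ n x‖ₑ ^ p) atTop (nhds (∫⁻ _ : ℝ, 0)) := by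
    refine tendsto_lintegral_of_dominated_convergence (fun x => M ^ p * ofReal (1 + |x|)⁻¹ ^ p)
      (fun n => (hm n).enorm.pow_const p) (fun n => ae_of_all _ fun x => ?_) ?_ (ae_of_all _ fun x => ?_)
    · dsimp only
      rw [← mul_rpow_of_nonneg _ _ hp0.le]
      exact rpow_le_rpow (hb n x) hp0.le
    · rw [lintegral_const_mul' _ _ (by finiteness)]
      have := finite_integral_one_add_norm (E := ℝ) (μ := volume) (r := p) (by simpa using hp)
      refine mul_ne_top (by finiteness) (ne_top_of_le_ne_top this.ne (lintegral_mono fun x => le_of_eq ?_))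
      rw [ofReal_rpow_of_nonneg (by positivity) hp0.le, inv_rpow (by positivity), rpow_neg (by positivity),
        norm_eq_abs]
    · have := ((continuous_rpow_const (y := p)).tendsto 0).comp (hpt x)
      simpa [Function.comp_def, ENNReal.zero_rpow_of_pos hp0] using this
  rw [lintegral_zero] at hlim
  obtain ⟨n, hn⟩ := (hlim.eventually (gt_mem_nhds (pos_iff_ne_zero.2 hε))).exists
  exact (hgt n).not_gt hn

theorem exists_lintegral_weight_le (hp : 1 < p) : ∃ Q ≠ ⊤, ∀ f : ℝ → ℂ, Measurable f →
    ∫⁻ y, ofReal (1 + |y|)⁻¹ * ‖f y‖ₑ ≤ Q + ∫⁻ y, ‖f y‖ₑ ^ p := by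
  have hc : (p / (p - 1)).HolderConjugate p := (HolderConjugate.conjExponent hp).symm
  refine ⟨_, (finite_integral_one_add_norm (E := ℝ) (μ := volume) (r := p / (p - 1)) (by simpa using hc.lt)).ne,
    fun f hf => ?_⟩
  rw [← lintegral_add_left (by fun_prop)]
  refine lintegral_mono fun y => (mul_le_rpow_add_rpow _ _ hc).trans (add_le_add (le_of_eq ?_) le_rfl)
  rw [ofReal_rpow_of_nonneg (by positivity) hc.nonneg, inv_rpow (by positivity),
    rpow_neg (by positivity), norm_eq_abs]

theorem LC.wt_mul (h : LC β K R) (hf : Wt f) : Wt fun y => (β y : ℂ) * f y := by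
  have := h.measurable
  have := hf.meas
  refine ⟨by fun_prop, (hf.int.bdd_mul (f := fun y => (β y : ℂ)) (c := K) (by fun_prop) (ae_of_all _ fun y => by
    rw [norm_real]; exact h.bdd y)).congr (ae_of_all _ fun y => by dsimp only; ring)⟩

/-- The commutator with `β` is well approximated by the regularized commutators `Fc A (δ ^ 2) β`. -/
theorem LipA.exists_LC_commutator (hA : LipA A L) (h : LC β K R) (hp : 1 < p) :
    ∃ C ≠ ⊤, ∀ f : ℝ → ℂ, Measurable f → ∫⁻ x, ‖f x‖ₑ ^ p ≠ ⊤ → (∀ᵐ x, ∃ u w, cauchyPV A f x u ∧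
      cauchyPV A (fun y => (β y : ℂ) * f y) x w ∧ ∀ δ, 0 < δ → ‖(β x * u - w) - Fc A (δ ^ 2) β f x‖ₑ ≤
        C * ofReal δ * hlMax (fun y => ‖f y‖ₑ) x) := by
  have hL := hA.1
  have hK := h.nonneg
  have hp0 : 0 < p := by linarith
  refine ⟨ofReal (6 * K * (2 + L) ^ 2) * 16, by finiteness, fun f hf hfp => ?_⟩
  have hw := wt_of_lintegral_rpow hp hf hfp
  have hbp : ∫⁻ x, ‖(β x : ℂ) * f x‖ₑ ^ p ≠ ⊤ := by
    refine ne_top_of_le_ne_top (mul_ne_top (a := ofReal K ^ p) (by finiteness) hfp) ?_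
    rw [← lintegral_const_mul' _ _ (by finiteness)]
    refine lintegral_mono fun x => ?_
    dsimp only
    rw [← mul_rpow_of_nonneg _ _ hp0.le, enorm_mul, ← ofReal_norm (β x : ℂ), norm_real]
    exact rpow_le_rpow (mul_le_mul_left (ofReal_le_ofReal (h.bdd x)) _) hp0.le
  filter_upwards [hA.ae_commutator hw (h.wt_mul hw) (hA.exists_cauchyPV_of_rpow hp hf hfp)
    (hA.exists_cauchyPV_of_rpow hp (h.wt_mul hw).meas hbp)] with x ⟨u, w, hu, hw', ht⟩
  refine ⟨u, w, hu, hw', fun δ hδ => ?_⟩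
  refine le_of_tendsto ((ht.sub_const (Fc A (δ ^ 2) β f x)).enorm) ?_
  filter_upwards [Ioo_mem_nhdsGT (show 0 < δ ^ 2 by positivity)] with σ hσ
  refine (hA.enorm_Fc_sub_le h hσ.1 hδ hσ.2.le hw x).trans (le_of_eq ?_)
  rw [ofReal_mul (by positivity)]
  ring

theorem LipA.cauchyPV_sub (hA : LipA A L) (hf : Wt f) (hg : Wt g) {u v : ℂ} (hu : cauchyPV A f x u)
    (hv : cauchyPV A g x v) : cauchyPV A (fun y => f y - g y) x (u - v) := by
  rw [cauchyPV_iff] at hu hv ⊢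
  exact (hu.sub hv).congr' (by filter_upwards [self_mem_nhdsWithin] with δ hδ using (hA.Tr_sub hδ hf hg x).symm)

theorem cauchyPV.const_mul {u : ℂ} (c : ℂ) (hu : cauchyPV A f x u) :
    cauchyPV A (fun y => c * f y) x (c * u) := by
  refine (Tendsto.const_mul c hu).congr fun δ => ?_
  rw [← integral_const_mul]
  congr 1; funext y; ring

theorem Wt.const_mul (hf : Wt f) (c : ℂ) : Wt fun y => c * f y :=
  ⟨hf.meas.const_mul c, (hf.int.const_mul c).congr (ae_of_all _ fun y => by dsimp only; ring)⟩

theorem cauchyPV.unique {u v : ℂ} (hu : cauchyPV A f x u) (hv : cauchyPV A f x v) : u = v :=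
  tendsto_nhds_unique hu hv

theorem LipA.commutator_split (hA : LipA A L) (hp : 1 < p) (hN : N ≠ ⊤) (hb : Bm b N)
    (h : LC β K R) (hf : Measurable f) (hfp : ∫⁻ x, ‖f x‖ₑ ^ p ≠ ⊤) {u w u' w' u'' w'' : ℂ}
    (h1 : cauchyPV A f x u) (h1' : cauchyPV A (fun y => (b y : ℂ) * f y) x w)
    (h2 : cauchyPV A f x u') (h2' : cauchyPV A (fun y => ((b y - c - β y : ℝ) : ℂ) * f y) x w')
    (h3 : cauchyPV A f x u'') (h3' : cauchyPV A (fun y => (β y : ℂ) * f y) x w'') :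
    b x * u - w = (((b x - c - β x : ℝ) : ℂ) * u' - w') + (β x * u'' - w'') := by
  have hw := wt_of_lintegral_rpow hp hf hfp
  have hbw := hb.wt_mul hN hp hf hfp
  have hd := hA.cauchyPV_sub hbw (hw.const_mul c) h1' (h1.const_mul c)
  have e := (hA.cauchyPV_sub (f := fun y => (b y : ℂ) * f y - c * f y) ⟨hbw.meas.sub (hw.const_mul c).meas,
    (hbw.int.sub (hw.const_mul c).int).congr (ae_of_all _ fun y => (mul_sub _ _ _).symm)⟩ (h.wt_mul hw) hd h3')
  have e' : w' = w - c * u - w'' := by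
    refine h2'.unique ?_
    convert e using 2
    push_cast
    ring
  rw [e', ← h1.unique h2, ← h1.unique h3]
  push_cast
  ring

/-- Finitely many integral functionals of `f` control the commutator of `f` up to `ε`. -/
theorem LipA.commutator_net (hA : LipA A L) (hp : 1 < p) (hN : N ≠ ⊤) (hb : Bm b N)
    (hsmall : ∀ ε > 0, ∃ δ > 0, ∀ z r, 0 < r → 2 * r < δ → Osc b (ofReal ε) z r)
    (hlarge : ∀ ε > 0, ∃ R > 0, ∀ z r, 0 < r → R < 2 * r → Osc b (ofReal ε) z r)
    (hfar : ∀ ε > 0, ∃ R > 0, ∀ z r, 0 < r → R + r ≤ |z| → Osc b (ofReal ε) z r)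
    {P ε : ℝ≥0∞} (hP : P ≠ ⊤) (hε : ε ≠ 0) :
    ∃ (n : ℕ) (κ : ℕ → ℝ → ℂ) (M : ℝ≥0∞), M ≠ ⊤ ∧ (∀ k f, Wt f → Integrable fun y => κ k y * f y) ∧
      ∀ f, Measurable f → ∫⁻ x, ‖f x‖ₑ ^ p ≤ P → (∀ k, ‖∫ y, κ k y * f y‖ₑ ≤ M) ∧
        ((∀ k < n, ‖∫ y, κ k y * f y‖ₑ ≤ ofReal (1 / ((n : ℝ) + 1))) →
          ∀ G, IsCommutatorFn A b f G → ∫⁻ x, ‖G x‖ₑ ^ p ≤ ε) := by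
  have hp0 : 0 < p := by linarith
  have h2p : (2 : ℝ≥0∞) ^ p ≠ ⊤ := by finiteness
  obtain ⟨C, hC, hcomm⟩ := hA.exists_commutator hp
  obtain ⟨Cm, hCm, hmax⟩ := lintegral_hlMax_rpow_le hp
  obtain ⟨Q, hQ, hweight⟩ := exists_lintegral_weight_le hp
  obtain ⟨s, hs, hsε⟩ := exists_ofReal_rpow_le (K := 2 ^ p * (1 + 2 ^ p * (1 + 1))) (by finiteness) hε one_pos
  have hs' := (ofReal_pos.2 hs).ne'
  obtain ⟨e, he, heε⟩ := exists_ofReal_rpow_le (K := C * 233 ^ p * P) (by finiteness) hs' hp0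
  obtain ⟨c, β, Λ, R, hΛ, hβ, hβs, hγ⟩ := _root_.exists_approx hb.meas ofReal_ne_top (hsmall e he) (hlarge e he) (hfar e he)
  obtain ⟨K, R, hLC⟩ := exists_LC hΛ hβ hβs
  obtain ⟨C₁, hC₁, hreg⟩ := hA.exists_LC_commutator hLC hp
  obtain ⟨δ, hδ, hδε⟩ := exists_ofReal_rpow_le (K := C₁ ^ p * Cm * P) (by finiteness) hs' hp0
  have hτ : 0 < δ ^ 2 := by positivity
  obtain ⟨D, hD, hFc⟩ := hA.exists_Fc_bounds hLC hτ
  obtain ⟨n, hn⟩ := exists_net hp (M := D * (Q + P)) (by finiteness) hs'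
  have hFcb : ∀ f, Measurable f → ∫⁻ x, ‖f x‖ₑ ^ p ≤ P →
      (∀ x, ‖Fc A (δ ^ 2) β f x‖ₑ ≤ D * (Q + P) * ofReal (1 + |x|)⁻¹) ∧
      ∀ x x', ‖Fc A (δ ^ 2) β f x - Fc A (δ ^ 2) β f x'‖ₑ ≤ D * (Q + P) * ofReal ((1 + |x|) * |x - x'|) := by
    intro f hf hfP
    have hI := (hweight f hf).trans (add_le_add le_rfl hfP)
    obtain ⟨h1, h2⟩ := hFc f (wt_of_lintegral_rpow hp hf (ne_top_of_le_ne_top hP hfP))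
    refine ⟨fun x => (h1 x).trans ((mul_le_mul_right hI _).trans (le_of_eq (by ring))),
      fun x x' => (h2 x x').trans ((mul_le_mul_right hI _).trans (le_of_eq (by ring)))⟩
  have hval : ∀ f, Wt f → ∀ x, ∫ y, ((β x - β y : ℝ) : ℂ) * kr A (δ ^ 2) x y * f y = Fc A (δ ^ 2) β f x := fun f hf x =>
    (hA.Fc_eq_integral hLC hτ.ne' hf x).symm
  refine ⟨n, fun k y => ((β (denseSeq ℝ k) - β y : ℝ) : ℂ) * kr A (δ ^ 2) (denseSeq ℝ k) y,
    D * (Q + P), by finiteness, fun k f hf => hA.integrable_LC_kr hLC hτ.ne' hf _, fun f hf hfP => ?_⟩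
  have hfp := ne_top_of_le_ne_top hP hfP
  have hw := wt_of_lintegral_rpow hp hf hfp
  obtain ⟨hF1, hF2⟩ := hFcb f hf hfP
  simp_rw [hval f hw]
  refine ⟨fun k => (hF1 _).trans (mul_le_of_le_one_right' ?_), fun hk G hG => ?_⟩
  · rw [← ofReal_one]
    exact ofReal_le_ofReal (inv_le_one_of_one_le₀ (by linarith [abs_nonneg (denseSeq ℝ k)]))
  have hFm := hA.measurable_Fc hLC.measurable hw.meas (δ ^ 2)
  obtain ⟨g, hgm, hg, hgp⟩ := hcomm (by finiteness) hγ hf hfp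
  have hpt : ∀ᵐ x, ‖G x‖ₑ ^ p ≤ 2 ^ p * (‖g x‖ₑ ^ p + 2 ^ p * (‖Fc A (δ ^ 2) β f x‖ₑ ^ p +
      C₁ ^ p * ofReal δ ^ p * hlMax (fun y => ‖f y‖ₑ) x ^ p)) := by
    filter_upwards [hG, hg, hreg f hf hfp] with x ⟨u, w, h1, h1', h1e⟩ ⟨u', w', h2, h2', h2e⟩ ⟨u'', w'', h3, h3', hle⟩
    rw [h1e, hA.commutator_split hp hN hb hLC hf hfp h1 h1' h2 h2' h3 h3', ← h2e,
      ← mul_rpow_of_nonneg _ _ hp0.le, ← mul_rpow_of_nonneg _ _ hp0.le]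
    refine (rpow_le_rpow ((enorm_add_le _ _).trans (add_le_add_right ?_ _)) hp0.le).trans
      ((add_rpow_le _ _ hp.le).trans (mul_le_mul_right (add_le_add_right
        (add_rpow_le _ (C₁ * ofReal δ * hlMax (fun y => ‖f y‖ₑ) x) hp.le) _) _))
    rw [← add_sub_cancel (Fc A (δ ^ 2) β f x) (β x * u'' - w'')]
    exact (enorm_add_le _ _).trans (add_le_add_right (hle δ hδ) _)
  have hIa : ∫⁻ x, ‖g x‖ₑ ^ p ≤ ofReal s := by
    refine hgp.trans ((mul_le_mul_right hfP _).trans (le_trans (le_of_eq ?_) heε))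
    rw [mul_rpow_of_nonneg _ _ hp0.le]
    ring
  have hIb : ∫⁻ x, C₁ ^ p * ofReal δ ^ p * hlMax (fun y => ‖f y‖ₑ) x ^ p ≤ ofReal s := by
    rw [lintegral_const_mul' _ _ (by finiteness)]
    refine (mul_le_mul_right ((hmax _ hf.enorm.aemeasurable).trans (mul_le_mul_right hfP _)) _).trans
      (le_trans (le_of_eq ?_) hδε)
    ring
  have hIc := hn _ hFm hF1 hF2 hk
  rw [rpow_one] at hsε
  calc _ ≤ _ := lintegral_mono_ae hpt
    _ = 2 ^ p * ((∫⁻ x, ‖g x‖ₑ ^ p) + 2 ^ p * ((∫⁻ x, ‖Fc A (δ ^ 2) β f x‖ₑ ^ p) +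
        ∫⁻ x, C₁ ^ p * ofReal δ ^ p * hlMax (fun y => ‖f y‖ₑ) x ^ p)) := by
      rw [lintegral_const_mul' _ _ h2p, lintegral_add_left (hgm.enorm.pow_const p), lintegral_const_mul' _ _ h2p,
        lintegral_add_left (hFm.enorm.pow_const p)]
    _ ≤ 2 ^ p * (ofReal s + 2 ^ p * (ofReal s + ofReal s)) := by gcongr
    _ = 2 ^ p * (1 + 2 ^ p * (1 + 1)) * ofReal s := by ring
    _ ≤ ε := hsε

theorem isCompactOperator_of_net {E F : Type*} [NormedAddCommGroup E] [NormedSpace ℂ E] [NormedAddCommGroup F]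
    [NormedSpace ℂ F] [CompleteSpace F] (T : E →L[ℂ] F) (h : ∀ ε > 0, ∃ (n : ℕ) (Φ : E → Fin n → ℂ) (M δ : ℝ), 0 < δ ∧
      (∀ x y, Φ (x - y) = Φ x - Φ y) ∧ (∀ x, ‖x‖ ≤ 2 → ‖Φ x‖ ≤ M) ∧ ∀ x, ‖x‖ ≤ 2 → ‖Φ x‖ ≤ δ → ‖T x‖ ≤ ε) :
    IsCompactOperator T := by
  refine (isCompactOperator_iff_isCompact_closure_image_closedBall T.toLinearMap one_pos).2 ?_
  refine TotallyBounded.isCompact_of_isClosed (TotallyBounded.closure ?_) isClosed_closure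
  rw [Metric.totallyBounded_iff]
  intro ε hε
  obtain ⟨n, Φ, M, δ, hδ, hΦ, hM, hT⟩ := h (ε / 2) (half_pos hε)
  have hb : TotallyBounded (Φ '' closedBall 0 1) := by
    refine (isCompact_closedBall (0 : Fin n → ℂ) M).totallyBounded.subset ?_
    rintro _ ⟨x, hx, rfl⟩
    rw [mem_closedBall_zero_iff] at hx ⊢
    exact hM x (by linarith)
  obtain ⟨s, hs, hsf, ht⟩ := exists_subset_image_finite_and.1 (Metric.finite_approx_of_totallyBounded hb δ hδ)
  refine ⟨T '' s, hsf.image T, ?_⟩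
  rintro _ ⟨x, hx, rfl⟩
  obtain ⟨_, ⟨y, hy, rfl⟩, hxy⟩ := mem_iUnion₂.1 (ht (mem_image_of_mem Φ hx))
  refine mem_iUnion₂.2 ⟨T y, mem_image_of_mem T hy, ?_⟩
  have hy' := hs hy
  rw [mem_closedBall_zero_iff] at hx hy'
  rw [mem_ball, dist_eq_norm, ← hΦ] at hxy
  rw [mem_ball, dist_eq_norm]
  change ‖T x - T y‖ < ε
  rw [← map_sub]
  exact (hT _ ((norm_sub_le _ _).trans (by linarith)) hxy.le).trans_lt (half_lt_self hε)

theorem osc_of_meanOsc_le {b' : ℝ → ℝ} (hb : LocallyIntegrable b) (h : b' =ᵐ[volume] b) {ε : ℝ} (hr : 0 < r)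
    (ho : meanOsc b z r ≤ ε) : Osc b' (ofReal ε) z r := by
  refine ⟨intervalAvg b z r, ?_⟩
  have hi : IntegrableOn (fun y => b y - intervalAvg b z r) (Ioo (z - r) (z + r)) :=
    ((hb.integrableOn_isCompact isCompact_Icc).mono_set Ioo_subset_Icc_self).sub (by simp)
  rw [ball_eq_Ioo, lintegral_congr_ae (ae_restrict_of_ae (h.mono fun y hy => by rw [hy])),
    ← ofReal_integral_norm_eq_lintegral_enorm hi, ← ofReal_mul (by positivity)]
  refine ofReal_le_ofReal (le_trans (le_of_eq ?_) (mul_le_mul_of_nonneg_left ho (by positivity)))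
  rw [meanOsc, mul_inv_cancel_left₀ (by positivity)]
  rfl

theorem cauchyPV.congr (h : f =ᵐ[volume] g) {u : ℂ} (hu : cauchyPV A f x u) : cauchyPV A g x u :=
  Tendsto.congr (fun _ => integral_congr_ae (ae_restrict_of_ae (h.mono fun y hy => by rw [hy]))) hu

theorem IsCommutatorFn.congr {b' : ℝ → ℝ} {f' g' : ℝ → ℂ} (h : IsCommutatorFn A b f g) (hb : b =ᵐ[volume] b')
    (hf : f =ᵐ[volume] f') (hg : g =ᵐ[volume] g') : IsCommutatorFn A b' f' g' := by
  filter_upwards [h, hb, hg] with x ⟨u, w, h1, h2, h3⟩ hbx hgx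
  refine ⟨u, w, h1.congr hf, h2.congr ?_, by rw [← hgx, ← hbx, h3]⟩
  filter_upwards [hb, hf] with y h1 h2
  rw [h1, h2]

theorem IsCommutatorFn.unique {g' : ℝ → ℂ} (h : IsCommutatorFn A b f g) (h' : IsCommutatorFn A b f g') :
    g =ᵐ[volume] g' := by
  filter_upwards [h, h'] with x ⟨u, w, h1, h2, h3⟩ ⟨u', w', h1', h2', h3'⟩
  rw [h3, h3', h1.unique h1', h2.unique h2']

theorem LipA.isCommutatorFn_sub (hA : LipA A L) {f' g' : ℝ → ℂ} (a c : ℂ) (hf : Wt f) (hf' : Wt f')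
    (hb : Wt fun y => (b y : ℂ) * f y) (hb' : Wt fun y => (b y : ℂ) * f' y) (h : IsCommutatorFn A b f g)
    (h' : IsCommutatorFn A b f' g') :
    IsCommutatorFn A b (fun y => a * f y - c * f' y) fun y => a * g y - c * g' y := by
  filter_upwards [h, h'] with x ⟨u, w, h1, h2, h3⟩ ⟨u', w', h1', h2', h3'⟩
  refine ⟨a * u - c * u', a * w - c * w', hA.cauchyPV_sub (hf.const_mul a) (hf'.const_mul c) (h1.const_mul a) (h1'.const_mul c), ?_, ?_⟩
  · convert hA.cauchyPV_sub (hb.const_mul a) (hb'.const_mul c) (h2.const_mul a) (h2'.const_mul c) using 2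
    ring
  · rw [h3, h3']
    ring

theorem lintegral_rpow_toReal_eq_enorm_rpow {p : ℝ≥0∞} (hp : 1 < p) (hp' : p ≠ ⊤) (f : Lp ℂ p (volume : Measure ℝ)) :
    ∫⁻ x, ‖f x‖ₑ ^ p.toReal = ‖f‖ₑ ^ p.toReal := by
  have h0 : 0 < p.toReal := toReal_pos (zero_lt_one.trans hp).ne' hp'
  rw [Lp.enorm_def, eLpNorm_eq_lintegral_rpow_enorm_toReal (zero_lt_one.trans hp).ne' hp', one_div,
    rpow_inv_rpow h0.ne']

/-- The commutator as a bounded operator on `L^p`. -/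
theorem LipA.exists_commutator_clm (hA : LipA A L) {p : ℝ≥0∞} (hp : 1 < p) (hp' : p ≠ ⊤) [Fact (1 ≤ p)] (hN : N ≠ ⊤) (hb : Bm b N) : ∃ T : Lp ℂ p (volume : Measure ℝ) →L[ℂ] Lp ℂ p (volume : Measure ℝ),
      ∀ f : Lp ℂ p (volume : Measure ℝ), IsCommutatorFn A b f (T f) := by
  have hp0 : p ≠ 0 := (zero_lt_one.trans hp).ne'
  have hq : 1 < p.toReal := (ENNReal.toReal_lt_toReal one_ne_top hp').2 hp
  have hq0 : 0 < p.toReal := by linarith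
  obtain ⟨C, hC, H⟩ := hA.exists_commutator hq
  have hfm (f : Lp ℂ p (volume : Measure ℝ)) : Measurable f := (Lp.stronglyMeasurable f).measurable
  have hft (f : Lp ℂ p (volume : Measure ℝ)) : ∫⁻ x, ‖f x‖ₑ ^ p.toReal ≠ ⊤ := by
    rw [lintegral_rpow_toReal_eq_enorm_rpow hp hp']
    finiteness
  choose g hgm hg hgp using fun f : Lp ℂ p (volume : Measure ℝ) => H hN hb (hfm f) (hft f)
  have hgL (f : Lp ℂ p (volume : Measure ℝ)) : MemLp (g f) p := ⟨(hgm f).aestronglyMeasurable,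
    (eLpNorm_lt_top_iff_lintegral_rpow_enorm_lt_top hp0 hp').2 ((hgp f).trans_lt
      (mul_lt_top (by finiteness) (hft f).lt_top))⟩
  have hg' (f : Lp ℂ p (volume : Measure ℝ)) : IsCommutatorFn A b f ((hgL f).toLp (g f)) :=
    (hg f).congr (ae_eq_refl _) (ae_eq_refl _) (hgL f).coeFn_toLp.symm
  have hW (f : Lp ℂ p (volume : Measure ℝ)) : Wt f := wt_of_lintegral_rpow hq (hfm f) (hft f)
  have hbW (f : Lp ℂ p (volume : Measure ℝ)) : Wt fun y => (b y : ℂ) * f y := hb.wt_mul hN hq (hfm f) (hft f)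
  have hlin (a c : ℂ) (f f' : Lp ℂ p (volume : Measure ℝ)) :
      (hgL (a • f - c • f')).toLp (g (a • f - c • f')) = a • (hgL f).toLp (g f) - c • (hgL f').toLp (g f') := by
    refine Lp.ext ((hg' _).unique ((hA.isCommutatorFn_sub a c (hW f) (hW f') (hbW f) (hbW f') (hg' f) (hg' f')).congr
      (ae_eq_refl _) ?_ ?_))
    · filter_upwards [Lp.coeFn_sub (a • f) (c • f'), Lp.coeFn_smul a f, Lp.coeFn_smul c f'] with x h1 h2 h3
      rw [h1, Pi.sub_apply, h2, h3]; rfl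
    · filter_upwards [Lp.coeFn_sub (a • (hgL f).toLp (g f)) (c • (hgL f').toLp (g f')),
        Lp.coeFn_smul a ((hgL f).toLp (g f)), Lp.coeFn_smul c ((hgL f').toLp (g f'))] with x h1 h2 h3
      rw [h1, Pi.sub_apply, h2, h3]; rfl
  let T : Lp ℂ p (volume : Measure ℝ) →ₗ[ℂ] Lp ℂ p (volume : Measure ℝ) :=
    { toFun := fun f => (hgL f).toLp (g f)
      map_add' := fun f f' => by simpa using hlin 1 (-1) f f'
      map_smul' := fun c f => by simpa using hlin c 0 f f }
  refine ⟨T.mkContinuous ((C * N ^ p.toReal) ^ p.toReal⁻¹).toReal fun f => ?_, hg'⟩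
  have h : ‖T f‖ₑ ≤ (C * N ^ p.toReal) ^ p.toReal⁻¹ * ‖f‖ₑ := by
    rw [← rpow_le_rpow_iff hq0, mul_rpow_of_nonneg _ _ hq0.le, rpow_inv_rpow hq0.ne',
      ← lintegral_rpow_toReal_eq_enorm_rpow hp hp', ← lintegral_rpow_toReal_eq_enorm_rpow hp hp']
    exact (lintegral_congr_ae ((hgL f).coeFn_toLp.mono fun x hx => by
      change ‖(hgL f).toLp (g f) x‖ₑ ^ p.toReal = ‖g f x‖ₑ ^ p.toReal
      rw [hx])).trans_le (hgp f)
  have := toReal_mono (by finiteness) h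
  rwa [ENNReal.toReal_mul, toReal_enorm, toReal_enorm] at this

theorem LipA.isCompactOperator (hA : LipA A L) {p : ℝ≥0∞} (hp : 1 < p) (hp' : p ≠ ⊤) [Fact (1 ≤ p)] (hN : N ≠ ⊤) (hb : Bm b N)
    (hsmall : ∀ ε > 0, ∃ δ > 0, ∀ z r, 0 < r → 2 * r < δ → Osc b (ofReal ε) z r)
    (hlarge : ∀ ε > 0, ∃ R > 0, ∀ z r, 0 < r → R < 2 * r → Osc b (ofReal ε) z r)
    (hfar : ∀ ε > 0, ∃ R > 0, ∀ z r, 0 < r → R + r ≤ |z| → Osc b (ofReal ε) z r)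
    (T : Lp ℂ p (volume : Measure ℝ) →L[ℂ] Lp ℂ p (volume : Measure ℝ))
    (hT : ∀ f : Lp ℂ p (volume : Measure ℝ), IsCommutatorFn A b f (T f)) :
    IsCompactOperator T := by
  have hq : 1 < p.toReal := (ENNReal.toReal_lt_toReal one_ne_top hp').2 hp
  have hq0 : 0 < p.toReal := by linarith
  have hfm (f : Lp ℂ p (volume : Measure ℝ)) : Measurable f := (Lp.stronglyMeasurable f).measurable
  have hW (f : Lp ℂ p (volume : Measure ℝ)) : Wt f := wt_of_lintegral_rpow hq (hfm f) (by
    rw [lintegral_rpow_toReal_eq_enorm_rpow hp hp']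
    finiteness)
  have hP {f : Lp ℂ p (volume : Measure ℝ)} (hf : ‖f‖ ≤ 2) : ∫⁻ x, ‖f x‖ₑ ^ p.toReal ≤ ofReal 2 ^ p.toReal := by
    rw [lintegral_rpow_toReal_eq_enorm_rpow hp hp', ← ofReal_norm]
    exact rpow_le_rpow (ofReal_le_ofReal hf) hq0.le
  refine isCompactOperator_of_net T fun ε hε => ?_
  have hε' : ofReal ε ^ p.toReal ≠ 0 := (rpow_pos (ofReal_pos.2 hε) ofReal_ne_top).ne'
  obtain ⟨n, κ, M, hM, hκ, h⟩ := hA.commutator_net hq hN hb hsmall hlarge hfar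
    (P := ofReal 2 ^ p.toReal) (by finiteness) hε'
  refine ⟨n, fun f k => ∫ y, κ k y * f y, M.toReal, 1 / ((n : ℝ) + 1), by positivity, fun f f' => ?_, fun f hf => ?_,
    fun f hf hd => ?_⟩
  · funext k
    rw [Pi.sub_apply, ← integral_sub (hκ k f (hW f)) (hκ k f' (hW f'))]
    refine integral_congr_ae ((Lp.coeFn_sub f f').mono fun y hy => ?_)
    dsimp only
    rw [hy, Pi.sub_apply, mul_sub]
  · refine (pi_norm_le_iff_of_nonneg toReal_nonneg).2 fun k => ?_
    have := toReal_mono hM ((h f (hfm f) (hP hf)).1 k)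
    rwa [toReal_enorm] at this
  · have := (h f (hfm f) (hP hf)).2 (fun k hk => ?_) _ (hT f)
    · rwa [lintegral_rpow_toReal_eq_enorm_rpow hp hp', rpow_le_rpow_iff hq0, ← ofReal_norm,
        ofReal_le_ofReal_iff hε.le] at this
    · rw [← ofReal_norm]
      exact ofReal_le_ofReal ((norm_le_pi_norm (fun k : Fin n => ∫ y, κ k y * f y) ⟨k, hk⟩).trans hd)

end

/-- If `b ∈ VMO(ℝ)`, then the commutator `[b, C_Γ]` is a compact operator on `L^p(ℝ)`
for `1 < p < ∞`. -/
theorem vmo_implies_commutator_compact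
    (A : ℝ → ℝ) (L : ℝ) (hL : 0 < L)
    (hA : ∀ x₁ x₂ : ℝ, |A x₁ - A x₂| ≤ L * |x₁ - x₂|)
    (p : ℝ≥0∞) (hp1 : 1 < p) (hp2 : p ≠ ⊤) [Fact (1 ≤ p)]
    (b : ℝ → ℝ) (hb : IsVMO b) :
    ∃ T : Lp ℂ p (volume : Measure ℝ) →L[ℂ] Lp ℂ p (volume : Measure ℝ),
      (∀ f : Lp ℂ p (volume : Measure ℝ), IsCommutatorFn A b ⇑f ⇑(T f)) ∧
      IsCompactOperator (⇑T) := by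
  obtain ⟨⟨N, hbl, hN⟩, hsmall, hlarge, hfar⟩ := hb
  have hm := hbl.aestronglyMeasurable
  set b' := hm.mk b with hb'
  have hbb : b' =ᵐ[volume] b := hm.ae_eq_mk.symm
  have hA' : LipA A L := ⟨hL, hA⟩
  have hB : Bm b' (ofReal N) :=
    ⟨hm.stronglyMeasurable_mk.measurable, fun z r hr => osc_of_meanOsc_le hbl hbb hr (hN z r hr)⟩
  obtain ⟨T, hT⟩ := hA'.exists_commutator_clm hp1 hp2 ofReal_ne_top hB
  refine ⟨T, fun f => (hT f).congr hbb (ae_eq_refl _) (ae_eq_refl _),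
    hA'.isCompactOperator hp1 hp2 ofReal_ne_top hB (fun ε hε => ?_) (fun ε hε => ?_) (fun ε hε => ?_) T hT⟩
  · obtain ⟨δ, hδ, h⟩ := hsmall ε hε
    exact ⟨δ, hδ, fun z r hr hz => osc_of_meanOsc_le hbl hbb hr (h z r hr hz).le⟩
  · obtain ⟨R, hR, h⟩ := hlarge ε hε
    exact ⟨R, hR, fun z r hr hz => osc_of_meanOsc_le hbl hbb hr (h z r hr hz).le⟩
  · obtain ⟨R, hR, h⟩ := hfar ε hε
    refine ⟨R, hR, fun z r hr hz => osc_of_meanOsc_le hbl hbb hr (h z r hr ?_).le⟩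
    refine eq_empty_of_forall_notMem fun y ⟨hy, hy'⟩ => ?_
    rcases le_abs.1 hz with h1 | h1
    · linarith [hy.1, hy'.2]
    · linarith [hy.2, hy'.1]
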